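/- For every integer n ≥ 0, writing N_i = N(i,11,11n+6), the following hold: 2N_1 + N_2 + 2N_4 ≥ 2N_3 + 3N_5; 2N_0 + N_2 + 2N_5 ≥ 2N_1 + N_3 + 2N_4; N_0 + N_1 + 3N_3 + N_4 ≥ 4N_2 + 2N_5; and N_0 + 6N_1 + 4N_2 ≥ 2N_3 + 5N_4 + 4N_5. -/

import Mathlib

/-- `p n`: the number of partitions of `n`. -/
def partitionCount (n : ℕ) : ℕ := Fintype.card (Nat.Partition n)

/-- The rank of a partition: its largest part minus its number of parts
(the empty partition has rank 0). -/
def partitionRank {n : ℕ} (π : Nat.Partition n) : ℤ :=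
  (π.parts.sup : ℤ) - (Multiset.card π.parts : ℤ)

/-- The crank of a partition `π`: if `π` has no parts equal to 1, it is the largest part;
otherwise it is (number of parts larger than the number of ones) − (number of ones). -/
def partitionCrank {n : ℕ} (π : Nat.Partition n) : ℤ :=
  if π.parts.count 1 = 0 then (π.parts.sup : ℤ)
  else ((π.parts.filter fun x => π.parts.count 1 < x).card : ℤ) - (π.parts.count 1 : ℤ)

/-- `rankCount a r n` = `N(a,r,n)`: the number of partitions of `n` whose rank is
congruent to `a` modulo `r`. -/
def rankCount (a r : ℤ) (n : ℕ) : ℕ :=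
  (Finset.univ.filter fun π : Nat.Partition n => partitionRank π % r = a % r).card

/-- `crankCount a n` = `M(a,11,n)`: for `n ≠ 1`, the number of partitions of `n` whose crank
is congruent to `a` modulo 11; at `n = 1` the standard convention `M(0,11,1) = −1`,
`M(1,11,1) = M(10,11,1) = 1`, and `M(a,11,1) = 0` otherwise. -/
def crankCount (a : ℤ) (n : ℕ) : ℤ :=
  if n = 1 then
    if a % 11 = 0 then -1
    else if a % 11 = 1 ∨ a % 11 = 10 then 1
    else 0
  else ((Finset.univ.filter fun π : Nat.Partition n => partitionCrank π % 11 = a % 11).card : ℤ)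

open Filter Topology

/-- The product `∏ (1 - z Qⁿ)` over `n ≥ 0`. -/
noncomputable def qProd (Q z : ℂ) : ℂ := ∏' n : ℕ, (1 - z * Q ^ n)

lemma summable_norm_mul_pow {Q : ℂ} (hQ : ‖Q‖ < 1) (z : ℂ) :
    Summable fun n : ℕ => ‖-(z * Q ^ n)‖ := by
  simpa using (summable_geometric_of_lt_one (norm_nonneg Q) hQ).mul_left ‖z‖

lemma multipliable_qProd {Q : ℂ} (hQ : ‖Q‖ < 1) (z : ℂ) :
    Multipliable fun n : ℕ => 1 - z * Q ^ n := by
  simpa [sub_eq_add_neg] using multipliable_one_add_of_summable (summable_norm_mul_pow hQ z)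

lemma qProd_eq_mul {Q : ℂ} (hQ : ‖Q‖ < 1) (z : ℂ) :
    qProd Q z = (1 - z) * qProd Q (Q * z) := by
  have h : Multipliable fun n : ℕ => 1 - z * Q ^ (n + 1) := by
    simpa [pow_succ', mul_left_comm, mul_assoc, mul_comm] using multipliable_qProd hQ (Q * z)
  have := tprod_eq_zero_mul' (f := fun n : ℕ => 1 - z * Q ^ n) h
  simp only [qProd, this, pow_zero, mul_one, pow_succ']
  congr 2; ext n; ring

lemma qProd_ne_zero {Q : ℂ} (hQ : ‖Q‖ < 1) {z : ℂ} (hz : ∀ n : ℕ, z * Q ^ n ≠ 1) :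
    qProd Q z ≠ 0 := by
  have := tprod_one_add_ne_zero_of_summable (f := fun n : ℕ => -(z * Q ^ n))
    (fun i => by rw [← sub_eq_add_neg]; exact sub_ne_zero.mpr (hz i).symm)
    (summable_norm_mul_pow hQ z)
  simpa [qProd, sub_eq_add_neg] using this

lemma differentiable_qProd {Q : ℂ} (hQ : ‖Q‖ < 1) : Differentiable ℂ (qProd Q) := by
  intro z
  have hu := (summable_geometric_of_lt_one (norm_nonneg Q) hQ).mul_left (‖z‖ + 1)
  have h := Summable.hasProdLocallyUniformlyOn_nat_one_add (K := Metric.ball z 1)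
    (f := fun (n : ℕ) (z : ℂ) => -(z * Q ^ n)) Metric.isOpen_ball hu
    (Eventually.of_forall fun n x hx => by
      have : ‖x‖ ≤ ‖z‖ + 1 := by
        have := norm_sub_norm_le x z
        have h2 : ‖x - z‖ < 1 := by simpa [dist_eq_norm] using hx
        linarith
      simp only [norm_neg, norm_mul, norm_pow]
      gcongr) (fun n => by fun_prop)
  have hd := h.tendstoLocallyUniformlyOn_finsetRange.differentiableOn
    (Eventually.of_forall fun n => by fun_prop) Metric.isOpen_ball
  have := (hd z (Metric.mem_ball_self one_pos)).differentiableAt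
    (Metric.isOpen_ball.mem_nhds (Metric.mem_ball_self one_pos))
  have h2 : qProd Q = fun x => ∏' i : ℕ, (1 + -(x * Q ^ i)) := by
    ext x; simp [qProd, sub_eq_add_neg]
  rwa [h2]

/-- The theta function `∏ (1 - z Qⁿ)(1 - z⁻¹ Qⁿ⁺¹)`. -/
noncomputable def theta (Q z : ℂ) : ℂ := qProd Q z * qProd Q (Q / z)

/-- The cofactor of `1 - z` in `theta Q z`. -/
noncomputable def thetaReg (Q z : ℂ) : ℂ := qProd Q (Q * z) * qProd Q (Q / z)

lemma theta_eq {Q : ℂ} (hQ : ‖Q‖ < 1) (z : ℂ) : theta Q z = (1 - z) * thetaReg Q z := by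
  rw [theta, thetaReg, qProd_eq_mul hQ z, mul_assoc]

lemma thetaReg_inv (Q z : ℂ) : thetaReg Q z⁻¹ = thetaReg Q z := by
  simp [thetaReg, div_eq_mul_inv, mul_comm]

lemma theta_one {Q : ℂ} (hQ : ‖Q‖ < 1) : theta Q 1 = 0 := by simp [theta_eq hQ]

lemma theta_inv {Q : ℂ} (hQ : ‖Q‖ < 1) {z : ℂ} (hz : z ≠ 0) :
    theta Q z⁻¹ = -(theta Q z / z) := by
  rw [theta_eq hQ, theta_eq hQ, thetaReg_inv]; field_simp; ring

lemma theta_mul {Q : ℂ} (hQ : ‖Q‖ < 1) (hQ0 : Q ≠ 0) {z : ℂ} (hz : z ≠ 0) :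
    theta Q (Q * z) = -(theta Q z / z) := by
  have h1 : Q / (Q * z) = z⁻¹ := by field_simp
  rw [theta, h1, qProd_eq_mul hQ z⁻¹, theta, qProd_eq_mul hQ z, div_eq_mul_inv Q z]
  field_simp; ring

lemma theta_div {Q : ℂ} (hQ : ‖Q‖ < 1) (hQ0 : Q ≠ 0) {z : ℂ} (hz : z ≠ 0) :
    theta Q (z / Q) = -(z / Q * theta Q z) := by
  have := theta_mul hQ hQ0 (z := z / Q) (by positivity)
  rw [mul_div_cancel₀ _ hQ0] at this
  rw [this]; field_simp

/-- `z` is not an integral power of `Q`. -/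
def NonPow (Q z : ℂ) : Prop := ∀ n : ℤ, z ≠ Q ^ n

lemma theta_ne_zero {Q : ℂ} (hQ : ‖Q‖ < 1) (hQ0 : Q ≠ 0) {z : ℂ} (hz : z ≠ 0)
    (h : NonPow Q z) : theta Q z ≠ 0 := by
  refine mul_ne_zero (qProd_ne_zero hQ fun n hn => h (-n) ?_)
    (qProd_ne_zero hQ fun n hn => h (n + 1) ?_)
  · rw [zpow_neg, zpow_natCast]; exact eq_inv_of_mul_eq_one_left hn
  · rw [zpow_add_one₀ hQ0, zpow_natCast]; field_simp at hn; rw [← hn]; ring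

lemma thetaReg_one_ne_zero {Q : ℂ} (hQ : ‖Q‖ < 1) : thetaReg Q 1 ≠ 0 := by
  have : ∀ n : ℕ, Q * Q ^ n ≠ 1 := fun n hn => by
    have := congrArg norm hn
    rw [← pow_succ', norm_pow, norm_one] at this
    exact absurd this (pow_lt_one₀ (norm_nonneg _) hQ (by simp)).ne
  simpa [thetaReg] using qProd_ne_zero hQ this

lemma thetaReg_one (Q : ℂ) : thetaReg Q 1 = qProd Q Q ^ 2 := by simp [thetaReg, sq]

lemma differentiableAt_thetaReg {Q : ℂ} (hQ : ‖Q‖ < 1) {z : ℂ} (hz : z ≠ 0) :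
    DifferentiableAt ℂ (thetaReg Q) z := by
  have := differentiable_qProd hQ
  unfold thetaReg
  refine DifferentiableAt.mul (DifferentiableAt.comp z (this _) (by fun_prop))
    (DifferentiableAt.comp z (this _) (by fun_prop (disch := assumption)))

lemma differentiableAt_theta {Q : ℂ} (hQ : ‖Q‖ < 1) {z : ℂ} (hz : z ≠ 0) :
    DifferentiableAt ℂ (theta Q) z := by
  rw [funext (theta_eq hQ)]
  exact (by fun_prop : DifferentiableAt ℂ (fun z : ℂ => 1 - z) z).mul
    (differentiableAt_thetaReg hQ hz)

lemma deriv_thetaReg_one {Q : ℂ} (hQ : ‖Q‖ < 1) : deriv (thetaReg Q) 1 = 0 := by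
  have h1 : HasDerivAt (thetaReg Q) (deriv (thetaReg Q) 1) (1 : ℂ)⁻¹ := by
    simpa using (differentiableAt_thetaReg hQ one_ne_zero).hasDerivAt
  have h2 := HasDerivAt.comp (1 : ℂ) h1 (hasDerivAt_inv one_ne_zero)
  have h3 : thetaReg Q ∘ Inv.inv = thetaReg Q := funext (thetaReg_inv Q)
  rw [h3] at h2
  have := h2.deriv
  norm_num at this
  linear_combination this / 2

/-- Near `z₀` and away from `z₀`, the function `f` agrees with one analytic at `z₀`. -/
def RemovableAt (f : ℂ → ℂ) (z₀ : ℂ) : Prop :=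
  ∃ g : ℂ → ℂ, AnalyticAt ℂ g z₀ ∧ f =ᶠ[𝓝[≠] z₀] g

lemma RemovableAt.exists_extension {f : ℂ → ℂ} (h : ∀ z ≠ 0, RemovableAt f z) :
    ∃ F : ℂ → ℂ, (∀ z ≠ 0, DifferentiableAt ℂ F z) ∧ (∀ z ≠ 0, f =ᶠ[𝓝[≠] z] F) ∧
      ∀ z ≠ 0, ContinuousAt f z → f z = F z := by
  have hlim : ∀ (z : ℂ) (g : ℂ → ℂ), ContinuousAt g z → f =ᶠ[𝓝[≠] z] g →
      limUnder (𝓝[≠] z) f = g z := fun z g hg hfg =>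
    Tendsto.limUnder_eq ((hg.tendsto.mono_left nhdsWithin_le_nhds).congr' hfg.symm)
  have key : ∀ z ≠ 0, ∃ g : ℂ → ℂ, AnalyticAt ℂ g z ∧ f =ᶠ[𝓝[≠] z] g ∧
      (fun w => limUnder (𝓝[≠] w) f) =ᶠ[𝓝 z] g := by
    intro z hz
    obtain ⟨g, hg, hfg⟩ := h z hz
    refine ⟨g, hg, hfg, ?_⟩
    have h1 : ∀ᶠ w in 𝓝[≠] z, f =ᶠ[𝓝 w] g := by
      have := eventually_eventually_nhdsWithin.mpr hfg
      filter_upwards [this, self_mem_nhdsWithin] with w hw hne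
      exact isOpen_compl_singleton.nhdsWithin_eq hne ▸ hw
    have h2 : ∀ᶠ w in 𝓝[≠] z, limUnder (𝓝[≠] w) f = g w := by
      filter_upwards [h1, nhdsWithin_le_nhds hg.eventually_continuousAt] with w hw hc
      exact hlim w g hc (hw.filter_mono nhdsWithin_le_nhds)
    have h3 : limUnder (𝓝[≠] z) f = g z := hlim z g hg.continuousAt hfg
    rw [eventually_nhdsWithin_iff] at h2
    filter_upwards [h2] with w hw
    by_cases hwz : w = z
    · subst hwz; exact h3
    · exact hw hwz
  refine ⟨fun w => limUnder (𝓝[≠] w) f, fun z hz => ?_, fun z hz => ?_, fun z hz hc => ?_⟩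
  · obtain ⟨g, hg, -, h2⟩ := key z hz
    exact (hg.congr h2.symm).differentiableAt
  · obtain ⟨g, hg, h1, h2⟩ := key z hz
    exact h1.trans (h2.filter_mono nhdsWithin_le_nhds).symm
  · exact (hlim z f hc EventuallyEq.rfl).symm

lemma eq_const_of_bounded_punctured {F : ℂ → ℂ} (hF : ∀ z ≠ 0, DifferentiableAt ℂ F z) {B : ℝ}
    (hB : ∀ z ≠ 0, ‖F z‖ ≤ B) {z w : ℂ} (hz : z ≠ 0) (hw : w ≠ 0) : F z = F w := by
  have hd : Differentiable ℂ fun u => F (Complex.exp u) := fun u =>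
    (hF _ (Complex.exp_ne_zero u)).comp u (Complex.differentiable_exp u)
  have hb : Bornology.IsBounded (Set.range fun u => F (Complex.exp u)) :=
    isBounded_iff_forall_norm_le.mpr ⟨B, by rintro _ ⟨u, rfl⟩; exact hB _ (Complex.exp_ne_zero u)⟩
  have := hd.apply_eq_apply_of_bounded hb (Complex.log z) (Complex.log w)
  simpa [Complex.exp_log hz, Complex.exp_log hw] using this

lemma exists_bound_annulus {F : ℂ → ℂ} (hF : ∀ z ≠ 0, DifferentiableAt ℂ F z) {a b : ℝ}
    (ha : 0 < a) : ∃ M : ℝ, 0 ≤ M ∧ ∀ z : ℂ, a ≤ ‖z‖ → ‖z‖ ≤ b → ‖F z‖ ≤ M := by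
  have hc : IsCompact (Metric.closedBall (0 : ℂ) b ∩ {z | a ≤ ‖z‖}) :=
    (isCompact_closedBall _ _).inter_right (isClosed_le continuous_const continuous_norm)
  obtain ⟨M, hM⟩ := hc.exists_bound_of_continuousOn (f := F) (fun z hz =>
    (hF z (norm_pos_iff.mp (ha.trans_le hz.2))).continuousAt.continuousWithinAt)
  exact ⟨max M 0, le_max_right _ _, fun z h1 h2 =>
    (hM z ⟨by simpa using h2, h1⟩).trans (le_max_left _ _)⟩

lemma eq_of_mul_invariant {Q : ℂ} (hQ : ‖Q‖ < 1) (hQ0 : Q ≠ 0) {F : ℂ → ℂ}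
    (hF : ∀ z ≠ 0, DifferentiableAt ℂ F z) (hper : ∀ z ≠ 0, F (Q * z) = F z)
    {z w : ℂ} (hz : z ≠ 0) (hw : w ≠ 0) : F z = F w := by
  have hq : 0 < ‖Q‖ := norm_pos_iff.mpr hQ0
  obtain ⟨M, -, hM⟩ := exists_bound_annulus hF (b := 1) hq
  have hz' : ∀ (n : ℕ) (z : ℂ), z ≠ 0 → F (Q ^ n * z) = F z := fun n => by
    induction n with
    | zero => simp
    | succ n ih =>
      intro z hz
      rw [pow_succ, mul_assoc, ih _ (mul_ne_zero hQ0 hz), hper z hz]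
  have hzz : ∀ (n : ℤ) (z : ℂ), z ≠ 0 → F (Q ^ n * z) = F z := fun n z hz => by
    obtain ⟨m, rfl | rfl⟩ := n.eq_nat_or_neg
    · exact_mod_cast hz' m z hz
    · have := hz' m (Q ^ (-(m : ℤ)) * z) (mul_ne_zero (zpow_ne_zero _ hQ0) hz)
      rw [← this, ← mul_assoc, ← zpow_natCast, ← zpow_add₀ hQ0]; simp
  refine eq_const_of_bounded_punctured hF (B := M) (fun z hz => ?_) hz hw
  obtain ⟨n, hn1, hn2⟩ := exists_mem_Ioc_zpow (norm_pos_iff.mpr hz) (one_lt_inv₀ hq |>.mpr hQ)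
  rw [← hzz (n + 1) z hz]
  have e : ∀ k : ℤ, (‖Q‖⁻¹) ^ k = (‖Q‖ ^ k)⁻¹ := fun k => inv_zpow _ _
  rw [e] at hn1 hn2
  have hp : 0 < ‖Q‖ ^ (n + 1) := zpow_pos hq _
  apply hM
  · rw [norm_mul, norm_zpow]
    rw [inv_lt_iff_one_lt_mul₀ (zpow_pos hq _)] at hn1
    rw [zpow_add_one₀ hq.ne']
    nlinarith
  · rw [norm_mul, norm_zpow]
    rw [le_inv_comm₀ (norm_pos_iff.mpr hz) hp, ← one_div, le_div_iff₀ (norm_pos_iff.mpr hz)] at hn2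
    exact hn2

lemma eq_zero_of_mul_cubic {Q : ℂ} (hQ : ‖Q‖ < 1) (hQ0 : Q ≠ 0) {F p : ℂ → ℂ} {C : ℝ}
    (hF : ∀ z ≠ 0, DifferentiableAt ℂ F z)
    (hper : ∀ z ≠ 0, F (Q * z) = -z ^ 3 * F z + p z)
    (hp : ∀ z, ‖p z‖ ≤ C * (1 + ‖z‖ ^ 2)) {z : ℂ} (hz : z ≠ 0) : F z = 0 := by
  have hq : 0 < ‖Q‖ := norm_pos_iff.mpr hQ0
  have hC : 0 ≤ C := by simpa using (norm_nonneg _).trans (hp 0)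
  obtain ⟨M, hM0, hM⟩ := exists_bound_annulus hF (b := 1) (pow_pos hq 2)
  set B := (M + 2 * C) / (1 - ‖Q‖) with hBdef
  have h1q : 0 < 1 - ‖Q‖ := by linarith
  have hB : (1 - ‖Q‖) * B = M + 2 * C := by rw [hBdef]; field_simp
  have hB0 : 0 ≤ B := by positivity
  have hMB : M ≤ B := by nlinarith
  have hin : ∀ (n : ℕ) (z : ℂ), ‖Q‖ ^ (n + 2) ≤ ‖z‖ → ‖z‖ ≤ 1 → ‖F z‖ ≤ B := by
    intro n
    induction n with
    | zero => exact fun z h1 h2 => (hM z (by simpa using h1) h2).trans hMB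
    | succ n ih =>
      intro z h1 h2
      by_cases h3 : ‖Q‖ ^ 2 ≤ ‖z‖
      · exact (hM z h3 h2).trans hMB
      · push Not at h3
        have hz0 : z ≠ 0 := norm_pos_iff.mp ((pow_pos hq _).trans_le h1)
        set w := z / Q with hw
        have hwz : z = Q * w := by rw [hw]; field_simp
        have hw0 : w ≠ 0 := div_ne_zero hz0 hQ0
        have hnz : ‖z‖ = ‖Q‖ * ‖w‖ := by rw [hwz, norm_mul]
        have hw1 : ‖w‖ ≤ ‖Q‖ := by
          by_contra hcon; push Not at hcon; nlinarith
        have hFw := ih w (by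
          rw [hnz, show n + 1 + 2 = (n + 2) + 1 from rfl, pow_succ'] at h1
          exact le_of_mul_le_mul_left h1 hq) (by linarith)
        rw [hwz, hper w hw0]
        have hpw : ‖p w‖ ≤ 2 * C := (hp w).trans (by
          have : ‖w‖ ^ 2 ≤ 1 := pow_le_one₀ (norm_nonneg _) (by linarith)
          nlinarith)
        have h3 : ‖w‖ ^ 3 ≤ ‖Q‖ := by
          calc ‖w‖ ^ 3 ≤ ‖w‖ ^ 1 := pow_le_pow_of_le_one (norm_nonneg _) (by linarith) (by norm_num)
            _ ≤ ‖Q‖ := by simpa using hw1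
        calc ‖-w ^ 3 * F w + p w‖ ≤ ‖w‖ ^ 3 * ‖F w‖ + ‖p w‖ := by
              refine (norm_add_le _ _).trans ?_
              simp
          _ ≤ ‖Q‖ * B + 2 * C := by gcongr
          _ ≤ B := by linarith
  have hin' : ∀ z ≠ 0, ‖z‖ ≤ 1 → ‖F z‖ ≤ B := by
    intro z hz h1
    obtain ⟨n, hn⟩ := exists_pow_lt_of_lt_one (norm_pos_iff.mpr hz) hQ
    refine hin n z (le_trans ?_ hn.le) h1
    exact pow_le_pow_of_le_one hq.le hQ.le (by omega)
  have h2q : 0 < 1 - ‖Q‖ ^ 2 := by nlinarith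
  set K := B + 2 * C / (1 - ‖Q‖ ^ 2) with hK
  have hK2 : (1 - ‖Q‖ ^ 2) * (K - B) = 2 * C := by rw [hK]; field_simp; ring
  have hKB : B + 2 * C ≤ K := by
    have : 2 * C ≤ 2 * C / (1 - ‖Q‖ ^ 2) := le_div_self (by positivity) h2q (by nlinarith)
    linarith
  have hstep : ∀ z : ℂ, 1 ≤ ‖z‖ → ‖F (Q * z)‖ ≤ (K - 2 * C) * ‖z‖ ^ 2 → ‖F z‖ ≤ K / ‖z‖ := by
    intro z h1 h2
    have hz0 : z ≠ 0 := norm_pos_iff.mp (by linarith)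
    have h3 : z ^ 3 * F z = p z - F (Q * z) := by rw [hper z hz0]; ring
    have h4 := congrArg norm h3
    rw [norm_mul, norm_pow] at h4
    have h5 : ‖z‖ ^ 3 * ‖F z‖ ≤ C * (1 + ‖z‖ ^ 2) + (K - 2 * C) * ‖z‖ ^ 2 := by
      rw [h4]; exact (norm_sub_le _ _).trans (add_le_add (hp z) h2)
    rw [le_div_iff₀ (by linarith)]
    have h1sq : 1 ≤ ‖z‖ ^ 2 := one_le_pow₀ h1
    have h6 : (‖F z‖ * ‖z‖) * ‖z‖ ^ 2 ≤ K * ‖z‖ ^ 2 := by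
      have : C ≤ C * ‖z‖ ^ 2 := le_mul_of_one_le_right hC h1sq
      calc (‖F z‖ * ‖z‖) * ‖z‖ ^ 2 = ‖z‖ ^ 3 * ‖F z‖ := by ring
        _ ≤ _ := h5
        _ ≤ _ := by linarith
    exact le_of_mul_le_mul_right h6 (by positivity)
  have hout : ∀ (n : ℕ) (z : ℂ), 1 ≤ ‖z‖ → ‖Q‖ ^ (n + 1) * ‖z‖ ≤ 1 → ‖F z‖ ≤ K / ‖z‖ := by
    intro n
    induction n with
    | zero =>
      intro z h1 h2
      have hz0 : z ≠ 0 := norm_pos_iff.mp (by linarith)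
      refine hstep z h1 ((hin' _ (mul_ne_zero hQ0 hz0) (by rw [norm_mul]; simpa using h2)).trans ?_)
      have h1sq : 1 ≤ ‖z‖ ^ 2 := one_le_pow₀ h1
      exact (by linarith : B ≤ K - 2 * C).trans (le_mul_of_one_le_right (by linarith) h1sq)
    | succ n ih =>
      intro z h1 h2
      have hz0 : z ≠ 0 := norm_pos_iff.mp (by linarith)
      refine hstep z h1 ?_
      by_cases h3 : ‖Q * z‖ ≤ 1
      · refine (hin' _ (mul_ne_zero hQ0 hz0) h3).trans ?_
        have h1sq : 1 ≤ ‖z‖ ^ 2 := one_le_pow₀ h1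
        exact (by linarith : B ≤ K - 2 * C).trans (le_mul_of_one_le_right (by linarith) h1sq)
      · push Not at h3
        have h4 := ih (Q * z) h3.le (by rw [norm_mul, ← mul_assoc, ← pow_succ]; exact h2)
        have h5 : K / ‖Q * z‖ ≤ K := div_le_self (by linarith) h3.le
        refine (h4.trans h5).trans ?_
        rw [norm_mul] at h3
        have h6 : 1 ≤ ‖Q‖ ^ 2 * ‖z‖ ^ 2 := by nlinarith
        have h7 : (1 - ‖Q‖ ^ 2) * K - 2 * C ≥ 0 := by nlinarith
        nlinarith [mul_nonneg h7 (sq_nonneg ‖z‖)]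
  have hout' : ∀ z : ℂ, 1 ≤ ‖z‖ → ‖F z‖ ≤ K / ‖z‖ := by
    intro z h1
    obtain ⟨n, hn⟩ := exists_pow_lt_of_lt_one (inv_pos.mpr (by linarith : 0 < ‖z‖)) hQ
    refine hout n z h1 ?_
    have : ‖Q‖ ^ (n + 1) ≤ ‖z‖⁻¹ :=
      (pow_le_pow_of_le_one hq.le hQ.le (by omega)).trans hn.le
    calc _ ≤ ‖z‖⁻¹ * ‖z‖ := by gcongr
      _ = 1 := inv_mul_cancel₀ (by linarith)
  have hbd : ∀ z ≠ 0, ‖F z‖ ≤ K := by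
    intro z hz
    rcases le_total ‖z‖ 1 with h | h
    · exact (hin' z hz h).trans (by linarith)
    · exact (hout' z h).trans (div_le_self (by linarith) h)
  by_contra hne
  have hpos : 0 < ‖F z‖ := norm_pos_iff.mpr hne
  obtain ⟨n, hn⟩ := exists_nat_gt (max 1 (K / ‖F z‖))
  have hn1 : (1 : ℝ) < n := (le_max_left _ _).trans_lt hn
  have hn2 : K / ‖F z‖ < n := (le_max_right _ _).trans_lt hn
  have hn0 : (n : ℂ) ≠ 0 := by
    intro h; have : (n : ℝ) = 0 := by exact_mod_cast h
    linarith
  have h8 := hout' n (by simpa using hn1.le)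
  rw [← eq_const_of_bounded_punctured hF hbd hz hn0] at h8
  simp only [Complex.norm_natCast] at h8
  rw [le_div_iff₀ (by linarith)] at h8
  rw [div_lt_iff₀ hpos] at hn2
  linarith

lemma RemovableAt.of_analyticAt {f : ℂ → ℂ} {z : ℂ} (h : AnalyticAt ℂ f z) : RemovableAt f z :=
  ⟨f, h, EventuallyEq.rfl⟩

lemma RemovableAt.congr {f g : ℂ → ℂ} {z : ℂ} (h : RemovableAt f z) (hfg : f =ᶠ[𝓝[≠] z] g) :
    RemovableAt g z := by
  obtain ⟨k, hk, hfk⟩ := h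
  exact ⟨k, hk, hfg.symm.trans hfk⟩

lemma RemovableAt.add {f g : ℂ → ℂ} {z : ℂ} (hf : RemovableAt f z) (hg : RemovableAt g z) :
    RemovableAt (fun w => f w + g w) z := by
  obtain ⟨k, hk, hfk⟩ := hf
  obtain ⟨l, hl, hgl⟩ := hg
  exact ⟨fun w => k w + l w, hk.add hl, hfk.add hgl⟩

lemma RemovableAt.mul {f g : ℂ → ℂ} {z : ℂ} (hf : RemovableAt f z) (hg : RemovableAt g z) :
    RemovableAt (fun w => f w * g w) z := by
  obtain ⟨k, hk, hfk⟩ := hf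
  obtain ⟨l, hl, hgl⟩ := hg
  exact ⟨fun w => k w * l w, hk.mul hl, hfk.mul hgl⟩

lemma RemovableAt.comp {f g : ℂ → ℂ} {z : ℂ} (hf : RemovableAt f (g z)) (hg : AnalyticAt ℂ g z)
    (hinj : Function.Injective g) : RemovableAt (fun w => f (g w)) z := by
  obtain ⟨k, hk, hfk⟩ := hf
  refine ⟨fun w => k (g w), hk.comp hg, ?_⟩
  have ht : Tendsto g (𝓝[≠] z) (𝓝[≠] (g z)) :=
    tendsto_nhdsWithin_of_tendsto_nhds_of_eventually_within _
      (hg.continuousAt.tendsto.mono_left nhdsWithin_le_nhds)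
      (eventually_mem_nhdsWithin.mono fun w hw => hinj.ne hw)
  exact ht.eventually hfk

lemma RemovableAt.div_sub {G H f : ℂ → ℂ} {z : ℂ} (hG : AnalyticAt ℂ G z)
    (hH : AnalyticAt ℂ H z) (hG0 : G z = 0) (hH0 : H z ≠ 0)
    (hf : ∀ w, f w = G w / ((w - z) * H w)) : RemovableAt f z := by
  obtain ⟨p, hp⟩ := hG
  refine ⟨fun w => dslope G z w / H w, AnalyticAt.div ⟨_, hp.has_fpower_series_dslope_fslope⟩ hH
    hH0,
    eventually_mem_nhdsWithin.mono fun w hw => ?_⟩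
  have hw' : w - z ≠ 0 := sub_ne_zero.mpr hw
  show f w = dslope G z w / H w
  rw [hf, dslope_of_ne _ hw, slope_def_field, hG0, sub_zero, div_div]

lemma eventually_punctured_ne_zero {z : ℂ} (hz : z ≠ 0) : ∀ᶠ w : ℂ in 𝓝[≠] z, w ≠ 0 :=
  nhdsWithin_le_nhds (isOpen_ne.mem_nhds hz)

lemma RemovableAt.zpow_mul {Q : ℂ} (hQ0 : Q ≠ 0) {f A p : ℂ → ℂ}
    (hA : ∀ z ≠ 0, AnalyticAt ℂ A z) (hA0 : ∀ z ≠ 0, A z ≠ 0) (hp : ∀ z ≠ 0, AnalyticAt ℂ p z)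
    (hf : ∀ z ≠ 0, ∀ᶠ w in 𝓝[≠] z, f (Q * w) = A w * f w + p w) {z : ℂ} (hz : z ≠ 0)
      (h : RemovableAt f z)
    (n : ℤ) : RemovableAt f (Q ^ n * z) := by
  have hne : ∀ z ≠ 0, ∀ᶠ w : ℂ in 𝓝[≠] z, w ≠ 0 := fun z hz => eventually_punctured_ne_zero hz
  have up : ∀ z ≠ 0, RemovableAt f z → RemovableAt f (Q * z) := by
    intro z hz h
    have h1 : RemovableAt (fun w => f (Q * w)) z :=
      (((RemovableAt.of_analyticAt (hA z hz)).mul h).add (.of_analyticAt (hp z hz))).congr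
        ((hf z hz).mono fun w hw => hw.symm)
    have h2 : RemovableAt (fun w => f (Q * w)) (Q⁻¹ * (Q * z)) := by
      rwa [inv_mul_cancel_left₀ hQ0]
    have h3 := RemovableAt.comp (g := fun w => Q⁻¹ * w) (z := Q * z) h2 (by fun_prop)
      (mul_right_injective₀ (inv_ne_zero hQ0))
    simpa [mul_inv_cancel_left₀ hQ0] using h3
  have down : ∀ z ≠ 0, RemovableAt f (Q * z) → RemovableAt f z := by
    intro z hz h
    have h1 : RemovableAt (fun w => f (Q * w)) z :=
      RemovableAt.comp (g := fun w => Q * w) h (by fun_prop) (mul_right_injective₀ hQ0)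
    refine ((RemovableAt.of_analyticAt ((hA z hz).inv (hA0 z hz))).mul
      (h1.add (.of_analyticAt (hp z hz).neg))).congr
      (((hne z hz).and (hf z hz)).mono fun w hw => ?_)
    have := hA0 w hw.1
    simp only [Pi.neg_apply, Pi.inv_apply]
    rw [hw.2]; field_simp; ring
  induction n with
  | zero => simpa using h
  | succ n ih =>
    rw [zpow_add_one₀ hQ0, mul_comm _ Q, mul_assoc]
    exact up _ (mul_ne_zero (zpow_ne_zero _ hQ0) hz) ih
  | pred n ih =>
    refine down _ (mul_ne_zero (zpow_ne_zero _ hQ0) hz) ?_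
    rwa [← mul_assoc, ← zpow_one_add₀ hQ0, add_sub_cancel]

lemma analyticAt_of_differentiable {f : ℂ → ℂ} (h : ∀ z ≠ 0, DifferentiableAt ℂ f z) {z : ℂ}
    (hz : z ≠ 0) : AnalyticAt ℂ f z :=
  DifferentiableOn.analyticAt (s := {0}ᶜ) (fun w hw => (h w hw).differentiableWithinAt)
    (isOpen_compl_singleton.mem_nhds hz)

lemma analyticAt_theta {Q : ℂ} (hQ : ‖Q‖ < 1) {z : ℂ} (hz : z ≠ 0) : AnalyticAt ℂ (theta Q) z :=
  analyticAt_of_differentiable (fun _ h => differentiableAt_theta hQ h) hz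

lemma analyticAt_thetaReg {Q : ℂ} (hQ : ‖Q‖ < 1) {z : ℂ} (hz : z ≠ 0) :
    AnalyticAt ℂ (thetaReg Q) z :=
  analyticAt_of_differentiable (fun _ h => differentiableAt_thetaReg hQ h) hz

lemma extension_quasiperiodic {Q : ℂ} (hQ0 : Q ≠ 0) {f F A p : ℂ → ℂ}
    (hA : ∀ z ≠ 0, ContinuousAt A z) (hp : ∀ z ≠ 0, ContinuousAt p z)
    (hf : ∀ z ≠ 0, ∀ᶠ w in 𝓝[≠] z, f (Q * w) = A w * f w + p w)
      (hF : ∀ z ≠ 0, DifferentiableAt ℂ F z)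
    (hfF : ∀ z ≠ 0, f =ᶠ[𝓝[≠] z] F) (z : ℂ) (hz : z ≠ 0) :
    F (Q * z) = A z * F z + p z := by
  have hQz := mul_ne_zero hQ0 hz
  have ht : Tendsto (fun w => Q * w) (𝓝[≠] z) (𝓝[≠] (Q * z)) :=
    tendsto_nhdsWithin_of_tendsto_nhds_of_eventually_within _
      (((continuous_const_mul Q).tendsto z).mono_left nhdsWithin_le_nhds)
      (eventually_mem_nhdsWithin.mono fun w hw => (mul_right_injective₀ hQ0).ne hw)
  have h1 : (fun w => F (Q * w)) =ᶠ[𝓝[≠] z] fun w => A w * F w + p w := by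
    filter_upwards [ht.eventually (hfF _ hQz), hfF z hz, hf z hz] with w h1 h2 h3
    rw [← h1, ← h2, h3]
  have h2 : Tendsto (fun w => F (Q * w)) (𝓝[≠] z) (𝓝 (F (Q * z))) :=
    (((hF _ hQz).continuousAt.tendsto).mono_left nhdsWithin_le_nhds).comp ht
  exact tendsto_nhds_unique (h2.congr' h1)
    ((((hA z hz).mul (hF z hz).continuousAt).add (hp z hz)).tendsto.mono_left nhdsWithin_le_nhds)

/-- The quasi-periodic product `θ(xy) θ(x/y)`. -/
noncomputable def thetaPair (Q x y : ℂ) : ℂ := theta Q (x * y) * theta Q (x / y)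

lemma analyticAt_thetaPair {Q : ℂ} (hQ : ‖Q‖ < 1) {x y : ℂ} (hx : x ≠ 0) (hy : y ≠ 0) :
    AnalyticAt ℂ (fun x => thetaPair Q x y) x :=
  ((analyticAt_theta hQ (mul_ne_zero hx hy)).comp (f := fun x => x * y) (by fun_prop)).mul
    ((analyticAt_theta hQ (div_ne_zero hx hy)).comp (f := fun x => x / y)
      (by fun_prop (disch := assumption)))

lemma thetaPair_mul {Q : ℂ} (hQ : ‖Q‖ < 1) (hQ0 : Q ≠ 0) {x y : ℂ} (hx : x ≠ 0) (hy : y ≠ 0) :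
    thetaPair Q (Q * x) y = thetaPair Q x y / x ^ 2 := by
  rw [thetaPair, thetaPair, mul_assoc, theta_mul hQ hQ0 (mul_ne_zero hx hy), mul_div_assoc,
    theta_mul hQ hQ0 (div_ne_zero hx hy)]
  field_simp

lemma thetaPair_inv {Q : ℂ} (hQ : ‖Q‖ < 1) {x y : ℂ} (hx : x ≠ 0) (hy : y ≠ 0) :
    thetaPair Q x⁻¹ y = thetaPair Q x y / x ^ 2 := by
  rw [thetaPair, thetaPair, show x⁻¹ * y = (x / y)⁻¹ by field_simp,
    show x⁻¹ / y = (x * y)⁻¹ by field_simp, theta_inv hQ (mul_ne_zero hx hy),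
    theta_inv hQ (div_ne_zero hx hy)]
  field_simp

lemma thetaPair_swap {Q : ℂ} (hQ : ‖Q‖ < 1) {x y : ℂ} (hx : x ≠ 0) (hy : y ≠ 0) :
    thetaPair Q y x = -(y / x * thetaPair Q x y) := by
  rw [thetaPair, thetaPair, show y / x = (x / y)⁻¹ by field_simp,
    theta_inv hQ (div_ne_zero hx hy), mul_comm y x]
  field_simp

lemma thetaPair_self {Q : ℂ} (hQ : ‖Q‖ < 1) {x : ℂ} (hx : x ≠ 0) : thetaPair Q x x = 0 := by
  rw [thetaPair, div_self hx, theta_one hQ, mul_zero]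

lemma exists_zpow_of_theta_eq_zero {Q : ℂ} (hQ : ‖Q‖ < 1) (hQ0 : Q ≠ 0) {z : ℂ} (hz : z ≠ 0)
    (h : theta Q z = 0) : ∃ n : ℤ, z = Q ^ n := by
  by_contra hc
  exact theta_ne_zero hQ hQ0 hz (fun n hn => hc ⟨n, hn⟩) h

/-- **Weierstrass's three-term relation** for theta functions. -/
lemma thetaPair_three_term {Q : ℂ} (hQ : ‖Q‖ < 1) (hQ0 : Q ≠ 0) {x y u v : ℂ} (hx : x ≠ 0)
    (hy : y ≠ 0) (hu : u ≠ 0) (hv : v ≠ 0) (huu : theta Q (u * u) ≠ 0)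
    (hxu : thetaPair Q x u ≠ 0) (hvu : thetaPair Q v u ≠ 0) :
    thetaPair Q x y * thetaPair Q u v - thetaPair Q x v * thetaPair Q u y =
      -(u / v * (thetaPair Q v y * thetaPair Q x u)) := by
  set L : ℂ → ℂ := fun x => thetaPair Q x y * thetaPair Q u v - thetaPair Q x v * thetaPair Q u y
    with hL
  set f : ℂ → ℂ := fun x => L x / thetaPair Q x u with hf
  have hLa : ∀ z ≠ 0, AnalyticAt ℂ L z := fun z hz =>
    ((analyticAt_thetaPair hQ hz hy).mul analyticAt_const).sub
      ((analyticAt_thetaPair hQ hz hv).mul analyticAt_const)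
  have hper : ∀ z ≠ 0, f (Q * z) = f z := fun z hz => by
    simp only [hf, hL]
    rw [thetaPair_mul hQ hQ0 hz hy, thetaPair_mul hQ hQ0 hz hv, thetaPair_mul hQ hQ0 hz hu]
    field_simp
  have hinv : ∀ z ≠ 0, f z⁻¹ = f z := fun z hz => by
    simp only [hf, hL]
    rw [thetaPair_inv hQ hz hy, thetaPair_inv hQ hz hv, thetaPair_inv hQ hz hu]
    field_simp
  have hru : RemovableAt f u := by
    refine RemovableAt.div_sub (H := fun w => -(theta Q (w * u) * thetaReg Q (w / u) / u))
      (hLa u hu)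
      ?_ (by simp only [hL]; ring) ?_ fun w => ?_
    · have h1 : AnalyticAt ℂ (fun w => theta Q (w * u)) u :=
        (analyticAt_theta hQ (mul_ne_zero hu hu)).comp (f := fun w => w * u) (by fun_prop)
      have h2 : AnalyticAt ℂ (fun w => thetaReg Q (w / u)) u :=
        (analyticAt_thetaReg hQ (div_ne_zero hu hu)).comp (f := fun x => x / u)
          (by fun_prop (disch := assumption))
      fun_prop (disch := assumption)
    · rw [div_self hu]
      exact neg_ne_zero.mpr (div_ne_zero (mul_ne_zero huu (thetaReg_one_ne_zero hQ)) hu)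
    · simp only [hf, thetaPair, theta_eq hQ (w / u)]
      congr 1; field_simp; ring
  have hru' : RemovableAt f u⁻¹ := by
    have h0 : RemovableAt f u⁻¹⁻¹ := by rwa [inv_inv]
    have := RemovableAt.comp (g := fun w : ℂ => w⁻¹) (z := u⁻¹) h0
      (analyticAt_inv (inv_ne_zero hu)) inv_injective
    exact this.congr ((eventually_punctured_ne_zero (inv_ne_zero hu)).mono fun w hw => hinv w hw)
  have htr : ∀ z ≠ 0, RemovableAt f z → ∀ n : ℤ, RemovableAt f (Q ^ n * z) := fun z hz h n =>
    RemovableAt.zpow_mul hQ0 (A := fun _ => 1) (p := fun _ => 0) (fun _ _ => analyticAt_const)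
      (fun _ _ => one_ne_zero) (fun _ _ => analyticAt_const)
      (fun z hz => (eventually_punctured_ne_zero hz).mono fun w hw => by simpa using hper w hw)
        hz h n
  have hrem : ∀ z ≠ 0, RemovableAt f z := by
    intro z hz
    by_cases h : thetaPair Q z u = 0
    · rcases mul_eq_zero.mp h with h | h
      · obtain ⟨n, hn⟩ := exists_zpow_of_theta_eq_zero hQ hQ0 (mul_ne_zero hz hu) h
        rw [show z = Q ^ n * u⁻¹ by rw [← hn]; field_simp]
        exact htr _ (inv_ne_zero hu) hru' n
      · obtain ⟨n, hn⟩ := exists_zpow_of_theta_eq_zero hQ hQ0 (div_ne_zero hz hu) h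
        rw [show z = Q ^ n * u by rw [← hn]; field_simp]
        exact htr _ hu hru n
    · exact .of_analyticAt ((hLa z hz).div (analyticAt_thetaPair hQ hz hu) h)
  obtain ⟨F, hF, hfF, hFc⟩ := RemovableAt.exists_extension hrem
  have hFv : ∀ z ≠ 0, thetaPair Q z u ≠ 0 → f z = F z := fun z hz h =>
    hFc z hz ((hLa z hz).div (analyticAt_thetaPair hQ hz hu) h).continuousAt
  have hFper : ∀ z ≠ 0, F (Q * z) = F z := by
    intro z hz
    have := extension_quasiperiodic hQ0 (A := fun _ => 1) (p := fun _ => 0)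
      (fun _ _ => continuousAt_const) (fun _ _ => continuousAt_const)
      (fun z hz => (eventually_punctured_ne_zero hz).mono fun w hw => by simpa using hper w hw)
        hF hfF z hz
    simpa using this
  have hfin : f x = f v := by
    rw [hFv x hx hxu, hFv v hv hvu]
    exact eq_of_mul_invariant hQ hQ0 hF hFper hx hv
  simp only [hf, hL, thetaPair_self hQ hv] at hfin
  rw [div_eq_iff hxu] at hfin
  rw [hfin, thetaPair_swap hQ hv hu]
  field_simp
  ring

/-- The logarithmic derivative of theta, multiplied by `z`. -/
noncomputable def thetaLog (Q z : ℂ) : ℂ := z * deriv (theta Q) z / theta Q z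

lemma hasDerivAt_theta_one {Q : ℂ} (hQ : ‖Q‖ < 1) :
    HasDerivAt (theta Q) (-(qProd Q Q ^ 2)) 1 := by
  have h := ((hasDerivAt_id (1 : ℂ)).const_sub 1).mul
    (differentiableAt_thetaReg hQ one_ne_zero).hasDerivAt
  rw [funext (theta_eq hQ)]
  refine h.congr_deriv ?_
  simp [thetaReg_one]

lemma hasDerivAt_theta_comp {Q : ℂ} (hQ : ‖Q‖ < 1) {f : ℂ → ℂ} {f' x : ℂ} (hf : HasDerivAt f f' x)
    (h0 : f x ≠ 0) : HasDerivAt (fun y => theta Q (f y)) (deriv (theta Q) (f x) * f') x :=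
  (differentiableAt_theta hQ h0).hasDerivAt.comp x hf

lemma deriv_theta {Q z : ℂ} (hz : z ≠ 0) (h : theta Q z ≠ 0) :
    deriv (theta Q) z = thetaLog Q z * theta Q z / z := by
  rw [thetaLog]; field_simp

lemma thetaLog_inv {Q : ℂ} (hQ : ‖Q‖ < 1) {z : ℂ} (hz : z ≠ 0) (h : theta Q z ≠ 0) :
    thetaLog Q z⁻¹ = 1 - thetaLog Q z := by
  have h1 := hasDerivAt_theta_comp hQ (hasDerivAt_inv hz) (inv_ne_zero hz)
  have h2 : HasDerivAt (fun y => -(theta Q y / y)) _ z :=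
    ((differentiableAt_theta hQ hz).hasDerivAt.div (hasDerivAt_id z) hz).neg
  have h3 : (fun y => theta Q y⁻¹) =ᶠ[𝓝 z] fun y => -(theta Q y / y) :=
    (eventually_ne_nhds hz).mono fun w hw => theta_inv hQ hw
  have h4 := h1.unique (h2.congr_of_eventuallyEq h3)
  have h5 : theta Q z⁻¹ ≠ 0 := by rw [theta_inv hQ hz]; simp [hz, h]
  rw [deriv_theta (inv_ne_zero hz) h5, deriv_theta hz h, theta_inv hQ hz] at h4
  simp only [id] at h4
  rw [← one_div]
  field_simp at h4
  linear_combination h4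

lemma thetaLog_mul {Q : ℂ} (hQ : ‖Q‖ < 1) (hQ0 : Q ≠ 0) {z : ℂ} (hz : z ≠ 0)
    (h : theta Q z ≠ 0) : thetaLog Q (Q * z) = thetaLog Q z - 1 := by
  have hQz := mul_ne_zero hQ0 hz
  have h1 := hasDerivAt_theta_comp hQ ((hasDerivAt_id z).const_mul Q) hQz
  have h2 : HasDerivAt (fun y => -(theta Q y / y)) _ z :=
    ((differentiableAt_theta hQ hz).hasDerivAt.div (hasDerivAt_id z) hz).neg
  have h3 : (fun y => theta Q (Q * y)) =ᶠ[𝓝 z] fun y => -(theta Q y / y) :=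
    (eventually_ne_nhds hz).mono fun w hw => theta_mul hQ hQ0 hw
  have h4 := h1.unique (h2.congr_of_eventuallyEq h3)
  have h5 : theta Q (Q * z) ≠ 0 := by rw [theta_mul hQ hQ0 hz]; simp [hz, h]
  simp only [id] at h4
  rw [deriv_theta hQz h5, deriv_theta hz h, theta_mul hQ hQ0 hz] at h4
  field_simp at h4
  linear_combination -h4

lemma thetaLog_three_term {Q : ℂ} (hQ : ‖Q‖ < 1) (hQ0 : Q ≠ 0) {u v : ℂ} (hu : u ≠ 0)
    (hv : v ≠ 0) (huu : theta Q (u * u) ≠ 0) (h1u : theta Q u ≠ 0) (huv : theta Q (v * u) ≠ 0)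
    (hvu : theta Q (v / u) ≠ 0) :
    theta Q u * theta Q u * theta Q (v * u) * theta Q (v / u) *
      (2 * thetaLog Q u - 1 - thetaLog Q (v * u) + thetaLog Q (v / u)) =
      -(theta Q v * theta Q v * theta Q (u * u) * qProd Q Q ^ 2) := by
  have hpair : ∀ y ≠ 0, thetaPair Q 1 y = -(theta Q y * theta Q y / y) := fun y hy => by
    rw [thetaPair, one_mul, one_div, theta_inv hQ hy]; ring
  have key : ∀ y ≠ 0, -(theta Q y * theta Q y / y) * thetaPair Q u v +
      theta Q v * theta Q v / v * (theta Q (u * y) * theta Q (u / y)) -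
      1 / v * (theta Q (v * y) * theta Q (v / y) * (theta Q u * theta Q u)) = 0 := by
    intro y hy
    have := thetaPair_three_term hQ hQ0 one_ne_zero hy hu hv huu
      (by rw [hpair u hu]; simp [hu, h1u]) (mul_ne_zero huv hvu)
    rw [hpair y hy, hpair v hv, hpair u hu, show thetaPair Q u y = theta Q (u * y) * theta Q (u / y)
      from rfl, show thetaPair Q v y = theta Q (v * y) * theta Q (v / y) from rfl] at this
    rw [← sub_eq_zero] at this
    rw [← this]; field_simp; ring
  have hT : ∀ x ≠ 0, HasDerivAt (theta Q) (deriv (theta Q) x) x := fun x hx =>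
    (differentiableAt_theta hQ hx).hasDerivAt
  have hm : ∀ c ≠ 0, HasDerivAt (fun y => theta Q (c * y)) _ u := fun c hc =>
    hasDerivAt_theta_comp hQ ((hasDerivAt_id u).const_mul c) (mul_ne_zero hc hu)
  have hd : ∀ c ≠ 0, HasDerivAt (fun y => theta Q (c / y)) _ u := fun c hc =>
    hasDerivAt_theta_comp hQ ((hasDerivAt_const u c).div (hasDerivAt_id u) hu) (div_ne_zero hc hu)
  have hder := ((((((hT u hu).mul (hT u hu)).div (hasDerivAt_id u) hu).neg.mul_const
    (thetaPair Q u v)).add (((hm u hu).mul (hd u hu)).const_mul (theta Q v * theta Q v / v))).sub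
    ((((hm v hv).mul (hd v hv)).mul_const (theta Q u * theta Q u)).const_mul (1 / v)))
  have h0 := hder.congr_of_eventuallyEq (f₁ := fun _ : ℂ => (0 : ℂ))
    ((eventually_ne_nhds hu).mono fun w hw => (key w hw).symm)
  have h1 := h0.unique (hasDerivAt_const u 0)
  simp only [id, div_self hu, theta_one hQ, Pi.mul_apply] at h1
  rw [(hasDerivAt_theta_one hQ).deriv, deriv_theta hu h1u, deriv_theta (mul_ne_zero hv hu) huv,
    deriv_theta (div_ne_zero hv hu) hvu, thetaPair_swap hQ hv hu, thetaPair] at h1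
  field_simp at h1
  refine mul_left_cancel₀ hv ?_
  rw [mul_comm v u, ← sq u]
  linear_combination h1

lemma exists_lower_bound_one_sub_zpow {Q : ℂ} (hQ : ‖Q‖ < 1) (hQ0 : Q ≠ 0) {z : ℂ} (hz : z ≠ 0) :
    ∃ δ > 0, ∀ᶠ w in 𝓝 z, ∀ n : ℤ, z * Q ^ n ≠ 1 → δ ≤ ‖1 - w * Q ^ n‖ := by
  have hq : 0 < ‖Q‖ := norm_pos_iff.mpr hQ0
  have hzp : 0 < ‖z‖ := norm_pos_iff.mpr hz
  obtain ⟨N₁, hN₁⟩ := exists_pow_lt_of_lt_one (by positivity : 0 < 1 / (4 * ‖z‖)) hQ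
  obtain ⟨N₂, hN₂⟩ := exists_pow_lt_of_lt_one (by positivity : 0 < ‖z‖ / 4) hQ
  set N := max N₁ N₂
  have hN1 : ‖Q‖ ^ N < 1 / (4 * ‖z‖) :=
    (pow_le_pow_of_le_one hq.le hQ.le (le_max_left _ _)).trans_lt hN₁
  have hN2 : ‖Q‖ ^ N < ‖z‖ / 4 :=
    (pow_le_pow_of_le_one hq.le hQ.le (le_max_right _ _)).trans_lt hN₂
  have hmid : ∀ᶠ p : ℝ × ℂ in 𝓝 0 ×ˢ 𝓝 z, ∀ n ∈ Finset.Icc (-(N : ℤ)) N,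
      z * Q ^ n ≠ 1 → p.1 < ‖1 - p.2 * Q ^ n‖ := by
    rw [eventually_all_finset]
    intro n _
    by_cases h : z * Q ^ n = 1
    · exact Eventually.of_forall fun p hp => absurd h hp
    · have h1 : ContinuousAt (fun p : ℝ × ℂ => ‖1 - p.2 * Q ^ n‖ - p.1) (0, z) := by fun_prop
      have h2 : (0 : ℝ) < ‖1 - z * Q ^ n‖ - 0 := by
        rw [sub_zero]; exact norm_pos_iff.mpr (sub_ne_zero.mpr (Ne.symm h))
      rw [← nhds_prod_eq]
      filter_upwards [h1.eventually (lt_mem_nhds h2)] with p hp _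
      linarith
  obtain ⟨δ, hδ, hδ0, hδ1⟩ := (((hmid.curry).filter_mono nhdsWithin_le_nhds :
    ∀ᶠ δ in 𝓝[>] (0 : ℝ), _).and (Ioo_mem_nhdsGT (by norm_num : (0 : ℝ) < 1 / 2))).exists
  refine ⟨δ, hδ0, ?_⟩
  have hball : ∀ᶠ w in 𝓝 z, ‖z‖ / 2 < ‖w‖ ∧ ‖w‖ < 2 * ‖z‖ :=
    (continuous_norm.tendsto z).eventually (Ioo_mem_nhds (by linarith) (by linarith))
  filter_upwards [hδ, hball] with w hw ⟨hw1, hw2⟩ n hn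
  by_cases hn1 : n ∈ Finset.Icc (-(N : ℤ)) N
  · exact (hw n hn1 hn).le
  · rw [Finset.mem_Icc, not_and_or, not_le, not_le] at hn1
    rcases hn1 with hn1 | hn1
    · have h1 : (‖Q‖ ^ N)⁻¹ ≤ ‖Q‖ ^ n := by
        rw [← zpow_natCast, ← zpow_neg]
        exact zpow_le_zpow_right_of_le_one₀ hq hQ.le hn1.le
      have h2 : 4 / ‖z‖ ≤ (‖Q‖ ^ N)⁻¹ := by
        rw [le_inv_comm₀ (by positivity) (by positivity), inv_div]; exact hN2.le
      have h3 : 2 ≤ ‖w * Q ^ n‖ := by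
        rw [norm_mul, norm_zpow]
        calc (2 : ℝ) = ‖z‖ / 2 * (4 / ‖z‖) := by field_simp; norm_num
          _ ≤ ‖w‖ * ‖Q‖ ^ n := by gcongr; exact h2.trans h1
      have h4 := norm_sub_norm_le (w * Q ^ n) 1
      rw [norm_one, norm_sub_rev] at h4
      linarith
    · have h1 : ‖Q‖ ^ n ≤ ‖Q‖ ^ N := by
        rw [← zpow_natCast]
        exact zpow_le_zpow_right_of_le_one₀ hq hQ.le hn1.le
      have h3 : ‖w * Q ^ n‖ ≤ 1 / 2 := by
        rw [norm_mul, norm_zpow]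
        calc ‖w‖ * ‖Q‖ ^ n ≤ (2 * ‖z‖) * (1 / (4 * ‖z‖)) := by gcongr; exact h1.trans hN1.le
          _ = 1 / 2 := by field_simp; norm_num
      have h4 := norm_sub_norm_le 1 (w * Q ^ n)
      rw [norm_one] at h4
      linarith

lemma eventually_mul_zpow_ne_one {Q : ℂ} (hQ : ‖Q‖ < 1) (hQ0 : Q ≠ 0) {z : ℂ} (hz : z ≠ 0) :
    ∀ᶠ w in 𝓝[≠] z, ∀ n : ℤ, w * Q ^ n ≠ 1 := by
  obtain ⟨δ, hδ, h⟩ := exists_lower_bound_one_sub_zpow hQ hQ0 hz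
  filter_upwards [nhdsWithin_le_nhds h, self_mem_nhdsWithin] with w hw hne n hn
  by_cases hz1 : z * Q ^ n = 1
  · exact hne (mul_right_cancel₀ (zpow_ne_zero n hQ0) (hn.trans hz1.symm))
  · have := hw n hz1
    rw [hn, sub_self, norm_zero] at this
    linarith

lemma Summable.div_one_sub_zpow {Q : ℂ} (hQ : ‖Q‖ < 1) (hQ0 : Q ≠ 0) {z : ℂ} (hz : z ≠ 0)
    {a : ℤ → ℂ} (ha : Summable fun n => ‖a n‖) : Summable fun n => ‖a n / (1 - z * Q ^ n)‖ := by
  obtain ⟨δ, hδ, h⟩ := exists_lower_bound_one_sub_zpow hQ hQ0 hz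
  refine (ha.mul_left δ⁻¹).of_nonneg_of_le (fun _ => norm_nonneg _) fun n => ?_
  by_cases h1 : z * Q ^ n = 1
  · rw [h1, sub_self, div_zero, norm_zero]; positivity
  · have := h.self_of_nhds n h1
    rw [norm_div, div_eq_inv_mul]
    gcongr

lemma analyticAt_tsum_div {Q : ℂ} (hQ : ‖Q‖ < 1) (hQ0 : Q ≠ 0) {z : ℂ} (hz : z ≠ 0)
    {a : ℤ → ℂ} (ha : Summable fun n => ‖a n‖) (h0 : ∀ n, z * Q ^ n = 1 → a n = 0) :
    AnalyticAt ℂ (fun w => ∑' n : ℤ, a n / (1 - w * Q ^ n)) z := by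
  obtain ⟨δ, hδ, h⟩ := exists_lower_bound_one_sub_zpow hQ hQ0 hz
  obtain ⟨U, hU, hUo, hzU⟩ := eventually_nhds_iff.mp h
  have hb : ∀ (n : ℤ) (w : ℂ), w ∈ U → a n ≠ 0 → δ ≤ ‖1 - w * Q ^ n‖ := fun n w hw han =>
    hU w hw n fun hc => han (h0 n hc)
  refine DifferentiableOn.analyticAt (s := U)
    (Complex.differentiableOn_tsum_of_summable_norm (ha.mul_left δ⁻¹) (fun n => ?_) hUo
      fun n w hw => ?_) (hUo.mem_nhds hzU)
  · by_cases han : a n = 0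
    · simp [han]
    · intro w hw
      have : 1 - w * Q ^ n ≠ 0 := norm_pos_iff.mp (hδ.trans_le (hb n w hw han))
      exact DifferentiableAt.differentiableWithinAt (by fun_prop (disch := assumption))
  · by_cases han : a n = 0
    · simp [han]
    · have := hb n w hw han
      rw [norm_div, div_eq_inv_mul]
      gcongr

/-- The triangular number `n (n + 1) / 2`. -/
def tri (n : ℤ) : ℤ := n * (n + 1) / 2

lemma two_mul_tri (n : ℤ) : 2 * tri n = n * (n + 1) :=
  Int.mul_ediv_cancel' (Int.even_mul_succ_self n).two_dvd

lemma summable_exp_quadratic {A B : ℝ} (hA : A < 0) :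
    Summable fun n : ℤ => Real.exp (A * n ^ 2 + B * n) := by
  have hpi := Real.pi_pos
  refine (summable_pow_mul_jacobiTheta₂_term_bound (|B| / (2 * Real.pi))
    (T := -A / Real.pi) (by apply div_pos <;> linarith) 0).of_nonneg_of_le
    (fun _ => (Real.exp_pos _).le) fun n => ?_
  rw [pow_zero, one_mul]
  refine Real.exp_le_exp.mpr ?_
  have h1 : B * n ≤ |B| * |(n : ℝ)| := (le_abs_self _).trans (abs_mul _ _).le
  have h2 : -Real.pi * (-A / Real.pi * n ^ 2 - 2 * (|B| / (2 * Real.pi)) * |(n : ℝ)|) =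
    A * n ^ 2 + |B| * |(n : ℝ)| := by field_simp; ring
  push_cast
  rw [h2]
  linarith

lemma summable_tri {Q : ℂ} (hQ : ‖Q‖ < 1) (hQ0 : Q ≠ 0) {w : ℂ} (hw : w ≠ 0) :
    Summable fun n : ℤ => ‖(-1) ^ n * Q ^ (3 * tri n) * w ^ n‖ := by
  have hq : 0 < ‖Q‖ := norm_pos_iff.mpr hQ0
  have hwp : 0 < ‖w‖ := norm_pos_iff.mpr hw
  have hl : Real.log ‖Q‖ < 0 := Real.log_neg hq hQ
  refine (summable_exp_quadratic (A := 3 / 2 * Real.log ‖Q‖)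
    (B := 3 / 2 * Real.log ‖Q‖ + Real.log ‖w‖) (by linarith)).congr fun n => ?_
  have h3 : ((tri n : ℤ) : ℝ) = n * (n + 1) / 2 := by
    have : (2 * (tri n : ℤ) : ℝ) = n * (n + 1) := by exact_mod_cast two_mul_tri n
    linarith
  rw [norm_mul, norm_mul, norm_zpow, norm_zpow, norm_zpow, norm_neg, norm_one, one_zpow, one_mul,
    ← Real.rpow_intCast, ← Real.rpow_intCast, Real.rpow_def_of_pos hq, Real.rpow_def_of_pos hwp,
    ← Real.exp_add]
  push_cast
  rw [h3]
  congr 1; ring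

/-- The Appell–Lerch type series `∑ (-1)ⁿ Q^(3n(n+1)/2) wⁿ / (1 - z Qⁿ)`. -/
noncomputable def appell (Q w z : ℂ) : ℂ :=
  ∑' n : ℤ, (-1) ^ n * Q ^ (3 * tri n) * w ^ n / (1 - z * Q ^ n)

/-- The partial theta-like series `∑ (-1)ⁿ Q^(3n(n+1)/2) wⁿ`. -/
noncomputable def triSum (Q w : ℂ) : ℂ := ∑' n : ℤ, (-1) ^ n * Q ^ (3 * tri n) * w ^ n

lemma tri_sub_one (n : ℤ) : tri (n - 1) = tri n - n := by
  have h1 := two_mul_tri n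
  have h2 := two_mul_tri (n - 1)
  have : 2 * tri (n - 1) = 2 * (tri n - n) := by rw [h2, mul_sub, h1]; ring
  omega

lemma hasSum_triSum {Q : ℂ} (hQ : ‖Q‖ < 1) (hQ0 : Q ≠ 0) {w : ℂ} (hw : w ≠ 0) :
    HasSum (fun n : ℤ => (-1) ^ n * Q ^ (3 * tri n) * w ^ n) (triSum Q w) :=
  (summable_tri hQ hQ0 hw).of_norm.hasSum

lemma hasSum_appell {Q : ℂ} (hQ : ‖Q‖ < 1) (hQ0 : Q ≠ 0) {w z : ℂ} (hw : w ≠ 0) (hz : z ≠ 0) :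
    HasSum (fun n : ℤ => (-1) ^ n * Q ^ (3 * tri n) * w ^ n / (1 - z * Q ^ n)) (appell Q w z) :=
  ((summable_tri hQ hQ0 hw).div_one_sub_zpow hQ hQ0 hz).of_norm.hasSum

lemma appell_mul {Q : ℂ} (hQ : ‖Q‖ < 1) (hQ0 : Q ≠ 0) {w z : ℂ} (hw : w ≠ 0) (hz : z ≠ 0)
    (h : ∀ n : ℤ, z * Q ^ n ≠ 1) :
    appell Q w (Q * z) = -(w⁻¹ * z ^ 3) * (appell Q w z + z⁻¹ * triSum Q (w / Q) +
      z⁻¹ ^ 2 * triSum Q (w / Q ^ 2) + z⁻¹ ^ 3 * triSum Q (w / Q ^ 3)) := by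
  have h1 := hasSum_appell hQ hQ0 hw (mul_ne_zero hQ0 hz)
  rw [← (Equiv.subRight (1 : ℤ)).hasSum_iff] at h1
  have ht : ∀ k : ℕ, HasSum (fun n : ℤ => (-1) ^ n * Q ^ (3 * tri n) * (w / Q ^ k) ^ n) _ :=
    fun k => hasSum_triSum hQ hQ0 (div_ne_zero hw (pow_ne_zero k hQ0))
  have h2 := ((((hasSum_appell hQ hQ0 hw hz).add ((ht 1).mul_left z⁻¹)).add
    ((ht 2).mul_left (z⁻¹ ^ 2))).add ((ht 3).mul_left (z⁻¹ ^ 3))).mul_left (-(w⁻¹ * z ^ 3))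
  rw [pow_one] at h2
  refine h1.unique (h2.congr_fun fun n => ?_)
  have hX : Q ^ n ≠ 0 := zpow_ne_zero n hQ0
  have hd : 1 - z * Q ^ n ≠ 0 := sub_ne_zero.mpr (h n).symm
  have e1 : Q ^ (3 * tri (n - 1)) = Q ^ (3 * tri n) / (Q ^ n) ^ 3 := by
    rw [tri_sub_one, mul_sub, zpow_sub₀ hQ0, mul_comm 3 n, zpow_mul Q n 3]; norm_cast
  have e2 : ∀ k : ℕ, (w / Q ^ k) ^ n = w ^ n / (Q ^ n) ^ k := fun k => by
    rw [div_zpow, ← zpow_natCast, ← zpow_natCast, ← zpow_mul, ← zpow_mul, mul_comm]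
  have e3 : Q * z * Q ^ (n - 1) = z * Q ^ n := by rw [zpow_sub_one₀ hQ0]; field_simp
  have e4 := e2 1
  rw [pow_one, pow_one] at e4
  simp only [Function.comp_apply, Equiv.subRight_apply]
  rw [e1, e2, e2, e4, e3, zpow_sub_one₀ hw, zpow_sub_one₀ (by norm_num : (-1 : ℂ) ≠ 0)]
  set X := Q ^ n
  have hd' : 1 - X * z ≠ 0 := by rwa [mul_comm]
  field_simp
  ring

lemma exists_analyticAt_appell_sub {Q : ℂ} (hQ : ‖Q‖ < 1) (hQ0 : Q ≠ 0) {w : ℂ} (hw : w ≠ 0) :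
    ∃ g : ℂ → ℂ, AnalyticAt ℂ g 1 ∧ g 1 = appell Q w 1 ∧
      (fun z => appell Q w z - 1 / (1 - z)) =ᶠ[𝓝[≠] 1] g := by
  set a : ℤ → ℂ := fun n => if n = 0 then 0 else (-1) ^ n * Q ^ (3 * tri n) * w ^ n with ha
  have hsum : Summable fun n => ‖a n‖ :=
    (summable_tri hQ hQ0 hw).of_nonneg_of_le (fun _ => norm_nonneg _) fun n => by
      by_cases h : n = 0
      · simp only [ha, h, if_true, norm_zero]; positivity
      · simp [ha, h]
  refine ⟨_, analyticAt_tsum_div hQ hQ0 one_ne_zero hsum fun n hn => ?_,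
    tsum_congr fun n => ?_,
    (eventually_punctured_ne_zero one_ne_zero).mono fun z hz => ?_⟩
  · rw [one_mul] at hn
    by_contra h
    have h0 : n ≠ 0 := fun h0 => h (by simp [ha, h0])
    have h1 := congrArg norm hn
    rw [norm_zpow, norm_one] at h1
    exact h0 ((zpow_eq_one_iff_right₀ (norm_nonneg Q) hQ.ne).mp h1)
  · by_cases h : n = 0 <;> simp [ha, h]
  · show appell Q w z - 1 / (1 - z) = _
    rw [appell, (hasSum_appell hQ hQ0 hw hz).summable.tsum_eq_add_tsum_ite 0]
    simp only [zpow_zero, mul_one, show tri 0 = 0 from rfl, mul_zero, add_sub_cancel_left]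
    refine tsum_congr fun n => ?_
    by_cases h : n = 0 <;> simp [ha, h]

lemma removableAt_appell {Q : ℂ} (hQ : ‖Q‖ < 1) (hQ0 : Q ≠ 0) {w : ℂ} (hw : w ≠ 0) :
    RemovableAt (fun z => appell Q w z - 1 / (1 - z)) 1 := by
  obtain ⟨g, hg, -, h⟩ := exists_analyticAt_appell_sub hQ hQ0 hw
  exact ⟨g, hg, h⟩

lemma tendsto_appell_sub {Q : ℂ} (hQ : ‖Q‖ < 1) (hQ0 : Q ≠ 0) {w : ℂ} (hw : w ≠ 0) :
    Tendsto (fun z => appell Q w z - 1 / (1 - z)) (𝓝[≠] 1) (𝓝 (appell Q w 1)) := by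
  obtain ⟨g, hg, h1, h⟩ := exists_analyticAt_appell_sub hQ hQ0 hw
  rw [tendsto_congr' h, ← h1]
  exact hg.continuousAt.tendsto.mono_left nhdsWithin_le_nhds

lemma analyticAt_appell {Q : ℂ} (hQ : ‖Q‖ < 1) (hQ0 : Q ≠ 0) {w z : ℂ} (hw : w ≠ 0)
    (hz : z ≠ 0) (h : ∀ n : ℤ, z * Q ^ n ≠ 1) : AnalyticAt ℂ (appell Q w) z :=
  analyticAt_tsum_div hQ hQ0 hz (summable_tri hQ hQ0 hw) fun n hn => absurd hn (h n)

lemma RemovableAt.sub_pole {G : ℂ → ℂ} {z b k : ℂ} (hG : AnalyticAt ℂ G z) (hzb : z * b = 1)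
    (hk : G z = k) : RemovableAt (fun w => G w / (1 - w * b) - k / (1 - w * b)) z := by
  have hb : b ≠ 0 := right_ne_zero_of_mul_eq_one hzb
  refine RemovableAt.div_sub (G := fun w => G w - k) (H := fun _ => -b)
    (hG.sub analyticAt_const) analyticAt_const (by rw [hk, sub_self]) (neg_ne_zero.mpr hb)
    fun w => ?_
  rw [← sub_div]
  congr 1
  linear_combination -hzb

lemma removableAt_appell_mul {Q : ℂ} (hQ : ‖Q‖ < 1) (hQ0 : Q ≠ 0) {w z b : ℂ} (hw : w ≠ 0)
    (hzb : z * b = 1) : RemovableAt (fun u => appell Q w (u * b) - 1 / (1 - u * b)) z :=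
  RemovableAt.comp (f := fun z => appell Q w z - 1 / (1 - z)) (g := fun u => u * b)
    (by rw [hzb]; exact removableAt_appell hQ hQ0 hw) (by fun_prop)
    (mul_left_injective₀ (right_ne_zero_of_mul_eq_one hzb))

/-- The theta quotient correcting the Appell–Lerch relation. -/
noncomputable def thetaTriple (Q ζ z : ℂ) : ℂ :=
  theta Q z * theta Q (z * ζ) * theta Q (z * ζ⁻¹)

lemma eq_zero_of_quadratic {p : ℂ → ℂ} {a b c : ℂ} (h : ∀ z ≠ 0, p z = 0)
    (hp : ∀ z ≠ 0, p z = a * z ^ 2 + b * z + c) : a = 0 ∧ b = 0 ∧ c = 0 := by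
  have h1 := (hp 1 one_ne_zero).symm.trans (h 1 one_ne_zero)
  have h2 := (hp (-1) (by norm_num)).symm.trans (h (-1) (by norm_num))
  have h3 := (hp 2 two_ne_zero).symm.trans (h 2 two_ne_zero)
  refine ⟨?_, ?_, ?_⟩
  · linear_combination (h3 - h1) / 3 - (h1 - h2) / 6
  · linear_combination (h1 - h2) / 2
  · linear_combination h1 - (h3 - h1) / 3 + (h1 - h2) / 6 - (h1 - h2) / 2

lemma theta_zpow {Q : ℂ} (hQ : ‖Q‖ < 1) (hQ0 : Q ≠ 0) (n : ℤ) : theta Q (Q ^ n) = 0 := by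
  induction n with
  | zero => rw [zpow_zero, theta_one hQ]
  | succ n ih =>
    rw [zpow_add_one₀ hQ0, mul_comm, theta_mul hQ hQ0 (zpow_ne_zero _ hQ0), ih, zero_div, neg_zero]
  | pred n ih =>
    rw [zpow_sub_one₀ hQ0, ← div_eq_mul_inv, theta_div hQ hQ0 (zpow_ne_zero _ hQ0), ih, mul_zero,
      neg_zero]

lemma mul_zpow_ne_one_of_theta_ne_zero {Q : ℂ} (hQ : ‖Q‖ < 1) (hQ0 : Q ≠ 0) {z : ℂ}
    (h : theta Q z ≠ 0) (n : ℤ) : z * Q ^ n ≠ 1 := fun hn => h <| by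
  rw [eq_inv_of_mul_eq_one_left hn, ← zpow_neg]; exact theta_zpow hQ hQ0 _

lemma theta_ne_zero_of_mul_zpow_ne_one {Q : ℂ} (hQ : ‖Q‖ < 1) (hQ0 : Q ≠ 0) {z : ℂ} (hz : z ≠ 0)
    (h : ∀ n : ℤ, z * Q ^ n ≠ 1) : theta Q z ≠ 0 :=
  theta_ne_zero hQ hQ0 hz fun n hn => h (-n) (by
    rw [hn, zpow_neg, mul_inv_cancel₀ (zpow_ne_zero n hQ0)])

theorem appell_relation {Q : ℂ} (hQ : ‖Q‖ < 1) (hQ0 : Q ≠ 0) {ζ : ℂ} (hζ : ζ ≠ 0)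
    (h1 : theta Q ζ ≠ 0) (h2 : theta Q (ζ * ζ) ≠ 0) :
    (∀ z ≠ 0, (∀ n : ℤ, z * Q ^ n ≠ 1) → (∀ n : ℤ, z * ζ * Q ^ n ≠ 1) →
      (∀ n : ℤ, z * ζ⁻¹ * Q ^ n ≠ 1) →
      appell Q (ζ ^ 3)⁻¹ (z * ζ⁻¹) + ζ ^ 3 * appell Q (ζ ^ 3) (z * ζ) =
        ζ * theta Q (ζ * ζ) / theta Q ζ * appell Q 1 z +
        qProd Q Q ^ 2 * theta Q ζ * theta Q (ζ * ζ) / thetaTriple Q ζ z) ∧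
    ζ * triSum Q ((ζ ^ 3)⁻¹ / Q) + ζ ^ 2 * triSum Q (ζ ^ 3 / Q) =
      ζ * theta Q (ζ * ζ) / theta Q ζ * triSum Q (1 / Q) := by
  set c := ζ * theta Q (ζ * ζ) / theta Q ζ with hc
  set K := qProd Q Q ^ 2 * theta Q ζ * theta Q (ζ * ζ) with hK
  have hζi : ζ⁻¹ ≠ 0 := inv_ne_zero hζ
  have hζ3 : ζ ^ 3 ≠ 0 := pow_ne_zero 3 hζ
  have hζ3i : (ζ ^ 3)⁻¹ ≠ 0 := inv_ne_zero hζ3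
  have hJ : thetaReg Q 1 = qProd Q Q ^ 2 := thetaReg_one Q
  have hJ0 : qProd Q Q ^ 2 ≠ 0 := hJ ▸ thetaReg_one_ne_zero hQ
  have hJ1 : qProd Q Q ≠ 0 := ne_zero_pow two_ne_zero hJ0
  have h2s : theta Q (ζ ^ 2) ≠ 0 := by rwa [sq]
  have hpole : ∀ d R : ℂ, K / (d * R) = K / R / d := fun d R => by rw [div_div, mul_comm]
  set f : ℂ → ℂ := fun z => appell Q (ζ ^ 3)⁻¹ (z * ζ⁻¹) + ζ ^ 3 * appell Q (ζ ^ 3) (z * ζ) -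
    c * appell Q 1 z - K / thetaTriple Q ζ z with hf
  set e : ℕ → ℂ := fun j => ζ ^ j * triSum Q ((ζ ^ 3)⁻¹ / Q ^ j) +
    ζ ^ 3 * ζ⁻¹ ^ j * triSum Q (ζ ^ 3 / Q ^ j) - c * triSum Q (1 / Q ^ j) with he
  set p : ℂ → ℂ := fun z => -(e 1) * z ^ 2 + -(e 2) * z + -(e 3) with hp
  have hgood : ∀ z ≠ 0, ∀ b ≠ 0, ∀ᶠ w in 𝓝[≠] z, ∀ n : ℤ, w * b * Q ^ n ≠ 1 := by
    intro z hz b hb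
    have ht : Tendsto (fun w => w * b) (𝓝[≠] z) (𝓝[≠] (z * b)) :=
      tendsto_nhdsWithin_of_tendsto_nhds_of_eventually_within _
        (((continuous_mul_const b).tendsto z).mono_left nhdsWithin_le_nhds)
        (eventually_mem_nhdsWithin.mono fun w hw => (mul_left_injective₀ hb).ne hw)
    exact ht.eventually (eventually_mul_zpow_ne_one hQ hQ0 (mul_ne_zero hz hb))
  have hper : ∀ z ≠ 0, ∀ᶠ w in 𝓝[≠] z, f (Q * w) = -w ^ 3 * f w + p w := by
    intro z hz
    filter_upwards [eventually_mul_zpow_ne_one hQ hQ0 hz, hgood z hz ζ hζ, hgood z hz ζ⁻¹ hζi,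
      eventually_punctured_ne_zero hz] with w g1 g2 g3 hw
    simp only [hf, hp, he, thetaTriple]
    rw [mul_assoc Q w, mul_assoc Q w, appell_mul hQ hQ0 hζ3i (mul_ne_zero hw hζi) g3,
      appell_mul hQ hQ0 hζ3 (mul_ne_zero hw hζ) g2, appell_mul hQ hQ0 one_ne_zero hw g1,
      theta_mul hQ hQ0 hw, theta_mul hQ hQ0 (mul_ne_zero hw hζ),
      theta_mul hQ hQ0 (mul_ne_zero hw hζi)]
    have e1 : K / (-(theta Q w / w) * -(theta Q (w * ζ) / (w * ζ)) *
        -(theta Q (w * ζ⁻¹) / (w * ζ⁻¹))) =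
        -w ^ 3 * (K / (theta Q w * theta Q (w * ζ) * theta Q (w * ζ⁻¹))) := by
      field_simp
    rw [e1]
    simp only [pow_one]
    field_simp
    ring
  have hA : ∀ b ≠ 0, ∀ w ≠ 0, ∀ z ≠ 0, (∀ n : ℤ, z * b * Q ^ n ≠ 1) →
      AnalyticAt ℂ (fun u => appell Q w (u * b)) z := fun b hb w hw z hz h =>
    (analyticAt_appell hQ hQ0 hw (mul_ne_zero hz hb) h).comp (f := fun u => u * b) (by fun_prop)
  have hθ : ∀ b ≠ 0, ∀ z ≠ 0, AnalyticAt ℂ (fun u => theta Q (u * b)) z := fun b hb z hz =>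
    (analyticAt_theta hQ (mul_ne_zero hz hb)).comp (f := fun u => u * b) (by fun_prop)
  have hR : ∀ b ≠ 0, ∀ z ≠ 0, AnalyticAt ℂ (fun u => thetaReg Q (u * b)) z := fun b hb z hz =>
    (analyticAt_thetaReg hQ (mul_ne_zero hz hb)).comp (f := fun u => u * b) (by fun_prop)
  have hi1 : theta Q ζ⁻¹ = -(theta Q ζ / ζ) := theta_inv hQ hζ
  have hi2 : theta Q (ζ⁻¹ * ζ⁻¹) = -(theta Q (ζ * ζ) / (ζ * ζ)) := by
    rw [← mul_inv, theta_inv hQ (mul_ne_zero hζ hζ)]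
  have h1i : theta Q ζ⁻¹ ≠ 0 := by rw [hi1]; simp [h1, hζ]
  have h2i : theta Q (ζ⁻¹ * ζ⁻¹) ≠ 0 := by rw [hi2]; simp [h2, hζ]
  have hne : ∀ {z : ℂ}, theta Q z ≠ 0 → ∀ n : ℤ, z * Q ^ n ≠ 1 := fun h n =>
    mul_zpow_ne_one_of_theta_ne_zero hQ hQ0 h n
  have hR0 : ∀ b z : ℂ, z * b = 1 → thetaReg Q (z * b) ≠ 0 := fun b z h =>
    h ▸ thetaReg_one_ne_zero hQ
  have rem_one : RemovableAt f 1 := by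
    have a1 := hA ζ hζ (ζ ^ 3) hζ3 1 one_ne_zero (by rw [one_mul]; exact hne h1)
    have a2 := hA ζ⁻¹ hζi (ζ ^ 3)⁻¹ hζ3i 1 one_ne_zero (by rw [one_mul]; exact hne h1i)
    have a3 := removableAt_appell_mul hQ hQ0 one_ne_zero (one_mul (1 : ℂ))
    have a4 : AnalyticAt ℂ (fun u => K / (thetaReg Q (u * 1) * theta Q (u * ζ) *
        theta Q (u * ζ⁻¹))) 1 :=
      analyticAt_const.div (((hR 1 one_ne_zero 1 one_ne_zero).mul (hθ ζ hζ 1 one_ne_zero)).mul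
        (hθ ζ⁻¹ hζi 1 one_ne_zero)) (mul_ne_zero (mul_ne_zero (hR0 1 1 (one_mul _))
          (by rwa [one_mul])) (by rwa [one_mul]))
    have a5 := RemovableAt.sub_pole a4 (one_mul (1 : ℂ)) (k := -c) (by
      simp only [one_mul]
      rw [hJ, hi1, hK, hc]; field_simp)
    refine (((RemovableAt.of_analyticAt (a2.add (analyticAt_const (v := ζ ^ 3) |>.mul a1))).add
      ((RemovableAt.of_analyticAt (analyticAt_const (v := -c))).mul a3)).add
      ((RemovableAt.of_analyticAt (analyticAt_const (v := -1))).mul a5)).congr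
      (Eventually.of_forall fun u => ?_)
    simp only [hf, thetaTriple, Pi.add_apply, Pi.mul_apply, mul_one, theta_eq hQ u]
    rw [mul_assoc (1 - u), mul_assoc (1 - u), hpole, ← mul_assoc]
    generalize 1 - u = d
    ring
  have rem_pos : RemovableAt f ζ := by
    have hz := mul_inv_cancel₀ hζ
    have a1 := hA ζ hζ (ζ ^ 3) hζ3 ζ hζ (hne h2)
    have a2 := hA 1 one_ne_zero 1 one_ne_zero ζ hζ (by rw [mul_one]; exact hne h1)
    have a3 := removableAt_appell_mul hQ hQ0 hζ3i hz
    have a4 : AnalyticAt ℂ (fun u => K / (theta Q (u * 1) * theta Q (u * ζ) *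
        thetaReg Q (u * ζ⁻¹))) ζ :=
      analyticAt_const.div (((hθ 1 one_ne_zero ζ hζ).mul (hθ ζ hζ ζ hζ)).mul
        (hR ζ⁻¹ hζi ζ hζ)) (mul_ne_zero (mul_ne_zero (by rwa [mul_one]) h2) (hR0 _ _ hz))
    have a5 := RemovableAt.sub_pole a4 hz (k := 1) (by
      simp only [mul_one, hz]
      rw [hJ, hK]; field_simp)
    refine (((RemovableAt.of_analyticAt ((analyticAt_const (v := ζ ^ 3) |>.mul a1).add
      (analyticAt_const (v := -c) |>.mul a2))).add a3).add
      ((RemovableAt.of_analyticAt (analyticAt_const (v := -1))).mul a5)).congr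
      (Eventually.of_forall fun u => ?_)
    simp only [hf, thetaTriple, Pi.add_apply, Pi.mul_apply, mul_one, theta_eq hQ (u * ζ⁻¹)]
    rw [mul_left_comm _ (1 - u * ζ⁻¹), hpole]
    generalize 1 - u * ζ⁻¹ = d
    ring
  have rem_neg : RemovableAt f ζ⁻¹ := by
    have hz := inv_mul_cancel₀ hζ
    have a1 := hA ζ⁻¹ hζi (ζ ^ 3)⁻¹ hζ3i ζ⁻¹ hζi (hne h2i)
    have a2 := hA 1 one_ne_zero 1 one_ne_zero ζ⁻¹ hζi (by rw [mul_one]; exact hne h1i)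
    have a3 := removableAt_appell_mul hQ hQ0 hζ3 hz
    have a4 : AnalyticAt ℂ (fun u => K / (theta Q (u * 1) * thetaReg Q (u * ζ) *
        theta Q (u * ζ⁻¹))) ζ⁻¹ :=
      analyticAt_const.div (((hθ 1 one_ne_zero ζ⁻¹ hζi).mul (hR ζ hζ ζ⁻¹ hζi)).mul
        (hθ ζ⁻¹ hζi ζ⁻¹ hζi)) (mul_ne_zero (mul_ne_zero (by rwa [mul_one]) (hR0 _ _ hz)) h2i)
    have a5 := RemovableAt.sub_pole a4 hz (k := ζ ^ 3) (by
      simp only [mul_one, hz]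
      rw [hJ, hK, hi1, hi2]; field_simp)
    refine (((RemovableAt.of_analyticAt (a1.add
      (analyticAt_const (v := -c) |>.mul a2))).add
      ((RemovableAt.of_analyticAt (analyticAt_const (v := ζ ^ 3))).mul a3)).add
      ((RemovableAt.of_analyticAt (analyticAt_const (v := -1))).mul a5)).congr
      (Eventually.of_forall fun u => ?_)
    simp only [hf, thetaTriple, Pi.add_apply, Pi.mul_apply, mul_one, theta_eq hQ (u * ζ)]
    rw [mul_left_comm _ (1 - u * ζ), mul_assoc (1 - u * ζ), hpole]
    generalize 1 - u * ζ = d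
    ring
  have hpa : ∀ z ≠ 0, AnalyticAt ℂ p z := fun z _ => by fun_prop
  have htr : ∀ z ≠ 0, RemovableAt f z → ∀ n : ℤ, RemovableAt f (Q ^ n * z) := fun z hz h n =>
    RemovableAt.zpow_mul hQ0 (A := fun z => -z ^ 3) (p := p) (fun _ _ => by fun_prop)
      (fun _ h => neg_ne_zero.mpr (pow_ne_zero 3 h)) hpa hper hz h n
  have hreg : ∀ z ≠ 0, (∀ n : ℤ, z * Q ^ n ≠ 1) → (∀ n : ℤ, z * ζ * Q ^ n ≠ 1) →
      (∀ n : ℤ, z * ζ⁻¹ * Q ^ n ≠ 1) → AnalyticAt ℂ f z := fun z hz g1 g2 g3 =>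
    (((hA ζ⁻¹ hζi _ hζ3i z hz g3).add (analyticAt_const.mul (hA ζ hζ _ hζ3 z hz g2))).sub
      (analyticAt_const.mul (analyticAt_appell hQ hQ0 one_ne_zero hz g1))).sub
      (analyticAt_const.div (((analyticAt_theta hQ hz).mul (hθ ζ hζ z hz)).mul (hθ ζ⁻¹ hζi z hz))
        (mul_ne_zero (mul_ne_zero (theta_ne_zero_of_mul_zpow_ne_one hQ hQ0 hz g1)
          (theta_ne_zero_of_mul_zpow_ne_one hQ hQ0 (mul_ne_zero hz hζ) g2))
          (theta_ne_zero_of_mul_zpow_ne_one hQ hQ0 (mul_ne_zero hz hζi) g3)))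
  have hrem : ∀ z ≠ 0, RemovableAt f z := by
    intro z hz
    have hpow : ∀ {b : ℂ} {n : ℤ}, b ≠ 0 → z * b * Q ^ n = 1 → z = Q ^ (-n) * b⁻¹ := by
      intro b n hb h
      have hX := zpow_ne_zero n hQ0
      rw [zpow_neg, ← mul_inv]
      exact eq_inv_of_mul_eq_one_left (by rw [← h]; ring)
    by_cases g1 : ∃ n : ℤ, z * Q ^ n = 1
    · obtain ⟨n, hn⟩ := g1
      rw [hpow one_ne_zero (by rw [mul_one]; exact hn), inv_one]
      exact htr 1 one_ne_zero rem_one _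
    by_cases g2 : ∃ n : ℤ, z * ζ * Q ^ n = 1
    · obtain ⟨n, hn⟩ := g2
      rw [hpow hζ hn]
      exact htr _ hζi rem_neg _
    by_cases g3 : ∃ n : ℤ, z * ζ⁻¹ * Q ^ n = 1
    · obtain ⟨n, hn⟩ := g3
      rw [hpow hζi hn, inv_inv]
      exact htr _ hζ rem_pos _
    exact .of_analyticAt (hreg z hz (not_exists.mp g1) (not_exists.mp g2) (not_exists.mp g3))
  obtain ⟨F, hF, hfF, hFc⟩ := RemovableAt.exists_extension hrem
  have hFper : ∀ z ≠ 0, F (Q * z) = -z ^ 3 * F z + p z := fun z hz =>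
    extension_quasiperiodic hQ0 (fun _ _ => by fun_prop) (fun z hz => (hpa z hz).continuousAt)
      hper hF hfF z hz
  have hbound : ∀ z, ‖p z‖ ≤ (‖e 1‖ + ‖e 2‖ + ‖e 3‖) * (1 + ‖z‖ ^ 2) := by
    intro z
    have h3 : ‖z‖ ≤ 1 + ‖z‖ ^ 2 := by nlinarith [sq_nonneg (‖z‖ - 1)]
    calc ‖p z‖ ≤ ‖e 1‖ * ‖z‖ ^ 2 + ‖e 2‖ * ‖z‖ + ‖e 3‖ := by
          refine (norm_add₃_le).trans ?_
          simp
      _ ≤ ‖e 1‖ * (1 + ‖z‖ ^ 2) + ‖e 2‖ * (1 + ‖z‖ ^ 2) + ‖e 3‖ * (1 + ‖z‖ ^ 2) := by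
          gcongr
          · linarith
          · exact le_mul_of_one_le_right (norm_nonneg _) (by nlinarith [sq_nonneg ‖z‖])
      _ = _ := by ring
  have hF0 : ∀ z ≠ 0, F z = 0 := fun z hz => eq_zero_of_mul_cubic hQ hQ0 hF hFper hbound hz
  refine ⟨fun z hz g1 g2 g3 => ?_, ?_⟩
  · have h3 := hFc z hz (hreg z hz g1 g2 g3).continuousAt
    rw [hF0 z hz] at h3
    simp only [hf] at h3
    linear_combination h3
  · have hp0 : ∀ z ≠ 0, p z = 0 := fun z hz => by
      have := hFper z hz
      rw [hF0 z hz, hF0 _ (mul_ne_zero hQ0 hz)] at this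
      linear_combination -this
    have h3 := (eq_zero_of_quadratic hp0 fun z _ => rfl).1
    simp only [he, pow_one] at h3
    have h4 : ζ ^ 3 * ζ⁻¹ = ζ ^ 2 := by field_simp
    rw [h4] at h3
    linear_combination -h3

/-- The limiting case `z = ζ` of `appell_relation`. -/
theorem appell_relation_self {Q : ℂ} (hQ : ‖Q‖ < 1) (hQ0 : Q ≠ 0) {ζ : ℂ} (hζ : ζ ≠ 0)
    (h1 : theta Q ζ ≠ 0) (h2 : theta Q (ζ * ζ) ≠ 0) :
    appell Q (ζ ^ 3)⁻¹ 1 + ζ ^ 3 * appell Q (ζ ^ 3) (ζ * ζ) =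
      ζ * theta Q (ζ * ζ) / theta Q ζ * appell Q 1 ζ + thetaLog Q ζ + thetaLog Q (ζ * ζ) := by
  have hζζ := mul_ne_zero hζ hζ
  have hζ3 : ζ ^ 3 ≠ 0 := pow_ne_zero 3 hζ
  set D : ℂ → ℂ := fun x => thetaReg Q x * theta Q (x * ζ) * theta Q (x * (ζ * ζ)) with hD
  set K := qProd Q Q ^ 2 * theta Q ζ * theta Q (ζ * ζ) with hK
  have hJ : thetaReg Q 1 = qProd Q Q ^ 2 := thetaReg_one Q
  have hJ0 : qProd Q Q ^ 2 ≠ 0 := hJ ▸ thetaReg_one_ne_zero hQ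
  have hK0 : K ≠ 0 := mul_ne_zero (mul_ne_zero hJ0 h1) h2
  have hD1 : D 1 = K := by simp [hD, hK, hJ]
  have d1 : HasDerivAt (thetaReg Q) 0 1 := by
    rw [← deriv_thetaReg_one hQ]; exact (differentiableAt_thetaReg hQ one_ne_zero).hasDerivAt
  have d2 : HasDerivAt (fun x => theta Q (x * ζ)) (deriv (theta Q) ζ * ζ) 1 := by
    have := hasDerivAt_theta_comp hQ ((hasDerivAt_id (1 : ℂ)).mul_const ζ) (by simpa using hζ)
    simpa using this
  have d3 : HasDerivAt (fun x => theta Q (x * (ζ * ζ))) (deriv (theta Q) (ζ * ζ) * (ζ * ζ)) 1 := by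
    have := hasDerivAt_theta_comp hQ ((hasDerivAt_id (1 : ℂ)).mul_const (ζ * ζ))
      (by simpa using hζ)
    simpa using this
  have hDd : HasDerivAt D (K * (thetaLog Q ζ + thetaLog Q (ζ * ζ))) 1 := by
    refine ((d1.mul d2).mul d3).congr_deriv ?_
    simp only [Pi.mul_apply, one_mul, hJ, hK]
    rw [deriv_theta hζ h1, deriv_theta hζζ h2]
    field_simp
    ring
  have hG : HasDerivAt (fun x => K / D x) (-(thetaLog Q ζ + thetaLog Q (ζ * ζ))) 1 := by
    refine ((hasDerivAt_const (1 : ℂ) K).div hDd (by rwa [hD1])).congr_deriv ?_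
    rw [hD1]; field_simp; ring
  have tG : Tendsto (fun x => K / D x / (1 - x) - 1 / (1 - x)) (𝓝[≠] 1)
      (𝓝 (thetaLog Q ζ + thetaLog Q (ζ * ζ))) := by
    have h := (hasDerivAt_iff_tendsto_slope.mp hG).neg
    rw [neg_neg] at h
    refine h.congr' (eventually_mem_nhdsWithin.mono fun x hx => ?_)
    have hx1 : x - 1 ≠ 0 := sub_ne_zero.mpr hx
    have hx2 : 1 - x ≠ 0 := sub_ne_zero.mpr (Ne.symm hx)
    rw [slope_def_field, hD1, div_self hK0]
    field_simp
    ring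
  have hmul : ∀ b : ℂ, b ≠ 0 → theta Q b ≠ 0 → ∀ w : ℂ, w ≠ 0 →
      Tendsto (fun x => appell Q w (x * b)) (𝓝[≠] 1) (𝓝 (appell Q w b)) := fun b hb hθ w hw => by
    have h := ((analyticAt_appell hQ hQ0 hw hb
      (mul_zpow_ne_one_of_theta_ne_zero hQ hQ0 hθ)).continuousAt.tendsto)
    refine (h.comp ?_).mono_left nhdsWithin_le_nhds
    have : Tendsto (fun x : ℂ => x * b) (𝓝 1) (𝓝 (1 * b)) := (continuous_mul_const b).tendsto 1
    rwa [one_mul] at this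
  have t1 := (tendsto_appell_sub hQ hQ0 (inv_ne_zero hζ3)).add
    ((hmul (ζ * ζ) hζζ h2 _ hζ3).const_mul (ζ ^ 3))
  have t2 := ((hmul ζ hζ h1 1 one_ne_zero).const_mul (ζ * theta Q (ζ * ζ) / theta Q ζ)).add tG
  rw [← add_assoc] at t2
  refine tendsto_nhds_unique (t1.congr' ?_) t2
  have hgood : ∀ b : ℂ, b ≠ 0 → ∀ᶠ x in 𝓝[≠] (1 : ℂ), ∀ n : ℤ, x * b * Q ^ n ≠ 1 := by
    intro b hb
    have ht : Tendsto (fun w => w * b) (𝓝[≠] 1) (𝓝[≠] (1 * b)) :=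
      tendsto_nhdsWithin_of_tendsto_nhds_of_eventually_within _
        (((continuous_mul_const b).tendsto 1).mono_left nhdsWithin_le_nhds)
        (eventually_mem_nhdsWithin.mono fun w hw => (mul_left_injective₀ hb).ne hw)
    exact ht.eventually (eventually_mul_zpow_ne_one hQ hQ0 (mul_ne_zero one_ne_zero hb))
  filter_upwards [hgood 1 one_ne_zero, hgood ζ hζ, hgood _ hζζ,
    eventually_punctured_ne_zero one_ne_zero] with x g1 g2 g3 hx
  have h3 : x * ζ * ζ⁻¹ = x := by field_simp
  have h := (appell_relation hQ hQ0 hζ h1 h2).1 (x * ζ) (mul_ne_zero hx hζ) g2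
    (by rwa [mul_assoc x]) (by rwa [h3, ← mul_one x])
  rw [h3, mul_assoc x ζ ζ] at h
  have h4 : K / thetaTriple Q ζ (x * ζ) = K / D x / (1 - x) := by
    rw [thetaTriple, h3, mul_assoc x ζ ζ, theta_eq hQ x, div_div, hD]
    congr 1; ring
  rw [← hK, h4] at h
  linear_combination h

/-- Lambert series in terms of theta quotients. -/
lemma thetaLog_duplication {Q : ℂ} (hQ : ‖Q‖ < 1) (hQ0 : Q ≠ 0) {u : ℂ} (hu : u ≠ 0)
    (h1 : theta Q u ≠ 0) (h2 : theta Q (u ^ 2) ≠ 0) (h4 : theta Q (u ^ 4) ≠ 0) :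
    2 * thetaLog Q u + thetaLog Q (u ^ 2) - thetaLog Q (u ^ 4) - 1 =
      -(qProd Q Q ^ 2 * theta Q (u ^ 3) ^ 2 / (theta Q u ^ 2 * theta Q (u ^ 4))) := by
  have e1 : u * u = u ^ 2 := by ring
  have e2 : u ^ 3 * u = u ^ 4 := by ring
  have e3 : u ^ 3 / u = u ^ 2 := by field_simp
  have h := thetaLog_three_term hQ hQ0 hu (pow_ne_zero 3 hu) (by rwa [e1]) h1 (by rwa [e2])
    (by rwa [e3])
  rw [e1, e2, e3] at h
  have h' : theta Q u ^ 2 * theta Q (u ^ 4) * (2 * thetaLog Q u + thetaLog Q (u ^ 2) -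
      thetaLog Q (u ^ 4) - 1) = -(qProd Q Q ^ 2 * theta Q (u ^ 3) ^ 2) :=
    mul_right_cancel₀ h2 (by linear_combination h)
  field_simp
  linear_combination h'

lemma neg_one_zpow_mul_tri (x : ℂ) (hx : x ≠ 0) (n : ℤ) :
    (-1) ^ n * x ^ (3 * tri n) * (1 / x) ^ n = (-1) ^ n * x ^ (pentagonal (-n)) := by
  have h1 := two_mul_tri n
  have h2 := two_mul_natCast_pentagonal_neg n
  rw [mul_assoc, one_div, inv_zpow, ← zpow_neg, ← zpow_add₀ hx, ← zpow_natCast x]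
  congr 2
  have : 2 * (3 * tri n + -n) = 2 * (pentagonal (-n) : ℤ) := by rw [h2]; linear_combination 3 * h1
  omega

/-- Euler's pentagonal number theorem for complex arguments in the unit disc. -/
theorem triSum_one_div {Q : ℂ} (hQ : ‖Q‖ < 1) (hQ0 : Q ≠ 0) : triSum Q (1 / Q) = qProd Q Q := by
  have hq := norm_nonneg Q
  have hgeo := summable_geometric_of_lt_one hq hQ
  set M := Real.exp (∑' n : ℕ, ‖Q‖ ^ n) with hM
  have hprod : ∀ k n : ℕ, ‖∏ i ∈ Finset.range (n + 1), (1 - Q ^ (k + i + 1))‖ ≤ M := by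
    intro k n
    rw [norm_prod]
    calc ∏ i ∈ Finset.range (n + 1), ‖1 - Q ^ (k + i + 1)‖
        ≤ ∏ i ∈ Finset.range (n + 1), (1 + ‖Q‖ ^ i) := by
          refine Finset.prod_le_prod (fun _ _ => norm_nonneg _) fun i _ => ?_
          refine (norm_sub_le _ _).trans ?_
          rw [norm_one, norm_pow]
          gcongr 1 + ?_
          exact pow_le_pow_of_le_one hq hQ.le (by omega)
      _ ≤ Real.exp (∑ i ∈ Finset.range (n + 1), ‖Q‖ ^ i) :=
          Real.prod_one_add_le_exp_sum _ fun i => pow_nonneg hq i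
      _ ≤ M := Real.exp_le_exp.mpr (hgeo.sum_le_tsum _ fun i _ => pow_nonneg hq i)
  have hterm : ∀ k n : ℕ, ‖Q ^ ((k + 1) * n) * ∏ i ∈ Finset.range (n + 1), (1 - Q ^ (k + i + 1))‖ ≤
      ‖Q‖ ^ n * M := fun k n => by
    rw [norm_mul, norm_pow]
    exact mul_le_mul (pow_le_pow_of_le_one hq hQ.le (by nlinarith)) (hprod k n) (norm_nonneg _)
      (pow_nonneg hq n)
  have hsum : ∀ k : ℕ, Summable fun n : ℕ =>
      ‖Q ^ ((k + 1) * n) * ∏ i ∈ Finset.range (n + 1), (1 - Q ^ (k + i + 1))‖ := fun k =>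
    (hgeo.mul_right M).of_nonneg_of_le (fun _ => norm_nonneg _) (hterm k)
  have hs := hasSum_triSum hQ hQ0 (one_div_ne_zero hQ0)
  simp only [neg_one_zpow_mul_tri Q hQ0] at hs
  have hs' := HasSum.nat_add_neg_add_one hs
  have hpair : ∀ n : ℕ, (-1 : ℂ) ^ (n : ℤ) * Q ^ pentagonal (-(n : ℤ)) +
      (-1) ^ (-((n : ℤ) + 1)) * Q ^ pentagonal (-(-((n : ℤ) + 1))) =
      (-1) ^ n * (Q ^ pentagonal (-n) - Q ^ pentagonal (n + 1)) := fun n => by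
    have : (-1 : ℂ) ^ (-((n : ℤ) + 1)) = -(-1) ^ n := by
      rw [zpow_neg, zpow_add_one₀ (by norm_num), zpow_natCast]
      rcases neg_one_pow_eq_or ℂ n with h | h <;> rw [h] <;> norm_num
    rw [this, neg_neg, zpow_natCast]; ring
  simp only [hpair] at hs'
  have h := Pentagonal.tprod_one_sub_pow (x := Q) (tendsto_pow_atTop_nhds_zero_of_norm_lt_one hQ)
    (fun k => (hsum k).of_norm) (fun k => ?_) hs'.summable ?_
  · rw [← hs'.tsum_eq, ← h, qProd]
    simp only [pow_succ']
  · have := multipliable_qProd hQ (Q ^ (k + 1))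
    refine this.congr fun n => ?_
    rw [← pow_add]; congr 2; omega
  · refine squeeze_zero_norm (a := fun k : ℕ => ‖Q‖ ^ k * ∑' n : ℕ, ‖Q‖ ^ n * M) (fun k => ?_) ?_
    · rw [norm_mul, norm_mul, norm_pow, norm_neg, norm_one, one_pow, one_mul, norm_pow]
      refine mul_le_mul (pow_le_pow_of_le_one hq hQ.le ?_) ?_ (norm_nonneg _) (pow_nonneg hq k)
      · rw [Nat.le_div_iff_mul_le two_pos]; nlinarith
      · exact (norm_tsum_le_tsum_norm (hsum k)).trans
          ((hsum k).tsum_le_tsum (hterm k) (hgeo.mul_right M))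
    · simpa using (tendsto_pow_atTop_nhds_zero_of_lt_one hq hQ).mul_const (∑' n : ℕ, ‖Q‖ ^ n * M)

lemma qProd_sq {S z : ℂ} (hS : ‖S‖ < 1) :
    qProd (S ^ 2) (z ^ 2) = qProd (S ^ 2) z * qProd (S ^ 2) (S * z) *
      (qProd (S ^ 2) (-z) * qProd (S ^ 2) (S * -z)) := by
  have hQ : ‖S ^ 2‖ < 1 := by rw [norm_pow]; exact pow_lt_one₀ (norm_nonneg _) hS two_ne_zero
  have key (z : ℂ) : qProd (S ^ 2) z * qProd (S ^ 2) (S * z) = qProd S z := by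
    have h0 := multipliable_qProd hQ z
    have h1 := multipliable_qProd hQ (S * z)
    have e0 : (fun n : ℕ => 1 - z * (S ^ 2) ^ n) = fun n => 1 - z * S ^ (2 * n) := by
      ext n; rw [pow_mul]
    have e1 : (fun n : ℕ => 1 - S * z * (S ^ 2) ^ n) = fun n => 1 - z * S ^ (2 * n + 1) := by
      ext n; rw [pow_add, pow_mul]; ring
    rw [e0] at h0; rw [e1] at h1
    rw [qProd, qProd, e0, e1]
    exact tprod_even_mul_odd (f := fun n => 1 - z * S ^ n) h0 h1
  rw [key, key]
  simp only [qProd]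
  rw [← (multipliable_qProd hS z).tprod_mul (multipliable_qProd hS (-z))]
  congr 1; ext n; ring

/-- Duplication of the argument of a theta function. -/
lemma theta_sq {S z : ℂ} (hS : ‖S‖ < 1) (hS0 : S ≠ 0) (hz : z ≠ 0) :
    theta (S ^ 2) (z ^ 2) = theta (S ^ 2) z * theta (S ^ 2) (-z) * theta (S ^ 2) (S * z) *
      theta (S ^ 2) (-S * z) := by
  have e : S ^ 2 / z ^ 2 = (S / z) ^ 2 := by ring
  have e1 : S ^ 2 / (S * z) = S / z := by field_simp
  have e2 : S ^ 2 / (-S * z) = -(S / z) := by field_simp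
  have e3 : S * (S / z) = S ^ 2 / z := by ring
  have e4 : S * -(S / z) = S ^ 2 / -z := by field_simp
  have e5 : S * -z = -S * z := by ring
  simp only [theta]
  rw [e, qProd_sq hS, qProd_sq hS, e1, e2, e3, e4, e5]
  ring

lemma theta_half_periods {S : ℂ} (hS : ‖S‖ < 1) (hS0 : S ≠ 0) :
    theta (S ^ 2) (-1) * theta (S ^ 2) S * theta (S ^ 2) (-S) = 2 := by
  have hQ : ‖S ^ 2‖ < 1 := by rw [norm_pow]; exact pow_lt_one₀ (norm_nonneg _) hS two_ne_zero
  set Q := S ^ 2 with hQd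
  have hr : ContinuousAt (thetaReg Q) 1 := (differentiableAt_thetaReg hQ one_ne_zero).continuousAt
  have ht {w : ℂ} (hw : w ≠ 0) : ContinuousAt (theta Q) w :=
    (differentiableAt_theta hQ hw).continuousAt
  have c1 : ContinuousAt (fun z : ℂ => (1 + z) * thetaReg Q (z ^ 2)) 1 :=
    (by fun_prop : ContinuousAt (fun z : ℂ => 1 + z) 1).mul
      (ContinuousAt.comp (g := thetaReg Q) (f := fun z : ℂ => z ^ 2) (by simpa using hr)
        (by fun_prop))
  have c2 : ContinuousAt (fun z : ℂ => thetaReg Q z * theta Q (-z) * theta Q (S * z) *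
      theta Q (-S * z)) 1 := by
    refine ((hr.mul ?_).mul ?_).mul ?_
    · exact ContinuousAt.comp (g := theta Q) (f := fun z : ℂ => -z) (ht (by simp)) (by fun_prop)
    · exact ContinuousAt.comp (g := theta Q) (f := fun z : ℂ => S * z) (ht (by simpa)) (by fun_prop)
    · exact ContinuousAt.comp (g := theta Q) (f := fun z : ℂ => -S * z) (ht (by simpa))
        (by fun_prop)
  have heq : (fun z : ℂ => (1 + z) * thetaReg Q (z ^ 2)) =ᶠ[𝓝[≠] 1]
      fun z : ℂ => thetaReg Q z * theta Q (-z) * theta Q (S * z) * theta Q (-S * z) := by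
    have h0 : ∀ᶠ z : ℂ in 𝓝[≠] 1, z ≠ 0 :=
      nhdsWithin_le_nhds (isOpen_ne.mem_nhds one_ne_zero)
    filter_upwards [h0, self_mem_nhdsWithin] with z hz hz1
    have h := theta_sq hS hS0 hz
    rw [← hQd, theta_eq hQ (z ^ 2), theta_eq hQ z] at h
    have : (1 - z) ≠ 0 := sub_ne_zero.mpr (Ne.symm hz1)
    apply mul_left_cancel₀ this
    linear_combination h
  have := tendsto_nhds_unique ((c1.tendsto.mono_left nhdsWithin_le_nhds).congr' heq)
    (c2.tendsto.mono_left nhdsWithin_le_nhds)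
  simp only [one_pow, mul_one] at this
  apply mul_left_cancel₀ (thetaReg_one_ne_zero hQ)
  linear_combination -this

/-- The difference of two values of the Weierstrass function, as a theta quotient. -/
noncomputable def thetaQuot (Q p u : ℂ) : ℂ :=
  u * thetaPair Q p u / (theta Q p ^ 2 * theta Q u ^ 2)

lemma thetaQuot_swap {Q : ℂ} (hQ : ‖Q‖ < 1) {p u : ℂ} (hp : p ≠ 0) (hu : u ≠ 0) :
    thetaQuot Q u p = -thetaQuot Q p u := by
  rw [thetaQuot, thetaQuot, thetaPair_swap hQ hp hu, mul_comm (theta Q p ^ 2)]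
  field_simp

lemma thetaQuot_add {Q : ℂ} (hQ : ‖Q‖ < 1) (hQ0 : Q ≠ 0) {x u v : ℂ} (hx : x ≠ 0)
    (hu : u ≠ 0) (hv : v ≠ 0) (hx1 : theta Q x ≠ 0) (hu1 : theta Q u ≠ 0) (hv1 : theta Q v ≠ 0)
    (huu : theta Q (u * u) ≠ 0) (hxu : thetaPair Q x u ≠ 0) (hvu : thetaPair Q v u ≠ 0) :
    thetaQuot Q x v = thetaQuot Q x u + thetaQuot Q u v := by
  have h := thetaPair_three_term hQ hQ0 hx one_ne_zero hu hv huu hxu hvu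
  have e (w : ℂ) : thetaPair Q w 1 = theta Q w ^ 2 := by rw [thetaPair]; simp [sq]
  rw [e, e, e] at h
  have h' : v * (theta Q x ^ 2 * thetaPair Q u v - thetaPair Q x v * theta Q u ^ 2) =
      -(u * (theta Q v ^ 2 * thetaPair Q x u)) := by rw [h]; field_simp
  rw [thetaQuot, thetaQuot, thetaQuot]
  field_simp
  linear_combination -h'

lemma thetaQuot_half_periods {S p : ℂ} (hS : ‖S‖ < 1) (hS0 : S ≠ 0) (hp : p ≠ 0)
    (hp1 : theta (S ^ 2) p ≠ 0) :
    thetaQuot (S ^ 2) p (-1) * thetaQuot (S ^ 2) p S * thetaQuot (S ^ 2) p (-S) =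
      -(p ^ 2 * theta (S ^ 2) (p ^ 2) ^ 2 / (4 * theta (S ^ 2) p ^ 8)) := by
  have hQ : ‖S ^ 2‖ < 1 := by rw [norm_pow]; exact pow_lt_one₀ (norm_nonneg _) hS two_ne_zero
  have h2 := theta_half_periods hS hS0
  have hne : theta (S ^ 2) (-1) * theta (S ^ 2) S * theta (S ^ 2) (-S) ≠ 0 := by
    rw [h2]; norm_num
  have hd := theta_sq hS hS0 hp
  have hS2 : S ^ 2 ≠ 0 := pow_ne_zero 2 hS0
  have a1 : theta (S ^ 2) (p / S) = -(p / S * theta (S ^ 2) (S * p)) := by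
    have := theta_div hQ hS2 (z := S * p) (mul_ne_zero hS0 hp)
    rw [show S * p / S ^ 2 = p / S by field_simp] at this
    exact this
  have a2 : theta (S ^ 2) (p / -S) = p / S * theta (S ^ 2) (-S * p) := by
    have := theta_div hQ hS2 (z := -S * p) (mul_ne_zero (neg_ne_zero.mpr hS0) hp)
    rw [show -S * p / S ^ 2 = p / -S by field_simp] at this
    rw [this]; field_simp
  simp only [thetaQuot, thetaPair]
  rw [a1, a2, div_neg, div_one, mul_neg_one, mul_comm p S, mul_comm p (-S), hd]
  have n1 : theta (S ^ 2) (-1) ≠ 0 := by intro h; simp [h] at hne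
  have n2 : theta (S ^ 2) S ≠ 0 := by intro h; simp [h] at hne
  have n3 : theta (S ^ 2) (-S) ≠ 0 := by intro h; simp [h] at hne
  have h4 : theta (S ^ 2) (-1) ^ 2 * theta (S ^ 2) S ^ 2 * theta (S ^ 2) (-S) ^ 2 = 4 := by
    rw [← mul_pow, ← mul_pow, h2]; norm_num
  rw [← h4]
  field_simp

/-- The values `e₁, e₂, e₃` at the half periods, relative to the value at `y`. -/
lemma exists_half_period_values {Q y : ℂ} (hQ : ‖Q‖ < 1) (hQ0 : Q ≠ 0) (hy : y ≠ 0)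
    (h1 : theta Q y ≠ 0) (h2 : theta Q (y ^ 2) ≠ 0) (h3 : theta Q (y ^ 3) ≠ 0)
    (h4 : theta Q (y ^ 4) ≠ 0) :
    ∃ e₁ e₂ e₃ : ℂ,
      e₁ * e₂ * e₃ = -(y ^ 2 * theta Q (y ^ 2) ^ 2 / (4 * theta Q y ^ 8)) ∧
      (let d := y * theta Q (y ^ 3) / (theta Q y * theta Q (y ^ 2) ^ 2)
       (e₁ + d) * (e₂ + d) * (e₃ + d) =
        -(y ^ 4 * theta Q (y ^ 4) ^ 2 / (4 * theta Q (y ^ 2) ^ 8))) ∧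
      (let d := y * theta Q (y ^ 2) * theta Q (y ^ 4) / (theta Q y ^ 2 * theta Q (y ^ 3) ^ 2)
       (e₁ + d) * (e₂ + d) * (e₃ + d) =
        -(y ^ 6 * theta Q (y ^ 6) ^ 2 / (4 * theta Q (y ^ 3) ^ 8))) ∧
      16 * ((e₁ - e₂) * (e₁ - e₃) * (e₂ - e₃)) ^ 2 = Q := by
  obtain ⟨S, hSQ⟩ := IsAlgClosed.exists_pow_nat_eq Q (n := 2) two_pos
  have hS : ‖S‖ < 1 := by
    rw [← hSQ, norm_pow] at hQ
    exact (pow_lt_one_iff_of_nonneg (norm_nonneg _) two_ne_zero).mp hQ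
  have hS0 : S ≠ 0 := by rintro rfl; simp at hSQ; exact hQ0 hSQ.symm
  subst hSQ
  set Q := S ^ 2 with hQd
  have hp := theta_half_periods hS hS0
  rw [← hQd] at hp
  have hne : theta Q (-1) * theta Q S * theta Q (-S) ≠ 0 := by rw [hp]; norm_num
  have n1 : theta Q (-1) ≠ 0 := by intro h; simp [h] at hne
  have n2 : theta Q S ≠ 0 := by intro h; simp [h] at hne
  have n3 : theta Q (-S) ≠ 0 := by intro h; simp [h] at hne
  have hS1 : -S ≠ 0 := neg_ne_zero.mpr hS0
  have hz := theta_sq hS hS0 hy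
  have hzi := theta_sq hS hS0 (inv_ne_zero hy)
  rw [← hQd] at hz hzi
  have hzi0 : theta Q (y⁻¹ ^ 2) ≠ 0 := by
    rw [inv_pow, theta_inv hQ (pow_ne_zero 2 hy)]
    exact neg_ne_zero.mpr (div_ne_zero h2 (pow_ne_zero 2 hy))
  rw [hz] at h2
  rw [hzi] at hzi0
  have p1 : thetaPair Q (-1) y ≠ 0 := by
    rw [thetaPair, neg_one_mul, div_eq_mul_inv, neg_one_mul]
    refine mul_ne_zero (fun h => ?_) (fun h => ?_)
    · simp [h] at h2
    · simp [h] at hzi0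
  have p2 : thetaPair Q S y ≠ 0 := by
    rw [thetaPair, div_eq_mul_inv]
    refine mul_ne_zero (fun h => ?_) (fun h => ?_)
    · simp [h] at h2
    · simp [h] at hzi0
  have p3 : thetaPair Q (-S) y ≠ 0 := by
    rw [thetaPair, div_eq_mul_inv]
    refine mul_ne_zero (fun h => ?_) (fun h => ?_)
    · simp only [h, mul_zero, ne_eq, not_true_eq_false] at h2
    · simp only [h, mul_zero, ne_eq, not_true_eq_false] at hzi0
  rw [← hz] at h2
  have hyy : theta Q (y * y) ≠ 0 := by rwa [← sq]
  have e2 : thetaPair Q (y ^ 2) y = theta Q (y ^ 3) * theta Q y := by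
    rw [thetaPair]; congr 2; field_simp
  have e3 : thetaPair Q (y ^ 3) y = theta Q (y ^ 4) * theta Q (y ^ 2) := by
    rw [thetaPair]; congr 2; field_simp
  have q2 : thetaPair Q (y ^ 2) y ≠ 0 := by rw [e2]; exact mul_ne_zero h3 h1
  have q3 : thetaPair Q (y ^ 3) y ≠ 0 := by rw [e3]; exact mul_ne_zero h4 h2
  have d2 : thetaQuot Q (y ^ 2) y = y * theta Q (y ^ 3) / (theta Q y * theta Q (y ^ 2) ^ 2) := by
    rw [thetaQuot, e2]; field_simp
  have d3 : thetaQuot Q (y ^ 3) y =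
      y * theta Q (y ^ 2) * theta Q (y ^ 4) / (theta Q y ^ 2 * theta Q (y ^ 3) ^ 2) := by
    rw [thetaQuot, e3]; field_simp
  have hy2 := pow_ne_zero 2 hy
  have hy3 := pow_ne_zero 3 hy
  have m1 : (-1 : ℂ) ≠ 0 := by simp
  have sh {x v : ℂ} (hx : x ≠ 0) (hx1 : theta Q x ≠ 0) (hxy : thetaPair Q x y ≠ 0)
      (hv : v ≠ 0) (hv1 : theta Q v ≠ 0) (hvy : thetaPair Q v y ≠ 0) :
      thetaQuot Q y v + thetaQuot Q x y = thetaQuot Q x v := by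
    rw [thetaQuot_add hQ hQ0 hx hy hv hx1 h1 hv1 hyy hxy hvy]; ring
  have df {x v : ℂ} (hx : x ≠ 0) (hx1 : theta Q x ≠ 0) (hxy : thetaPair Q x y ≠ 0)
      (hv : v ≠ 0) (hv1 : theta Q v ≠ 0) (hvy : thetaPair Q v y ≠ 0) :
      thetaQuot Q y v - thetaQuot Q y x = thetaQuot Q x v := by
    rw [← sh hx hx1 hxy hv hv1 hvy, thetaQuot_swap hQ hy hx]; ring
  have hhp {p : ℂ} (hp : p ≠ 0) (hp1 : theta Q p ≠ 0) :
      thetaQuot Q p (-1) * thetaQuot Q p S * thetaQuot Q p (-S) =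
        -(p ^ 2 * theta Q (p ^ 2) ^ 2 / (4 * theta Q p ^ 8)) :=
    thetaQuot_half_periods hS hS0 hp hp1
  refine ⟨thetaQuot Q y (-1), thetaQuot Q y S, thetaQuot Q y (-S), ?_, ?_, ?_, ?_⟩
  · exact hhp hy h1
  · simp only
    rw [← d2, sh hy2 h2 q2 m1 n1 p1, sh hy2 h2 q2 hS0 n2 p2, sh hy2 h2 q2 hS1 n3 p3,
      hhp hy2 h2, ← pow_mul]
  · simp only
    rw [← d3, sh hy3 h3 q3 m1 n1 p1, sh hy3 h3 q3 hS0 n2 p2, sh hy3 h3 q3 hS1 n3 p3,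
      hhp hy3 h3, ← pow_mul]
  · rw [df hS0 n2 p2 m1 n1 p1, df hS1 n3 p3 m1 n1 p1, df hS1 n3 p3 hS0 n2 p2]
    have b1 : theta Q (-S / -1) = theta Q S := by rw [neg_div_neg_eq, div_one]
    have b2 : theta Q (S / -1) = theta Q (-S) := by rw [div_neg, div_one]
    have b3 : theta Q (-S * S) = theta Q (-1) := by
      rw [show -S * S = Q * -1 by rw [hQd]; ring, theta_mul hQ hQ0 m1, div_neg, div_one, neg_neg]
    have b4 : theta Q (-S / S) = theta Q (-1) := by rw [neg_div, div_self hS0]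
    have hp4 : 16 = (theta Q (-1) * theta Q S * theta Q (-S)) ^ 4 := by rw [hp]; norm_num
    simp only [thetaQuot, thetaPair, b1, b2, b3, b4, mul_neg_one, neg_neg]
    rw [hp4]
    clear_value Q
    field_simp
    exact hQd.symm

set_option maxHeartbeats 4000000 in
/-- The coefficients of the inverse of `dissectionFactor`, up to normalisation. -/
def invCoeff {R : Type*} [CommRing R] (r s : R) : ℕ → R
  | 0 => s * (s - 1) * (
      (-11 + 88 * s - 1100 * s ^ 2 + 5522 * s ^ 3 - 14938 * s ^ 4 + 23617 * s ^ 5 - 23386 * s ^ 6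
      + 15114 * s ^ 7 - 6336 * s ^ 8 + 1639 * s ^ 9 - 220 * s ^ 10 + 11 * s ^ 11) + r * (121 -
      484 * s + 484 * s ^ 2 + 968 * s ^ 3 - 2541 * s ^ 4 + 2420 * s ^ 5 - 1210 * s ^ 6 + 242 * s
      ^ 7))
  | 1 => s * (s - 1) * (
      (-3 + 50 * s + 336 * s ^ 2 - 3843 * s ^ 3 + 12488 * s ^ 4 - 21799 * s ^ 5 + 23732 * s ^ 6 -
      16731 * s ^ 7 + 7627 * s ^ 8 - 2174 * s ^ 9 + 336 * s ^ 10 - 22 * s ^ 11) + r * (87 - 759 *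
      s + 2838 * s ^ 2 - 5415 * s ^ 3 + 6214 * s ^ 4 - 4700 * s ^ 5 + 2294 * s ^ 6 - 655 * s ^ 7
      + 92 * s ^ 8 + 7 * s ^ 9))
  | 2 => s * (s - 1) ^ 2 * (
      (1 - 178 * s + 1142 * s ^ 2 - 3504 * s ^ 3 + 7875 * s ^ 4 - 12057 * s ^ 5 + 11541 * s ^ 6 -
      6710 * s ^ 7 + 2349 * s ^ 8 - 456 * s ^ 9 + 42 * s ^ 10) + r * (-40 + 363 * s - 1221 * s ^
      2 + 1431 * s ^ 3 - 304 * s ^ 4 - 593 * s ^ 5 + 515 * s ^ 6 - 262 * s ^ 7 + 61 * s ^ 8 + 5 *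
      s ^ 9))
  | 3 => s * (s - 1) ^ 2 * (
      (-116 * s + 199 * s ^ 2 + 1552 * s ^ 3 - 6377 * s ^ 4 + 11314 * s ^ 5 - 11687 * s ^ 6 +
      7512 * s ^ 7 - 2970 * s ^ 8 + 646 * s ^ 9 - 69 * s ^ 10 + s ^ 11) + r * (-22 + 504 * s -
      2519 * s ^ 2 + 5467 * s ^ 3 - 6540 * s ^ 4 + 4640 * s ^ 5 - 2184 * s ^ 6 + 903 * s ^ 7 -
      320 * s ^ 8 + 63 * s ^ 9 + 3 * s ^ 10))
  | 4 => s * (s - 1) ^ 2 * (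
      (-112 * s + 766 * s ^ 2 - 2702 * s ^ 3 + 6849 * s ^ 4 - 11465 * s ^ 5 + 12174 * s ^ 6 -
      8298 * s ^ 7 + 3582 * s ^ 8 - 901 * s ^ 9 + 111 * s ^ 10 - 3 * s ^ 11) + r * (-7 + 336 * s
      - 1849 * s ^ 2 + 4446 * s ^ 3 - 6484 * s ^ 4 + 6098 * s ^ 5 - 3286 * s ^ 6 + 611 * s ^ 7 +
      319 * s ^ 8 - 238 * s ^ 9 + 51 * s ^ 10 + 2 * s ^ 11))
  | 5 => s * (s - 1) ^ 3 * (
      (67 * s - 270 * s ^ 2 - 310 * s ^ 3 + 2593 * s ^ 4 - 5311 * s ^ 5 + 5601 * s ^ 6 - 3221 * s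
      ^ 7 + 988 * s ^ 8 - 169 * s ^ 9 + 7 * s ^ 10) + r * (2 - 319 * s + 2150 * s ^ 2 - 5642 * s
      ^ 3 + 8310 * s ^ 4 - 7646 * s ^ 5 + 4596 * s ^ 6 - 1992 * s ^ 7 + 774 * s ^ 8 - 261 * s ^ 9
      + 52 * s ^ 10 + s ^ 11))
  | 6 => s ^ 2 * (s - 1) ^ 3 * (
      (42 - 501 * s + 2011 * s ^ 2 - 4874 * s ^ 3 + 7534 * s ^ 4 - 7355 * s ^ 5 + 4310 * s ^ 6 -
      1373 * s ^ 7 + 217 * s ^ 8 - 16 * s ^ 9) + r * (-204 + 1683 * s - 5407 * s ^ 2 + 10273 * s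
      ^ 3 - 13390 * s ^ 4 + 12482 * s ^ 5 - 7874 * s ^ 6 + 2932 * s ^ 7 - 459 * s ^ 8 - 62 * s ^
      9 + 30 * s ^ 10 + s ^ 11))
  | 7 => s ^ 2 * (s - 1) ^ 3 * (
      (15 - 230 * s + 609 * s ^ 2 - 152 * s ^ 3 - 2033 * s ^ 4 + 3941 * s ^ 5 - 3230 * s ^ 6 +
      1316 * s ^ 7 - 225 * s ^ 8 - 12 * s ^ 9) + r * (-175 + 1848 * s - 7435 * s ^ 2 + 16480 * s
      ^ 3 - 22665 * s ^ 4 + 20851 * s ^ 5 - 13743 * s ^ 6 + 6841 * s ^ 7 - 2712 * s ^ 8 + 927 * s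
      ^ 9 - 258 * s ^ 10 + 42 * s ^ 11))
  | 8 => s ^ 2 * (s - 1) ^ 4 * (
      (-5 + 271 * s - 1567 * s ^ 2 + 4183 * s ^ 3 - 5761 * s ^ 4 + 4476 * s ^ 5 - 2095 * s ^ 6 +
      555 * s ^ 7 - 13 * s ^ 8 - 29 * s ^ 9) + r * (106 - 1298 * s + 5749 * s ^ 2 - 13692 * s ^ 3
      + 19105 * s ^ 4 - 16414 * s ^ 5 + 9058 * s ^ 6 - 3263 * s ^ 7 + 596 * s ^ 8 + 131 * s ^ 9 -
      123 * s ^ 10 + 30 * s ^ 11))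
  | 9 => s ^ 2 * (s - 1) ^ 4 * (
      (-1 + 195 * s - 925 * s ^ 2 + 1985 * s ^ 3 - 2085 * s ^ 4 + 794 * s ^ 5 + 417 * s ^ 6 - 538
      * s ^ 7 + 169 * s ^ 8 + 14 * s ^ 9 - 22 * s ^ 10) + r * (63 - 1243 * s + 6641 * s ^ 2 -
      18508 * s ^ 3 + 31266 * s ^ 4 - 33524 * s ^ 5 + 22496 * s ^ 6 - 8632 * s ^ 7 + 1327 * s ^ 8
      + 123 * s ^ 9 + 48 * s ^ 10 - 82 * s ^ 11 + 22 * s ^ 12))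
  | 10 => s ^ 2 * (s - 1) ^ 5 * (
      (-177 * s + 1287 * s ^ 2 - 3850 * s ^ 3 + 6003 * s ^ 4 - 5743 * s ^ 5 + 3528 * s ^ 6 - 1424
      * s ^ 7 + 390 * s ^ 8 - 40 * s ^ 9 - 15 * s ^ 10) + r * (-30 + 878 * s - 5289 * s ^ 2 +
      15592 * s ^ 3 - 27700 * s ^ 4 + 33355 * s ^ 5 - 28692 * s ^ 6 + 18041 * s ^ 7 - 8297 * s ^
      8 + 2618 * s ^ 9 - 445 * s ^ 10 - 5 * s ^ 11 + 15 * s ^ 12))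
  | _ => 0

/-- The norm of `dissectionFactor`, up to normalisation. -/
def normCoeff {R : Type*} [CommRing R] (r s : R) : R :=
  (-19 * s + 602 * s ^ 2 - 2577 * s ^ 3 + 4182 * s ^ 4 - 2000 * s ^ 5 - 1556 * s ^ 6 + 1413 * s ^
  7 + 450 * s ^ 8 - 528 * s ^ 9 - 50 * s ^ 10 + 84 * s ^ 11 + 8 * s ^ 12 - 6 * s ^ 13 - s ^ 14) +
  r * (1 - 111 * s + 540 * s ^ 2 - 856 * s ^ 3 - 429 * s ^ 4 + 3114 * s ^ 5 - 4447 * s ^ 6 + 3315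
  * s ^ 7 - 1383 * s ^ 8 + 268 * s ^ 9 - 16 * s ^ 10 + 2 * s ^ 11)

/-- The quantity cutting out the cusps on the curve. -/
def cuspDisc {R : Type*} [CommRing R] (r s : R) : R :=
  (-1 + 5 * s - s ^ 2 - s ^ 3) + r * (-3 + s)

set_option maxHeartbeats 4000000 in
lemma invCoeff_relation_0 {R : Type*} [CommRing R] {r s : R}
    (h : r ^ 2 = r * ((s - 1) ^ 3 + s + 1) - s) :
    r * s * (r - 1) * (s - 1) ^ 3 * (1 * invCoeff r s 0 - normCoeff r s) + - 1 * invCoeff r s 10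
    + (s - r) * invCoeff r s 8 + - (s * (r - 1)) * invCoeff r s 7 + r * (s - 1) ^ 2 * invCoeff r
    s 6 + s * (r - 1) ^ 2 * (s - 1) * invCoeff r s 2 = 0 := by
  simp only [invCoeff, normCoeff]
  linear_combination (
    (-s - 16 * s ^ 2 + 1059 * s ^ 3 - 8615 * s ^ 4 + 32683 * s ^ 5 - 74141 * s ^ 6 + 112726 * s ^
    7 - 123546 * s ^ 8 + 103082 * s ^ 9 - 67718 * s ^ 10 + 34909 * s ^ 11 - 13352 * s ^ 12 + 3286
    * s ^ 13 - 307 * s ^ 14 - 64 * s ^ 15 + 15 * s ^ 16) + r * (s + 47 * s ^ 2 - 575 * s ^ 3 +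
    2766 * s ^ 4 - 6709 * s ^ 5 + 8464 * s ^ 6 - 4081 * s ^ 7 - 3048 * s ^ 8 + 6233 * s ^ 9 -
    4625 * s ^ 10 + 1907 * s ^ 11 - 371 * s ^ 12 - 34 * s ^ 13 + 27 * s ^ 14 - 2 * s ^ 15)) * h

set_option maxHeartbeats 4000000 in
lemma invCoeff_relation_1 {R : Type*} [CommRing R] {r s : R}
    (h : r ^ 2 = r * ((s - 1) ^ 3 + s + 1) - s) :
    r * s * (r - 1) * (s - 1) ^ 3 * (1 * invCoeff r s 1 + - 1 * invCoeff r s 0) + (s - r) *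
    invCoeff r s 9 + - (s * (r - 1)) * invCoeff r s 8 + r * (s - 1) ^ 2 * invCoeff r s 7 + s * (r
    - 1) ^ 2 * (s - 1) * invCoeff r s 3 = 0 := by
  simp only [invCoeff]
  linear_combination (
    (110 * s ^ 2 - 57 * s ^ 3 - 4999 * s ^ 4 + 29276 * s ^ 5 - 84242 * s ^ 6 + 150408 * s ^ 7 -
    179890 * s ^ 8 + 147782 * s ^ 9 - 82685 * s ^ 10 + 29874 * s ^ 11 - 5888 * s ^ 12 + 247 * s ^
    13 + 12 * s ^ 14 + 74 * s ^ 15 - 22 * s ^ 16) + r * (-12 * s ^ 2 - 709 * s ^ 3 + 7347 * s ^ 4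
    - 31871 * s ^ 5 + 80479 * s ^ 6 - 133309 * s ^ 7 + 153591 * s ^ 8 - 126951 * s ^ 9 + 76160 *
    s ^ 10 - 32795 * s ^ 11 + 9665 * s ^ 12 - 1723 * s ^ 13 + 118 * s ^ 14 + 10 * s ^ 15)) * h

set_option maxHeartbeats 4000000 in
lemma invCoeff_relation_2 {R : Type*} [CommRing R] {r s : R}
    (h : r ^ 2 = r * ((s - 1) ^ 3 + s + 1) - s) :
    r * s * (r - 1) * (s - 1) ^ 3 * (1 * invCoeff r s 2 + - 1 * invCoeff r s 1) + (s - r) *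
    invCoeff r s 10 + - (s * (r - 1)) * invCoeff r s 9 + r * (s - 1) ^ 2 * invCoeff r s 8 + s *
    (r - 1) ^ 2 * (s - 1) * invCoeff r s 4 = 0 := by
  simp only [invCoeff]
  linear_combination (
    (111 * s ^ 2 - 726 * s ^ 3 + 1453 * s ^ 4 + 1549 * s ^ 5 - 15365 * s ^ 6 + 43134 * s ^ 7 -
    75455 * s ^ 8 + 93481 * s ^ 9 - 85808 * s ^ 10 + 59606 * s ^ 11 - 31582 * s ^ 12 + 12588 * s
    ^ 13 - 3523 * s ^ 14 + 539 * s ^ 15 + 13 * s ^ 16 - 15 * s ^ 17) + r * (-40 * s ^ 2 + 187 * s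
    ^ 3 - 82 * s ^ 4 - 905 * s ^ 5 + 1179 * s ^ 6 + 4118 * s ^ 7 - 17060 * s ^ 8 + 30406 * s ^ 9
    - 33520 * s ^ 10 + 24974 * s ^ 11 - 12922 * s ^ 12 + 4550 * s ^ 13 - 966 * s ^ 14 + 74 * s ^
    15 + 7 * s ^ 16)) * h

set_option maxHeartbeats 4000000 in
lemma invCoeff_relation_3 {R : Type*} [CommRing R] {r s : R}
    (h : r ^ 2 = r * ((s - 1) ^ 3 + s + 1) - s) :
    r * s * (r - 1) * (s - 1) ^ 3 * (1 * invCoeff r s 3 + - 1 * invCoeff r s 2 + (s - r) *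
    invCoeff r s 0) + - (s * (r - 1)) * invCoeff r s 10 + r * (s - 1) ^ 2 * invCoeff r s 9 + s *
    (r - 1) ^ 2 * (s - 1) * invCoeff r s 5 = 0 := by
  simp only [invCoeff]
  linear_combination (
    (67 * s ^ 2 - 361 * s ^ 3 - 1000 * s ^ 4 + 14000 * s ^ 5 - 56289 * s ^ 6 + 131386 * s ^ 7 -
    205558 * s ^ 8 + 228376 * s ^ 9 - 185247 * s ^ 10 + 111324 * s ^ 11 - 49923 * s ^ 12 + 16579
    * s ^ 13 - 3821 * s ^ 14 + 447 * s ^ 15 + 35 * s ^ 16 - 15 * s ^ 17) + r * (116 * s ^ 2 -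
    1841 * s ^ 3 + 13192 * s ^ 4 - 55233 * s ^ 5 + 151783 * s ^ 6 - 290972 * s ^ 7 + 401203 * s ^
    8 - 402922 * s ^ 9 + 295273 * s ^ 10 - 157386 * s ^ 11 + 61018 * s ^ 12 - 17582 * s ^ 13 +
    4030 * s ^ 14 - 785 * s ^ 15 + 113 * s ^ 16 - 7 * s ^ 17) + r ^ 2 * (-121 * s ^ 2 + 968 * s ^
    3 - 3146 * s ^ 4 + 4356 * s ^ 5 + 1452 * s ^ 6 - 15972 * s ^ 7 + 29524 * s ^ 8 - 30734 * s ^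
    9 + 20449 * s ^ 10 - 8712 * s ^ 11 + 2178 * s ^ 12 - 242 * s ^ 13)) * h

set_option maxHeartbeats 4000000 in
lemma invCoeff_relation_4 {R : Type*} [CommRing R] {r s : R}
    (h : r ^ 2 = r * ((s - 1) ^ 3 + s + 1) - s) :
    r * s * (r - 1) * (s - 1) ^ 3 * (1 * invCoeff r s 4 + - 1 * invCoeff r s 3 + (s - r) *
    invCoeff r s 1 + - (s * (r - 1)) * invCoeff r s 0) + r * (s - 1) ^ 2 * invCoeff r s 10 + s *
    (r - 1) ^ 2 * (s - 1) * invCoeff r s 6 = 0 := by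
  simp only [invCoeff]
  linear_combination (
    (42 * s ^ 2 - 669 * s ^ 3 + 4267 * s ^ 4 - 16092 * s ^ 5 + 41142 * s ^ 6 - 75280 * s ^ 7 +
    100441 * s ^ 8 - 97753 * s ^ 9 + 68523 * s ^ 10 - 33717 * s ^ 11 + 11168 * s ^ 12 - 2337 * s
    ^ 13 + 281 * s ^ 14 - 16 * s ^ 15) + r * (75 * s ^ 2 - 1138 * s ^ 3 + 8147 * s ^ 4 - 34507 *
    s ^ 5 + 98038 * s ^ 6 - 201890 * s ^ 7 + 315171 * s ^ 8 - 381548 * s ^ 9 + 361205 * s ^ 10 -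
    267075 * s ^ 11 + 152828 * s ^ 12 - 66370 * s ^ 13 + 20969 * s ^ 14 - 4305 * s ^ 15 + 350 * s
    ^ 16 + 65 * s ^ 17 - 15 * s ^ 18) + r ^ 2 * (-87 * s ^ 2 + 986 * s ^ 3 - 5428 * s ^ 4 + 18523
    * s ^ 5 - 43669 * s ^ 6 + 75609 * s ^ 7 - 98848 * s ^ 8 + 97826 * s ^ 9 - 72224 * s ^ 10 +
    38616 * s ^ 11 - 14150 * s ^ 12 + 3159 * s ^ 13 - 306 * s ^ 14 - 7 * s ^ 15)) * h

set_option maxHeartbeats 4000000 in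
lemma invCoeff_relation_5 {R : Type*} [CommRing R] {r s : R}
    (h : r ^ 2 = r * ((s - 1) ^ 3 + s + 1) - s) :
    r * s * (r - 1) * (s - 1) ^ 3 * (1 * invCoeff r s 5 + - 1 * invCoeff r s 4 + (s - r) *
    invCoeff r s 2 + - (s * (r - 1)) * invCoeff r s 1 + r * (s - 1) ^ 2 * invCoeff r s 0) + s *
    (r - 1) ^ 2 * (s - 1) * invCoeff r s 7 = 0 := by
  simp only [invCoeff]
  linear_combination (
    (15 * s ^ 2 - 290 * s ^ 3 + 1619 * s ^ 4 - 4028 * s ^ 5 + 3164 * s ^ 6 + 8495 * s ^ 7 - 29975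
    * s ^ 8 + 45862 * s ^ 9 - 42666 * s ^ 10 + 25645 * s ^ 11 - 9796 * s ^ 12 + 2144 * s ^ 13 -
    177 * s ^ 14 - 12 * s ^ 15) + r * (-96 * s ^ 2 + 1024 * s ^ 3 - 4493 * s ^ 4 + 10474 * s ^ 5
    - 11740 * s ^ 6 - 4292 * s ^ 7 + 39076 * s ^ 8 - 71389 * s ^ 9 + 76305 * s ^ 10 - 53768 * s ^
    11 + 25307 * s ^ 12 - 7631 * s ^ 13 + 1341 * s ^ 14 - 130 * s ^ 15 + 12 * s ^ 16) + r ^ 2 *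
    (81 * s ^ 2 - 734 * s ^ 3 + 2874 * s ^ 4 - 6446 * s ^ 5 + 8576 * s ^ 6 - 4203 * s ^ 7 - 9101
    * s ^ 8 + 25527 * s ^ 9 - 33639 * s ^ 10 + 28123 * s ^ 11 - 15511 * s ^ 12 + 5487 * s ^ 13 -
    1164 * s ^ 14 + 142 * s ^ 15 - 12 * s ^ 16)) * h

set_option maxHeartbeats 4000000 in
lemma invCoeff_relation_6 {R : Type*} [CommRing R] {r s : R}
    (h : r ^ 2 = r * ((s - 1) ^ 3 + s + 1) - s) :
    r * s * (r - 1) * (s - 1) ^ 3 * (1 * invCoeff r s 6 + - 1 * invCoeff r s 5 + (s - r) *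
    invCoeff r s 3 + - (s * (r - 1)) * invCoeff r s 2 + r * (s - 1) ^ 2 * invCoeff r s 1) + s *
    (r - 1) ^ 2 * (s - 1) * invCoeff r s 8 = 0 := by
  simp only [invCoeff]
  linear_combination (
    (5 * s ^ 2 - 296 * s ^ 3 + 2972 * s ^ 4 - 14778 * s ^ 5 + 45081 * s ^ 6 - 92141 * s ^ 7 +
    132021 * s ^ 8 - 135882 * s ^ 9 + 101486 * s ^ 10 - 54677 * s ^ 11 + 20486 * s ^ 12 - 4710 *
    s ^ 13 + 330 * s ^ 14 + 132 * s ^ 15 - 29 * s ^ 16) + r * (-70 * s ^ 2 + 1003 * s ^ 3 - 6973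
    * s ^ 4 + 30460 * s ^ 5 - 90191 * s ^ 6 + 187774 * s ^ 7 - 281985 * s ^ 8 + 310954 * s ^ 9 -
    253863 * s ^ 10 + 152353 * s ^ 11 - 64915 * s ^ 12 + 17847 * s ^ 13 - 2306 * s ^ 14 - 152 * s
    ^ 15 + 63 * s ^ 16 + s ^ 17) + r ^ 2 * (65 * s ^ 2 - 707 * s ^ 3 + 4001 * s ^ 4 - 15682 * s ^
    5 + 45110 * s ^ 6 - 95633 * s ^ 7 + 149964 * s ^ 8 - 175072 * s ^ 9 + 152377 * s ^ 10 - 97676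
    * s ^ 11 + 44429 * s ^ 12 - 13137 * s ^ 13 + 1976 * s ^ 14 + 20 * s ^ 15 - 34 * s ^ 16 - s ^
    17)) * h

set_option maxHeartbeats 4000000 in
lemma invCoeff_relation_7 {R : Type*} [CommRing R] {r s : R}
    (h : r ^ 2 = r * ((s - 1) ^ 3 + s + 1) - s) :
    r * s * (r - 1) * (s - 1) ^ 3 * (1 * invCoeff r s 7 + - 1 * invCoeff r s 6 + (s - r) *
    invCoeff r s 4 + - (s * (r - 1)) * invCoeff r s 3 + r * (s - 1) ^ 2 * invCoeff r s 2) + s *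
    (r - 1) ^ 2 * (s - 1) * invCoeff r s 9 = 0 := by
  simp only [invCoeff]
  linear_combination (
    (s ^ 2 - 200 * s ^ 3 + 1910 * s ^ 4 - 8570 * s ^ 5 + 23215 * s ^ 6 - 41295 * s ^ 7 + 49073 *
    s ^ 8 - 37017 * s ^ 9 + 13321 * s ^ 10 + 4326 * s ^ 11 - 8269 * s ^ 12 + 4547 * s ^ 13 - 1023
    * s ^ 14 - 121 * s ^ 15 + 124 * s ^ 16 - 22 * s ^ 17) + r * (-34 * s ^ 2 + 494 * s ^ 3 - 3527
    * s ^ 4 + 15709 * s ^ 5 - 46005 * s ^ 6 + 90221 * s ^ 7 - 118599 * s ^ 8 + 101257 * s ^ 9 -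
    49492 * s ^ 10 + 5723 * s ^ 11 + 7538 * s ^ 12 - 2825 * s ^ 13 - 1695 * s ^ 14 + 1768 * s ^
    15 - 618 * s ^ 16 + 85 * s ^ 17) + r ^ 2 * (33 * s ^ 2 - 294 * s ^ 3 + 1617 * s ^ 4 - 7139 *
    s ^ 5 + 22790 * s ^ 6 - 48926 * s ^ 7 + 69526 * s ^ 8 - 64240 * s ^ 9 + 36171 * s ^ 10 -
    10049 * s ^ 11 + 731 * s ^ 12 - 1722 * s ^ 13 + 2718 * s ^ 14 - 1647 * s ^ 15 + 494 * s ^ 16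
    - 63 * s ^ 17)) * h

set_option maxHeartbeats 4000000 in
lemma invCoeff_relation_8 {R : Type*} [CommRing R] {r s : R}
    (h : r ^ 2 = r * ((s - 1) ^ 3 + s + 1) - s) :
    r * s * (r - 1) * (s - 1) ^ 3 * (1 * invCoeff r s 8 + - 1 * invCoeff r s 7 + (s - r) *
    invCoeff r s 5 + - (s * (r - 1)) * invCoeff r s 4 + r * (s - 1) ^ 2 * invCoeff r s 3) + s *
    (r - 1) ^ 2 * (s - 1) * invCoeff r s 10 = 0 := by
  simp only [invCoeff]
  linear_combination (
    (-177 * s ^ 3 + 2349 * s ^ 4 - 14227 * s ^ 5 + 51948 * s ^ 6 - 127906 * s ^ 7 + 225398 * s ^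
    8 - 294446 * s ^ 9 + 291146 * s ^ 10 - 220313 * s ^ 11 + 127936 * s ^ 12 - 56581 * s ^ 13 +
    18497 * s ^ 14 - 4064 * s ^ 15 + 405 * s ^ 16 + 50 * s ^ 17 - 15 * s ^ 18) + r * (-20 * s ^ 2
    + 511 * s ^ 3 - 5135 * s ^ 4 + 28913 * s ^ 5 - 104365 * s ^ 6 + 260066 * s ^ 7 - 468677 * s ^
    8 + 629121 * s ^ 9 - 639597 * s ^ 10 + 495092 * s ^ 11 - 289743 * s ^ 12 + 124971 * s ^ 13 -
    37096 * s ^ 14 + 5949 * s ^ 15 + 333 * s ^ 16 - 383 * s ^ 17 + 60 * s ^ 18) + r ^ 2 * (20 * s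
    ^ 2 - 334 * s ^ 3 + 2786 * s ^ 4 - 14686 * s ^ 5 + 52417 * s ^ 6 - 132160 * s ^ 7 + 243279 *
    s ^ 8 - 334675 * s ^ 9 + 348451 * s ^ 10 - 274779 * s ^ 11 + 161807 * s ^ 12 - 68390 * s ^ 13
    + 18599 * s ^ 14 - 1885 * s ^ 15 - 738 * s ^ 16 + 333 * s ^ 17 - 45 * s ^ 18)) * h

set_option maxHeartbeats 4000000 in
lemma invCoeff_relation_9 {R : Type*} [CommRing R] {r s : R}
    (h : r ^ 2 = r * ((s - 1) ^ 3 + s + 1) - s) :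
    r * s * (r - 1) * (s - 1) ^ 3 * (1 * invCoeff r s 9 + - 1 * invCoeff r s 8 + (s - r) *
    invCoeff r s 6 + - (s * (r - 1)) * invCoeff r s 5 + r * (s - 1) ^ 2 * invCoeff r s 4 + s * (r
    - 1) ^ 2 * (s - 1) * invCoeff r s 0) = 0 := by
  simp only [invCoeff]
  linear_combination (
    r * (-7 * s ^ 2 - 70 * s ^ 3 + 1033 * s ^ 4 - 4378 * s ^ 5 + 7093 * s ^ 6 + 5713 * s ^ 7 -
    49607 * s ^ 8 + 109869 * s ^ 9 - 140424 * s ^ 10 + 114639 * s ^ 11 - 58755 * s ^ 12 + 16491 *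
    s ^ 13 - 1659 * s ^ 14 + 832 * s ^ 15 - 1347 * s ^ 16 + 754 * s ^ 17 - 199 * s ^ 18 + 22 * s
    ^ 19) + r ^ 2 * (7 * s ^ 2 + 191 * s ^ 3 - 2122 * s ^ 4 + 8492 * s ^ 5 - 14595 * s ^ 6 - 2809
    * s ^ 7 + 67031 * s ^ 8 - 155365 * s ^ 9 + 200682 * s ^ 10 - 165822 * s ^ 11 + 87916 * s ^ 12
    - 27381 * s ^ 13 + 4079 * s ^ 14 - 1074 * s ^ 15 + 1347 * s ^ 16 - 754 * s ^ 17 + 199 * s ^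
    18 - 22 * s ^ 19) + r ^ 3 * (-121 * s ^ 3 + 1089 * s ^ 4 - 4114 * s ^ 5 + 7502 * s ^ 6 - 2904
    * s ^ 7 - 17424 * s ^ 8 + 45496 * s ^ 9 - 60258 * s ^ 10 + 51183 * s ^ 11 - 29161 * s ^ 12 +
    10890 * s ^ 13 - 2420 * s ^ 14 + 242 * s ^ 15)) * h

set_option maxHeartbeats 4000000 in
lemma invCoeff_relation_10 {R : Type*} [CommRing R] {r s : R}
    (h : r ^ 2 = r * ((s - 1) ^ 3 + s + 1) - s) :
    r * s * (r - 1) * (s - 1) ^ 3 * (1 * invCoeff r s 10 + - 1 * invCoeff r s 9 + (s - r) *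
    invCoeff r s 7 + - (s * (r - 1)) * invCoeff r s 6 + r * (s - 1) ^ 2 * invCoeff r s 5 + s * (r
    - 1) ^ 2 * (s - 1) * invCoeff r s 1) = 0 := by
  simp only [invCoeff]
  linear_combination (
    r * (-2 * s ^ 2 - 17 * s ^ 3 + 737 * s ^ 4 - 6342 * s ^ 5 + 26913 * s ^ 6 - 66474 * s ^ 7 +
    94904 * s ^ 8 - 49464 * s ^ 9 - 96525 * s ^ 10 + 271191 * s ^ 11 - 356386 * s ^ 12 + 307705 *
    s ^ 13 - 186896 * s ^ 14 + 80172 * s ^ 15 - 23184 * s ^ 16 + 3827 * s ^ 17 - 72 * s ^ 18 -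
    102 * s ^ 19 + 15 * s ^ 20) + r ^ 2 * (2 * s ^ 2 + 104 * s ^ 3 - 1931 * s ^ 4 + 13845 * s ^ 5
    - 54978 * s ^ 6 + 136168 * s ^ 7 - 217086 * s ^ 8 + 206497 * s ^ 9 - 54653 * s ^ 10 - 161399
    * s ^ 11 + 296729 * s ^ 12 - 284100 * s ^ 13 + 180477 * s ^ 14 - 79127 * s ^ 15 + 23127 * s ^
    16 - 3834 * s ^ 17 + 72 * s ^ 18 + 102 * s ^ 19 - 15 * s ^ 20) + r ^ 3 * (-87 * s ^ 3 + 1194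
    * s ^ 4 - 7503 * s ^ 5 + 28065 * s ^ 6 - 69694 * s ^ 7 + 122182 * s ^ 8 - 157033 * s ^ 9 +
    151178 * s ^ 10 - 109792 * s ^ 11 + 59657 * s ^ 12 - 23605 * s ^ 13 + 6419 * s ^ 14 - 1045 *
    s ^ 15 + 57 * s ^ 16 + 7 * s ^ 17)) * h

set_option maxHeartbeats 4000000 in
lemma normCoeff_eq {R : Type*} [CommRing R] {r s : R}
    (h : r ^ 2 = r * ((s - 1) ^ 3 + s + 1) - s) :
    r * (s - 1) ^ 4 * normCoeff r s = s * cuspDisc r s ^ 5 := by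
  simp only [normCoeff, cuspDisc]
  linear_combination (
    (1 - 25 * s + 255 * s ^ 2 - 1345 * s ^ 3 + 3785 * s ^ 4 - 5005 * s ^ 5 + 1095 * s ^ 6 + 3155
    * s ^ 7 - 1765 * s ^ 8 - 795 * s ^ 9 + 581 * s ^ 10 + 125 * s ^ 11 - 85 * s ^ 12 - 15 * s ^
    13 + 5 * s ^ 14 + s ^ 15) + r * (270 * s - 1593 * s ^ 2 + 2898 * s ^ 3 - 1342 * s ^ 4 + 1651
    * s ^ 5 - 6148 * s ^ 6 + 7754 * s ^ 7 - 4671 * s ^ 8 + 1529 * s ^ 9 - 277 * s ^ 10 + 26 * s ^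
    11 - s ^ 12) + r ^ 2 * (405 * s - 1593 * s ^ 2 + 1026 * s ^ 3 + 993 * s ^ 4 - 1540 * s ^ 5 +
    785 * s ^ 6 - 194 * s ^ 7 + 23 * s ^ 8 - s ^ 9) + r ^ 3 * (243 * s - 405 * s ^ 2 + 270 * s ^
    3 - 90 * s ^ 4 + 15 * s ^ 5 - s ^ 6)) * h

set_option maxHeartbeats 4000000 in
lemma invCoeff_combination_one {R : Type*} [CommRing R] {r s : R}
    (h : r ^ 2 = r * ((s - 1) ^ 3 + s + 1) - s) :
    4 * (r ^ 2 * s * (r - 1) ^ 3 * (s - 1) ^ 3) * invCoeff r s 0 + 9 * (s * (r - 1) ^ 3) *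
    invCoeff r s 8 - 9 * (r * s * (r - 1) ^ 4 * (s - 1)) * invCoeff r s 3 - 9 * (r * s * (r - 1)
    ^ 2 * (s - 1) ^ 2) * invCoeff r s 7 + 9 * (r * (r - 1) ^ 2 * (s - 1) ^ 2) * invCoeff r s 9 +
    6 * (r * s * (r - 1) ^ 3 * (s - 1) ^ 3) * invCoeff r s 3 + 5 * (s ^ 2 * (r - 1) ^ 6) *
    invCoeff r s 0 - 6 * (r * s * (r - 1) ^ 3 * (s - 1)) * invCoeff r s 6 - 6 * (r * s * (r - 1)
    ^ 2 * (s - 1)) * invCoeff r s 10 + 6 * (r * s * (r - 1) ^ 4 * (s - 1) ^ 3) * invCoeff r s 1 +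
    12 * (r * (r - 1) ^ 2 * (s - 1) ^ 3) * invCoeff r s 8 - 12 * (r * s * (r - 1) ^ 2 * (s - 1) ^
    3) * invCoeff r s 5 + 1 * (r * s * (r - 1) ^ 3 * (s - 1) ^ 4) * invCoeff r s 0 + 12 * (r * s
    * (r - 1) ^ 3 * (s - 1) ^ 2) * invCoeff r s 4 - 12 * (s * (r - 1) ^ 4 * (s - 1)) * invCoeff r
    s 6 - 15 * (r ^ 2 * (r - 1) * (s - 1) ^ 6) * invCoeff r s 4 + 15 * (r ^ 2 * s * (r - 1) ^ 2 *
    (s - 1) ^ 5) * invCoeff r s 1 + 15 * (r * (r - 1) ^ 3 * (s - 1)) * invCoeff r s 7 + 10 * (r ^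
    3 * (r - 1) * (s - 1) ^ 8) * invCoeff r s 0 - 15 * (r * s * (r - 1) ^ 4 * (s - 1) ^ 2) *
    invCoeff r s 2 - 3 * (r ^ 3 * (s - 1) ^ 8) * invCoeff r s 2 + 3 * (r * (r - 1) * (s - 1) ^ 3)
    * invCoeff r s 10 + 3 * (r * s * (r - 1) ^ 3 * (s - 1) ^ 2) * invCoeff r s 5 - 3 * (r * s *
    (r - 1) ^ 2 * (s - 1)) * invCoeff r s 9 + 1 * (r ^ 2 * s ^ 2 * (r - 1) ^ 2 * (s - 1) ^ 5) *
    invCoeff r s 0 = 33 * (s ^ 3 * (r - 1) ^ 4 * (s - 1)) * cuspDisc r s ^ 4 := by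
  simp only [invCoeff, cuspDisc]
  linear_combination (
    (-371 * s ^ 2 + 4221 * s ^ 3 - 15393 * s ^ 4 + 27691 * s ^ 5 - 47457 * s ^ 6 + 141245 * s ^ 7
    - 321497 * s ^ 8 + 436210 * s ^ 9 - 373071 * s ^ 10 + 213733 * s ^ 11 - 84974 * s ^ 12 +
    23586 * s ^ 13 - 4343 * s ^ 14 + 420 * s ^ 15) + r * (-218 * s + 6868 * s ^ 2 - 59666 * s ^ 3
    + 248640 * s ^ 4 - 630418 * s ^ 5 + 1133367 * s ^ 6 - 1714974 * s ^ 7 + 2231570 * s ^ 8 -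
    2248896 * s ^ 9 + 1670131 * s ^ 10 - 966703 * s ^ 11 + 509080 * s ^ 12 - 278405 * s ^ 13 +
    144616 * s ^ 14 - 58052 * s ^ 15 + 14778 * s ^ 16 - 1613 * s ^ 17 - 150 * s ^ 18 + 45 * s ^
    19) + r ^ 2 * (1545 * s - 18385 * s ^ 2 + 87649 * s ^ 3 - 165223 * s ^ 4 - 161373 * s ^ 5 +
    1820243 * s ^ 6 - 5289694 * s ^ 7 + 9649115 * s ^ 8 - 13040884 * s ^ 9 + 13627115 * s ^ 10 -
    10984302 * s ^ 11 + 6747266 * s ^ 12 - 3100608 * s ^ 13 + 1030473 * s ^ 14 - 233072 * s ^ 15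
    + 32608 * s ^ 16 - 2724 * s ^ 17 + 296 * s ^ 18 - 45 * s ^ 19) + r ^ 3 * (-1210 * s + 9106 *
    s ^ 2 - 14585 * s ^ 3 - 133806 * s ^ 4 + 827715 * s ^ 5 - 2712286 * s ^ 6 + 5934815 * s ^ 7 -
    9411347 * s ^ 8 + 11527137 * s ^ 9 - 11176816 * s ^ 10 + 8542338 * s ^ 11 - 5083716 * s ^ 12
    + 2316128 * s ^ 13 - 783876 * s ^ 14 + 186360 * s ^ 15 - 28039 * s ^ 16 + 2102 * s ^ 17 - 20
    * s ^ 18) + r ^ 4 * (1408 * s ^ 2 - 5980 * s ^ 3 + 47112 * s ^ 4 - 91475 * s ^ 5 + 85258 * s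
    ^ 6 - 36706 * s ^ 7 - 64820 * s ^ 8 + 148308 * s ^ 9 - 135161 * s ^ 10 + 72230 * s ^ 11 -
    25360 * s ^ 12 + 5886 * s ^ 13 - 695 * s ^ 14 - 5 * s ^ 15) + r ^ 5 * (-7733 * s ^ 3 + 13717
    * s ^ 4 - 15235 * s ^ 5 + 20416 * s ^ 6 - 10802 * s ^ 7 - 8305 * s ^ 8 + 13365 * s ^ 9 - 6600
    * s ^ 10 + 1177 * s ^ 11) + r ^ 6 * (2673 * s ^ 3 - 6237 * s ^ 4 + 5346 * s ^ 5 - 2178 * s ^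
    6 + 429 * s ^ 7 - 33 * s ^ 8)) * h

set_option maxHeartbeats 4000000 in
lemma invCoeff_combination_two {R : Type*} [CommRing R] {r s : R}
    (h : r ^ 2 = r * ((s - 1) ^ 3 + s + 1) - s) :
    2 * (r ^ 2 * s * (r - 1) ^ 3 * (s - 1) ^ 3) * invCoeff r s 0 + 2 * (s * (r - 1) ^ 3) *
    invCoeff r s 8 - 2 * (r * s * (r - 1) ^ 4 * (s - 1)) * invCoeff r s 3 - 2 * (r * s * (r - 1)
    ^ 2 * (s - 1) ^ 2) * invCoeff r s 7 + 2 * (r * (r - 1) ^ 2 * (s - 1) ^ 2) * invCoeff r s 9 -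
    6 * (r * s * (r - 1) ^ 3 * (s - 1) ^ 3) * invCoeff r s 3 - 2 * (s ^ 2 * (r - 1) ^ 6) *
    invCoeff r s 0 + 6 * (r * s * (r - 1) ^ 3 * (s - 1)) * invCoeff r s 6 + 6 * (r * s * (r - 1)
    ^ 2 * (s - 1)) * invCoeff r s 10 - 6 * (r * s * (r - 1) ^ 4 * (s - 1) ^ 3) * invCoeff r s 1 -
    1 * (r * (r - 1) ^ 2 * (s - 1) ^ 3) * invCoeff r s 8 + 1 * (r * s * (r - 1) ^ 2 * (s - 1) ^
    3) * invCoeff r s 5 + 1 * (r * s * (r - 1) ^ 3 * (s - 1) ^ 4) * invCoeff r s 0 - 1 * (r * s *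
    (r - 1) ^ 3 * (s - 1) ^ 2) * invCoeff r s 4 + 1 * (s * (r - 1) ^ 4 * (s - 1)) * invCoeff r s
    6 + 4 * (r ^ 2 * (r - 1) * (s - 1) ^ 6) * invCoeff r s 4 - 4 * (r ^ 2 * s * (r - 1) ^ 2 * (s
    - 1) ^ 5) * invCoeff r s 1 - 4 * (r * (r - 1) ^ 3 * (s - 1)) * invCoeff r s 7 - 3 * (r ^ 3 *
    (r - 1) * (s - 1) ^ 8) * invCoeff r s 0 + 4 * (r * s * (r - 1) ^ 4 * (s - 1) ^ 2) * invCoeff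
    r s 2 + 3 * (r ^ 3 * (s - 1) ^ 8) * invCoeff r s 2 - 3 * (r * (r - 1) * (s - 1) ^ 3) *
    invCoeff r s 10 - 3 * (r * s * (r - 1) ^ 3 * (s - 1) ^ 2) * invCoeff r s 5 + 3 * (r * s * (r
    - 1) ^ 2 * (s - 1)) * invCoeff r s 9 - 2 * (r ^ 2 * s ^ 2 * (r - 1) ^ 2 * (s - 1) ^ 5) *
    invCoeff r s 0 = 11 * (r ^ 2 * s ^ 2 * (r - 1) * (s - 1) ^ 6) * cuspDisc r s ^ 4 := by
  simp only [invCoeff, cuspDisc]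
  linear_combination (
    (30 * s ^ 2 - 1053 * s ^ 3 + 7253 * s ^ 4 - 27042 * s ^ 5 + 66190 * s ^ 6 - 116484 * s ^ 7 +
    152163 * s ^ 8 - 146789 * s ^ 9 + 102559 * s ^ 10 - 50185 * s ^ 11 + 16004 * s ^ 12 - 2741 *
    s ^ 13 + 53 * s ^ 14 + 42 * s ^ 15) + r * (64 * s - 2061 * s ^ 2 + 16062 * s ^ 3 - 54413 * s
    ^ 4 + 104035 * s ^ 5 - 146304 * s ^ 6 + 252964 * s ^ 7 - 540342 * s ^ 8 + 940831 * s ^ 9 -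
    1189860 * s ^ 10 + 1109428 * s ^ 11 - 781858 * s ^ 12 + 422428 * s ^ 13 - 174833 * s ^ 14 +
    54015 * s ^ 15 - 11335 * s ^ 16 + 1074 * s ^ 17 + 150 * s ^ 18 - 45 * s ^ 19) + r ^ 2 * (-544
    * s + 6912 * s ^ 2 - 25675 * s ^ 3 - 30841 * s ^ 4 + 535417 * s ^ 5 - 2040199 * s ^ 6 +
    4570624 * s ^ 7 - 7131831 * s ^ 8 + 8357887 * s ^ 9 - 7650232 * s ^ 10 + 5565218 * s ^ 11 -
    3221546 * s ^ 12 + 1462862 * s ^ 13 - 503914 * s ^ 14 + 123710 * s ^ 15 - 19474 * s ^ 16 +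
    1800 * s ^ 17 - 219 * s ^ 18 + 45 * s ^ 19) + r ^ 3 * (363 * s - 1835 * s ^ 2 - 13311 * s ^ 3
    + 173208 * s ^ 4 - 815076 * s ^ 5 + 2273045 * s ^ 6 - 4308168 * s ^ 7 + 5967423 * s ^ 8 -
    6333949 * s ^ 9 + 5307777 * s ^ 10 - 3571812 * s ^ 11 + 1944767 * s ^ 12 - 852435 * s ^ 13 +
    292594 * s ^ 14 - 73357 * s ^ 15 + 11462 * s ^ 16 - 639 * s ^ 17 - 57 * s ^ 18) + r ^ 4 *
    (-781 * s ^ 2 + 10622 * s ^ 3 - 61720 * s ^ 4 + 199143 * s ^ 5 - 404225 * s ^ 6 + 546677 * s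
    ^ 7 - 512284 * s ^ 8 + 347088 * s ^ 9 - 177195 * s ^ 10 + 69164 * s ^ 11 - 19652 * s ^ 12 +
    3299 * s ^ 13 - 75 * s ^ 14 - 61 * s ^ 15) + r ^ 5 * (-891 * s ^ 2 + 6776 * s ^ 3 - 22297 * s
    ^ 4 + 41272 * s ^ 5 - 45870 * s ^ 6 + 30074 * s ^ 7 - 9812 * s ^ 8 - 308 * s ^ 9 + 1353 * s ^
    10 - 286 * s ^ 11 - 11 * s ^ 12)) * h

set_option maxHeartbeats 4000000 in
lemma invCoeff_combination_three {R : Type*} [CommRing R] {r s : R}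
    (h : r ^ 2 = r * ((s - 1) ^ 3 + s + 1) - s) :
    - 5 * (r ^ 2 * s * (r - 1) ^ 3 * (s - 1) ^ 3) * invCoeff r s 0 - 7 * (s * (r - 1) ^ 3) *
    invCoeff r s 8 + 7 * (r * s * (r - 1) ^ 4 * (s - 1)) * invCoeff r s 3 + 7 * (r * s * (r - 1)
    ^ 2 * (s - 1) ^ 2) * invCoeff r s 7 - 7 * (r * (r - 1) ^ 2 * (s - 1) ^ 2) * invCoeff r s 9 -
    1 * (r * s * (r - 1) ^ 3 * (s - 1) ^ 3) * invCoeff r s 3 - 3 * (s ^ 2 * (r - 1) ^ 6) *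
    invCoeff r s 0 + 1 * (r * s * (r - 1) ^ 3 * (s - 1)) * invCoeff r s 6 + 1 * (r * s * (r - 1)
    ^ 2 * (s - 1)) * invCoeff r s 10 - 1 * (r * s * (r - 1) ^ 4 * (s - 1) ^ 3) * invCoeff r s 1 -
    2 * (r * (r - 1) ^ 2 * (s - 1) ^ 3) * invCoeff r s 8 + 2 * (r * s * (r - 1) ^ 2 * (s - 1) ^
    3) * invCoeff r s 5 - 1 * (r * s * (r - 1) ^ 3 * (s - 1) ^ 4) * invCoeff r s 0 - 2 * (r * s *
    (r - 1) ^ 3 * (s - 1) ^ 2) * invCoeff r s 4 + 2 * (s * (r - 1) ^ 4 * (s - 1)) * invCoeff r s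
    6 - 3 * (r ^ 2 * (r - 1) * (s - 1) ^ 6) * invCoeff r s 4 + 3 * (r ^ 2 * s * (r - 1) ^ 2 * (s
    - 1) ^ 5) * invCoeff r s 1 + 3 * (r * (r - 1) ^ 3 * (s - 1)) * invCoeff r s 7 - 3 * (r * s *
    (r - 1) ^ 4 * (s - 1) ^ 2) * invCoeff r s 2 - 5 * (r ^ 3 * (s - 1) ^ 8) * invCoeff r s 2 + 5
    * (r * (r - 1) * (s - 1) ^ 3) * invCoeff r s 10 + 5 * (r * s * (r - 1) ^ 3 * (s - 1) ^ 2) *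
    invCoeff r s 5 - 5 * (r * s * (r - 1) ^ 2 * (s - 1)) * invCoeff r s 9 + 3 * (r ^ 2 * s ^ 2 *
    (r - 1) ^ 2 * (s - 1) ^ 5) * invCoeff r s 0 = -11 * (r * s ^ 2 * (r - 1) ^ 3 * (s - 1) ^ 3) *
    cuspDisc r s ^ 4 := by
  simp only [invCoeff, cuspDisc]
  linear_combination (
    (16 * s ^ 2 + 996 * s ^ 3 - 13797 * s ^ 4 + 72361 * s ^ 5 - 209984 * s ^ 6 + 379204 * s ^ 7 -
    450175 * s ^ 8 + 361120 * s ^ 9 - 196580 * s ^ 10 + 69954 * s ^ 11 - 13180 * s ^ 12 - 950 * s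
    ^ 13 + 1250 * s ^ 14 - 235 * s ^ 15) + r * (-26 * s + 2797 * s ^ 2 - 22799 * s ^ 3 + 99129 *
    s ^ 4 - 311317 * s ^ 5 + 790738 * s ^ 6 - 1633902 * s ^ 7 + 2739550 * s ^ 8 - 3741307 * s ^ 9
    + 4125735 * s ^ 10 - 3600375 * s ^ 11 + 2432221 * s ^ 12 - 1247113 * s ^ 13 + 475125 * s ^ 14
    - 128965 * s ^ 15 + 21924 * s ^ 16 - 1075 * s ^ 17 - 415 * s ^ 18 + 75 * s ^ 19) + r ^ 2 *
    (221 * s - 5514 * s ^ 2 + 22493 * s ^ 3 + 10137 * s ^ 4 - 335472 * s ^ 5 + 1231865 * s ^ 6 -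
    2559474 * s ^ 7 + 3595047 * s ^ 8 - 3611797 * s ^ 9 + 2651305 * s ^ 10 - 1447261 * s ^ 11 +
    620822 * s ^ 12 - 241550 * s ^ 13 + 96440 * s ^ 14 - 36171 * s ^ 15 + 11366 * s ^ 16 - 3022 *
    s ^ 17 + 640 * s ^ 18 - 75 * s ^ 19) + r ^ 3 * (-62 * s ^ 2 + 17873 * s ^ 3 - 149475 * s ^ 4
    + 607996 * s ^ 5 - 1494054 * s ^ 6 + 2407567 * s ^ 7 - 2601434 * s ^ 8 + 1795804 * s ^ 9 -
    581720 * s ^ 10 - 232555 * s ^ 11 + 402622 * s ^ 12 - 234280 * s ^ 13 + 70927 * s ^ 14 - 8521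
    * s ^ 15 - 1045 * s ^ 16 + 372 * s ^ 17 - 15 * s ^ 18) + r ^ 4 * (-121 * s ^ 2 - 7367 * s ^ 3
    + 37864 * s ^ 4 - 94019 * s ^ 5 + 154204 * s ^ 6 - 179049 * s ^ 7 + 138220 * s ^ 8 - 58642 *
    s ^ 9 + 4188 * s ^ 10 + 8660 * s ^ 11 - 5336 * s ^ 12 + 1538 * s ^ 13 - 117 * s ^ 14 - 23 * s
    ^ 15) + r ^ 5 * (1485 * s ^ 2 - 4092 * s ^ 3 + 4323 * s ^ 4 - 8833 * s ^ 5 + 26213 * s ^ 6 -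
    41514 * s ^ 7 + 36762 * s ^ 8 - 19789 * s ^ 9 + 6402 * s ^ 10 - 968 * s ^ 11 + 11 * s ^ 12) +
    r ^ 6 * (-891 * s ^ 2 + 3861 * s ^ 3 - 6831 * s ^ 4 + 6369 * s ^ 5 - 3377 * s ^ 6 + 1023 * s
    ^ 7 - 165 * s ^ 8 + 11 * s ^ 9)) * h

set_option maxHeartbeats 4000000 in
lemma invCoeff_combination_four {R : Type*} [CommRing R] {r s : R}
    (h : r ^ 2 = r * ((s - 1) ^ 3 + s + 1) - s) :
    2 * (r ^ 3 * s * (r - 1) ^ 3 * (s - 1) ^ 5) * invCoeff r s 0 + 6 * (r * s * (r - 1) ^ 3 * (s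
    - 1) ^ 2) * invCoeff r s 8 - 6 * (r ^ 2 * s * (r - 1) ^ 4 * (s - 1) ^ 3) * invCoeff r s 3 - 6
    * (r ^ 2 * s * (r - 1) ^ 2 * (s - 1) ^ 4) * invCoeff r s 7 + 6 * (r ^ 2 * (r - 1) ^ 2 * (s -
    1) ^ 4) * invCoeff r s 9 + 4 * (r ^ 2 * s * (r - 1) ^ 3 * (s - 1) ^ 5) * invCoeff r s 3 + 3 *
    (r * s ^ 2 * (r - 1) ^ 6 * (s - 1) ^ 2) * invCoeff r s 0 - 4 * (r ^ 2 * s * (r - 1) ^ 3 * (s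
    - 1) ^ 3) * invCoeff r s 6 - 4 * (r ^ 2 * s * (r - 1) ^ 2 * (s - 1) ^ 3) * invCoeff r s 10 +
    4 * (r ^ 2 * s * (r - 1) ^ 4 * (s - 1) ^ 5) * invCoeff r s 1 - 3 * (r ^ 2 * (r - 1) ^ 2 * (s
    - 1) ^ 5) * invCoeff r s 8 + 3 * (r ^ 2 * s * (r - 1) ^ 2 * (s - 1) ^ 5) * invCoeff r s 5 - 2
    * (r ^ 2 * s * (r - 1) ^ 3 * (s - 1) ^ 6) * invCoeff r s 0 - 3 * (r ^ 2 * s * (r - 1) ^ 3 *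
    (s - 1) ^ 4) * invCoeff r s 4 + 3 * (r * s * (r - 1) ^ 4 * (s - 1) ^ 3) * invCoeff r s 6 + 1
    * (r ^ 3 * (r - 1) * (s - 1) ^ 8) * invCoeff r s 4 - 1 * (r ^ 3 * s * (r - 1) ^ 2 * (s - 1) ^
    7) * invCoeff r s 1 - 1 * (r ^ 2 * (r - 1) ^ 3 * (s - 1) ^ 3) * invCoeff r s 7 + 1 * (r ^ 4 *
    (r - 1) * (s - 1) ^ 10) * invCoeff r s 0 + 1 * (r ^ 2 * s * (r - 1) ^ 4 * (s - 1) ^ 4) *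
    invCoeff r s 2 - 2 * (r ^ 4 * (s - 1) ^ 10) * invCoeff r s 2 + 2 * (r ^ 2 * (r - 1) * (s - 1)
    ^ 5) * invCoeff r s 10 + 2 * (r ^ 2 * s * (r - 1) ^ 3 * (s - 1) ^ 4) * invCoeff r s 5 - 2 *
    (r ^ 2 * s * (r - 1) ^ 2 * (s - 1) ^ 3) * invCoeff r s 9 + 2 * (r ^ 3 * s ^ 2 * (r - 1) ^ 2 *
    (s - 1) ^ 7) * invCoeff r s 0 = -11 * (s ^ 3 * (r - 1) ^ 6) * cuspDisc r s ^ 4 := by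
  simp only [invCoeff, cuspDisc]
  linear_combination (
    (11 * s ^ 2 - 220 * s ^ 3 + 1694 * s ^ 4 - 6116 * s ^ 5 + 9581 * s ^ 6 - 2728 * s ^ 7 - 5060
    * s ^ 8 + 2552 * s ^ 9 + 1133 * s ^ 10 - 572 * s ^ 11 - 154 * s ^ 12 + 44 * s ^ 13 + 11 * s ^
    14) + r * (299 * s ^ 2 - 6045 * s ^ 3 + 48979 * s ^ 4 - 226242 * s ^ 5 + 710513 * s ^ 6 -
    1625394 * s ^ 7 + 2676669 * s ^ 8 - 3235438 * s ^ 9 + 2939919 * s ^ 10 - 2010354 * s ^ 11 +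
    1013243 * s ^ 12 - 362316 * s ^ 13 + 85297 * s ^ 14 - 10681 * s ^ 15 + 17 * s ^ 16 + 126 * s
    ^ 17) + r ^ 2 * (-6 * s + 33 * s ^ 2 - 4992 * s ^ 3 + 47420 * s ^ 4 - 246823 * s ^ 5 + 855653
    * s ^ 6 - 1973977 * s ^ 7 + 3599855 * s ^ 8 - 5453927 * s ^ 9 + 6738712 * s ^ 10 - 6738467 *
    s ^ 11 + 5449787 * s ^ 12 - 3550680 * s ^ 13 + 1855139 * s ^ 14 - 772591 * s ^ 15 + 252320 *
    s ^ 16 - 61908 * s ^ 17 + 10073 * s ^ 18 - 563 * s ^ 19 - 160 * s ^ 20 + 30 * s ^ 21) + r ^ 3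
    * (205 * s - 2620 * s ^ 2 + 33981 * s ^ 3 - 226397 * s ^ 4 + 875104 * s ^ 5 - 2378010 * s ^ 6
    + 4255509 * s ^ 7 - 5126697 * s ^ 8 + 3823756 * s ^ 9 - 540531 * s ^ 10 - 2866454 * s ^ 11 +
    4458962 * s ^ 12 - 3928331 * s ^ 13 + 2396479 * s ^ 14 - 1054123 * s ^ 15 + 332075 * s ^ 16 -
    71938 * s ^ 17 + 10080 * s ^ 18 - 1071 * s ^ 19 + 195 * s ^ 20 - 30 * s ^ 21) + r ^ 4 * (-121
    * s + 787 * s ^ 2 - 15151 * s ^ 3 + 128256 * s ^ 4 - 421870 * s ^ 5 + 1075952 * s ^ 6 -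
    1719697 * s ^ 7 + 1568514 * s ^ 8 - 314892 * s ^ 9 - 1540299 * s ^ 10 + 2940231 * s ^ 11 -
    3158566 * s ^ 12 + 2388597 * s ^ 13 - 1343321 * s ^ 14 + 566099 * s ^ 15 - 174853 * s ^ 16 +
    36820 * s ^ 17 - 4191 * s ^ 18 - 24 * s ^ 19 + 49 * s ^ 20) + r ^ 5 * (418 * s ^ 2 - 4478 * s
    ^ 3 - 23106 * s ^ 4 + 18107 * s ^ 5 - 8969 * s ^ 6 - 51911 * s ^ 7 + 239707 * s ^ 8 - 422590
    * s ^ 9 + 458002 * s ^ 10 - 345157 * s ^ 11 + 183410 * s ^ 12 - 67739 * s ^ 13 + 16593 * s ^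
    14 - 2112 * s ^ 15 - 79 * s ^ 16 + 48 * s ^ 17) + r ^ 6 * (6468 * s ^ 3 + 3630 * s ^ 4 + 4851
    * s ^ 5 - 29073 * s ^ 6 + 50215 * s ^ 7 - 72094 * s ^ 8 + 74206 * s ^ 9 - 50413 * s ^ 10 +
    22451 * s ^ 11 - 6050 * s ^ 12 + 737 * s ^ 13) + r ^ 7 * (-4158 * s ^ 3 + 3564 * s ^ 4 - 3465
    * s ^ 5 + 5599 * s ^ 6 - 4136 * s ^ 7 + 1386 * s ^ 8 - 209 * s ^ 9 + 11 * s ^ 10) + r ^ 8 *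
    (891 * s ^ 3 - 1188 * s ^ 4 + 594 * s ^ 5 - 132 * s ^ 6 + 11 * s ^ 7)) * h

/-- The parametrisation of theta quotients of level eleven by the curve
`r ^ 2 = r * ((s - 1) ^ 3 + s + 1) - s`. -/
structure ThetaCurve (t : ℤ → ℂ) (r s ρ σ τ : ℂ) : Prop where
  neg : ∀ n, t (-n) = -t n
  refl : ∀ n, t (11 - n) = t n
  ne₁ : t 1 ≠ 0
  ne₂ : t 2 ≠ 0
  ne₃ : t 3 ≠ 0
  ne₄ : t 4 ≠ 0
  ne₅ : t 5 ≠ 0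
  hr : r = t 3 ^ 3 * t 1 / (t 2 ^ 3 * t 4)
  hs : s = t 4 ^ 2 * t 1 / (t 2 ^ 2 * t 5)
  hρ : ρ = -(t 5 * t 1 ^ 3 / (t 2 ^ 3 * t 4))
  hσ : σ = -(t 1 ^ 2 / (t 2 * t 3))
  hτ : τ = t 2 / t 1
  sub_one_r : r - 1 = ρ
  sub_one_s : s - 1 = σ
  curve : r ^ 2 = r * ((s - 1) ^ 3 + s + 1) - s

/-- The theta quotients occurring in the dissection of the rank generating function. -/
noncomputable def pairTerm (t : ℤ → ℂ) (a b : ℤ) : ℂ :=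
  if a = b then t (3 * a) ^ 2 / (t a ^ 2 * t (4 * a))
  else t b * t (2 * b) / (t (a - b) * t a * t (a + b))

/-- The residue class modulo eleven picked out by `pairTerm t a b`. -/
def classIndex (a b : ℤ) : ℕ := ((a ^ 2 - b ^ 2) % 11).toNat

namespace ThetaCurve

variable {t : ℤ → ℂ} {r s ρ σ τ : ℂ}

lemma add_eleven (H : ThetaCurve t r s ρ σ τ) (n : ℤ) : t (n + 11) = -t n := by
  rw [← H.neg, ← H.refl (-n)]; congr 1; ring

lemma values (H : ThetaCurve t r s ρ σ τ) :
    t 6 = t 5 ∧ t 7 = t 4 ∧ t 8 = t 3 ∧ t 9 = t 2 ∧ t 10 = t 1 ∧ t 12 = -t 1 ∧ t 15 = -t 4 ∧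
      t 16 = -t 5 ∧ t 20 = -t 2 ∧ t (-1) = -t 1 ∧ t (-2) = -t 2 ∧ t (-3) = -t 3 ∧
      t (-4) = -t 4 := by
  have h6 := H.refl 5; have h7 := H.refl 4; have h8 := H.refl 3
  have h9 := H.refl 2; have h10 := H.refl 1
  have h12 := H.add_eleven 1; have h15 := H.add_eleven 4
  have h16 := H.add_eleven 5; have h20 := H.add_eleven 9
  norm_num at h6 h7 h8 h9 h10 h12 h15 h16 h20
  exact ⟨h6, h7, h8, h9, h10, h12, h15, h16, h20.trans (by rw [h9]), H.neg 1, H.neg 2, H.neg 3,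
    H.neg 4⟩

lemma pairTerm_1_1 (H : ThetaCurve t r s ρ σ τ) : pairTerm t 1 1 * τ ^ 0 =
    -(τ ^ 4 / t 1 * (r * σ)) := by
  obtain ⟨h6, h7, h8, h9, h10, h12, h15, h16, h20, g1, g2, g3, g4⟩ := H.values
  have := H.ne₁; have := H.ne₂; have := H.ne₃; have := H.ne₄; have := H.ne₅
  obtain ⟨-, -, -, -, -, -, -, rfl, rfl, rfl, rfl, rfl, -, -, -⟩ := H
  rw [pairTerm]
  norm_num [h6, h7, h8, h9, h10, h12, h15, h16, h20, g1, g2, g3, g4]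
  field_simp

lemma pairTerm_1_2 (H : ThetaCurve t r s ρ σ τ) : pairTerm t 1 2 * τ ^ 8 =
    -(τ ^ 4 / t 1 * (1 / (r * σ ^ 2))) := by
  obtain ⟨h6, h7, h8, h9, h10, h12, h15, h16, h20, g1, g2, g3, g4⟩ := H.values
  have := H.ne₁; have := H.ne₂; have := H.ne₃; have := H.ne₄; have := H.ne₅
  obtain ⟨-, -, -, -, -, -, -, rfl, rfl, rfl, rfl, rfl, -, -, -⟩ := H
  rw [pairTerm]
  norm_num [h6, h7, h8, h9, h10, h12, h15, h16, h20, g1, g2, g3, g4]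
  field_simp

lemma pairTerm_1_3 (H : ThetaCurve t r s ρ σ τ) : pairTerm t 1 3 * τ ^ 3 =
    -(τ ^ 4 / t 1 * (ρ / (σ))) := by
  obtain ⟨h6, h7, h8, h9, h10, h12, h15, h16, h20, g1, g2, g3, g4⟩ := H.values
  have := H.ne₁; have := H.ne₂; have := H.ne₃; have := H.ne₄; have := H.ne₅
  obtain ⟨-, -, -, -, -, -, -, rfl, rfl, rfl, rfl, rfl, -, -, -⟩ := H
  rw [pairTerm]
  norm_num [h6, h7, h8, h9, h10, h12, h15, h16, h20, g1, g2, g3, g4]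
  field_simp

lemma pairTerm_1_4 (H : ThetaCurve t r s ρ σ τ) : pairTerm t 1 4 * τ ^ 7 =
    (τ ^ 4 / t 1 * (1 / (ρ))) := by
  obtain ⟨h6, h7, h8, h9, h10, h12, h15, h16, h20, g1, g2, g3, g4⟩ := H.values
  have := H.ne₁; have := H.ne₂; have := H.ne₃; have := H.ne₄; have := H.ne₅
  obtain ⟨-, -, -, -, -, -, -, rfl, rfl, rfl, rfl, rfl, -, -, -⟩ := H
  rw [pairTerm]
  norm_num [h6, h7, h8, h9, h10, h12, h15, h16, h20, g1, g2, g3, g4]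
  field_simp

lemma pairTerm_1_5 (H : ThetaCurve t r s ρ σ τ) : pairTerm t 1 5 * τ ^ 9 =
    (τ ^ 4 / t 1 * (1 / (s * ρ))) := by
  obtain ⟨h6, h7, h8, h9, h10, h12, h15, h16, h20, g1, g2, g3, g4⟩ := H.values
  have := H.ne₁; have := H.ne₂; have := H.ne₃; have := H.ne₄; have := H.ne₅
  obtain ⟨-, -, -, -, -, -, -, rfl, rfl, rfl, rfl, rfl, -, -, -⟩ := H
  rw [pairTerm]
  norm_num [h6, h7, h8, h9, h10, h12, h15, h16, h20, g1, g2, g3, g4]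
  field_simp

lemma pairTerm_2_1 (H : ThetaCurve t r s ρ σ τ) : pairTerm t 2 1 * τ ^ 3 =
    -(τ ^ 4 / t 1 * (σ)) := by
  obtain ⟨h6, h7, h8, h9, h10, h12, h15, h16, h20, g1, g2, g3, g4⟩ := H.values
  have := H.ne₁; have := H.ne₂; have := H.ne₃; have := H.ne₄; have := H.ne₅
  obtain ⟨-, -, -, -, -, -, -, rfl, rfl, rfl, rfl, rfl, -, -, -⟩ := H
  rw [pairTerm]
  norm_num [h6, h7, h8, h9, h10, h12, h15, h16, h20, g1, g2, g3, g4]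
  field_simp

lemma pairTerm_2_2 (H : ThetaCurve t r s ρ σ τ) : pairTerm t 2 2 * τ ^ 0 =
    -(τ ^ 4 / t 1 * (s * ρ ^ 3 / (r * σ ^ 2))) := by
  obtain ⟨h6, h7, h8, h9, h10, h12, h15, h16, h20, g1, g2, g3, g4⟩ := H.values
  have := H.ne₁; have := H.ne₂; have := H.ne₃; have := H.ne₄; have := H.ne₅
  obtain ⟨-, -, -, -, -, -, -, rfl, rfl, rfl, rfl, rfl, -, -, -⟩ := H
  rw [pairTerm]
  norm_num [h6, h7, h8, h9, h10, h12, h15, h16, h20, g1, g2, g3, g4]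
  field_simp

lemma pairTerm_2_3 (H : ThetaCurve t r s ρ σ τ) : pairTerm t 2 3 * τ ^ 6 =
    (τ ^ 4 / t 1 * (1 / (σ))) := by
  obtain ⟨h6, h7, h8, h9, h10, h12, h15, h16, h20, g1, g2, g3, g4⟩ := H.values
  have := H.ne₁; have := H.ne₂; have := H.ne₃; have := H.ne₄; have := H.ne₅
  obtain ⟨-, -, -, -, -, -, -, rfl, rfl, rfl, rfl, rfl, -, -, -⟩ := H
  rw [pairTerm]
  norm_num [h6, h7, h8, h9, h10, h12, h15, h16, h20, g1, g2, g3, g4]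
  field_simp

lemma pairTerm_2_4 (H : ThetaCurve t r s ρ σ τ) : pairTerm t 2 4 * τ ^ 10 =
    -(τ ^ 4 / t 1 * (1 / (ρ * σ))) := by
  obtain ⟨h6, h7, h8, h9, h10, h12, h15, h16, h20, g1, g2, g3, g4⟩ := H.values
  have := H.ne₁; have := H.ne₂; have := H.ne₃; have := H.ne₄; have := H.ne₅
  obtain ⟨-, -, -, -, -, -, -, rfl, rfl, rfl, rfl, rfl, -, -, -⟩ := H
  rw [pairTerm]
  norm_num [h6, h7, h8, h9, h10, h12, h15, h16, h20, g1, g2, g3, g4]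
  field_simp

lemma pairTerm_2_5 (H : ThetaCurve t r s ρ σ τ) : pairTerm t 2 5 * τ ^ 1 =
    -(τ ^ 4 / t 1 * (ρ * σ)) := by
  obtain ⟨h6, h7, h8, h9, h10, h12, h15, h16, h20, g1, g2, g3, g4⟩ := H.values
  have := H.ne₁; have := H.ne₂; have := H.ne₃; have := H.ne₄; have := H.ne₅
  obtain ⟨-, -, -, -, -, -, -, rfl, rfl, rfl, rfl, rfl, -, -, -⟩ := H
  rw [pairTerm]
  norm_num [h6, h7, h8, h9, h10, h12, h15, h16, h20, g1, g2, g3, g4]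
  field_simp

lemma pairTerm_3_1 (H : ThetaCurve t r s ρ σ τ) : pairTerm t 3 1 * τ ^ 8 =
    (τ ^ 4 / t 1 * (σ / (s * ρ))) := by
  obtain ⟨h6, h7, h8, h9, h10, h12, h15, h16, h20, g1, g2, g3, g4⟩ := H.values
  have := H.ne₁; have := H.ne₂; have := H.ne₃; have := H.ne₄; have := H.ne₅
  obtain ⟨-, -, -, -, -, -, -, rfl, rfl, rfl, rfl, rfl, -, -, -⟩ := H
  rw [pairTerm]
  norm_num [h6, h7, h8, h9, h10, h12, h15, h16, h20, g1, g2, g3, g4]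
  field_simp

lemma pairTerm_3_2 (H : ThetaCurve t r s ρ σ τ) : pairTerm t 3 2 * τ ^ 5 =
    (τ ^ 4 / t 1 * (σ / (ρ))) := by
  obtain ⟨h6, h7, h8, h9, h10, h12, h15, h16, h20, g1, g2, g3, g4⟩ := H.values
  have := H.ne₁; have := H.ne₂; have := H.ne₃; have := H.ne₄; have := H.ne₅
  obtain ⟨-, -, -, -, -, -, -, rfl, rfl, rfl, rfl, rfl, -, -, -⟩ := H
  rw [pairTerm]
  norm_num [h6, h7, h8, h9, h10, h12, h15, h16, h20, g1, g2, g3, g4]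
  field_simp

lemma pairTerm_3_3 (H : ThetaCurve t r s ρ σ τ) : pairTerm t 3 3 * τ ^ 0 =
    -(τ ^ 4 / t 1 * (σ ^ 2)) := by
  obtain ⟨h6, h7, h8, h9, h10, h12, h15, h16, h20, g1, g2, g3, g4⟩ := H.values
  have := H.ne₁; have := H.ne₂; have := H.ne₃; have := H.ne₄; have := H.ne₅
  obtain ⟨-, -, -, -, -, -, -, rfl, rfl, rfl, rfl, rfl, -, -, -⟩ := H
  rw [pairTerm]
  norm_num [h6, h7, h8, h9, h10, h12, h15, h16, h20, g1, g2, g3, g4]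
  field_simp

lemma pairTerm_3_4 (H : ThetaCurve t r s ρ σ τ) : pairTerm t 3 4 * τ ^ 4 =
    -(τ ^ 4 / t 1 * (1)) := by
  obtain ⟨h6, h7, h8, h9, h10, h12, h15, h16, h20, g1, g2, g3, g4⟩ := H.values
  have := H.ne₁; have := H.ne₂; have := H.ne₃; have := H.ne₄; have := H.ne₅
  obtain ⟨-, -, -, -, -, -, -, rfl, rfl, rfl, rfl, rfl, -, -, -⟩ := H
  rw [pairTerm]
  norm_num [h6, h7, h8, h9, h10, h12, h15, h16, h20, g1, g2, g3, g4]
  field_simp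

lemma pairTerm_3_5 (H : ThetaCurve t r s ρ σ τ) : pairTerm t 3 5 * τ ^ 6 =
    -(τ ^ 4 / t 1 * (ρ / (r * σ))) := by
  obtain ⟨h6, h7, h8, h9, h10, h12, h15, h16, h20, g1, g2, g3, g4⟩ := H.values
  have := H.ne₁; have := H.ne₂; have := H.ne₃; have := H.ne₄; have := H.ne₅
  obtain ⟨-, -, -, -, -, -, -, rfl, rfl, rfl, rfl, rfl, -, -, -⟩ := H
  rw [pairTerm]
  norm_num [h6, h7, h8, h9, h10, h12, h15, h16, h20, g1, g2, g3, g4]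
  field_simp

lemma pairTerm_4_1 (H : ThetaCurve t r s ρ σ τ) : pairTerm t 4 1 * τ ^ 4 =
    (τ ^ 4 / t 1 * (r * σ ^ 4 / (s * ρ ^ 2))) := by
  obtain ⟨h6, h7, h8, h9, h10, h12, h15, h16, h20, g1, g2, g3, g4⟩ := H.values
  have := H.ne₁; have := H.ne₂; have := H.ne₃; have := H.ne₄; have := H.ne₅
  obtain ⟨-, -, -, -, -, -, -, rfl, rfl, rfl, rfl, rfl, -, -, -⟩ := H
  rw [pairTerm]
  norm_num [h6, h7, h8, h9, h10, h12, h15, h16, h20, g1, g2, g3, g4]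
  field_simp

lemma pairTerm_4_2 (H : ThetaCurve t r s ρ σ τ) : pairTerm t 4 2 * τ ^ 1 =
    (τ ^ 4 / t 1 * (r * σ ^ 3 / (ρ))) := by
  obtain ⟨h6, h7, h8, h9, h10, h12, h15, h16, h20, g1, g2, g3, g4⟩ := H.values
  have := H.ne₁; have := H.ne₂; have := H.ne₃; have := H.ne₄; have := H.ne₅
  obtain ⟨-, -, -, -, -, -, -, rfl, rfl, rfl, rfl, rfl, -, -, -⟩ := H
  rw [pairTerm]
  norm_num [h6, h7, h8, h9, h10, h12, h15, h16, h20, g1, g2, g3, g4]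
  field_simp

lemma pairTerm_4_3 (H : ThetaCurve t r s ρ σ τ) : pairTerm t 4 3 * τ ^ 7 =
    -(τ ^ 4 / t 1 * (1 / (s * σ))) := by
  obtain ⟨h6, h7, h8, h9, h10, h12, h15, h16, h20, g1, g2, g3, g4⟩ := H.values
  have := H.ne₁; have := H.ne₂; have := H.ne₃; have := H.ne₄; have := H.ne₅
  obtain ⟨-, -, -, -, -, -, -, rfl, rfl, rfl, rfl, rfl, -, -, -⟩ := H
  rw [pairTerm]
  norm_num [h6, h7, h8, h9, h10, h12, h15, h16, h20, g1, g2, g3, g4]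
  field_simp

lemma pairTerm_4_4 (H : ThetaCurve t r s ρ σ τ) : pairTerm t 4 4 * τ ^ 0 =
    -(τ ^ 4 / t 1 * (r ^ 2 * σ ^ 6 / (s * ρ ^ 2))) := by
  obtain ⟨h6, h7, h8, h9, h10, h12, h15, h16, h20, g1, g2, g3, g4⟩ := H.values
  have := H.ne₁; have := H.ne₂; have := H.ne₃; have := H.ne₄; have := H.ne₅
  obtain ⟨-, -, -, -, -, -, -, rfl, rfl, rfl, rfl, rfl, -, -, -⟩ := H
  rw [pairTerm]
  norm_num [h6, h7, h8, h9, h10, h12, h15, h16, h20, g1, g2, g3, g4]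
  field_simp

lemma pairTerm_4_5 (H : ThetaCurve t r s ρ σ τ) : pairTerm t 4 5 * τ ^ 2 =
    (τ ^ 4 / t 1 * (ρ)) := by
  obtain ⟨h6, h7, h8, h9, h10, h12, h15, h16, h20, g1, g2, g3, g4⟩ := H.values
  have := H.ne₁; have := H.ne₂; have := H.ne₃; have := H.ne₄; have := H.ne₅
  obtain ⟨-, -, -, -, -, -, -, rfl, rfl, rfl, rfl, rfl, -, -, -⟩ := H
  rw [pairTerm]
  norm_num [h6, h7, h8, h9, h10, h12, h15, h16, h20, g1, g2, g3, g4]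
  field_simp

lemma pairTerm_5_1 (H : ThetaCurve t r s ρ σ τ) : pairTerm t 5 1 * τ ^ 2 =
    -(τ ^ 4 / t 1 * (r ^ 2 * σ ^ 6 / (s * ρ ^ 3))) := by
  obtain ⟨h6, h7, h8, h9, h10, h12, h15, h16, h20, g1, g2, g3, g4⟩ := H.values
  have := H.ne₁; have := H.ne₂; have := H.ne₃; have := H.ne₄; have := H.ne₅
  obtain ⟨-, -, -, -, -, -, -, rfl, rfl, rfl, rfl, rfl, -, -, -⟩ := H
  rw [pairTerm]
  norm_num [h6, h7, h8, h9, h10, h12, h15, h16, h20, g1, g2, g3, g4]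
  field_simp

lemma pairTerm_5_2 (H : ThetaCurve t r s ρ σ τ) : pairTerm t 5 2 * τ ^ 10 =
    -(τ ^ 4 / t 1 * (σ / (s * ρ ^ 2))) := by
  obtain ⟨h6, h7, h8, h9, h10, h12, h15, h16, h20, g1, g2, g3, g4⟩ := H.values
  have := H.ne₁; have := H.ne₂; have := H.ne₃; have := H.ne₄; have := H.ne₅
  obtain ⟨-, -, -, -, -, -, -, rfl, rfl, rfl, rfl, rfl, -, -, -⟩ := H
  rw [pairTerm]
  norm_num [h6, h7, h8, h9, h10, h12, h15, h16, h20, g1, g2, g3, g4]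
  field_simp

lemma pairTerm_5_3 (H : ThetaCurve t r s ρ σ τ) : pairTerm t 5 3 * τ ^ 5 =
    (τ ^ 4 / t 1 * (1)) := by
  obtain ⟨h6, h7, h8, h9, h10, h12, h15, h16, h20, g1, g2, g3, g4⟩ := H.values
  have := H.ne₁; have := H.ne₂; have := H.ne₃; have := H.ne₄; have := H.ne₅
  obtain ⟨-, -, -, -, -, -, -, rfl, rfl, rfl, rfl, rfl, -, -, -⟩ := H
  rw [pairTerm]
  norm_num [h6, h7, h8, h9, h10, h12, h15, h16, h20, g1, g2, g3, g4]
  field_simp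

lemma pairTerm_5_4 (H : ThetaCurve t r s ρ σ τ) : pairTerm t 5 4 * τ ^ 9 =
    (τ ^ 4 / t 1 * (1 / (ρ * σ))) := by
  obtain ⟨h6, h7, h8, h9, h10, h12, h15, h16, h20, g1, g2, g3, g4⟩ := H.values
  have := H.ne₁; have := H.ne₂; have := H.ne₃; have := H.ne₄; have := H.ne₅
  obtain ⟨-, -, -, -, -, -, -, rfl, rfl, rfl, rfl, rfl, -, -, -⟩ := H
  rw [pairTerm]
  norm_num [h6, h7, h8, h9, h10, h12, h15, h16, h20, g1, g2, g3, g4]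
  field_simp

lemma pairTerm_5_5 (H : ThetaCurve t r s ρ σ τ) : pairTerm t 5 5 * τ ^ 0 =
    -(τ ^ 4 / t 1 * (r * s * σ ^ 3 / (ρ))) := by
  obtain ⟨h6, h7, h8, h9, h10, h12, h15, h16, h20, g1, g2, g3, g4⟩ := H.values
  have := H.ne₁; have := H.ne₂; have := H.ne₃; have := H.ne₄; have := H.ne₅
  obtain ⟨-, -, -, -, -, -, -, rfl, rfl, rfl, rfl, rfl, -, -, -⟩ := H
  rw [pairTerm]
  norm_num [h6, h7, h8, h9, h10, h12, h15, h16, h20, g1, g2, g3, g4]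
  field_simp

end ThetaCurve

namespace ThetaCurve

variable {t : ℤ → ℂ} {r s ρ σ τ : ℂ}

lemma ne (H : ThetaCurve t r s ρ σ τ) : r ≠ 0 ∧ s ≠ 0 ∧ ρ ≠ 0 ∧ σ ≠ 0 ∧ τ ≠ 0 := by
  have := H.ne₁; have := H.ne₂; have := H.ne₃; have := H.ne₄; have := H.ne₅
  obtain ⟨-, -, -, -, -, -, -, rfl, rfl, rfl, rfl, rfl, -, -, -⟩ := H
  refine ⟨?_, ?_, ?_, ?_, ?_⟩ <;> field_simp <;> simp [*]

lemma tau_pow_eleven (H : ThetaCurve t r s ρ σ τ) : τ ^ 11 * (r * s * ρ * σ ^ 3) = 1 := by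
  have := H.ne₁; have := H.ne₂; have := H.ne₃; have := H.ne₄; have := H.ne₅
  obtain ⟨-, -, -, -, -, -, -, rfl, rfl, rfl, rfl, rfl, -, -, -⟩ := H
  field_simp

/-- The eleven-dissection of Euler's product, up to normalisation. -/
lemma dissection_mul_sum_invCoeff (H : ThetaCurve t r s ρ σ τ) :
    (1 - τ + (s - r) * τ ^ 3 - s * ρ * τ ^ 4 + r * σ ^ 2 * τ ^ 5 + s * ρ ^ 2 * σ * τ ^ 9) *
      ∑ j ∈ Finset.range 11, invCoeff r s j * τ ^ j = normCoeff r s := by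
  have hτ := H.tau_pow_eleven
  obtain ⟨hr, hs, hρ, hσ, -⟩ := H.ne
  have h0 := invCoeff_relation_0 H.curve
  have h1 := invCoeff_relation_1 H.curve
  have h2 := invCoeff_relation_2 H.curve
  have h3 := invCoeff_relation_3 H.curve
  have h4 := invCoeff_relation_4 H.curve
  have h5 := invCoeff_relation_5 H.curve
  have h6 := invCoeff_relation_6 H.curve
  have h7 := invCoeff_relation_7 H.curve
  have h8 := invCoeff_relation_8 H.curve
  have h9 := invCoeff_relation_9 H.curve
  have h10 := invCoeff_relation_10 H.curve
  simp only [H.sub_one_r, H.sub_one_s] at h0 h1 h2 h3 h4 h5 h6 h7 h8 h9 h10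
  simp only [Finset.sum_range_succ, Finset.sum_range_zero]
  generalize invCoeff r s 0 = n0 at *
  generalize invCoeff r s 1 = n1 at *
  generalize invCoeff r s 2 = n2 at *
  generalize invCoeff r s 3 = n3 at *
  generalize invCoeff r s 4 = n4 at *
  generalize invCoeff r s 5 = n5 at *
  generalize invCoeff r s 6 = n6 at *
  generalize invCoeff r s 7 = n7 at *
  generalize invCoeff r s 8 = n8 at *
  generalize invCoeff r s 9 = n9 at *
  generalize invCoeff r s 10 = n10 at *
  generalize normCoeff r s = N at *
  have hne : r * s * ρ * σ ^ 3 ≠ 0 := by positivity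
  apply mul_left_cancel₀ hne
  linear_combination
    τ ^ 0 * h0 + τ ^ 1 * h1 + τ ^ 2 * h2 + τ ^ 3 * h3 + τ ^ 4 * h4 + τ ^ 5 * h5 + τ ^ 6 * h6 + τ
    ^ 7 * h7 + τ ^ 8 * h8 + τ ^ 9 * h9 + τ ^ 10 * h10 + ((s * ρ ^ 2 * σ) * n2 * τ ^ 0 + (r * σ ^
    2) * n6 * τ ^ 0 + (- (s * ρ)) * n7 * τ ^ 0 + ((s - r)) * n8 * τ ^ 0 + (- 1) * n10 * τ ^ 0 +
    (s * ρ ^ 2 * σ) * n3 * τ ^ 1 + (r * σ ^ 2) * n7 * τ ^ 1 + (- (s * ρ)) * n8 * τ ^ 1 + ((s -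
    r)) * n9 * τ ^ 1 + (s * ρ ^ 2 * σ) * n4 * τ ^ 2 + (r * σ ^ 2) * n8 * τ ^ 2 + (- (s * ρ)) * n9
    * τ ^ 2 + ((s - r)) * n10 * τ ^ 2 + (s * ρ ^ 2 * σ) * n5 * τ ^ 3 + (r * σ ^ 2) * n9 * τ ^ 3 +
    (- (s * ρ)) * n10 * τ ^ 3 + (s * ρ ^ 2 * σ) * n6 * τ ^ 4 + (r * σ ^ 2) * n10 * τ ^ 4 + (s * ρ
    ^ 2 * σ) * n7 * τ ^ 5 + (s * ρ ^ 2 * σ) * n8 * τ ^ 6 + (s * ρ ^ 2 * σ) * n9 * τ ^ 7 + (s * ρ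
    ^ 2 * σ) * n10 * τ ^ 8) * hτ

end ThetaCurve

/-- The coefficients of the theta quotients in the dissection. -/
noncomputable def thetaCoeff (κ μ : ℤ → ℂ) (a b : ℤ) : ℂ :=
  if a = b then -μ a else κ a * (-1) ^ (a + b)

namespace ThetaCurve

set_option maxHeartbeats 4000000 in
lemma theta_combination_one {Q : ℂ} {κ μ : ℤ → ℂ} (H : ThetaCurve t r s ρ σ τ)
    (hΔ : cuspDisc r s * (r * σ ^ 4) = ρ ^ 6 * s ^ 4 * τ ^ 18 * t 1 ^ 12 * Q)
    (hκ : κ 1 = 3 ∧ κ 2 = 2 ∧ κ 3 = 4 ∧ κ 4 = 5 ∧ κ 5 = 1)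
    (hμ : μ 1 = 4 / 3 ∧ μ 2 = 5 / 3 ∧ μ 3 = 1 / 3 ∧ μ 4 = 10 / 3 ∧ μ 5 = 1 / 3) :
    (∑ a ∈ Finset.Icc (1 : ℤ) 5, ∑ b ∈ Finset.Icc (1 : ℤ) 5, thetaCoeff κ μ a b *
      pairTerm t a b * (invCoeff r s (classIndex a b) * τ ^ classIndex a b)) *
      (Q * (t 1 ^ 2 * t 2 ^ 3 * t 3 ^ 4 * t 4 ^ 2 * t 5 ^ 2)) = 11 * normCoeff r s := by
  have hc := invCoeff_combination_one H.curve
  have hn := normCoeff_eq H.curve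
  simp only [H.sub_one_r, H.sub_one_s] at hc hn
  obtain ⟨hr, hs, hρ, hσ, hτ⟩ := H.ne
  have hm : τ ^ 4 / t 1 * (s ^ 3 * ρ ^ 4 * σ) * (t 1 ^ 2 * t 2 ^ 3 * t 3 ^ 4 * t 4 ^ 2 * t 5 ^ 2) *
      (r ^ 2 * σ ^ 8) = s ^ 5 * (r * s * ρ ^ 3 * σ ^ 2) * ρ ^ 6 * τ ^ 18 * t 1 ^ 12 := by
    have := H.ne₁; have := H.ne₂; have := H.ne₃; have := H.ne₄; have := H.ne₅
    rw [H.hr, H.hs, H.hρ, H.hσ, H.hτ]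
    field_simp
  have f11 : pairTerm t 1 1 * τ ^ 0 * (r * s * ρ ^ 3 * σ ^ 2) =
      -(τ ^ 4 / t 1 * (r ^ 2 * s * ρ ^ 3 * σ ^ 3)) := by
    rw [H.pairTerm_1_1]; field_simp
  have f12 : pairTerm t 1 2 * τ ^ 8 * (r * s * ρ ^ 3 * σ ^ 2) =
      -(τ ^ 4 / t 1 * (s * ρ ^ 3)) := by
    rw [H.pairTerm_1_2]; field_simp
  have f13 : pairTerm t 1 3 * τ ^ 3 * (r * s * ρ ^ 3 * σ ^ 2) =
      -(τ ^ 4 / t 1 * (r * s * ρ ^ 4 * σ)) := by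
    rw [H.pairTerm_1_3]; field_simp
  have f14 : pairTerm t 1 4 * τ ^ 7 * (r * s * ρ ^ 3 * σ ^ 2) =
      (τ ^ 4 / t 1 * (r * s * ρ ^ 2 * σ ^ 2)) := by
    rw [H.pairTerm_1_4]; field_simp
  have f15 : pairTerm t 1 5 * τ ^ 9 * (r * s * ρ ^ 3 * σ ^ 2) =
      (τ ^ 4 / t 1 * (r * ρ ^ 2 * σ ^ 2)) := by
    rw [H.pairTerm_1_5]; field_simp
  have f21 : pairTerm t 2 1 * τ ^ 3 * (r * s * ρ ^ 3 * σ ^ 2) =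
      -(τ ^ 4 / t 1 * (r * s * ρ ^ 3 * σ ^ 3)) := by
    rw [H.pairTerm_2_1]; field_simp
  have f22 : pairTerm t 2 2 * τ ^ 0 * (r * s * ρ ^ 3 * σ ^ 2) =
      -(τ ^ 4 / t 1 * (s ^ 2 * ρ ^ 6)) := by
    rw [H.pairTerm_2_2]; field_simp
  have f23 : pairTerm t 2 3 * τ ^ 6 * (r * s * ρ ^ 3 * σ ^ 2) =
      (τ ^ 4 / t 1 * (r * s * ρ ^ 3 * σ)) := by
    rw [H.pairTerm_2_3]; field_simp
  have f24 : pairTerm t 2 4 * τ ^ 10 * (r * s * ρ ^ 3 * σ ^ 2) =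
      -(τ ^ 4 / t 1 * (r * s * ρ ^ 2 * σ)) := by
    rw [H.pairTerm_2_4]; field_simp
  have f25 : pairTerm t 2 5 * τ ^ 1 * (r * s * ρ ^ 3 * σ ^ 2) =
      -(τ ^ 4 / t 1 * (r * s * ρ ^ 4 * σ ^ 3)) := by
    rw [H.pairTerm_2_5]; field_simp
  have f31 : pairTerm t 3 1 * τ ^ 8 * (r * s * ρ ^ 3 * σ ^ 2) =
      (τ ^ 4 / t 1 * (r * ρ ^ 2 * σ ^ 3)) := by
    rw [H.pairTerm_3_1]; field_simp
  have f32 : pairTerm t 3 2 * τ ^ 5 * (r * s * ρ ^ 3 * σ ^ 2) =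
      (τ ^ 4 / t 1 * (r * s * ρ ^ 2 * σ ^ 3)) := by
    rw [H.pairTerm_3_2]; field_simp
  have f33 : pairTerm t 3 3 * τ ^ 0 * (r * s * ρ ^ 3 * σ ^ 2) =
      -(τ ^ 4 / t 1 * (r * s * ρ ^ 3 * σ ^ 4)) := by
    rw [H.pairTerm_3_3]; field_simp
  have f34 : pairTerm t 3 4 * τ ^ 4 * (r * s * ρ ^ 3 * σ ^ 2) =
      -(τ ^ 4 / t 1 * (r * s * ρ ^ 3 * σ ^ 2)) := by
    rw [H.pairTerm_3_4]; field_simp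
  have f35 : pairTerm t 3 5 * τ ^ 6 * (r * s * ρ ^ 3 * σ ^ 2) =
      -(τ ^ 4 / t 1 * (s * ρ ^ 4 * σ)) := by
    rw [H.pairTerm_3_5]; field_simp
  have f41 : pairTerm t 4 1 * τ ^ 4 * (r * s * ρ ^ 3 * σ ^ 2) =
      (τ ^ 4 / t 1 * (r ^ 2 * ρ * σ ^ 6)) := by
    rw [H.pairTerm_4_1]; field_simp
  have f42 : pairTerm t 4 2 * τ ^ 1 * (r * s * ρ ^ 3 * σ ^ 2) =
      (τ ^ 4 / t 1 * (r ^ 2 * s * ρ ^ 2 * σ ^ 5)) := by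
    rw [H.pairTerm_4_2]; field_simp
  have f43 : pairTerm t 4 3 * τ ^ 7 * (r * s * ρ ^ 3 * σ ^ 2) =
      -(τ ^ 4 / t 1 * (r * ρ ^ 3 * σ)) := by
    rw [H.pairTerm_4_3]; field_simp
  have f44 : pairTerm t 4 4 * τ ^ 0 * (r * s * ρ ^ 3 * σ ^ 2) =
      -(τ ^ 4 / t 1 * (r ^ 3 * ρ * σ ^ 8)) := by
    rw [H.pairTerm_4_4]; field_simp
  have f45 : pairTerm t 4 5 * τ ^ 2 * (r * s * ρ ^ 3 * σ ^ 2) =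
      (τ ^ 4 / t 1 * (r * s * ρ ^ 4 * σ ^ 2)) := by
    rw [H.pairTerm_4_5]; field_simp
  have f51 : pairTerm t 5 1 * τ ^ 2 * (r * s * ρ ^ 3 * σ ^ 2) =
      -(τ ^ 4 / t 1 * (r ^ 3 * σ ^ 8)) := by
    rw [H.pairTerm_5_1]; field_simp
  have f52 : pairTerm t 5 2 * τ ^ 10 * (r * s * ρ ^ 3 * σ ^ 2) =
      -(τ ^ 4 / t 1 * (r * ρ * σ ^ 3)) := by
    rw [H.pairTerm_5_2]; field_simp
  have f53 : pairTerm t 5 3 * τ ^ 5 * (r * s * ρ ^ 3 * σ ^ 2) =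
      (τ ^ 4 / t 1 * (r * s * ρ ^ 3 * σ ^ 2)) := by
    rw [H.pairTerm_5_3]; field_simp
  have f54 : pairTerm t 5 4 * τ ^ 9 * (r * s * ρ ^ 3 * σ ^ 2) =
      (τ ^ 4 / t 1 * (r * s * ρ ^ 2 * σ)) := by
    rw [H.pairTerm_5_4]; field_simp
  have f55 : pairTerm t 5 5 * τ ^ 0 * (r * s * ρ ^ 3 * σ ^ 2) =
      -(τ ^ 4 / t 1 * (r ^ 2 * s ^ 2 * ρ ^ 2 * σ ^ 5)) := by
    rw [H.pairTerm_5_5]; field_simp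
  obtain ⟨k1, k2, k3, k4, k5⟩ := hκ
  obtain ⟨m1, m2, m3, m4, m5⟩ := hμ
  have hI : Finset.Icc (1 : ℤ) 5 = {1, 2, 3, 4, 5} := by decide
  rw [hI]
  have hA : (∑ a ∈ ({1, 2, 3, 4, 5} : Finset ℤ), ∑ b ∈ ({1, 2, 3, 4, 5} : Finset ℤ),
      thetaCoeff κ μ a b * pairTerm t a b *
      (invCoeff r s (classIndex a b) * τ ^ classIndex a b)) * (r * s * ρ ^ 3 * σ ^ 2) =
      11 * (τ ^ 4 / t 1 * (s ^ 3 * ρ ^ 4 * σ)) * cuspDisc r s ^ 4 := by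
    norm_num [thetaCoeff, classIndex, k1, k2, k3, k4, k5, m1, m2, m3, m4, m5, zpow_ofNat]
    simp only [Int.reduceToNat]
    linear_combination (τ ^ 4 / t 1 * hc +
    (-4) * invCoeff r s 0 * f11 + (-9) * invCoeff r s 8 * f12 + (9) * invCoeff r s 3 * f13 + (-9)
    * invCoeff r s 7 * f14 + (9) * invCoeff r s 9 * f15 + (-6) * invCoeff r s 3 * f21 + (-5) *
    invCoeff r s 0 * f22 + (-6) * invCoeff r s 6 * f23 + (6) * invCoeff r s 10 * f24 + (-6) *
    invCoeff r s 1 * f25 + (12) * invCoeff r s 8 * f31 + (-12) * invCoeff r s 5 * f32 + (-1) *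
    invCoeff r s 0 * f33 + (-12) * invCoeff r s 4 * f34 + (12) * invCoeff r s 6 * f35 + (-15) *
    invCoeff r s 4 * f41 + (15) * invCoeff r s 1 * f42 + (-15) * invCoeff r s 7 * f43 + (-10) *
    invCoeff r s 0 * f44 + (-15) * invCoeff r s 2 * f45 + (3) * invCoeff r s 2 * f51 + (-3) *
    invCoeff r s 10 * f52 + (3) * invCoeff r s 5 * f53 + (-3) * invCoeff r s 9 * f54 + (-1) *
    invCoeff r s 0 * f55) / 3
  generalize (∑ a ∈ ({1, 2, 3, 4, 5} : Finset ℤ), ∑ b ∈ ({1, 2, 3, 4, 5} : Finset ℤ),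
      thetaCoeff κ μ a b * pairTerm t a b *
      (invCoeff r s (classIndex a b) * τ ^ classIndex a b)) = A at hA ⊢
  have hne : (r * s * ρ ^ 3 * σ ^ 2) * (r ^ 2 * σ ^ 8) ≠ 0 := by simp [hr, hs, hρ, hσ]
  apply mul_left_cancel₀ hne
  linear_combination (r ^ 2 * σ ^ 8) * Q * (t 1 ^ 2 * t 2 ^ 3 * t 3 ^ 4 * t 4 ^ 2 * t 5 ^ 2) * hA +
    11 * cuspDisc r s ^ 4 * Q * hm - 11 * (r * s * ρ ^ 3 * σ ^ 2) * r * σ ^ 4 * hn -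
    11 * (r * s * ρ ^ 3 * σ ^ 2) * s * cuspDisc r s ^ 4 * hΔ

set_option maxHeartbeats 4000000 in
lemma theta_combination_two {Q : ℂ} {κ μ : ℤ → ℂ} (H : ThetaCurve t r s ρ σ τ)
    (hΔ : cuspDisc r s * (r * σ ^ 4) = ρ ^ 6 * s ^ 4 * τ ^ 18 * t 1 ^ 12 * Q)
    (hκ : κ 1 = 2 ∧ κ 2 = -6 ∧ κ 3 = -1 ∧ κ 4 = -4 ∧ κ 5 = -3)
    (hμ : μ 1 = 2 ∧ μ 2 = -2 ∧ μ 3 = 1 ∧ μ 4 = -3 ∧ μ 5 = -2) :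
    (∑ a ∈ Finset.Icc (1 : ℤ) 5, ∑ b ∈ Finset.Icc (1 : ℤ) 5, thetaCoeff κ μ a b *
      pairTerm t a b * (invCoeff r s (classIndex a b) * τ ^ classIndex a b)) *
      (Q * (t 1 ^ 0 * t 2 ^ 3 * t 3 ^ 3 * t 4 ^ 3 * t 5 ^ 4)) = 11 * normCoeff r s := by
  have hc := invCoeff_combination_two H.curve
  have hn := normCoeff_eq H.curve
  simp only [H.sub_one_r, H.sub_one_s] at hc hn
  obtain ⟨hr, hs, hρ, hσ, hτ⟩ := H.ne
  have hm : τ ^ 4 / t 1 * (r ^ 2 * s ^ 2 * ρ * σ ^ 6) * (t 1 ^ 0 * t 2 ^ 3 * t 3 ^ 3 * t 4 ^ 3 *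
    t 5 ^ 4) *
      (r ^ 2 * σ ^ 8) = s ^ 5 * (r * s * ρ ^ 3 * σ ^ 2) * ρ ^ 6 * τ ^ 18 * t 1 ^ 12 := by
    have := H.ne₁; have := H.ne₂; have := H.ne₃; have := H.ne₄; have := H.ne₅
    rw [H.hr, H.hs, H.hρ, H.hσ, H.hτ]
    field_simp
  have f11 : pairTerm t 1 1 * τ ^ 0 * (r * s * ρ ^ 3 * σ ^ 2) =
      -(τ ^ 4 / t 1 * (r ^ 2 * s * ρ ^ 3 * σ ^ 3)) := by
    rw [H.pairTerm_1_1]; field_simp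
  have f12 : pairTerm t 1 2 * τ ^ 8 * (r * s * ρ ^ 3 * σ ^ 2) =
      -(τ ^ 4 / t 1 * (s * ρ ^ 3)) := by
    rw [H.pairTerm_1_2]; field_simp
  have f13 : pairTerm t 1 3 * τ ^ 3 * (r * s * ρ ^ 3 * σ ^ 2) =
      -(τ ^ 4 / t 1 * (r * s * ρ ^ 4 * σ)) := by
    rw [H.pairTerm_1_3]; field_simp
  have f14 : pairTerm t 1 4 * τ ^ 7 * (r * s * ρ ^ 3 * σ ^ 2) =
      (τ ^ 4 / t 1 * (r * s * ρ ^ 2 * σ ^ 2)) := by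
    rw [H.pairTerm_1_4]; field_simp
  have f15 : pairTerm t 1 5 * τ ^ 9 * (r * s * ρ ^ 3 * σ ^ 2) =
      (τ ^ 4 / t 1 * (r * ρ ^ 2 * σ ^ 2)) := by
    rw [H.pairTerm_1_5]; field_simp
  have f21 : pairTerm t 2 1 * τ ^ 3 * (r * s * ρ ^ 3 * σ ^ 2) =
      -(τ ^ 4 / t 1 * (r * s * ρ ^ 3 * σ ^ 3)) := by
    rw [H.pairTerm_2_1]; field_simp
  have f22 : pairTerm t 2 2 * τ ^ 0 * (r * s * ρ ^ 3 * σ ^ 2) =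
      -(τ ^ 4 / t 1 * (s ^ 2 * ρ ^ 6)) := by
    rw [H.pairTerm_2_2]; field_simp
  have f23 : pairTerm t 2 3 * τ ^ 6 * (r * s * ρ ^ 3 * σ ^ 2) =
      (τ ^ 4 / t 1 * (r * s * ρ ^ 3 * σ)) := by
    rw [H.pairTerm_2_3]; field_simp
  have f24 : pairTerm t 2 4 * τ ^ 10 * (r * s * ρ ^ 3 * σ ^ 2) =
      -(τ ^ 4 / t 1 * (r * s * ρ ^ 2 * σ)) := by
    rw [H.pairTerm_2_4]; field_simp
  have f25 : pairTerm t 2 5 * τ ^ 1 * (r * s * ρ ^ 3 * σ ^ 2) =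
      -(τ ^ 4 / t 1 * (r * s * ρ ^ 4 * σ ^ 3)) := by
    rw [H.pairTerm_2_5]; field_simp
  have f31 : pairTerm t 3 1 * τ ^ 8 * (r * s * ρ ^ 3 * σ ^ 2) =
      (τ ^ 4 / t 1 * (r * ρ ^ 2 * σ ^ 3)) := by
    rw [H.pairTerm_3_1]; field_simp
  have f32 : pairTerm t 3 2 * τ ^ 5 * (r * s * ρ ^ 3 * σ ^ 2) =
      (τ ^ 4 / t 1 * (r * s * ρ ^ 2 * σ ^ 3)) := by
    rw [H.pairTerm_3_2]; field_simp
  have f33 : pairTerm t 3 3 * τ ^ 0 * (r * s * ρ ^ 3 * σ ^ 2) =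
      -(τ ^ 4 / t 1 * (r * s * ρ ^ 3 * σ ^ 4)) := by
    rw [H.pairTerm_3_3]; field_simp
  have f34 : pairTerm t 3 4 * τ ^ 4 * (r * s * ρ ^ 3 * σ ^ 2) =
      -(τ ^ 4 / t 1 * (r * s * ρ ^ 3 * σ ^ 2)) := by
    rw [H.pairTerm_3_4]; field_simp
  have f35 : pairTerm t 3 5 * τ ^ 6 * (r * s * ρ ^ 3 * σ ^ 2) =
      -(τ ^ 4 / t 1 * (s * ρ ^ 4 * σ)) := by
    rw [H.pairTerm_3_5]; field_simp
  have f41 : pairTerm t 4 1 * τ ^ 4 * (r * s * ρ ^ 3 * σ ^ 2) =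
      (τ ^ 4 / t 1 * (r ^ 2 * ρ * σ ^ 6)) := by
    rw [H.pairTerm_4_1]; field_simp
  have f42 : pairTerm t 4 2 * τ ^ 1 * (r * s * ρ ^ 3 * σ ^ 2) =
      (τ ^ 4 / t 1 * (r ^ 2 * s * ρ ^ 2 * σ ^ 5)) := by
    rw [H.pairTerm_4_2]; field_simp
  have f43 : pairTerm t 4 3 * τ ^ 7 * (r * s * ρ ^ 3 * σ ^ 2) =
      -(τ ^ 4 / t 1 * (r * ρ ^ 3 * σ)) := by
    rw [H.pairTerm_4_3]; field_simp
  have f44 : pairTerm t 4 4 * τ ^ 0 * (r * s * ρ ^ 3 * σ ^ 2) =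
      -(τ ^ 4 / t 1 * (r ^ 3 * ρ * σ ^ 8)) := by
    rw [H.pairTerm_4_4]; field_simp
  have f45 : pairTerm t 4 5 * τ ^ 2 * (r * s * ρ ^ 3 * σ ^ 2) =
      (τ ^ 4 / t 1 * (r * s * ρ ^ 4 * σ ^ 2)) := by
    rw [H.pairTerm_4_5]; field_simp
  have f51 : pairTerm t 5 1 * τ ^ 2 * (r * s * ρ ^ 3 * σ ^ 2) =
      -(τ ^ 4 / t 1 * (r ^ 3 * σ ^ 8)) := by
    rw [H.pairTerm_5_1]; field_simp
  have f52 : pairTerm t 5 2 * τ ^ 10 * (r * s * ρ ^ 3 * σ ^ 2) =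
      -(τ ^ 4 / t 1 * (r * ρ * σ ^ 3)) := by
    rw [H.pairTerm_5_2]; field_simp
  have f53 : pairTerm t 5 3 * τ ^ 5 * (r * s * ρ ^ 3 * σ ^ 2) =
      (τ ^ 4 / t 1 * (r * s * ρ ^ 3 * σ ^ 2)) := by
    rw [H.pairTerm_5_3]; field_simp
  have f54 : pairTerm t 5 4 * τ ^ 9 * (r * s * ρ ^ 3 * σ ^ 2) =
      (τ ^ 4 / t 1 * (r * s * ρ ^ 2 * σ)) := by
    rw [H.pairTerm_5_4]; field_simp
  have f55 : pairTerm t 5 5 * τ ^ 0 * (r * s * ρ ^ 3 * σ ^ 2) =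
      -(τ ^ 4 / t 1 * (r ^ 2 * s ^ 2 * ρ ^ 2 * σ ^ 5)) := by
    rw [H.pairTerm_5_5]; field_simp
  obtain ⟨k1, k2, k3, k4, k5⟩ := hκ
  obtain ⟨m1, m2, m3, m4, m5⟩ := hμ
  have hI : Finset.Icc (1 : ℤ) 5 = {1, 2, 3, 4, 5} := by decide
  rw [hI]
  have hA : (∑ a ∈ ({1, 2, 3, 4, 5} : Finset ℤ), ∑ b ∈ ({1, 2, 3, 4, 5} : Finset ℤ),
      thetaCoeff κ μ a b * pairTerm t a b *
      (invCoeff r s (classIndex a b) * τ ^ classIndex a b)) * (r * s * ρ ^ 3 * σ ^ 2) =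
      11 * (τ ^ 4 / t 1 * (r ^ 2 * s ^ 2 * ρ * σ ^ 6)) * cuspDisc r s ^ 4 := by
    norm_num [thetaCoeff, classIndex, k1, k2, k3, k4, k5, m1, m2, m3, m4, m5, zpow_ofNat]
    simp only [Int.reduceToNat]
    linear_combination (τ ^ 4 / t 1 * hc +
    (-2) * invCoeff r s 0 * f11 + (-2) * invCoeff r s 8 * f12 + (2) * invCoeff r s 3 * f13 + (-2)
    * invCoeff r s 7 * f14 + (2) * invCoeff r s 9 * f15 + (6) * invCoeff r s 3 * f21 + (2) *
    invCoeff r s 0 * f22 + (6) * invCoeff r s 6 * f23 + (-6) * invCoeff r s 10 * f24 + (6) *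
    invCoeff r s 1 * f25 + (-1) * invCoeff r s 8 * f31 + (1) * invCoeff r s 5 * f32 + (-1) *
    invCoeff r s 0 * f33 + (1) * invCoeff r s 4 * f34 + (-1) * invCoeff r s 6 * f35 + (4) *
    invCoeff r s 4 * f41 + (-4) * invCoeff r s 1 * f42 + (4) * invCoeff r s 7 * f43 + (3) *
    invCoeff r s 0 * f44 + (4) * invCoeff r s 2 * f45 + (-3) * invCoeff r s 2 * f51 + (3) *
    invCoeff r s 10 * f52 + (-3) * invCoeff r s 5 * f53 + (3) * invCoeff r s 9 * f54 + (2) *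
    invCoeff r s 0 * f55) / 1
  generalize (∑ a ∈ ({1, 2, 3, 4, 5} : Finset ℤ), ∑ b ∈ ({1, 2, 3, 4, 5} : Finset ℤ),
      thetaCoeff κ μ a b * pairTerm t a b *
      (invCoeff r s (classIndex a b) * τ ^ classIndex a b)) = A at hA ⊢
  have hne : (r * s * ρ ^ 3 * σ ^ 2) * (r ^ 2 * σ ^ 8) ≠ 0 := by simp [hr, hs, hρ, hσ]
  apply mul_left_cancel₀ hne
  linear_combination (r ^ 2 * σ ^ 8) * Q * (t 1 ^ 0 * t 2 ^ 3 * t 3 ^ 3 * t 4 ^ 3 * t 5 ^ 4) * hA +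
    11 * cuspDisc r s ^ 4 * Q * hm - 11 * (r * s * ρ ^ 3 * σ ^ 2) * r * σ ^ 4 * hn -
    11 * (r * s * ρ ^ 3 * σ ^ 2) * s * cuspDisc r s ^ 4 * hΔ

set_option maxHeartbeats 4000000 in
lemma theta_combination_three {Q : ℂ} {κ μ : ℤ → ℂ} (H : ThetaCurve t r s ρ σ τ)
    (hΔ : cuspDisc r s * (r * σ ^ 4) = ρ ^ 6 * s ^ 4 * τ ^ 18 * t 1 ^ 12 * Q)
    (hκ : κ 1 = -7 ∧ κ 2 = -1 ∧ κ 3 = -2 ∧ κ 4 = 3 ∧ κ 5 = 5)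
    (hμ : μ 1 = -5 ∧ μ 2 = -3 ∧ μ 3 = -1 ∧ μ 4 = 0 ∧ μ 5 = 3) :
    (∑ a ∈ Finset.Icc (1 : ℤ) 5, ∑ b ∈ Finset.Icc (1 : ℤ) 5, thetaCoeff κ μ a b *
      pairTerm t a b * (invCoeff r s (classIndex a b) * τ ^ classIndex a b)) *
      (Q * (t 1 ^ 1 * t 2 ^ 3 * t 3 ^ 3 * t 4 ^ 4 * t 5 ^ 2)) = 11 * normCoeff r s := by
  have hc := invCoeff_combination_three H.curve
  have hn := normCoeff_eq H.curve
  simp only [H.sub_one_r, H.sub_one_s] at hc hn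
  obtain ⟨hr, hs, hρ, hσ, hτ⟩ := H.ne
  have hm : τ ^ 4 / t 1 * -1 * (r * s ^ 2 * ρ ^ 3 * σ ^ 3) * (t 1 ^ 1 * t 2 ^ 3 * t 3 ^ 3 *
    t 4 ^ 4 * t 5 ^ 2) *
      (r ^ 2 * σ ^ 8) = s ^ 5 * (r * s * ρ ^ 3 * σ ^ 2) * ρ ^ 6 * τ ^ 18 * t 1 ^ 12 := by
    have := H.ne₁; have := H.ne₂; have := H.ne₃; have := H.ne₄; have := H.ne₅
    rw [H.hr, H.hs, H.hρ, H.hσ, H.hτ]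
    field_simp
  have f11 : pairTerm t 1 1 * τ ^ 0 * (r * s * ρ ^ 3 * σ ^ 2) =
      -(τ ^ 4 / t 1 * (r ^ 2 * s * ρ ^ 3 * σ ^ 3)) := by
    rw [H.pairTerm_1_1]; field_simp
  have f12 : pairTerm t 1 2 * τ ^ 8 * (r * s * ρ ^ 3 * σ ^ 2) =
      -(τ ^ 4 / t 1 * (s * ρ ^ 3)) := by
    rw [H.pairTerm_1_2]; field_simp
  have f13 : pairTerm t 1 3 * τ ^ 3 * (r * s * ρ ^ 3 * σ ^ 2) =
      -(τ ^ 4 / t 1 * (r * s * ρ ^ 4 * σ)) := by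
    rw [H.pairTerm_1_3]; field_simp
  have f14 : pairTerm t 1 4 * τ ^ 7 * (r * s * ρ ^ 3 * σ ^ 2) =
      (τ ^ 4 / t 1 * (r * s * ρ ^ 2 * σ ^ 2)) := by
    rw [H.pairTerm_1_4]; field_simp
  have f15 : pairTerm t 1 5 * τ ^ 9 * (r * s * ρ ^ 3 * σ ^ 2) =
      (τ ^ 4 / t 1 * (r * ρ ^ 2 * σ ^ 2)) := by
    rw [H.pairTerm_1_5]; field_simp
  have f21 : pairTerm t 2 1 * τ ^ 3 * (r * s * ρ ^ 3 * σ ^ 2) =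
      -(τ ^ 4 / t 1 * (r * s * ρ ^ 3 * σ ^ 3)) := by
    rw [H.pairTerm_2_1]; field_simp
  have f22 : pairTerm t 2 2 * τ ^ 0 * (r * s * ρ ^ 3 * σ ^ 2) =
      -(τ ^ 4 / t 1 * (s ^ 2 * ρ ^ 6)) := by
    rw [H.pairTerm_2_2]; field_simp
  have f23 : pairTerm t 2 3 * τ ^ 6 * (r * s * ρ ^ 3 * σ ^ 2) =
      (τ ^ 4 / t 1 * (r * s * ρ ^ 3 * σ)) := by
    rw [H.pairTerm_2_3]; field_simp
  have f24 : pairTerm t 2 4 * τ ^ 10 * (r * s * ρ ^ 3 * σ ^ 2) =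
      -(τ ^ 4 / t 1 * (r * s * ρ ^ 2 * σ)) := by
    rw [H.pairTerm_2_4]; field_simp
  have f25 : pairTerm t 2 5 * τ ^ 1 * (r * s * ρ ^ 3 * σ ^ 2) =
      -(τ ^ 4 / t 1 * (r * s * ρ ^ 4 * σ ^ 3)) := by
    rw [H.pairTerm_2_5]; field_simp
  have f31 : pairTerm t 3 1 * τ ^ 8 * (r * s * ρ ^ 3 * σ ^ 2) =
      (τ ^ 4 / t 1 * (r * ρ ^ 2 * σ ^ 3)) := by
    rw [H.pairTerm_3_1]; field_simp
  have f32 : pairTerm t 3 2 * τ ^ 5 * (r * s * ρ ^ 3 * σ ^ 2) =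
      (τ ^ 4 / t 1 * (r * s * ρ ^ 2 * σ ^ 3)) := by
    rw [H.pairTerm_3_2]; field_simp
  have f33 : pairTerm t 3 3 * τ ^ 0 * (r * s * ρ ^ 3 * σ ^ 2) =
      -(τ ^ 4 / t 1 * (r * s * ρ ^ 3 * σ ^ 4)) := by
    rw [H.pairTerm_3_3]; field_simp
  have f34 : pairTerm t 3 4 * τ ^ 4 * (r * s * ρ ^ 3 * σ ^ 2) =
      -(τ ^ 4 / t 1 * (r * s * ρ ^ 3 * σ ^ 2)) := by
    rw [H.pairTerm_3_4]; field_simp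
  have f35 : pairTerm t 3 5 * τ ^ 6 * (r * s * ρ ^ 3 * σ ^ 2) =
      -(τ ^ 4 / t 1 * (s * ρ ^ 4 * σ)) := by
    rw [H.pairTerm_3_5]; field_simp
  have f41 : pairTerm t 4 1 * τ ^ 4 * (r * s * ρ ^ 3 * σ ^ 2) =
      (τ ^ 4 / t 1 * (r ^ 2 * ρ * σ ^ 6)) := by
    rw [H.pairTerm_4_1]; field_simp
  have f42 : pairTerm t 4 2 * τ ^ 1 * (r * s * ρ ^ 3 * σ ^ 2) =
      (τ ^ 4 / t 1 * (r ^ 2 * s * ρ ^ 2 * σ ^ 5)) := by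
    rw [H.pairTerm_4_2]; field_simp
  have f43 : pairTerm t 4 3 * τ ^ 7 * (r * s * ρ ^ 3 * σ ^ 2) =
      -(τ ^ 4 / t 1 * (r * ρ ^ 3 * σ)) := by
    rw [H.pairTerm_4_3]; field_simp
  have f45 : pairTerm t 4 5 * τ ^ 2 * (r * s * ρ ^ 3 * σ ^ 2) =
      (τ ^ 4 / t 1 * (r * s * ρ ^ 4 * σ ^ 2)) := by
    rw [H.pairTerm_4_5]; field_simp
  have f51 : pairTerm t 5 1 * τ ^ 2 * (r * s * ρ ^ 3 * σ ^ 2) =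
      -(τ ^ 4 / t 1 * (r ^ 3 * σ ^ 8)) := by
    rw [H.pairTerm_5_1]; field_simp
  have f52 : pairTerm t 5 2 * τ ^ 10 * (r * s * ρ ^ 3 * σ ^ 2) =
      -(τ ^ 4 / t 1 * (r * ρ * σ ^ 3)) := by
    rw [H.pairTerm_5_2]; field_simp
  have f53 : pairTerm t 5 3 * τ ^ 5 * (r * s * ρ ^ 3 * σ ^ 2) =
      (τ ^ 4 / t 1 * (r * s * ρ ^ 3 * σ ^ 2)) := by
    rw [H.pairTerm_5_3]; field_simp
  have f54 : pairTerm t 5 4 * τ ^ 9 * (r * s * ρ ^ 3 * σ ^ 2) =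
      (τ ^ 4 / t 1 * (r * s * ρ ^ 2 * σ)) := by
    rw [H.pairTerm_5_4]; field_simp
  have f55 : pairTerm t 5 5 * τ ^ 0 * (r * s * ρ ^ 3 * σ ^ 2) =
      -(τ ^ 4 / t 1 * (r ^ 2 * s ^ 2 * ρ ^ 2 * σ ^ 5)) := by
    rw [H.pairTerm_5_5]; field_simp
  obtain ⟨k1, k2, k3, k4, k5⟩ := hκ
  obtain ⟨m1, m2, m3, m4, m5⟩ := hμ
  have hI : Finset.Icc (1 : ℤ) 5 = {1, 2, 3, 4, 5} := by decide
  rw [hI]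
  have hA : (∑ a ∈ ({1, 2, 3, 4, 5} : Finset ℤ), ∑ b ∈ ({1, 2, 3, 4, 5} : Finset ℤ),
      thetaCoeff κ μ a b * pairTerm t a b *
      (invCoeff r s (classIndex a b) * τ ^ classIndex a b)) * (r * s * ρ ^ 3 * σ ^ 2) =
      11 * (τ ^ 4 / t 1 * -1 * (r * s ^ 2 * ρ ^ 3 * σ ^ 3)) * cuspDisc r s ^ 4 := by
    norm_num [thetaCoeff, classIndex, k1, k2, k3, k4, k5, m1, m2, m3, m4, m5, zpow_ofNat]
    simp only [Int.reduceToNat]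
    linear_combination (τ ^ 4 / t 1 * hc +
    (5) * invCoeff r s 0 * f11 + (7) * invCoeff r s 8 * f12 + (-7) * invCoeff r s 3 * f13 + (7) *
    invCoeff r s 7 * f14 + (-7) * invCoeff r s 9 * f15 + (1) * invCoeff r s 3 * f21 + (3) *
    invCoeff r s 0 * f22 + (1) * invCoeff r s 6 * f23 + (-1) * invCoeff r s 10 * f24 + (1) *
    invCoeff r s 1 * f25 + (-2) * invCoeff r s 8 * f31 + (2) * invCoeff r s 5 * f32 + (1) *
    invCoeff r s 0 * f33 + (2) * invCoeff r s 4 * f34 + (-2) * invCoeff r s 6 * f35 + (-3) *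
    invCoeff r s 4 * f41 + (3) * invCoeff r s 1 * f42 + (-3) * invCoeff r s 7 * f43 + (-3) *
    invCoeff r s 2 * f45 + (5) * invCoeff r s 2 * f51 + (-5) * invCoeff r s 10 * f52 + (5) *
    invCoeff r s 5 * f53 + (-5) * invCoeff r s 9 * f54 + (-3) * invCoeff r s 0 * f55) / 1
  generalize (∑ a ∈ ({1, 2, 3, 4, 5} : Finset ℤ), ∑ b ∈ ({1, 2, 3, 4, 5} : Finset ℤ),
      thetaCoeff κ μ a b * pairTerm t a b *
      (invCoeff r s (classIndex a b) * τ ^ classIndex a b)) = A at hA ⊢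
  have hne : (r * s * ρ ^ 3 * σ ^ 2) * (r ^ 2 * σ ^ 8) ≠ 0 := by simp [hr, hs, hρ, hσ]
  apply mul_left_cancel₀ hne
  linear_combination (r ^ 2 * σ ^ 8) * Q * (t 1 ^ 1 * t 2 ^ 3 * t 3 ^ 3 * t 4 ^ 4 * t 5 ^ 2) * hA +
    11 * cuspDisc r s ^ 4 * Q * hm - 11 * (r * s * ρ ^ 3 * σ ^ 2) * r * σ ^ 4 * hn -
    11 * (r * s * ρ ^ 3 * σ ^ 2) * s * cuspDisc r s ^ 4 * hΔ

set_option maxHeartbeats 4000000 in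
lemma theta_combination_four {Q : ℂ} {κ μ : ℤ → ℂ} (H : ThetaCurve t r s ρ σ τ)
    (hΔ : cuspDisc r s * (r * σ ^ 4) = ρ ^ 6 * s ^ 4 * τ ^ 18 * t 1 ^ 12 * Q)
    (hκ : κ 1 = 6 ∧ κ 2 = 4 ∧ κ 3 = -3 ∧ κ 4 = -1 ∧ κ 5 = 2)
    (hμ : μ 1 = 2 ∧ μ 2 = 3 ∧ μ 3 = -2 ∧ μ 4 = 1 ∧ μ 5 = 2) :
    (∑ a ∈ Finset.Icc (1 : ℤ) 5, ∑ b ∈ Finset.Icc (1 : ℤ) 5, thetaCoeff κ μ a b *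
      pairTerm t a b * (invCoeff r s (classIndex a b) * τ ^ classIndex a b)) *
      (Q * (t 1 ^ 3 * t 2 ^ 3 * t 3 ^ 4 * t 4 ^ 3 * t 5 ^ 0)) = 11 * normCoeff r s := by
  have hc := invCoeff_combination_four H.curve
  have hn := normCoeff_eq H.curve
  simp only [H.sub_one_r, H.sub_one_s] at hc hn
  obtain ⟨hr, hs, hρ, hσ, hτ⟩ := H.ne
  have hm : τ ^ 4 / t 1 * -1 * (s ^ 3 * ρ ^ 6) * (t 1 ^ 3 * t 2 ^ 3 * t 3 ^ 4 * t 4 ^ 3 * t 5 ^ 0) *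
      (r ^ 2 * σ ^ 8) = s ^ 5 * (r ^ 2 * s * ρ ^ 3 * σ ^ 4) * ρ ^ 6 * τ ^ 18 * t 1 ^ 12 := by
    have := H.ne₁; have := H.ne₂; have := H.ne₃; have := H.ne₄; have := H.ne₅
    rw [H.hr, H.hs, H.hρ, H.hσ, H.hτ]
    field_simp
  have f11 : pairTerm t 1 1 * τ ^ 0 * (r ^ 2 * s * ρ ^ 3 * σ ^ 4) =
      -(τ ^ 4 / t 1 * (r ^ 3 * s * ρ ^ 3 * σ ^ 5)) := by
    rw [H.pairTerm_1_1]; field_simp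
  have f12 : pairTerm t 1 2 * τ ^ 8 * (r ^ 2 * s * ρ ^ 3 * σ ^ 4) =
      -(τ ^ 4 / t 1 * (r * s * ρ ^ 3 * σ ^ 2)) := by
    rw [H.pairTerm_1_2]; field_simp
  have f13 : pairTerm t 1 3 * τ ^ 3 * (r ^ 2 * s * ρ ^ 3 * σ ^ 4) =
      -(τ ^ 4 / t 1 * (r ^ 2 * s * ρ ^ 4 * σ ^ 3)) := by
    rw [H.pairTerm_1_3]; field_simp
  have f14 : pairTerm t 1 4 * τ ^ 7 * (r ^ 2 * s * ρ ^ 3 * σ ^ 4) =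
      (τ ^ 4 / t 1 * (r ^ 2 * s * ρ ^ 2 * σ ^ 4)) := by
    rw [H.pairTerm_1_4]; field_simp
  have f15 : pairTerm t 1 5 * τ ^ 9 * (r ^ 2 * s * ρ ^ 3 * σ ^ 4) =
      (τ ^ 4 / t 1 * (r ^ 2 * ρ ^ 2 * σ ^ 4)) := by
    rw [H.pairTerm_1_5]; field_simp
  have f21 : pairTerm t 2 1 * τ ^ 3 * (r ^ 2 * s * ρ ^ 3 * σ ^ 4) =
      -(τ ^ 4 / t 1 * (r ^ 2 * s * ρ ^ 3 * σ ^ 5)) := by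
    rw [H.pairTerm_2_1]; field_simp
  have f22 : pairTerm t 2 2 * τ ^ 0 * (r ^ 2 * s * ρ ^ 3 * σ ^ 4) =
      -(τ ^ 4 / t 1 * (r * s ^ 2 * ρ ^ 6 * σ ^ 2)) := by
    rw [H.pairTerm_2_2]; field_simp
  have f23 : pairTerm t 2 3 * τ ^ 6 * (r ^ 2 * s * ρ ^ 3 * σ ^ 4) =
      (τ ^ 4 / t 1 * (r ^ 2 * s * ρ ^ 3 * σ ^ 3)) := by
    rw [H.pairTerm_2_3]; field_simp
  have f24 : pairTerm t 2 4 * τ ^ 10 * (r ^ 2 * s * ρ ^ 3 * σ ^ 4) =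
      -(τ ^ 4 / t 1 * (r ^ 2 * s * ρ ^ 2 * σ ^ 3)) := by
    rw [H.pairTerm_2_4]; field_simp
  have f25 : pairTerm t 2 5 * τ ^ 1 * (r ^ 2 * s * ρ ^ 3 * σ ^ 4) =
      -(τ ^ 4 / t 1 * (r ^ 2 * s * ρ ^ 4 * σ ^ 5)) := by
    rw [H.pairTerm_2_5]; field_simp
  have f31 : pairTerm t 3 1 * τ ^ 8 * (r ^ 2 * s * ρ ^ 3 * σ ^ 4) =
      (τ ^ 4 / t 1 * (r ^ 2 * ρ ^ 2 * σ ^ 5)) := by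
    rw [H.pairTerm_3_1]; field_simp
  have f32 : pairTerm t 3 2 * τ ^ 5 * (r ^ 2 * s * ρ ^ 3 * σ ^ 4) =
      (τ ^ 4 / t 1 * (r ^ 2 * s * ρ ^ 2 * σ ^ 5)) := by
    rw [H.pairTerm_3_2]; field_simp
  have f33 : pairTerm t 3 3 * τ ^ 0 * (r ^ 2 * s * ρ ^ 3 * σ ^ 4) =
      -(τ ^ 4 / t 1 * (r ^ 2 * s * ρ ^ 3 * σ ^ 6)) := by
    rw [H.pairTerm_3_3]; field_simp
  have f34 : pairTerm t 3 4 * τ ^ 4 * (r ^ 2 * s * ρ ^ 3 * σ ^ 4) =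
      -(τ ^ 4 / t 1 * (r ^ 2 * s * ρ ^ 3 * σ ^ 4)) := by
    rw [H.pairTerm_3_4]; field_simp
  have f35 : pairTerm t 3 5 * τ ^ 6 * (r ^ 2 * s * ρ ^ 3 * σ ^ 4) =
      -(τ ^ 4 / t 1 * (r * s * ρ ^ 4 * σ ^ 3)) := by
    rw [H.pairTerm_3_5]; field_simp
  have f41 : pairTerm t 4 1 * τ ^ 4 * (r ^ 2 * s * ρ ^ 3 * σ ^ 4) =
      (τ ^ 4 / t 1 * (r ^ 3 * ρ * σ ^ 8)) := by
    rw [H.pairTerm_4_1]; field_simp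
  have f42 : pairTerm t 4 2 * τ ^ 1 * (r ^ 2 * s * ρ ^ 3 * σ ^ 4) =
      (τ ^ 4 / t 1 * (r ^ 3 * s * ρ ^ 2 * σ ^ 7)) := by
    rw [H.pairTerm_4_2]; field_simp
  have f43 : pairTerm t 4 3 * τ ^ 7 * (r ^ 2 * s * ρ ^ 3 * σ ^ 4) =
      -(τ ^ 4 / t 1 * (r ^ 2 * ρ ^ 3 * σ ^ 3)) := by
    rw [H.pairTerm_4_3]; field_simp
  have f44 : pairTerm t 4 4 * τ ^ 0 * (r ^ 2 * s * ρ ^ 3 * σ ^ 4) =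
      -(τ ^ 4 / t 1 * (r ^ 4 * ρ * σ ^ 10)) := by
    rw [H.pairTerm_4_4]; field_simp
  have f45 : pairTerm t 4 5 * τ ^ 2 * (r ^ 2 * s * ρ ^ 3 * σ ^ 4) =
      (τ ^ 4 / t 1 * (r ^ 2 * s * ρ ^ 4 * σ ^ 4)) := by
    rw [H.pairTerm_4_5]; field_simp
  have f51 : pairTerm t 5 1 * τ ^ 2 * (r ^ 2 * s * ρ ^ 3 * σ ^ 4) =
      -(τ ^ 4 / t 1 * (r ^ 4 * σ ^ 10)) := by
    rw [H.pairTerm_5_1]; field_simp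
  have f52 : pairTerm t 5 2 * τ ^ 10 * (r ^ 2 * s * ρ ^ 3 * σ ^ 4) =
      -(τ ^ 4 / t 1 * (r ^ 2 * ρ * σ ^ 5)) := by
    rw [H.pairTerm_5_2]; field_simp
  have f53 : pairTerm t 5 3 * τ ^ 5 * (r ^ 2 * s * ρ ^ 3 * σ ^ 4) =
      (τ ^ 4 / t 1 * (r ^ 2 * s * ρ ^ 3 * σ ^ 4)) := by
    rw [H.pairTerm_5_3]; field_simp
  have f54 : pairTerm t 5 4 * τ ^ 9 * (r ^ 2 * s * ρ ^ 3 * σ ^ 4) =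
      (τ ^ 4 / t 1 * (r ^ 2 * s * ρ ^ 2 * σ ^ 3)) := by
    rw [H.pairTerm_5_4]; field_simp
  have f55 : pairTerm t 5 5 * τ ^ 0 * (r ^ 2 * s * ρ ^ 3 * σ ^ 4) =
      -(τ ^ 4 / t 1 * (r ^ 3 * s ^ 2 * ρ ^ 2 * σ ^ 7)) := by
    rw [H.pairTerm_5_5]; field_simp
  obtain ⟨k1, k2, k3, k4, k5⟩ := hκ
  obtain ⟨m1, m2, m3, m4, m5⟩ := hμ
  have hI : Finset.Icc (1 : ℤ) 5 = {1, 2, 3, 4, 5} := by decide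
  rw [hI]
  have hA : (∑ a ∈ ({1, 2, 3, 4, 5} : Finset ℤ), ∑ b ∈ ({1, 2, 3, 4, 5} : Finset ℤ),
      thetaCoeff κ μ a b * pairTerm t a b *
      (invCoeff r s (classIndex a b) * τ ^ classIndex a b)) * (r ^ 2 * s * ρ ^ 3 * σ ^ 4) =
      11 * (τ ^ 4 / t 1 * -1 * (s ^ 3 * ρ ^ 6)) * cuspDisc r s ^ 4 := by
    norm_num [thetaCoeff, classIndex, k1, k2, k3, k4, k5, m1, m2, m3, m4, m5, zpow_ofNat]
    simp only [Int.reduceToNat]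
    linear_combination (τ ^ 4 / t 1 * hc +
    (-2) * invCoeff r s 0 * f11 + (-6) * invCoeff r s 8 * f12 + (6) * invCoeff r s 3 * f13 + (-6)
    * invCoeff r s 7 * f14 + (6) * invCoeff r s 9 * f15 + (-4) * invCoeff r s 3 * f21 + (-3) *
    invCoeff r s 0 * f22 + (-4) * invCoeff r s 6 * f23 + (4) * invCoeff r s 10 * f24 + (-4) *
    invCoeff r s 1 * f25 + (-3) * invCoeff r s 8 * f31 + (3) * invCoeff r s 5 * f32 + (2) *
    invCoeff r s 0 * f33 + (3) * invCoeff r s 4 * f34 + (-3) * invCoeff r s 6 * f35 + (1) *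
    invCoeff r s 4 * f41 + (-1) * invCoeff r s 1 * f42 + (1) * invCoeff r s 7 * f43 + (-1) *
    invCoeff r s 0 * f44 + (1) * invCoeff r s 2 * f45 + (2) * invCoeff r s 2 * f51 + (-2) *
    invCoeff r s 10 * f52 + (2) * invCoeff r s 5 * f53 + (-2) * invCoeff r s 9 * f54 + (-2) *
    invCoeff r s 0 * f55) / 1
  generalize (∑ a ∈ ({1, 2, 3, 4, 5} : Finset ℤ), ∑ b ∈ ({1, 2, 3, 4, 5} : Finset ℤ),
      thetaCoeff κ μ a b * pairTerm t a b *
      (invCoeff r s (classIndex a b) * τ ^ classIndex a b)) = A at hA ⊢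
  have hne : (r ^ 2 * s * ρ ^ 3 * σ ^ 4) * (r ^ 2 * σ ^ 8) ≠ 0 := by simp [hr, hs, hρ, hσ]
  apply mul_left_cancel₀ hne
  linear_combination (r ^ 2 * σ ^ 8) * Q * (t 1 ^ 3 * t 2 ^ 3 * t 3 ^ 4 * t 4 ^ 3 * t 5 ^ 0) * hA +
    11 * cuspDisc r s ^ 4 * Q * hm - 11 * (r ^ 2 * s * ρ ^ 3 * σ ^ 4) * r * σ ^ 4 * hn -
    11 * (r ^ 2 * s * ρ ^ 3 * σ ^ 4) * s * cuspDisc r s ^ 4 * hΔ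

end ThetaCurve

lemma cuspDisc_mul_eq {r s ρ σ X₁ X₂ X₃ D : ℂ} (hr : r ≠ 0) (hρ : ρ ≠ 0) (hσ : σ ≠ 0)
    (hrρ : r - 1 = ρ) (hsσ : s - 1 = σ) (h : r ^ 2 = r * ((s - 1) ^ 3 + s + 1) - s)
    (h0 : 4 * (s * ρ) * (X₁ * X₂ * X₃) = r ^ 2)
    (h2 : 4 * ((X₁ + r) * (X₂ + r) * (X₃ + r)) = r ^ 2 * s * ρ)
    (h3 : 4 * s * ((X₁ + 1) * (X₂ + 1) * (X₃ + 1)) = ρ * σ ^ 2)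
    (hD : 16 * ((X₁ - X₂) * (X₁ - X₃) * (X₂ - X₃)) ^ 2 = r ^ 6 * σ ^ 6 * D) :
    cuspDisc r s * (r * σ ^ 4) = ρ ^ 6 * s ^ 4 * D := by
  obtain ⟨A, hA⟩ : ∃ A, A = 4 * (s * ρ) * (X₁ + X₂ + X₃) := ⟨_, rfl⟩
  obtain ⟨B, hB⟩ : ∃ B, B = 4 * (s * ρ) * (X₁ * X₂ + X₁ * X₃ + X₂ * X₃) := ⟨_, rfl⟩
  have hA' : A = r * s ^ 2 * ρ + r - 4 * (s * ρ) * (r + 1) - ρ * σ ^ 2 := by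
    apply mul_left_cancel₀ (mul_ne_zero hr hρ)
    subst hA
    subst hrρ
    linear_combination s * (r - 1) * h2 - r * (r - 1) * h3 + (r - 1) * h0
  have hB' : B = -A - 4 * (s * ρ) - r ^ 2 + ρ ^ 2 * σ ^ 2 := by
    rw [hA, hB]; linear_combination ρ * h3 - h0
  have hdisc : 16 * (s * ρ) ^ 4 * (r ^ 6 * σ ^ 6 * D) = A ^ 2 * B ^ 2 - 16 * (s * ρ) * B ^ 3 -
      4 * A ^ 3 * r ^ 2 + 72 * (s * ρ) * A * B * r ^ 2 - 432 * (s * ρ) ^ 2 * (r ^ 2) ^ 2 := by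
    rw [← hD, ← h0, hA, hB]; ring
  rw [hB', hA'] at hdisc
  have hρ4 : 16 * r ^ 6 * σ ^ 6 ≠ 0 := by simp [hr, hσ]
  apply mul_left_cancel₀ hρ4
  subst hrρ hsσ
  rw [cuspDisc]
  linear_combination -(r - 1) ^ 2 * hdisc - (r ^ 3 * (-16 * s - 48 * s ^ 2 - 48 * s ^ 3 - 16 *
    s ^ 4) + r ^ 4 * (16 * s + 416 * s ^ 2 + 96
 * s ^ 3 + 144 * s ^ 4 - 16 * s ^ 6) + r ^ 5 * (16 - 48 * s - 672 * s ^ 2 - 784 * s ^ 3 + 368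
 * s ^ 4 - 336 * s ^ 5 + 80 * s ^ 6 + 48 * s ^ 7 - 16 * s ^ 8) + r ^ 6 * (48 - 496 * s + 2336
 * s ^ 2 - 2272 * s ^ 3 + 3712 * s ^ 4 - 3216 * s ^ 5 + 1696 * s ^ 6 - 384 * s ^ 7 - 128 * s ^
 8 + 96 * s ^ 9 - 16 * s ^ 10) + r ^ 7 * (-1600 * s ^ 3 + 1744 * s ^ 4 - 1392 * s ^ 5 + 704 *
 s ^ 6 - 176 * s ^ 7 + 16 * s ^ 8) + r ^ 8 * (256 * s ^ 3 - 128 * s ^ 4 + 16 * s ^ 5)) * h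

lemma ThetaCurve.cuspDisc_eq {t : ℤ → ℂ} {r s ρ σ τ Q e₁ e₂ e₃ : ℂ} (H : ThetaCurve t r s ρ σ τ)
    (h1 : e₁ * e₂ * e₃ = -(t 2 ^ 2 / (4 * t 1 ^ 8)))
    (h2 : (e₁ + t 3 / (t 1 * t 2 ^ 2)) * (e₂ + t 3 / (t 1 * t 2 ^ 2)) *
      (e₃ + t 3 / (t 1 * t 2 ^ 2)) = -(t 4 ^ 2 / (4 * t 2 ^ 8)))
    (h3 : (e₁ + t 2 * t 4 / (t 1 ^ 2 * t 3 ^ 2)) * (e₂ + t 2 * t 4 / (t 1 ^ 2 * t 3 ^ 2)) *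
      (e₃ + t 2 * t 4 / (t 1 ^ 2 * t 3 ^ 2)) = -(t 6 ^ 2 / (4 * t 3 ^ 8)))
    (hD : 16 * ((e₁ - e₂) * (e₁ - e₃) * (e₂ - e₃)) ^ 2 = Q) :
    cuspDisc r s * (r * σ ^ 4) = ρ ^ 6 * s ^ 4 * τ ^ 18 * t 1 ^ 12 * Q := by
  obtain ⟨hr, hs, hρ, hσ, hτ⟩ := H.ne
  have hX2 : r * σ * τ ^ 3 * t 1 ^ 2 * (t 3 / (t 1 * t 2 ^ 2)) = -r := by
    have := H.ne₁; have := H.ne₂; have := H.ne₃; have := H.ne₄; have := H.ne₅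
    rw [H.hr, H.hσ, H.hτ]; field_simp
  have hX3 : r * σ * τ ^ 3 * t 1 ^ 2 * (t 2 * t 4 / (t 1 ^ 2 * t 3 ^ 2)) = -1 := by
    have := H.ne₁; have := H.ne₂; have := H.ne₃; have := H.ne₄; have := H.ne₅
    rw [H.hr, H.hσ, H.hτ]; field_simp
  have key := cuspDisc_mul_eq (X₁ := -(r * σ * τ ^ 3 * t 1 ^ 2 * e₁))
    (X₂ := -(r * σ * τ ^ 3 * t 1 ^ 2 * e₂)) (X₃ := -(r * σ * τ ^ 3 * t 1 ^ 2 * e₃))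
    (D := τ ^ 18 * t 1 ^ 12 * Q) hr hρ hσ H.sub_one_r H.sub_one_s H.curve ?_ ?_ ?_ ?_
  · rw [key]; ring
  · have h1' : -(r * σ * τ ^ 3 * t 1 ^ 2 * e₁) * -(r * σ * τ ^ 3 * t 1 ^ 2 * e₂) *
        -(r * σ * τ ^ 3 * t 1 ^ 2 * e₃) = -(r * σ * τ ^ 3 * t 1 ^ 2) ^ 3 * (e₁ * e₂ * e₃) := by
      ring
    rw [h1', h1]
    have := H.ne₁; have := H.ne₂; have := H.ne₃; have := H.ne₄; have := H.ne₅
    rw [H.hr, H.hs, H.hρ, H.hσ, H.hτ]; field_simp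
  · have h2' : (-(r * σ * τ ^ 3 * t 1 ^ 2 * e₁) + r) * (-(r * σ * τ ^ 3 * t 1 ^ 2 * e₂) + r) *
        (-(r * σ * τ ^ 3 * t 1 ^ 2 * e₃) + r) = -(r * σ * τ ^ 3 * t 1 ^ 2) ^ 3 *
        ((e₁ + t 3 / (t 1 * t 2 ^ 2)) * (e₂ + t 3 / (t 1 * t 2 ^ 2)) *
        (e₃ + t 3 / (t 1 * t 2 ^ 2))) := by
      have hf : ∀ e : ℂ, -(r * σ * τ ^ 3 * t 1 ^ 2 * e) + r =
          -(r * σ * τ ^ 3 * t 1 ^ 2) * (e + t 3 / (t 1 * t 2 ^ 2)) := fun e => by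
        linear_combination hX2
      rw [hf, hf, hf]; ring
    rw [h2', h2]
    have := H.ne₁; have := H.ne₂; have := H.ne₃; have := H.ne₄; have := H.ne₅
    rw [H.hr, H.hs, H.hρ, H.hσ, H.hτ]; field_simp
  · have h3' : (-(r * σ * τ ^ 3 * t 1 ^ 2 * e₁) + 1) * (-(r * σ * τ ^ 3 * t 1 ^ 2 * e₂) + 1) *
        (-(r * σ * τ ^ 3 * t 1 ^ 2 * e₃) + 1) = -(r * σ * τ ^ 3 * t 1 ^ 2) ^ 3 *
        ((e₁ + t 2 * t 4 / (t 1 ^ 2 * t 3 ^ 2)) * (e₂ + t 2 * t 4 / (t 1 ^ 2 * t 3 ^ 2)) *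
        (e₃ + t 2 * t 4 / (t 1 ^ 2 * t 3 ^ 2))) := by
      have hf : ∀ e : ℂ, -(r * σ * τ ^ 3 * t 1 ^ 2 * e) + 1 =
          -(r * σ * τ ^ 3 * t 1 ^ 2) * (e + t 2 * t 4 / (t 1 ^ 2 * t 3 ^ 2)) := fun e => by
        linear_combination hX3
      rw [hf, hf, hf]; ring
    have h6 := H.refl 5
    norm_num at h6
    rw [h3', h3, h6]
    have := H.ne₁; have := H.ne₂; have := H.ne₃; have := H.ne₄; have := H.ne₅
    rw [H.hs, H.hr, H.hρ, H.hσ, H.hτ]; field_simp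
  · rw [← hD]; ring

/-- Normalised theta values at the powers of `q ^ 11`, for the nome `q ^ 121`. -/
noncomputable def thetaEleven (q : ℂ) (n : ℤ) : ℂ :=
  q ^ (n * (n - 11) / 2) * theta (q ^ 121) (q ^ (11 * n))

section

variable {q : ℂ}

lemma norm_pow_lt_one (hq : ‖q‖ < 1) {n : ℕ} (hn : n ≠ 0) : ‖q ^ n‖ < 1 := by
  rw [norm_pow]; exact pow_lt_one₀ (norm_nonneg q) hq hn

lemma two_mul_half (n : ℤ) : 2 * (n * (n - 11) / 2) = n * (n - 11) := by
  apply Int.mul_ediv_cancel'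
  have : Even (n * (n - 11)) := by
    rw [Int.even_mul, Int.even_sub]; have : ¬ Even (11 : ℤ) := by decide
    tauto
  exact this.two_dvd

lemma zpow_ne_one (hq : ‖q‖ < 1) {n : ℤ} (hn : n ≠ 0) : q ^ n ≠ 1 := by
  intro h
  have := congrArg norm h
  rw [norm_zpow, norm_one] at this
  exact hn ((zpow_eq_one_iff_right₀ (norm_nonneg q) hq.ne).1 this)

lemma theta_zpow_ne_zero (hq : ‖q‖ < 1) (hq0 : q ≠ 0) {n : ℤ} (hn : ¬ (11 : ℤ) ∣ n) :
    theta (q ^ 121) (q ^ (11 * n)) ≠ 0 := by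
  refine theta_ne_zero_of_mul_zpow_ne_one (norm_pow_lt_one hq (by norm_num)) (pow_ne_zero _ hq0)
    (zpow_ne_zero _ hq0) fun m hm => ?_
  rw [← zpow_natCast, ← zpow_mul, ← zpow_add₀ hq0] at hm
  refine zpow_ne_one hq (fun h => hn ⟨-m, ?_⟩) hm
  push_cast at h
  omega

lemma thetaEleven_ne_zero (hq : ‖q‖ < 1) (hq0 : q ≠ 0) {n : ℤ} (hn : ¬ (11 : ℤ) ∣ n) :
    thetaEleven q n ≠ 0 :=
  mul_ne_zero (zpow_ne_zero _ hq0) (theta_zpow_ne_zero hq hq0 hn)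

lemma thetaEleven_neg (hq : ‖q‖ < 1) (hq0 : q ≠ 0) (n : ℤ) :
    thetaEleven q (-n) = -thetaEleven q n := by
  have h : -n * (-n - 11) / 2 = n * (n - 11) / 2 + 11 * n := by
    have := two_mul_half n; have := two_mul_half (-n); lia
  rw [thetaEleven, thetaEleven, mul_neg, zpow_neg, theta_inv (norm_pow_lt_one hq (by norm_num))
    (zpow_ne_zero _ hq0), h, zpow_add₀ hq0]
  have := zpow_ne_zero (11 * n) hq0
  field_simp

lemma theta_div_self {Q : ℂ} (hQ0 : Q ≠ 0) (z : ℂ) : theta Q (Q / z) = theta Q z := by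
  rw [theta, theta, div_div_cancel₀ hQ0, mul_comm]

lemma thetaEleven_refl (hq0 : q ≠ 0) (n : ℤ) : thetaEleven q (11 - n) = thetaEleven q n := by
  have h : (11 - n) * (11 - n - 11) / 2 = n * (n - 11) / 2 := by congr 1; ring
  have h2 : q ^ (11 * (11 - n)) = q ^ 121 / q ^ (11 * n) := by
    rw [mul_sub, zpow_sub₀ hq0]; norm_cast
  rw [thetaEleven, thetaEleven, h, h2, theta_div_self (pow_ne_zero _ hq0)]

lemma thetaEleven_mul (hq0 : q ≠ 0) (a b : ℤ) : thetaEleven q (a + b) * thetaEleven q (a - b) =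
    q ^ (a ^ 2 + b ^ 2 - 11 * a) * thetaPair (q ^ 121) (q ^ (11 * a)) (q ^ (11 * b)) := by
  have h : a ^ 2 + b ^ 2 - 11 * a =
      (a + b) * (a + b - 11) / 2 + (a - b) * (a - b - 11) / 2 := by
    have := two_mul_half (a + b); have := two_mul_half (a - b); lia
  rw [thetaEleven, thetaEleven, thetaPair, h, zpow_add₀ hq0, ← zpow_add₀ hq0 (11 * a),
    ← zpow_sub₀ hq0 (11 * a), ← mul_add, ← mul_sub]
  ring

lemma thetaEleven_three_term (hq : ‖q‖ < 1) (hq0 : q ≠ 0) {a b c d : ℤ}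
    (h1 : ¬ (11 : ℤ) ∣ c + c) (h2 : ¬ (11 : ℤ) ∣ a + c) (h3 : ¬ (11 : ℤ) ∣ a - c)
    (h4 : ¬ (11 : ℤ) ∣ d + c) (h5 : ¬ (11 : ℤ) ∣ d - c) :
    thetaEleven q (a + b) * thetaEleven q (a - b) * (thetaEleven q (c + d) * thetaEleven q (c - d))
      - thetaEleven q (a + d) * thetaEleven q (a - d) *
        (thetaEleven q (c + b) * thetaEleven q (c - b)) =
      -(thetaEleven q (d + b) * thetaEleven q (d - b) *
        (thetaEleven q (a + c) * thetaEleven q (a - c))) := by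
  have hp : ∀ m n : ℤ, ¬ (11 : ℤ) ∣ m + n → ¬ (11 : ℤ) ∣ m - n →
      thetaPair (q ^ 121) (q ^ (11 * m)) (q ^ (11 * n)) ≠ 0 := fun m n hm hn => by
    rw [thetaPair, ← zpow_add₀ hq0, ← zpow_sub₀ hq0, ← mul_add, ← mul_sub]
    exact mul_ne_zero (theta_zpow_ne_zero hq hq0 hm) (theta_zpow_ne_zero hq hq0 hn)
  have key := thetaPair_three_term (Q := q ^ 121) (x := q ^ (11 * a)) (y := q ^ (11 * b))
    (u := q ^ (11 * c)) (v := q ^ (11 * d)) (norm_pow_lt_one hq (by norm_num))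
    (pow_ne_zero _ hq0) (zpow_ne_zero _ hq0) (zpow_ne_zero _ hq0) (zpow_ne_zero _ hq0)
    (zpow_ne_zero _ hq0) (by
      rw [← zpow_add₀ hq0, ← mul_add]; exact theta_zpow_ne_zero hq hq0 h1)
    (hp _ _ h2 h3) (hp _ _ h4 h5)
  simp only [thetaEleven_mul hq0]
  rw [← zpow_sub₀ hq0] at key
  have e1 : q ^ (c ^ 2 + b ^ 2 - 11 * c) * q ^ (a ^ 2 + d ^ 2 - 11 * a) =
      q ^ (a ^ 2 + b ^ 2 - 11 * a) * q ^ (c ^ 2 + d ^ 2 - 11 * c) := by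
    rw [← zpow_add₀ hq0, ← zpow_add₀ hq0]; congr 1; ring
  have e2 : q ^ (d ^ 2 + b ^ 2 - 11 * d) * q ^ (a ^ 2 + c ^ 2 - 11 * a) =
      q ^ (a ^ 2 + b ^ 2 - 11 * a) * q ^ (c ^ 2 + d ^ 2 - 11 * c) * q ^ (11 * c - 11 * d) := by
    rw [← zpow_add₀ hq0, ← zpow_add₀ hq0, ← zpow_add₀ hq0]; congr 1; ring
  generalize thetaPair (q ^ 121) = P at *
  linear_combination q ^ (a ^ 2 + b ^ 2 - 11 * a) * q ^ (c ^ 2 + d ^ 2 - 11 * c) * key -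
    P (q ^ (11 * a)) (q ^ (11 * d)) * P (q ^ (11 * c)) (q ^ (11 * b)) * e1 +
    P (q ^ (11 * d)) (q ^ (11 * b)) * P (q ^ (11 * a)) (q ^ (11 * c)) * e2

lemma thetaCurve_thetaEleven (hq : ‖q‖ < 1) (hq0 : q ≠ 0) :
    ∃ r s ρ σ τ, ThetaCurve (thetaEleven q) r s ρ σ τ := by
  have w1 := thetaEleven_three_term hq hq0 (a := 3) (b := 2) (c := 1) (d := 0) (by decide)
    (by decide) (by decide) (by decide) (by decide)
  have w2 := thetaEleven_three_term hq hq0 (a := 4) (b := 0) (c := 2) (d := 1) (by decide)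
    (by decide) (by decide) (by decide) (by decide)
  have w3 := thetaEleven_three_term hq hq0 (a := 4) (b := 1) (c := 3) (d := 0) (by decide)
    (by decide) (by decide) (by decide) (by decide)
  have n1 : thetaEleven q 1 ≠ 0 := thetaEleven_ne_zero hq hq0 (by decide)
  have n2 : thetaEleven q 2 ≠ 0 := thetaEleven_ne_zero hq hq0 (by decide)
  have n3 : thetaEleven q 3 ≠ 0 := thetaEleven_ne_zero hq hq0 (by decide)
  have n4 : thetaEleven q 4 ≠ 0 := thetaEleven_ne_zero hq hq0 (by decide)
  have n5 : thetaEleven q 5 ≠ 0 := thetaEleven_ne_zero hq hq0 (by decide)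
  have hneg := thetaEleven_neg hq hq0
  have hrefl := thetaEleven_refl hq0
  generalize thetaEleven q = t at *
  have m1 := hneg 1
  have m2 := hneg 2
  have r6 := hrefl 5
  have r7 := hrefl 4
  norm_num at w1 w2 w3 m1 m2 r6 r7
  norm_num [m1, m2, r6, r7] at w1 w2 w3
  have W1 : t 5 * t 1 ^ 3 + t 3 ^ 3 * t 1 = t 2 ^ 3 * t 4 := by linear_combination w1
  have W2 : t 4 ^ 2 * t 1 = t 2 ^ 2 * t 5 - t 1 ^ 2 * t 5 * t 2 / t 3 := by
    field_simp; linear_combination w2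
  have W3 : t 5 * t 3 ^ 3 = t 4 ^ 3 * t 2 + t 1 ^ 3 * t 4 := by linear_combination w3
  refine ⟨_, _, _, _, _, hneg, hrefl, n1, n2, n3, n4, n5, rfl, rfl, rfl, rfl, rfl, ?_, ?_, ?_⟩
  · field_simp; linear_combination W1
  · rw [W2]; field_simp; ring
  · have hs : t 4 ^ 2 * t 1 / (t 2 ^ 2 * t 5) - 1 = -(t 1 ^ 2 / (t 2 * t 3)) := by
      rw [W2]; field_simp; ring
    have hr : t 3 ^ 3 * t 1 / (t 2 ^ 3 * t 4) - 1 = -(t 5 * t 1 ^ 3 / (t 2 ^ 3 * t 4)) := by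
      field_simp; linear_combination W1
    have hrs : t 3 ^ 3 * t 1 / (t 2 ^ 3 * t 4) - t 4 ^ 2 * t 1 / (t 2 ^ 2 * t 5) =
        t 1 ^ 4 / (t 2 ^ 3 * t 5) := by
      field_simp; linear_combination W3
    have : (t 3 ^ 3 * t 1 / (t 2 ^ 3 * t 4) - 1) *
        (t 3 ^ 3 * t 1 / (t 2 ^ 3 * t 4) - t 4 ^ 2 * t 1 / (t 2 ^ 2 * t 5)) =
        t 3 ^ 3 * t 1 / (t 2 ^ 3 * t 4) * (t 4 ^ 2 * t 1 / (t 2 ^ 2 * t 5) - 1) ^ 3 := by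
      rw [hr, hs, hrs]; field_simp
    linear_combination this

/-- The discriminant relation identifying `cuspDisc` with an eta quotient. -/
lemma cuspDisc_thetaEleven (hq : ‖q‖ < 1) (hq0 : q ≠ 0) {r s ρ σ τ : ℂ}
    (H : ThetaCurve (thetaEleven q) r s ρ σ τ) :
    cuspDisc r s * (r * σ ^ 4) =
      ρ ^ 6 * s ^ 4 * τ ^ 18 * thetaEleven q 1 ^ 12 * q ^ 121 := by
  have hz : ∀ n : ℕ, (q ^ 11) ^ n = q ^ (11 * (n : ℤ)) := fun n => by
    rw [← pow_mul]; norm_cast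
  have hne : ∀ n : ℕ, ¬ (11 : ℤ) ∣ n → theta (q ^ 121) ((q ^ 11) ^ n) ≠ 0 := fun n hn => by
    rw [hz]; exact theta_zpow_ne_zero hq hq0 hn
  have hn1 : theta (q ^ 121) (q ^ 11) ≠ 0 := by simpa using hne 1 (by decide)
  obtain ⟨e₁, e₂, e₃, h1, h2, h3, h4⟩ := exists_half_period_values (Q := q ^ 121) (y := q ^ 11)
    (norm_pow_lt_one hq (by norm_num)) (pow_ne_zero _ hq0) (pow_ne_zero _ hq0) hn1
    (hne 2 (by decide)) (hne 3 (by decide)) (hne 4 (by decide))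
  have ht : ∀ (n : ℕ) (k : ℕ), 2 * (k : ℤ) = n * (11 - n) →
      theta (q ^ 121) ((q ^ 11) ^ n) = q ^ k * thetaEleven q n := fun n k hk => by
    have : (n : ℤ) * (n - 11) / 2 = -k := by have := two_mul_half n; lia
    rw [thetaEleven, this, hz, ← mul_assoc, zpow_neg, zpow_natCast,
      mul_inv_cancel₀ (pow_ne_zero _ hq0), one_mul]
  have t1 := ht 1 5 (by norm_num)
  have t2 := ht 2 9 (by norm_num)
  have t3 := ht 3 12 (by norm_num)
  have t4 := ht 4 14 (by norm_num)
  have t6 := ht 6 15 (by norm_num)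
  have := H.ne₁; have := H.ne₂; have := H.ne₃; have := H.ne₄
  push_cast at t1 t2 t3 t4 t6
  rw [pow_one] at t1
  generalize thetaEleven q = t at *
  have d2 : q ^ 11 * (q ^ 12 * t 3) / (q ^ 5 * t 1 * (q ^ 9 * t 2) ^ 2) =
      t 3 / (t 1 * t 2 ^ 2) := by field_simp
  have d3 : q ^ 11 * (q ^ 9 * t 2) * (q ^ 14 * t 4) / ((q ^ 5 * t 1) ^ 2 * (q ^ 12 * t 3) ^ 2) =
      t 2 * t 4 / (t 1 ^ 2 * t 3 ^ 2) := by field_simp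
  simp only [t1, t2, t3, t4, t6, d2, d3] at h1 h2 h3
  refine H.cuspDisc_eq (e₁ := e₁) (e₂ := e₂) (e₃ := e₃) ?_ ?_ ?_ h4
  · rw [h1]; field_simp
  · rw [h2]; field_simp
  · rw [h3]; field_simp

end

lemma tsum_eq_sum_residues {f : ℤ → ℂ} (hf : Summable f) (c : ℤ) :
    ∑' n, f n = ∑' m, f (11 * m + c) +
      ∑ b ∈ Finset.Icc (1 : ℤ) 5, (∑' m, f (11 * m + (c - b)) + ∑' m, f (11 * m + (c + b))) := by
  have h1 : Summable fun p : Fin 11 × ℤ => f (11 * p.2 + (c - 5 + (p.1 : ℕ))) := by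
    refine (((Equiv.prodComm _ _).trans ((Int.divModEquiv 11).symm.trans
      (Equiv.addRight (c - 5)))).summable_iff.mpr hf).congr fun p => ?_
    simp only [Function.comp, Equiv.trans_apply, Equiv.coe_addRight, Int.divModEquiv,
      Equiv.coe_fn_symm_mk, Equiv.prodComm_apply, Prod.fst_swap, Prod.snd_swap]
    congr 1; push_cast; ring
  have h2 : ∑' n, f n = ∑' p : Fin 11 × ℤ, f (11 * p.2 + (c - 5 + (p.1 : ℕ))) := by
    rw [← ((Equiv.prodComm _ _).trans ((Int.divModEquiv 11).symm.trans
      (Equiv.addRight (c - 5)))).tsum_eq f]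
    refine tsum_congr fun p => ?_
    simp only [Equiv.trans_apply, Equiv.coe_addRight, Int.divModEquiv,
      Equiv.coe_fn_symm_mk, Equiv.prodComm_apply, Prod.fst_swap, Prod.snd_swap]
    congr 1; push_cast; ring
  rw [h2, h1.tsum_prod, tsum_fintype, show Finset.Icc (1 : ℤ) 5 = {1, 2, 3, 4, 5} from rfl]
  simp only [Fin.sum_univ_succ, Fin.sum_univ_zero]
  repeat rw [Finset.sum_insert (by decide)]
  rw [Finset.sum_singleton]
  norm_num [Fin.val_succ, sub_add]
  ring

/-- The Lambert-type series dissected below; the term of index zero is omitted. -/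
noncomputable def lambert (q : ℂ) (a : ℤ) : ℂ :=
  ∑' n : ℤ, (-1) ^ n * q ^ (3 * tri n + (15 - 3 * a) * n) / (1 - q ^ (11 * n))

/-- The sum of theta quotients produced by the eleven-dissection of Euler's product. -/
noncomputable def eulerFactor (t : ℤ → ℂ) : ℂ :=
  1 + ∑ b ∈ Finset.Icc (1 : ℤ) 5, (-1) ^ b * (t (2 * b) / t b)

section

variable {q : ℂ}

lemma neg_one_zpow_eleven_mul_add (m c : ℤ) : (-1 : ℂ) ^ (11 * m + c) = (-1) ^ m * (-1) ^ c := by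
  rw [zpow_add₀ (by norm_num), zpow_mul]; norm_num

lemma neg_one_zpow_sub (a b : ℤ) : (-1 : ℂ) ^ (a - b) = (-1) ^ (a + b) := by
  rw [show a - b = a + b - (b + b) by ring, zpow_sub₀ (by norm_num), Even.neg_one_zpow ⟨b, rfl⟩,
    div_one]

lemma neg_one_zpow_neg (n : ℤ) : (-1 : ℂ) ^ (-n) = (-1) ^ n := by
  simpa using neg_one_zpow_sub 0 n

lemma thetaEleven_double_div (hq0 : q ≠ 0) (b : ℤ) :
    thetaEleven q (2 * b) / thetaEleven q b = q ^ (3 * tri b - 7 * b) *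
      (theta (q ^ 121) (q ^ (11 * b) * q ^ (11 * b)) / theta (q ^ 121) (q ^ (11 * b))) := by
  have h : 3 * tri b - 7 * b = 2 * b * (2 * b - 11) / 2 - b * (b - 11) / 2 := by
    have := two_mul_half (2 * b); have := two_mul_half b; have := two_mul_tri b; lia
  rw [thetaEleven, thetaEleven, h, zpow_sub₀ hq0, ← zpow_add₀ hq0, mul_div_mul_comm]
  congr 3; congr 1; ring

lemma appell_pow (hq0 : q ≠ 0) (a b : ℤ) :
    ∑' m, (-1) ^ (11 * m + (a + b)) * q ^ (3 * tri (11 * m + (a + b)) +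
      (15 - 3 * a) * (11 * m + (a + b))) / (1 - q ^ (11 * (11 * m + (a + b)))) =
    (-1) ^ (a + b) * q ^ (3 * tri (a + b) + (15 - 3 * a) * (a + b)) *
      appell (q ^ 121) (q ^ (33 * b)) (q ^ (11 * (a + b))) := by
  rw [appell, ← tsum_mul_left]
  refine tsum_congr fun m => ?_
  have h1 : 3 * tri (11 * m + (a + b)) + (15 - 3 * a) * (11 * m + (a + b)) =
      3 * tri (a + b) + (15 - 3 * a) * (a + b) + (121 * (3 * tri m) + 33 * b * m) := by
    have := two_mul_tri m; have := two_mul_tri (a + b); have := two_mul_tri (11 * m + (a + b))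
    lia
  have h2 : q ^ (11 * (11 * m + (a + b))) = q ^ (11 * (a + b)) * (q ^ 121) ^ m := by
    rw [← zpow_natCast q, ← zpow_mul, ← zpow_add₀ hq0]; congr 1; push_cast; ring
  rw [h1, h2, neg_one_zpow_eleven_mul_add, zpow_add₀ hq0, zpow_add₀ hq0 (121 * _),
    zpow_mul q 121, zpow_mul q (33 * b)]
  simp only [zpow_ofNat]
  ring

lemma triSum_pow (hq0 : q ≠ 0) (b : ℤ) :
    ∑' m, (-1) ^ (11 * m + (2 + b)) * q ^ (3 * tri (11 * m + (2 + b)) - 2 * (11 * m + (2 + b))) =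
    (-1) ^ b * q ^ (3 * tri (2 + b) - 2 * (2 + b)) *
      triSum (q ^ 121) (q ^ (33 * b) / q ^ 121) := by
  rw [triSum, ← tsum_mul_left]
  refine tsum_congr fun m => ?_
  have h1 : 3 * tri (11 * m + (2 + b)) - 2 * (11 * m + (2 + b)) =
      3 * tri (2 + b) - 2 * (2 + b) + (121 * (3 * tri m) + (33 * b - 121) * m) := by
    have := two_mul_tri m; have := two_mul_tri (2 + b); have := two_mul_tri (11 * m + (2 + b))
    lia
  have h2 : q ^ (33 * b) / q ^ 121 = q ^ (33 * b - 121) := by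
    rw [zpow_sub₀ hq0]; norm_cast
  rw [h1, h2, neg_one_zpow_eleven_mul_add, zpow_add₀ hq0, zpow_add₀ hq0 (121 * _),
    zpow_mul q 121, zpow_mul q (33 * b - 121), zpow_add₀ (by norm_num) 2 b]
  simp only [zpow_ofNat]
  ring

/-- The eleven-dissection of Euler's product. -/
lemma qProd_self_eq (hq : ‖q‖ < 1) (hq0 : q ≠ 0) :
    qProd q q = q ^ 5 * qProd (q ^ 121) (q ^ 121) * eulerFactor (thetaEleven q) := by
  have hQ : ‖q ^ 121‖ < 1 := norm_pow_lt_one hq (by norm_num)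
  have hQ0 : q ^ 121 ≠ 0 := pow_ne_zero _ hq0
  have h1 := hasSum_triSum hq hq0 (one_div_ne_zero hq0)
  rw [triSum_one_div hq hq0, ← (Equiv.neg ℤ).hasSum_iff] at h1
  have h2 : HasSum (fun n : ℤ => (-1) ^ n * q ^ (3 * tri n - 2 * n)) (qProd q q) := by
    refine h1.congr_fun fun n => ?_
    have : 3 * tri n - 2 * n = 3 * tri (-n) + -(-n) := by
      have := two_mul_tri n; have := two_mul_tri (-n); lia
    rw [this, zpow_add₀ hq0, Function.comp, Equiv.neg_apply, neg_one_zpow_neg, one_div,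
      inv_zpow', mul_assoc]
  rw [← h2.tsum_eq, tsum_eq_sum_residues h2.summable 2]
  have hpair : ∀ b ∈ Finset.Icc (1 : ℤ) 5,
      ∑' m, (-1) ^ (11 * m + (2 - b)) * q ^ (3 * tri (11 * m + (2 - b)) - 2 * (11 * m + (2 - b))) +
      ∑' m, (-1) ^ (11 * m + (2 + b)) * q ^ (3 * tri (11 * m + (2 + b)) - 2 * (11 * m + (2 + b)))
      = q ^ 5 * qProd (q ^ 121) (q ^ 121) *
        ((-1) ^ b * (thetaEleven q (2 * b) / thetaEleven q b)) := fun b hb => by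
    rw [Finset.mem_Icc] at hb
    have hζ := zpow_ne_zero (11 * b) hq0
    have n1 := theta_zpow_ne_zero hq hq0 (n := b) (by omega)
    have n2 := theta_zpow_ne_zero hq hq0 (n := 2 * b) (by omega)
    rw [show 11 * (2 * b) = 11 * b + 11 * b by ring, zpow_add₀ hq0] at n2
    have h3 := (appell_relation hQ hQ0 hζ n1 n2).2
    rw [triSum_one_div hQ hQ0] at h3
    have h4 := triSum_pow hq0 (-b)
    rw [← sub_eq_add_neg] at h4
    rw [h4, triSum_pow hq0, thetaEleven_double_div hq0]
    have e3 : q ^ (33 * b) = (q ^ (11 * b)) ^ 3 := by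
      rw [← zpow_natCast, ← zpow_mul]; congr 1; push_cast; ring
    have e4 : q ^ (33 * -b) = ((q ^ (11 * b)) ^ 3)⁻¹ := by rw [← e3, ← zpow_neg]; congr 1; ring
    have e5 : 3 * tri (2 - b) - 2 * (2 - b) = 5 + (3 * tri b - 7 * b) := by
      have := two_mul_tri b; have := two_mul_tri (2 - b); lia
    have e6 : 3 * tri (2 + b) - 2 * (2 + b) = 5 + (3 * tri b - 7 * b) + 11 * b := by
      have := two_mul_tri b; have := two_mul_tri (2 + b); lia
    rw [e3, e4, e5, e6, neg_one_zpow_neg, zpow_add₀ hq0 _ (11 * b), zpow_add₀ hq0 5]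
    apply mul_left_cancel₀ hζ
    simp only [zpow_ofNat]
    linear_combination (-1) ^ b * q ^ 5 * q ^ (3 * tri b - 7 * b) * h3
  rw [Finset.sum_congr rfl hpair, ← Finset.mul_sum]
  have h0 := triSum_pow hq0 0
  simp only [mul_zero, add_zero, pow_zero, triSum_one_div hQ hQ0, one_mul, show tri 2 = 3 from rfl,
    show (3 : ℤ) * 3 - 2 * 2 = 5 from rfl, zpow_ofNat] at h0
  rw [h0, eulerFactor]
  ring

lemma pairTerm_thetaEleven (hq0 : q ≠ 0) {a b : ℤ} (hab : a ≠ b) :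
    pairTerm (thetaEleven q) a b = q ^ (3 * tri (a - b) + (15 - 3 * a) * (a - b)) *
      (theta (q ^ 121) (q ^ (11 * b)) * theta (q ^ 121) (q ^ (11 * b) * q ^ (11 * b)) /
        thetaTriple (q ^ 121) (q ^ (11 * b)) (q ^ (11 * a))) := by
  have h : 3 * tri (a - b) + (15 - 3 * a) * (a - b) = b * (b - 11) / 2 +
      2 * b * (2 * b - 11) / 2 - ((a - b) * (a - b - 11) / 2 + a * (a - 11) / 2 +
      (a + b) * (a + b - 11) / 2) := by
    have := two_mul_half (2 * b); have := two_mul_half b; have := two_mul_tri (a - b)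
    have := two_mul_half (a - b); have := two_mul_half (a + b); have := two_mul_half a
    lia
  rw [pairTerm, if_neg hab, h, thetaTriple, zpow_sub₀ hq0, zpow_add₀ hq0, zpow_add₀ hq0 (_ + _),
    zpow_add₀ hq0 ((a - b) * (a - b - 11) / 2)]
  simp only [thetaEleven]
  rw [show 11 * (2 * b) = 11 * b + 11 * b by ring, show 11 * (a - b) = 11 * a + -(11 * b) by ring,
    show 11 * (a + b) = 11 * a + 11 * b by ring]
  simp only [zpow_add₀ hq0, zpow_neg]
  rw [div_mul_div_comm]
  congr 1 <;> ring

/-- The sum of the logarithmic derivatives of theta appearing in the dissection. -/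
noncomputable def thetaLogSum (q : ℂ) (a : ℤ) : ℂ :=
  thetaLog (q ^ 121) (q ^ (11 * a)) + thetaLog (q ^ 121) (q ^ (11 * (2 * a)))

/-- The eleven-dissection of the Lambert-type series. -/
lemma lambert_eq (hq : ‖q‖ < 1) (hq0 : q ≠ 0) {a : ℤ} (ha : a ∈ Finset.Icc (1 : ℤ) 5) :
    lambert q a = (-1) ^ a * q ^ (3 * tri a + (15 - 3 * a) * a) *
      appell (q ^ 121) 1 (q ^ (11 * a)) * eulerFactor (thetaEleven q) + thetaLogSum q a +
      qProd (q ^ 121) (q ^ 121) ^ 2 * ∑ b ∈ Finset.Icc (1 : ℤ) 5,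
        if a = b then 0 else (-1) ^ (a + b) * pairTerm (thetaEleven q) a b := by
  have hQ : ‖q ^ 121‖ < 1 := norm_pow_lt_one hq (by norm_num)
  have hQ0 : q ^ 121 ≠ 0 := pow_ne_zero _ hq0
  have hs : Summable fun n : ℤ =>
      (-1) ^ n * q ^ (3 * tri n + (15 - 3 * a) * n) / (1 - q ^ (11 * n)) := by
    have h := ((summable_tri hq hq0 (zpow_ne_zero (15 - 3 * a) hq0)).div_one_sub_zpow
      (norm_pow_lt_one hq (n := 11) (by norm_num)) (pow_ne_zero 11 hq0) one_ne_zero).of_norm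
    refine h.congr fun n => ?_
    have : q ^ (11 * n) = (q ^ 11) ^ n := by rw [zpow_mul, zpow_ofNat]
    rw [zpow_add₀ hq0, zpow_mul q (15 - 3 * a), one_mul, this, mul_assoc]
  rw [lambert, tsum_eq_sum_residues hs a]
  have hpair : ∀ b ∈ Finset.Icc (1 : ℤ) 5,
      ∑' m, (-1) ^ (11 * m + (a - b)) * q ^ (3 * tri (11 * m + (a - b)) +
        (15 - 3 * a) * (11 * m + (a - b))) / (1 - q ^ (11 * (11 * m + (a - b)))) +
      ∑' m, (-1) ^ (11 * m + (a + b)) * q ^ (3 * tri (11 * m + (a + b)) +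
        (15 - 3 * a) * (11 * m + (a + b))) / (1 - q ^ (11 * (11 * m + (a + b)))) =
      (-1) ^ a * q ^ (3 * tri a + (15 - 3 * a) * a) * appell (q ^ 121) 1 (q ^ (11 * a)) *
        ((-1) ^ b * (thetaEleven q (2 * b) / thetaEleven q b)) +
      ((if a = b then thetaLogSum q a else 0) + qProd (q ^ 121) (q ^ 121) ^ 2 *
        if a = b then 0 else (-1) ^ (a + b) * pairTerm (thetaEleven q) a b) := fun b hb => by
    rw [Finset.mem_Icc] at ha hb
    have hζ := zpow_ne_zero (11 * b) hq0
    have hz := zpow_ne_zero (11 * a) hq0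
    have n1 := theta_zpow_ne_zero hq hq0 (n := b) (by omega)
    have n2 := theta_zpow_ne_zero hq hq0 (n := 2 * b) (by omega)
    rw [show 11 * (2 * b) = 11 * b + 11 * b by ring, zpow_add₀ hq0] at n2
    have h4 := appell_pow hq0 a (-b)
    rw [← sub_eq_add_neg] at h4
    have e3 : q ^ (33 * b) = (q ^ (11 * b)) ^ 3 := by
      rw [← zpow_natCast, ← zpow_mul]; congr 1; push_cast; ring
    have e4 : q ^ (33 * -b) = ((q ^ (11 * b)) ^ 3)⁻¹ := by rw [← e3, ← zpow_neg]; congr 1; ring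
    have e5 : q ^ (11 * (a - b)) = q ^ (11 * a) * (q ^ (11 * b))⁻¹ := by
      rw [← zpow_neg, ← zpow_add₀ hq0]; congr 1; ring
    have e6 : q ^ (11 * (a + b)) = q ^ (11 * a) * q ^ (11 * b) := by
      rw [← zpow_add₀ hq0]; congr 1; ring
    have e7 : q ^ (3 * tri (a + b) + (15 - 3 * a) * (a + b)) =
        q ^ (3 * tri (a - b) + (15 - 3 * a) * (a - b)) * (q ^ (11 * b)) ^ 3 := by
      rw [← e3, ← zpow_add₀ hq0]; congr 1
      have := two_mul_tri (a + b); have := two_mul_tri (a - b); lia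
    have e8 : q ^ (3 * tri (a - b) + (15 - 3 * a) * (a - b)) * q ^ (11 * b) =
        q ^ (3 * tri a + (15 - 3 * a) * a) * q ^ (3 * tri b - 7 * b) := by
      rw [← zpow_add₀ hq0, ← zpow_add₀ hq0]; congr 1
      have := two_mul_tri a; have := two_mul_tri (a - b); have := two_mul_tri b; lia
    rw [h4, appell_pow hq0, thetaEleven_double_div hq0, neg_one_zpow_sub, e3, e4, e5, e6, e7]
    have e9 : (-1 : ℂ) ^ (a + b) = (-1) ^ a * (-1) ^ b := zpow_add₀ (by norm_num) _ _
    by_cases hab : a = b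
    · subst hab
      have h3 := appell_relation_self hQ hQ0 hζ n1 n2
      rw [if_pos rfl, if_pos rfl, mul_inv_cancel₀ hz, thetaLogSum,
        show 11 * (2 * a) = 11 * a + 11 * a by ring, zpow_add₀ hq0 (11 * a) (11 * a)]
      have e10 : q ^ (3 * tri (a - a) + (15 - 3 * a) * (a - a)) = 1 := by simp [tri]
      have e11 : (-1 : ℂ) ^ a * (-1) ^ a = 1 := by rw [← e9, Even.neg_one_zpow ⟨a, rfl⟩]
      rw [e10, e9]
      rw [e10] at e8
      linear_combination (-1) ^ a * (-1) ^ a * h3 + (-1) ^ a * (-1) ^ a *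
        (theta (q ^ 121) (q ^ (11 * a) * q ^ (11 * a)) / theta (q ^ 121) (q ^ (11 * a)) *
        appell (q ^ 121) 1 (q ^ (11 * a))) * e8 + (thetaLog (q ^ 121) (q ^ (11 * a)) +
          thetaLog (q ^ 121) (q ^ (11 * a) * q ^ (11 * a))) * e11
    · have hne : ∀ c : ℤ, ¬ (11 : ℤ) ∣ c → ∀ n : ℤ, q ^ (11 * c) * (q ^ 121) ^ n ≠ 1 :=
        fun c hc n => by
          rw [← zpow_natCast q, ← zpow_mul, ← zpow_add₀ hq0]
          exact zpow_ne_one hq (by push_cast; omega)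
      have h3 := (appell_relation hQ hQ0 hζ n1 n2).1 (q ^ (11 * a)) hz (hne a (by omega))
        (by rw [← e6]; exact hne _ (by omega)) (by rw [← e5]; exact hne _ (by omega))
      rw [if_neg hab, if_neg hab, pairTerm_thetaEleven hq0 hab, e9]
      linear_combination (-1) ^ a * (-1) ^ b * q ^ (3 * tri (a - b) + (15 - 3 * a) * (a - b)) * h3 +
        (-1) ^ a * (-1) ^ b * (theta (q ^ 121) (q ^ (11 * b) * q ^ (11 * b)) /
        theta (q ^ 121) (q ^ (11 * b)) * appell (q ^ 121) 1 (q ^ (11 * a))) * e8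
  rw [Finset.sum_congr rfl hpair, Finset.sum_add_distrib, Finset.sum_add_distrib, ← Finset.mul_sum,
    ← Finset.mul_sum, Finset.sum_ite_eq, if_pos ha]
  have h0 := appell_pow hq0 a 0
  simp only [mul_zero, add_zero, zpow_ofNat, pow_zero] at h0
  rw [h0, eulerFactor]
  ring

end

lemma ThetaCurve.eulerFactor_eq {t : ℤ → ℂ} {r s ρ σ τ : ℂ} (H : ThetaCurve t r s ρ σ τ) :
    eulerFactor t =
      1 - τ + (s - r) * τ ^ 3 - s * ρ * τ ^ 4 + r * σ ^ 2 * τ ^ 5 + s * ρ ^ 2 * σ * τ ^ 9 := by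
  obtain ⟨h6, h7, h8, h9, h10, -⟩ := H.values
  obtain ⟨-, -, hρ0, -, -⟩ := H.ne
  have h : (s - r) = -(r * σ ^ 3 / ρ) := by
    field_simp
    rw [← H.sub_one_r, ← H.sub_one_s]
    linear_combination -H.curve
  have := H.ne₁; have := H.ne₂; have := H.ne₃; have := H.ne₄; have := H.ne₅
  rw [h, eulerFactor, show Finset.Icc (1 : ℤ) 5 = {1, 2, 3, 4, 5} from rfl]
  repeat rw [Finset.sum_insert (by decide)]
  rw [Finset.sum_singleton]
  norm_num [h6, h8, h10]
  obtain ⟨-, -, -, -, -, -, -, rfl, rfl, rfl, rfl, rfl, -, -, -⟩ := H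
  field_simp
  ring

section

variable {q : ℂ}

lemma thetaLog_pow_neg (hq : ‖q‖ < 1) (hq0 : q ≠ 0) {n : ℤ} (hn : ¬ (11 : ℤ) ∣ n) :
    thetaLog (q ^ 121) (q ^ (11 * -n)) = 1 - thetaLog (q ^ 121) (q ^ (11 * n)) := by
  rw [mul_neg, zpow_neg, thetaLog_inv (norm_pow_lt_one hq (by norm_num)) (zpow_ne_zero _ hq0)
    (theta_zpow_ne_zero hq hq0 hn)]

lemma thetaLog_pow_add (hq : ‖q‖ < 1) (hq0 : q ≠ 0) {n : ℤ} (hn : ¬ (11 : ℤ) ∣ n) :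
    thetaLog (q ^ 121) (q ^ (11 * (n + 11))) = thetaLog (q ^ 121) (q ^ (11 * n)) - 1 := by
  rw [← thetaLog_mul (norm_pow_lt_one hq (by norm_num)) (pow_ne_zero _ hq0) (zpow_ne_zero _ hq0)
    (theta_zpow_ne_zero hq hq0 hn), mul_add, add_comm, zpow_add₀ hq0]
  norm_cast

lemma thetaLog_pow_sub (hq : ‖q‖ < 1) (hq0 : q ≠ 0) {n : ℤ} (hn : ¬ (11 : ℤ) ∣ n) :
    thetaLog (q ^ 121) (q ^ (11 * (11 - n))) = -thetaLog (q ^ 121) (q ^ (11 * n)) := by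
  rw [sub_eq_neg_add, thetaLog_pow_add hq hq0 (by simpa using hn), thetaLog_pow_neg hq hq0 hn]
  ring

lemma thetaLogSum_sub (hq : ‖q‖ < 1) (hq0 : q ≠ 0) {n : ℤ} (hn : ¬ (11 : ℤ) ∣ n) :
    thetaLogSum q (11 - n) = -1 - thetaLogSum q n := by
  rw [thetaLogSum, thetaLogSum, thetaLog_pow_sub hq hq0 hn,
    show 2 * (11 - n) = (11 - 2 * n) + 11 by ring, thetaLog_pow_add hq hq0 (by omega),
    thetaLog_pow_sub hq hq0 (by omega)]
  ring

lemma two_mul_thetaLogSum_sub (hq : ‖q‖ < 1) (hq0 : q ≠ 0) {a : ℤ} (ha : ¬ (11 : ℤ) ∣ a) :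
    2 * thetaLogSum q a - thetaLogSum q (2 * a) =
      1 - qProd (q ^ 121) (q ^ 121) ^ 2 * pairTerm (thetaEleven q) a a := by
  have hp : ∀ k : ℕ, (q ^ (11 * a)) ^ k = q ^ (11 * (k * a)) := fun k => by
    rw [← zpow_natCast, ← zpow_mul]; congr 1; ring
  have h1 := theta_zpow_ne_zero hq hq0 ha
  have h2 := theta_zpow_ne_zero hq hq0 (n := 2 * a) (by omega)
  have h4 := theta_zpow_ne_zero hq hq0 (n := 4 * a) (by omega)
  have hp2 := hp 2
  have hp3 := hp 3
  have hp4 := hp 4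
  push_cast at hp2 hp3 hp4
  have h := thetaLog_duplication (norm_pow_lt_one hq (n := 121) (by norm_num)) (pow_ne_zero _ hq0)
    (zpow_ne_zero (11 * a) hq0) h1 (by rwa [hp2]) (by rwa [hp4])
  rw [hp2, hp3, hp4] at h
  have hP : pairTerm (thetaEleven q) a a = theta (q ^ 121) (q ^ (11 * (3 * a))) ^ 2 /
      (theta (q ^ 121) (q ^ (11 * a)) ^ 2 * theta (q ^ 121) (q ^ (11 * (4 * a)))) := by
    have e : q ^ (3 * a * (3 * a - 11) / 2) * q ^ (3 * a * (3 * a - 11) / 2) =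
        q ^ (a * (a - 11) / 2) * q ^ (a * (a - 11) / 2) * q ^ (4 * a * (4 * a - 11) / 2) := by
      rw [← zpow_add₀ hq0, ← zpow_add₀ hq0, ← zpow_add₀ hq0]; congr 1
      have := two_mul_half a; have := two_mul_half (3 * a); have := two_mul_half (4 * a); lia
    have := zpow_ne_zero (a * (a - 11) / 2) hq0
    have := zpow_ne_zero (4 * a * (4 * a - 11) / 2) hq0
    rw [pairTerm, if_pos rfl]
    simp only [thetaEleven]
    rw [div_eq_div_iff (by positivity) (by positivity)]
    linear_combination theta (q ^ 121) (q ^ (11 * (3 * a))) ^ 2 *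
      theta (q ^ 121) (q ^ (11 * a)) ^ 2 * theta (q ^ 121) (q ^ (11 * (4 * a))) * e
  rw [hP, thetaLogSum, thetaLogSum, show 2 * (2 * a) = 4 * a by ring]
  linear_combination h

/-- A combination of the Lambert-type series as a combination of Appell sums and theta
quotients. -/
lemma sum_lambert_eq (hq : ‖q‖ < 1) (hq0 : q ≠ 0) {κ μ : ℤ → ℂ} (h1 : κ 1 = 2 * μ 1 + μ 5)
    (h2 : κ 2 = 2 * μ 2 - μ 1) (h3 : κ 3 = 2 * μ 3 + μ 4) (h4 : κ 4 = 2 * μ 4 - μ 2)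
    (h5 : κ 5 = 2 * μ 5 + μ 3) :
    ∑ a ∈ Finset.Icc (1 : ℤ) 5, κ a * lambert q a = μ 1 + μ 2 +
      (∑ a ∈ Finset.Icc (1 : ℤ) 5, κ a * (-1) ^ a * appell (q ^ 121) 1 (q ^ (11 * a)) *
        q ^ (3 * tri a + (15 - 3 * a) * a)) * eulerFactor (thetaEleven q) +
      qProd (q ^ 121) (q ^ 121) ^ 2 * ∑ a ∈ Finset.Icc (1 : ℤ) 5, ∑ b ∈ Finset.Icc (1 : ℤ) 5,
        thetaCoeff κ μ a b * pairTerm (thetaEleven q) a b := by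
  have hg : ∑ a ∈ Finset.Icc (1 : ℤ) 5, κ a * thetaLogSum q a = μ 1 + μ 2 -
      qProd (q ^ 121) (q ^ 121) ^ 2 *
        ∑ a ∈ Finset.Icc (1 : ℤ) 5, μ a * pairTerm (thetaEleven q) a a := by
    have d1 := two_mul_thetaLogSum_sub hq hq0 (a := 1) (by decide)
    have d2 := two_mul_thetaLogSum_sub hq hq0 (a := 2) (by decide)
    have d3 := two_mul_thetaLogSum_sub hq hq0 (a := 3) (by decide)
    have d4 := two_mul_thetaLogSum_sub hq hq0 (a := 4) (by decide)
    have d5 := two_mul_thetaLogSum_sub hq hq0 (a := 5) (by decide)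
    have r1 := thetaLogSum_sub hq hq0 (n := 1) (by decide)
    have r3 := thetaLogSum_sub hq hq0 (n := 3) (by decide)
    have r5 := thetaLogSum_sub hq hq0 (n := 5) (by decide)
    norm_num at d1 d2 d3 d4 d5 r1 r3 r5
    rw [show Finset.Icc (1 : ℤ) 5 = {1, 2, 3, 4, 5} from rfl]
    repeat rw [Finset.sum_insert (by decide)]
    rw [Finset.sum_singleton, Finset.sum_singleton, h1, h2, h3, h4, h5]
    linear_combination μ 1 * d1 + μ 2 * d2 + μ 3 * d3 + μ 4 * d4 + μ 5 * d5 + μ 3 * r5 +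
      μ 4 * r3 + μ 5 * r1
  have hX : ∀ a ∈ Finset.Icc (1 : ℤ) 5, ∑ b ∈ Finset.Icc (1 : ℤ) 5,
      thetaCoeff κ μ a b * pairTerm (thetaEleven q) a b =
      κ a * (∑ b ∈ Finset.Icc (1 : ℤ) 5,
        if a = b then 0 else (-1) ^ (a + b) * pairTerm (thetaEleven q) a b) -
      μ a * pairTerm (thetaEleven q) a a := fun a ha => by
    rw [Finset.mul_sum, ← Finset.sum_ite_eq_of_mem (Finset.Icc (1 : ℤ) 5) a
      (fun b => μ a * pairTerm (thetaEleven q) a b) ha, ← Finset.sum_sub_distrib]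
    refine Finset.sum_congr rfl fun b _ => ?_
    rw [thetaCoeff]
    split_ifs <;> ring
  have hS : ∀ a ∈ Finset.Icc (1 : ℤ) 5, κ a * lambert q a =
      κ a * (-1) ^ a * appell (q ^ 121) 1 (q ^ (11 * a)) *
        q ^ (3 * tri a + (15 - 3 * a) * a) * eulerFactor (thetaEleven q) +
      κ a * thetaLogSum q a + qProd (q ^ 121) (q ^ 121) ^ 2 * (κ a * ∑ b ∈ Finset.Icc (1 : ℤ) 5,
        if a = b then 0 else (-1) ^ (a + b) * pairTerm (thetaEleven q) a b) := fun a ha => by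
    rw [lambert_eq hq hq0 ha]; ring
  rw [Finset.sum_congr rfl hS, Finset.sum_add_distrib, Finset.sum_add_distrib, hg,
    Finset.sum_congr rfl hX, Finset.sum_sub_distrib, ← Finset.mul_sum, ← Finset.sum_mul]
  ring

end

/-- `φ` has nonnegative coefficients and sums to `f` on the open unit disc. -/
def HasNonnegSeries (φ : PowerSeries ℝ) (f : ℂ → ℂ) : Prop :=
  (∀ n, 0 ≤ φ.coeff n) ∧ ∀ y : ℂ, ‖y‖ < 1 → HasSum (fun n => ((φ.coeff n : ℝ) : ℂ) * y ^ n) (f y)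

namespace HasNonnegSeries

lemma congr {φ : PowerSeries ℝ} {f g : ℂ → ℂ} (h : HasNonnegSeries φ f)
    (hfg : ∀ y, ‖y‖ < 1 → f y = g y) : HasNonnegSeries φ g :=
  ⟨h.1, fun y hy => hfg y hy ▸ h.2 y hy⟩

lemma add {φ ψ : PowerSeries ℝ} {f g : ℂ → ℂ} (h : HasNonnegSeries φ f)
    (h' : HasNonnegSeries ψ g) : HasNonnegSeries (φ + ψ) (fun y => f y + g y) :=
  ⟨fun n => by simpa using add_nonneg (h.1 n) (h'.1 n), fun y hy => by
    simpa [add_mul] using (h.2 y hy).add (h'.2 y hy)⟩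

lemma mul {φ ψ : PowerSeries ℝ} {f g : ℂ → ℂ} (h : HasNonnegSeries φ f)
    (h' : HasNonnegSeries ψ g) : HasNonnegSeries (φ * ψ) (fun y => f y * g y) := by
  refine ⟨fun n => ?_, fun y hy => ?_⟩
  · rw [PowerSeries.coeff_mul]
    exact Finset.sum_nonneg fun p _ => mul_nonneg (h.1 _) (h'.1 _)
  · have h1 := (h.2 y hy).summable.norm
    have h2 := (h'.2 y hy).summable.norm
    have := tsum_mul_tsum_eq_tsum_sum_antidiagonal_of_summable_norm h1 h2
    rw [(h.2 y hy).tsum_eq, (h'.2 y hy).tsum_eq] at this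
    simp only [this]
    refine (summable_norm_sum_mul_antidiagonal_of_summable_norm h1 h2).of_norm.hasSum.congr_fun ?_
    intro n
    rw [PowerSeries.coeff_mul, Complex.ofReal_sum, Finset.sum_mul]
    refine Finset.sum_congr rfl fun p hp => ?_
    rw [← Finset.HasAntidiagonal.mem_antidiagonal.1 hp, pow_add]
    push_cast
    ring

lemma X_pow (m : ℕ) : HasNonnegSeries (PowerSeries.X ^ m) (fun y => y ^ m) := by
  refine ⟨fun n => ?_, fun y _ => ?_⟩
  · rw [PowerSeries.coeff_X_pow]; positivity
  · convert hasSum_ite_eq m (y ^ m) using 2 with n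
    rw [PowerSeries.coeff_X_pow]
    split_ifs with h <;> simp [h]

lemma one : HasNonnegSeries 1 (fun _ => 1) := by simpa using X_pow 0

lemma prod {ι : Type*} (s : Finset ι) {φ : ι → PowerSeries ℝ} {f : ι → ℂ → ℂ}
    (h : ∀ i ∈ s, HasNonnegSeries (φ i) (f i)) :
    HasNonnegSeries (∏ i ∈ s, φ i) (fun y => ∏ i ∈ s, f i y) := by
  classical
  induction s using Finset.induction_on with
  | empty => simpa using one
  | insert i s hi ih =>
    simp only [Finset.prod_insert hi]
    exact (h i (by simp)).mul (ih fun j hj => h j (by simp [hj]))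

lemma pow {φ : PowerSeries ℝ} {f : ℂ → ℂ} (h : HasNonnegSeries φ f) (m : ℕ) :
    HasNonnegSeries (φ ^ m) (fun y => f y ^ m) := by
  simpa using prod (Finset.range m) (fun _ _ => h)

lemma sum {ι : Type*} (s : Finset ι) {φ : ι → PowerSeries ℝ} {f : ι → ℂ → ℂ}
    (h : ∀ i ∈ s, HasNonnegSeries (φ i) (f i)) :
    HasNonnegSeries (∑ i ∈ s, φ i) (fun y => ∑ i ∈ s, f i y) := by
  refine ⟨fun n => ?_, fun y hy => ?_⟩
  · rw [map_sum]
    exact Finset.sum_nonneg fun i hi => (h i hi).1 n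
  · convert hasSum_sum fun i hi => (h i hi).2 y hy using 2 with n
    rw [map_sum, Complex.ofReal_sum, Finset.sum_mul]

lemma hasSum_real {φ : PowerSeries ℝ} {f : ℂ → ℂ} (h : HasNonnegSeries φ f) {x : ℝ}
    (h0 : 0 ≤ x) (h1 : x < 1) : HasSum (fun n => φ.coeff n * x ^ n) (f x).re := by
  convert Complex.hasSum_re (h.2 x (by simpa [abs_of_nonneg h0] using h1)) using 2 with n
  rw [← Complex.ofReal_pow, ← Complex.ofReal_mul, Complex.ofReal_re]

lemma coeff_mul_pow_le {φ : PowerSeries ℝ} {f : ℂ → ℂ} (h : HasNonnegSeries φ f) {x : ℝ}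
    (h0 : 0 ≤ x) (h1 : x < 1) (n : ℕ) : φ.coeff n * x ^ n ≤ (f x).re :=
  le_hasSum (h.hasSum_real h0 h1) n fun m _ => mul_nonneg (h.1 m) (pow_nonneg h0 m)

lemma of_tendsto {ι : Type*} {l : Filter ι} [l.NeBot] {φ : ι → PowerSeries ℝ} {f : ι → ℂ → ℂ}
    {Φ : PowerSeries ℝ} {F : ℂ → ℂ} (h : ∀ i, HasNonnegSeries (φ i) (f i))
    (hf : ∀ y, ‖y‖ < 1 → Tendsto (fun i => f i y) l (𝓝 (F y)))
    (hφ : ∀ n, Tendsto (fun i => (φ i).coeff n) l (𝓝 (Φ.coeff n))) : HasNonnegSeries Φ F := by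
  refine ⟨fun n => ge_of_tendsto' (hφ n) fun i => (h i).1 n, fun y hy => ?_⟩
  obtain ⟨x, hyx, hx1⟩ := exists_between hy
  have hx0 : 0 < x := (norm_nonneg y).trans_lt hyx
  set M := (F x).re + 1
  have hM : ∀ᶠ i in l, (f i x).re < M :=
    ((Complex.continuous_re.tendsto _).comp
      (hf x (by simpa [abs_of_pos hx0] using hx1))).eventually_lt_const (by simp [M])
  have hb : ∀ᶠ i in l, ∀ n, ‖(((φ i).coeff n : ℝ) : ℂ) * y ^ n‖ ≤ M * (‖y‖ / x) ^ n := by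
    filter_upwards [hM] with i hi n
    have h1 := ((h i).coeff_mul_pow_le hx0.le hx1 n).trans hi.le
    rw [norm_mul, norm_pow, Complex.norm_real, Real.norm_of_nonneg ((h i).1 n), div_pow,
      ← mul_div_assoc, le_div_iff₀ (by positivity), mul_right_comm]
    gcongr
  have hs : Summable fun n : ℕ => M * (‖y‖ / x) ^ n :=
    (summable_geometric_of_lt_one (by positivity) ((div_lt_one hx0).2 hyx)).mul_left M
  have hlim : ∀ n, Tendsto (fun i => (((φ i).coeff n : ℝ) : ℂ) * y ^ n) l
      (𝓝 (((Φ.coeff n : ℝ) : ℂ) * y ^ n)) := fun n =>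
    ((Complex.continuous_ofReal.tendsto _).comp (hφ n)).mul_const _
  have h2 := tendsto_tsum_of_dominated_convergence hs hlim hb
  simp only [((h _).2 y hy).tsum_eq] at h2
  rw [tendsto_nhds_unique (hf y hy) h2]
  refine (Summable.of_norm_bounded hs fun n => ?_).hasSum
  exact le_of_tendsto (hlim n).norm (hb.mono fun i hi => hi n)

lemma exists_of_tendsto {φ : ℕ → PowerSeries ℝ} {f : ℕ → ℂ → ℂ} {F : ℂ → ℂ}
    (h : ∀ i, HasNonnegSeries (φ i) (f i))
    (hf : ∀ y, ‖y‖ < 1 → Tendsto (fun i => f i y) atTop (𝓝 (F y))) :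
    ∃ Φ, HasNonnegSeries Φ F := by
  have hb : ∀ n, ∃ c, Tendsto (fun i => (φ i).coeff n) (hyperfilter ℕ : Filter ℕ) (𝓝 c) := by
    intro n
    have h1 : Tendsto (fun i => (f i ((1 / 2 : ℝ) : ℂ)).re) atTop (𝓝 (F ((1 / 2 : ℝ) : ℂ)).re) :=
      (Complex.continuous_re.tendsto _).comp (hf _ (by norm_num))
    obtain ⟨B, hB⟩ := h1.bddAbove_range
    have hmem : ∀ i, (φ i).coeff n ∈ Set.Icc 0 (B * 2 ^ n) := fun i => by
      refine ⟨(h i).1 n, ?_⟩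
      have h2 := ((h i).coeff_mul_pow_le (x := 1 / 2) (by norm_num) (by norm_num) n).trans
        (hB ⟨i, rfl⟩)
      rwa [div_pow, one_pow, mul_one_div, div_le_iff₀ (by positivity)] at h2
    obtain ⟨c, -, hc⟩ := isCompact_Icc.ultrafilter_le_nhds
      ((hyperfilter ℕ).map fun i => (φ i).coeff n) (by
        rw [le_principal_iff]
        exact mem_map.2 (univ_mem' hmem))
    exact ⟨c, hc⟩
  choose c hc using hb
  exact ⟨PowerSeries.mk c, of_tendsto h
    (fun y hy => (hf y hy).mono_left (Nat.hyperfilter_le_atTop)) (by simpa using hc)⟩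

open scoped PowerSeries.WithPiTopology in
lemma geometric {m : ℕ} (hm : m ≠ 0) :
    HasNonnegSeries (∑' j : ℕ, PowerSeries.X ^ (m * j)) (fun y => (1 - y ^ m)⁻¹) := by
  have hs : Summable fun j : ℕ => (PowerSeries.X ^ (m * j) : PowerSeries ℝ) := by
    simp_rw [pow_mul]
    exact PowerSeries.WithPiTopology.summable_pow_of_constantCoeff_eq_zero (by simp [hm])
  refine of_tendsto (l := atTop) (fun i => sum (Finset.range i) fun j _ => X_pow (m * j))
    (fun y hy => ?_) fun n => ?_
  · simp_rw [pow_mul]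
    exact (hasSum_geometric_of_norm_lt_one
      (by simpa using pow_lt_one₀ (norm_nonneg y) hy hm)).tendsto_sum_nat
  · exact ((PowerSeries.WithPiTopology.continuous_coeff ℝ n).tendsto _).comp
      hs.hasSum.tendsto_sum_nat

end HasNonnegSeries

open scoped PowerSeries.WithPiTopology in
lemma hasNonnegSeries_partition : HasNonnegSeries
    (PowerSeries.mk fun n => (Fintype.card (Nat.Partition n) : ℝ)) (fun y => (qProd y y)⁻¹) := by
  have hp := Nat.Partition.hasProd_powerSeriesMk_card_restricted ℝ (fun _ => True)
  have hr : ∀ n, (Nat.Partition.restricted n fun _ => True) = Finset.univ := fun n => by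
    simp [Nat.Partition.restricted]
  simp only [if_true, hr, Finset.card_univ] at hp
  refine HasNonnegSeries.of_tendsto (l := atTop)
    (fun i => HasNonnegSeries.prod (Finset.range i) fun j _ =>
      HasNonnegSeries.geometric (Nat.succ_ne_zero j)) (fun y hy => ?_) fun n => ?_
  · simp only [Finset.prod_inv_distrib]
    have h0 : qProd y y ≠ 0 := qProd_ne_zero hy fun n hn => by
      rw [← pow_succ'] at hn
      have := congrArg norm hn
      rw [norm_pow, norm_one] at this
      exact (pow_lt_one₀ (norm_nonneg y) hy (Nat.succ_ne_zero n)).ne this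
    refine Tendsto.inv₀ ?_ h0
    simpa [pow_succ', qProd] using (multipliable_qProd hy y).hasProd.tendsto_prod_nat
  · exact ((PowerSeries.WithPiTopology.continuous_coeff ℝ n).tendsto _).comp
      hp.tendsto_prod_nat

lemma pow_ne_one_of_norm_lt_one {y : ℂ} (hy : ‖y‖ < 1) {n : ℕ} (hn : n ≠ 0) : y ^ n ≠ 1 :=
  fun h => by
  have := congrArg norm h
  rw [norm_pow, norm_one] at this
  exact (pow_lt_one₀ (norm_nonneg y) hy hn).ne this

lemma qProd_pow_ne_zero {y : ℂ} (hy : ‖y‖ < 1) {m a : ℕ} (hm : m ≠ 0) (ha : a ≠ 0) :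
    qProd (y ^ m) (y ^ a) ≠ 0 :=
  qProd_ne_zero (by simpa using pow_lt_one₀ (norm_nonneg y) hy hm) fun n => by
    rw [← pow_mul, ← pow_add]
    exact pow_ne_one_of_norm_lt_one hy (by omega)

lemma tendsto_prod_qProd {y : ℂ} (hy : ‖y‖ < 1) {m : ℕ} (hm : m ≠ 0) (a : ℕ) :
    Tendsto (fun i => ∏ n ∈ Finset.range i, (1 - y ^ (a + m * n))) atTop
      (𝓝 (qProd (y ^ m) (y ^ a))) := by
  have h := multipliable_qProd (Q := y ^ m) (by simpa using pow_lt_one₀ (norm_nonneg y) hy hm)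
    (y ^ a)
  simpa [qProd, pow_add, pow_mul] using h.hasProd.tendsto_prod_nat

lemma exists_hasNonnegSeries_inv_qProd {m a : ℕ} (hm : m ≠ 0) (ha : a ≠ 0) :
    ∃ φ, HasNonnegSeries φ (fun y => (qProd (y ^ m) (y ^ a))⁻¹) := by
  refine HasNonnegSeries.exists_of_tendsto
    (fun i => HasNonnegSeries.prod (Finset.range i) fun n _ =>
      HasNonnegSeries.geometric (m := a + m * n) (by omega)) fun y hy => ?_
  simp only [Finset.prod_inv_distrib]
  exact (tendsto_prod_qProd hy hm a).inv₀ (qProd_pow_ne_zero hy hm ha)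

lemma exists_hasNonnegSeries_one_sub_mul {a b : ℕ} (ha : a ≠ 0) (hb : b ≠ 0) :
    ∃ φ, HasNonnegSeries φ (fun y => (1 - y ^ (a + b)) / ((1 - y ^ a) * (1 - y ^ b))) :=
  ⟨_, (((HasNonnegSeries.X_pow a).mul (HasNonnegSeries.geometric ha)).add
    (HasNonnegSeries.geometric hb)).congr fun y hy => by
      have h1 := sub_ne_zero.2 (pow_ne_one_of_norm_lt_one hy ha).symm
      have h2 := sub_ne_zero.2 (pow_ne_one_of_norm_lt_one hy hb).symm
      field_simp
      ring⟩

lemma prod_range_two_mul_eq (f : ℕ → ℂ) (i : ℕ) :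
    ∏ n ∈ Finset.range (2 * i), f n = ∏ n ∈ Finset.range i, (f (2 * n) * f (2 * n + 1)) := by
  induction i with
  | zero => simp
  | succ i ih => rw [Finset.prod_range_succ, ← ih, mul_add, mul_one, Finset.prod_range_succ,
      Finset.prod_range_succ, mul_assoc]

lemma theta_pow_eq {y : ℂ} {m a : ℕ} (ha : a ≠ 0) (ham : a < m) :
    theta (y ^ m) (y ^ a) = qProd (y ^ m) (y ^ a) * qProd (y ^ m) (y ^ (m - a)) := by
  rw [theta]
  congr 2
  rcases eq_or_ne y 0 with rfl | h
  · rw [zero_pow ha, zero_pow (by omega : m ≠ 0), zero_pow (by omega : m - a ≠ 0), div_zero]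
  · rw [div_eq_iff (pow_ne_zero _ h), ← pow_add]
    congr 1
    omega

lemma exists_hasNonnegSeries_inv_theta {m a : ℕ} (ha : a ≠ 0) (ham : a < m) :
    ∃ φ, HasNonnegSeries φ (fun y => (theta (y ^ m) (y ^ a))⁻¹) := by
  obtain ⟨φ, h1⟩ := exists_hasNonnegSeries_inv_qProd (m := m) (by omega) ha
  obtain ⟨ψ, h2⟩ := exists_hasNonnegSeries_inv_qProd (m := m) (a := m - a) (by omega) (by omega)
  exact ⟨_, (h1.mul h2).congr fun y _ => by rw [theta_pow_eq ha ham, mul_inv]⟩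

lemma exists_hasNonnegSeries_qProd_div_theta_sq {m a : ℕ} (ha : a ≠ 0) (ham : a < m) :
    ∃ φ, HasNonnegSeries φ (fun y => qProd (y ^ m) (y ^ m) / theta (y ^ m) (y ^ a) ^ 2) := by
  have hm : m ≠ 0 := by omega
  have hb : m - a ≠ 0 := by omega
  choose φ hφ using fun n => exists_hasNonnegSeries_one_sub_mul
    (a := a + m * n) (b := m - a + m * n) (by omega) (by omega)
  choose ψ hψ using fun n => exists_hasNonnegSeries_one_sub_mul
    (a := a + m * n) (b := m - a + m + m * n) (by omega) (by omega)
  obtain ⟨Φ, hΦ⟩ := HasNonnegSeries.exists_of_tendsto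
    (F := fun y => qProd (y ^ m) (y ^ m) / (qProd (y ^ m) (y ^ a) * qProd (y ^ m) (y ^ (m - a)) *
      (qProd (y ^ m) (y ^ a) * qProd (y ^ m) (y ^ (m - a + m)))))
    (fun i => HasNonnegSeries.prod (Finset.range i) fun n _ => (hφ n).mul (hψ n)) fun y hy => by
      have h0 := (tendsto_prod_qProd hy hm m).comp
        (tendsto_id.const_mul_atTop' (by norm_num : 0 < 2))
      have h1 := tendsto_prod_qProd hy hm a
      have h2 := tendsto_prod_qProd hy hm (m - a)
      have h3 := tendsto_prod_qProd hy hm (m - a + m)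
      refine (h0.div ((h1.mul h2).mul (h1.mul h3)) ?_).congr fun i => ?_
      · exact mul_ne_zero
          (mul_ne_zero (qProd_pow_ne_zero hy hm ha) (qProd_pow_ne_zero hy hm hb))
          (mul_ne_zero (qProd_pow_ne_zero hy hm ha) (qProd_pow_ne_zero hy hm (by omega)))
      · simp only [Function.comp, id, Pi.div_apply, prod_range_two_mul_eq,
          ← Finset.prod_mul_distrib, ← Finset.prod_div_distrib]
        refine Finset.prod_congr rfl fun n _ => ?_
        have e1 : m + m * (2 * n) = a + m * n + (m - a + m * n) := by
          zify [ham.le]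
          ring
        have e2 : m + m * (2 * n + 1) = a + m * n + (m - a + m + m * n) := by
          zify [ham.le]
          ring
        rw [div_mul_div_comm, e1, e2]
  refine ⟨_, (hΦ.mul (HasNonnegSeries.geometric hb)).congr fun y hy => ?_⟩
  have h4 := qProd_eq_mul (Q := y ^ m) (by simpa using pow_lt_one₀ (norm_nonneg y) hy hm)
    (y ^ (m - a))
  rw [← pow_add, add_comm m] at h4
  rw [theta_pow_eq ha ham, ← div_eq_mul_inv, div_div, h4]
  ring

lemma exists_hasNonnegSeries_theta_quotient (v e₁ e₂ e₃ e₄ e₅ : ℕ) :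
    ∃ φ, HasNonnegSeries φ (fun y => y ^ v * qProd (y ^ 11) (y ^ 11) /
      (theta (y ^ 11) (y ^ 1) ^ e₁ * theta (y ^ 11) (y ^ 2) ^ (e₂ + 2) *
        theta (y ^ 11) (y ^ 3) ^ e₃ * theta (y ^ 11) (y ^ 4) ^ e₄ *
        theta (y ^ 11) (y ^ 5) ^ e₅)) := by
  obtain ⟨φ, h⟩ := exists_hasNonnegSeries_qProd_div_theta_sq (m := 11) (a := 2)
    (by norm_num) (by norm_num)
  obtain ⟨_, h1⟩ := exists_hasNonnegSeries_inv_theta (m := 11) (a := 1) (by norm_num) (by norm_num)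
  obtain ⟨_, h2⟩ := exists_hasNonnegSeries_inv_theta (m := 11) (a := 2) (by norm_num) (by norm_num)
  obtain ⟨_, h3⟩ := exists_hasNonnegSeries_inv_theta (m := 11) (a := 3) (by norm_num) (by norm_num)
  obtain ⟨_, h4⟩ := exists_hasNonnegSeries_inv_theta (m := 11) (a := 4) (by norm_num) (by norm_num)
  obtain ⟨_, h5⟩ := exists_hasNonnegSeries_inv_theta (m := 11) (a := 5) (by norm_num) (by norm_num)
  exact ⟨_, (((((((HasNonnegSeries.X_pow v).mul h).mul (h1.pow e₁)).mul (h2.pow e₂)).mul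
    (h3.pow e₃)).mul (h4.pow e₄)).mul (h5.pow e₅)).congr fun y _ => by
      simp only [div_eq_mul_inv, mul_inv, inv_pow, pow_add]
      ring⟩

lemma Multiset.sup_mem_of_ne_zero {s : Multiset ℕ} (h : s ≠ 0) : s.sup ∈ s := by
  induction s using Multiset.induction_on with
  | empty => exact absurd rfl h
  | cons a s ih =>
    rw [Multiset.sup_cons]
    rcases eq_or_ne s 0 with rfl | hs
    · simp
    · rcases le_total a s.sup with h1 | h1
      · rw [sup_eq_right.2 h1]
        exact Multiset.mem_cons_of_mem (ih hs)
      · rw [sup_eq_left.2 h1]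
        exact Multiset.mem_cons_self _ _

lemma Multiset.sum_map_pred_add_card {s : Multiset ℕ} (h : ∀ x ∈ s, 0 < x) :
    (s.map Nat.pred).sum + card s = s.sum := by
  induction s using Multiset.induction_on with
  | empty => simp
  | cons a s ih =>
    have h1 := ih fun x hx => h x (Multiset.mem_cons_of_mem hx)
    have h2 := h a (Multiset.mem_cons_self _ _)
    simp only [Multiset.map_cons, Multiset.sum_cons, Multiset.card_cons, Nat.pred_eq_sub_one] at *
    omega

lemma Multiset.filter_ne_zero_add_replicate (s : Multiset ℕ) :
    s.filter (· ≠ 0) + replicate (card s - card (s.filter (· ≠ 0))) 0 = s := by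
  have h := Multiset.filter_add_not (fun x : ℕ => x ≠ 0) s
  have h2 : s.filter (fun x => ¬ x ≠ 0) = replicate (s.count 0) 0 := by
    simp only [ne_eq, not_not]
    exact Multiset.filter_eq' s 0
  rw [h2] at h
  have h3 := congrArg card h
  rw [Multiset.card_add, Multiset.card_replicate] at h3
  rw [show card s - card (s.filter (· ≠ 0)) = s.count 0 by omega]
  exact h

lemma Multiset.sum_filter_ne_zero (s : Multiset ℕ) : (s.filter (· ≠ 0)).sum = s.sum := by
  conv_rhs => rw [← Multiset.filter_ne_zero_add_replicate s]
  simp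

lemma Multiset.sup_filter_ne_zero (s : Multiset ℕ) : (s.filter (· ≠ 0)).sup = s.sup := by
  refine le_antisymm (Multiset.sup_mono (Multiset.filter_subset _ _))
    (Multiset.sup_le.2 fun x hx => ?_)
  rcases eq_or_ne x 0 with rfl | h
  · exact Nat.zero_le _
  · exact Multiset.le_sup (Multiset.mem_filter.2 ⟨hx, h⟩)

/-- The number of partitions of `n` with rank at least `s`. -/
def rankGe (s : ℤ) (n : ℕ) : ℕ :=
  (Finset.univ.filter fun π : Nat.Partition n => s ≤ partitionRank π).card

/-- The number of partitions of `n` with rank at most `s`. -/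
def rankLe (s : ℤ) (n : ℕ) : ℕ :=
  (Finset.univ.filter fun π : Nat.Partition n => partitionRank π ≤ s).card

/-- Decrease every part by one and adjoin the part `#s + r`. -/
def dysonMap (r : ℤ) (s : Multiset ℕ) : Multiset ℕ :=
  ((Multiset.card s + r).toNat ::ₘ s.map Nat.pred).filter (· ≠ 0)

/-- Remove a largest part `m`, pad with zeros to `m - r` parts and increase every part by one. -/
def dysonInv (r : ℤ) (s : Multiset ℕ) : Multiset ℕ :=
  (s.erase s.sup + Multiset.replicate
    ((s.sup - r).toNat - Multiset.card (s.erase s.sup)) 0).map Nat.succ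

lemma sup_dysonMap {r : ℤ} {s : Multiset ℕ} (h : (s.sup : ℤ) ≤ Multiset.card s + r + 1) :
    (dysonMap r s).sup = (Multiset.card s + r).toNat := by
  rw [dysonMap, Multiset.sup_filter_ne_zero, Multiset.sup_cons, sup_eq_left]
  refine Multiset.sup_le.2 fun x hx => ?_
  obtain ⟨y, hy, rfl⟩ := Multiset.mem_map.1 hx
  have := Multiset.le_sup hy
  rw [Nat.pred_eq_sub_one]
  omega

lemma dysonInv_dysonMap {r : ℤ} {s : Multiset ℕ} (hs : ∀ x ∈ s, 0 < x)
    (h : (s.sup : ℤ) ≤ Multiset.card s + r + 1) (h0 : 0 ≤ Multiset.card s + r) :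
    dysonInv r (dysonMap r s) = s := by
  have hsup := sup_dysonMap h
  have he : (dysonMap r s).erase (Multiset.card s + r).toNat = (s.map Nat.pred).filter (· ≠ 0) := by
    rcases eq_or_ne (Multiset.card s + r).toNat 0 with h1 | h1
    · rw [h1] at hsup ⊢
      have h2 : dysonMap r s = 0 := by
        by_contra h3
        have h4 := Multiset.sup_mem_of_ne_zero h3
        rw [hsup, dysonMap] at h4
        exact (Multiset.mem_filter.1 h4).2 rfl
      rw [h2]
      rw [dysonMap, h1, Multiset.filter_cons_of_neg _ (by simp)] at h2
      rw [h2]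
      rfl
    · rw [dysonMap, Multiset.filter_cons_of_pos (p := (· ≠ 0)) _ h1, Multiset.erase_cons_head]
  have hc : (((Multiset.card s + r).toNat : ℤ) - r).toNat = Multiset.card (s.map Nat.pred) := by
    rw [Multiset.card_map]
    omega
  rw [dysonInv, hsup, he, hc, Multiset.filter_ne_zero_add_replicate, Multiset.map_map]
  conv_rhs => rw [← Multiset.map_id s]
  refine Multiset.map_congr rfl fun x hx => ?_
  have := hs x hx
  simp only [Function.comp, Nat.pred_eq_sub_one, id]
  omega

lemma card_dysonInv {r : ℤ} {s : Multiset ℕ}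
    (h : (Multiset.card (s.erase s.sup) : ℤ) ≤ s.sup - r) :
    Multiset.card (dysonInv r s) = (s.sup - r).toNat := by
  rw [dysonInv, Multiset.card_map, Multiset.card_add, Multiset.card_replicate]
  omega

lemma dysonMap_dysonInv {r : ℤ} {s : Multiset ℕ} (hs : ∀ x ∈ s, 0 < x)
    (h : (Multiset.card (s.erase s.sup) : ℤ) ≤ s.sup - r) :
    dysonMap r (dysonInv r s) = s := by
  have hc := card_dysonInv h
  have h1 : ((s.sup - r).toNat + r).toNat = s.sup := by omega
  rw [dysonMap, hc, h1, dysonInv, Multiset.map_map]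
  have h2 : Nat.pred ∘ Nat.succ = id := rfl
  rw [h2, Multiset.map_id, ← Multiset.cons_add, Multiset.filter_add]
  have h3 : (Multiset.replicate ((s.sup - r).toNat - Multiset.card (s.erase s.sup)) 0).filter
      (· ≠ 0) = 0 := Multiset.filter_eq_nil.2 fun a ha => by
    simp [Multiset.eq_of_mem_replicate ha]
  rw [h3, add_zero]
  rcases eq_or_ne s 0 with rfl | h0
  · simp
  · rw [Multiset.cons_erase (Multiset.sup_mem_of_ne_zero h0)]
    exact Multiset.filter_eq_self.2 fun a ha => (hs a ha).ne'

lemma rankLe_eq_rankGe {n m : ℕ} {r : ℤ} (h : (m : ℤ) = n + r) :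
    rankLe (r + 1) n = rankGe (r - 1) m := by
  have hfwd : ∀ π : Nat.Partition n, partitionRank π ≤ r + 1 →
      0 ≤ Multiset.card π.parts + r := by
    intro π hπ
    rw [partitionRank] at hπ
    rcases eq_or_ne π.parts 0 with h0 | h0
    · have := π.parts_sum
      rw [h0, Multiset.sum_zero] at this
      omega
    · have := π.parts_pos (Multiset.sup_mem_of_ne_zero h0)
      omega
  have hinv : ∀ π : Nat.Partition m, r - 1 ≤ partitionRank π →
      (Multiset.card (π.parts.erase π.parts.sup) : ℤ) ≤ π.parts.sup - r := by
    intro π hπ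
    rw [partitionRank] at hπ
    rcases eq_or_ne π.parts 0 with h0 | h0
    · have := π.parts_sum
      rw [h0, Multiset.sum_zero] at this
      simp [h0]
      omega
    · have := Multiset.card_erase_add_one (Multiset.sup_mem_of_ne_zero h0)
      omega
  have hsum : ∀ π : Nat.Partition n, partitionRank π ≤ r + 1 →
      (dysonMap r π.parts).sum = m := by
    intro π hπ
    have h0 := hfwd π hπ
    have h1 := Multiset.sum_map_pred_add_card fun x hx => π.parts_pos hx
    rw [π.parts_sum] at h1
    rw [dysonMap, Multiset.sum_filter_ne_zero, Multiset.sum_cons]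
    omega
  have hpos : ∀ π : Nat.Partition m, ∀ {x : ℕ}, x ∈ dysonInv r π.parts → 0 < x := by
    intro π x hx
    obtain ⟨y, -, rfl⟩ := Multiset.mem_map.1 hx
    exact Nat.succ_pos y
  have hsum' : ∀ π : Nat.Partition m, r - 1 ≤ partitionRank π →
      (dysonInv r π.parts).sum = n := by
    intro π hπ
    have h0 := hinv π hπ
    have h1 := Multiset.sum_map_pred_add_card fun x hx => hpos π hx
    have h2 := congrArg Multiset.sum (dysonMap_dysonInv (fun x hx => π.parts_pos hx) h0)
    have h3 := card_dysonInv h0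
    rw [dysonMap, Multiset.sum_filter_ne_zero, Multiset.sum_cons, π.parts_sum] at h2
    omega
  refine Finset.card_bij'
    (fun π hπ => ⟨dysonMap r π.parts, fun {i} hi => Nat.pos_of_ne_zero (Multiset.mem_filter.1 hi).2,
      hsum π (Finset.mem_filter.1 hπ).2⟩)
    (fun π hπ => ⟨dysonInv r π.parts, fun {i} hi => hpos π hi,
      hsum' π (Finset.mem_filter.1 hπ).2⟩) ?_ ?_ ?_ ?_
  · intro π hπ
    have h1 := (Finset.mem_filter.1 hπ).2
    have h0 := hfwd π h1
    refine Finset.mem_filter.2 ⟨Finset.mem_univ _, ?_⟩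
    rw [partitionRank] at h1 ⊢
    dsimp only
    rw [sup_dysonMap (by omega)]
    have h2 : Multiset.card (dysonMap r π.parts) ≤ Multiset.card π.parts + 1 := by
      rw [dysonMap]
      exact (Multiset.card_le_card (Multiset.filter_le _ _)).trans (by simp)
    omega
  · intro π hπ
    have h1 := (Finset.mem_filter.1 hπ).2
    have h0 := hinv π h1
    refine Finset.mem_filter.2 ⟨Finset.mem_univ _, ?_⟩
    rw [partitionRank] at h1 ⊢
    dsimp only
    rw [card_dysonInv h0]
    have h2 : (dysonInv r π.parts).sup ≤ π.parts.sup + 1 := by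
      refine Multiset.sup_le.2 fun x hx => ?_
      obtain ⟨y, hy, rfl⟩ := Multiset.mem_map.1 hx
      rcases Multiset.mem_add.1 hy with hy | hy
      · exact Nat.succ_le_succ (Multiset.le_sup (Multiset.mem_of_mem_erase hy))
      · simp [Multiset.eq_of_mem_replicate hy]
    omega
  · intro π hπ
    have h1 := (Finset.mem_filter.1 hπ).2
    refine Nat.Partition.ext ?_
    refine dysonInv_dysonMap (fun x hx => π.parts_pos hx) ?_ (hfwd π h1)
    rw [partitionRank] at h1
    omega
  · intro π hπ
    exact Nat.Partition.ext (dysonMap_dysonInv (fun x hx => π.parts_pos hx)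
      (hinv π (Finset.mem_filter.1 hπ).2))

lemma rankLe_add_rankGe (s : ℤ) (n : ℕ) :
    rankLe s n + rankGe (s + 1) n = Fintype.card (Nat.Partition n) := by
  have h := Finset.card_filter_add_card_filter_not (s := Finset.univ)
    (fun π : Nat.Partition n => partitionRank π ≤ s)
  simp only [not_le, ← Int.add_one_le_iff] at h
  exact h

lemma Nat.Partition.card_parts_le {n : ℕ} (π : Nat.Partition n) : Multiset.card π.parts ≤ n := by
  have := Multiset.sum_map_pred_add_card fun x hx => π.parts_pos hx
  rw [π.parts_sum] at this
  omega

lemma Nat.Partition.sup_parts_le {n : ℕ} (π : Nat.Partition n) : π.parts.sup ≤ n :=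
  Multiset.sup_le.2 fun _ hx => π.parts_sum ▸ Multiset.le_sum_of_mem hx

lemma partitionRank_bound {n : ℕ} (hn : n ≠ 0) (π : Nat.Partition n) :
    partitionRank π < n ∧ -(n : ℤ) < partitionRank π := by
  have h1 := π.card_parts_le
  have h2 := π.sup_parts_le
  have h0 : π.parts ≠ 0 := fun h => hn (by simpa [h] using π.parts_sum.symm)
  have h3 := π.parts_pos (Multiset.sup_mem_of_ne_zero h0)
  have h4 := Multiset.card_pos.2 h0
  rw [partitionRank]
  omega

lemma partitionRank_zero (π : Nat.Partition 0) : partitionRank π = 0 := by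
  have h1 := π.card_parts_le
  have h2 := π.sup_parts_le
  rw [partitionRank]
  omega

lemma partitionRank_lt {n s : ℕ} (h : n ≤ s) (hs : s ≠ 0) (π : Nat.Partition n) :
    partitionRank π < s ∧ -(s : ℤ) < partitionRank π := by
  rcases eq_or_ne n 0 with rfl | hn
  · rw [partitionRank_zero]
    omega
  · have := partitionRank_bound hn π
    omega

lemma rankGe_eq_zero {n s : ℕ} (h : n ≤ s) (hs : s ≠ 0) : rankGe s n = 0 :=
  Finset.card_eq_zero.2 (Finset.filter_eq_empty_iff.2 fun π _ =>
    (partitionRank_lt h hs π).1.not_ge)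

lemma rankLe_neg_eq_zero {n s : ℕ} (h : n ≤ s) (hs : s ≠ 0) : rankLe (-s) n = 0 :=
  Finset.card_eq_zero.2 (Finset.filter_eq_empty_iff.2 fun π _ =>
    (partitionRank_lt h hs π).2.not_ge)

lemma rankGe_zero_zero : rankGe 0 0 = 1 := by
  simp [rankGe, partitionRank_zero]

lemma rankLe_zero_zero : rankLe 0 0 = 1 := by
  simp [rankLe, partitionRank_zero]

lemma rankGe_add_rankGe (s n : ℕ) :
    rankGe s (n + s + 1) + rankGe (s + 3) n = Fintype.card (Nat.Partition n) := by
  have h1 := rankLe_eq_rankGe (n := n) (m := n + s + 1) (r := s + 1) (by push_cast; ring)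
  have h2 := rankLe_add_rankGe (s + 2) n
  rw [show (s : ℤ) + 1 + 1 = s + 2 by ring, add_sub_cancel_right] at h1
  rw [show (s : ℤ) + 2 + 1 = s + 3 by ring] at h2
  omega

lemma rankLe_neg (s n : ℕ) : rankLe (-s) n = rankGe s n := by
  induction n using Nat.strong_induction_on generalizing s with
  | _ n ih =>
    rcases le_or_gt n s with h | h
    · rcases eq_or_ne s 0 with rfl | hs
      · obtain rfl : n = 0 := by omega
        exact rankLe_zero_zero.trans rankGe_zero_zero.symm
      · rw [rankLe_neg_eq_zero h hs, rankGe_eq_zero h hs]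
    · obtain ⟨m, rfl⟩ : ∃ m, n = m + s + 1 := ⟨n - s - 1, by omega⟩
      have h1 := rankLe_eq_rankGe (n := m + s + 1) (m := m) (r := -s - 1) (by push_cast; ring)
      have h2 := rankLe_add_rankGe (-(s + 3 : ℕ)) m
      have h3 := rankGe_add_rankGe s m
      have h4 := ih m (by omega) (s + 3)
      rw [show -(s : ℤ) - 1 + 1 = -s by ring] at h1
      rw [show -((s + 3 : ℕ) : ℤ) + 1 = -s - 1 - 1 by push_cast; ring] at h2
      push_cast at h4 h2
      omega

section

variable {q : ℂ}

lemma summable_partitionBound (hq : ‖q‖ < 1) :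
    Summable fun n => (Fintype.card (Nat.Partition n) : ℝ) * ‖q‖ ^ n := by
  have h := hasNonnegSeries_partition.hasSum_real (norm_nonneg q) hq
  simpa using h.summable

lemma summable_norm_of_le_partition (hq : ‖q‖ < 1) {a : ℕ → ℕ}
    (ha : ∀ n, a n ≤ Fintype.card (Nat.Partition n)) :
    Summable fun n => ‖(a n : ℂ) * q ^ n‖ := by
  refine (summable_partitionBound hq).of_nonneg_of_le (fun _ => norm_nonneg _) fun n => ?_
  rw [norm_mul, norm_pow, Complex.norm_natCast]
  gcongr
  exact ha n

lemma rankGe_le (s : ℤ) (n : ℕ) : rankGe s n ≤ Fintype.card (Nat.Partition n) :=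
  Finset.card_le_univ _

lemma hasSum_partition (hq : ‖q‖ < 1) :
    HasSum (fun n => (Fintype.card (Nat.Partition n) : ℂ) * q ^ n) (qProd q q)⁻¹ := by
  simpa using hasNonnegSeries_partition.2 q hq

/-- The generating function of partitions with rank at least `s`. -/
noncomputable def rankGeSeries (q : ℂ) (s : ℕ) : ℂ := ∑' n, (rankGe s n : ℂ) * q ^ n

lemma hasSum_rankGeSeries (hq : ‖q‖ < 1) (s : ℕ) :
    HasSum (fun n => (rankGe s n : ℂ) * q ^ n) (rankGeSeries q s) :=
  (summable_norm_of_le_partition hq (rankGe_le s)).of_norm.hasSum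

lemma rankGeSeries_eq (hq : ‖q‖ < 1) (s : ℕ) :
    rankGeSeries q s = (if s = 0 then 1 else 0) +
      q ^ (s + 1) * ((qProd q q)⁻¹ - rankGeSeries q (s + 3)) := by
  have h1 := (hasSum_rankGeSeries hq s).summable.sum_add_tsum_nat_add (s + 1)
  rw [(hasSum_rankGeSeries hq s).tsum_eq] at h1
  rw [← h1]
  congr 1
  · rcases eq_or_ne s 0 with rfl | hs
    · simp [rankGe_zero_zero]
    · rw [if_neg hs]
      refine Finset.sum_eq_zero fun n hn => ?_
      rw [rankGe_eq_zero (Finset.mem_range_succ_iff.1 hn) hs]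
      simp
  · refine HasSum.tsum_eq ((((hasSum_partition hq).sub
      (hasSum_rankGeSeries hq (s + 3))).mul_left (q ^ (s + 1))).congr_fun fun n => ?_)
    rw [← rankGe_add_rankGe s n, ← add_assoc]
    push_cast
    ring

/-- `∑ (-1)ᵏ q^((k+1)s + (k+1)(3k+2)/2)`. -/
noncomputable def dysonSum (q : ℂ) (s : ℕ) : ℂ :=
  ∑' k : ℕ, (-1) ^ k * q ^ ((k + 1) * s + (3 * (k + 1).choose 2 + k + 1))

lemma norm_dysonTerm_le (hq : ‖q‖ < 1) (s k : ℕ) :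
    ‖(-1) ^ k * q ^ ((k + 1) * s + (3 * (k + 1).choose 2 + k + 1))‖ ≤ ‖q‖ ^ s * ‖q‖ ^ k := by
  rw [norm_mul, norm_pow, norm_neg, norm_one, one_pow, one_mul, norm_pow, ← pow_add]
  refine pow_le_pow_of_le_one (norm_nonneg q) hq.le ?_
  nlinarith [Nat.zero_le (k * s)]

lemma summable_dysonTerm (hq : ‖q‖ < 1) (s : ℕ) :
    Summable fun k : ℕ => (-1) ^ k * q ^ ((k + 1) * s + (3 * (k + 1).choose 2 + k + 1)) :=
  Summable.of_norm_bounded ((summable_geometric_of_lt_one (norm_nonneg q) hq).mul_left _)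
    (norm_dysonTerm_le hq s)

lemma dysonSum_eq (hq : ‖q‖ < 1) (s : ℕ) :
    dysonSum q s = q ^ (s + 1) * (1 - dysonSum q (s + 3)) := by
  rw [dysonSum, (summable_dysonTerm hq s).tsum_eq_zero_add, dysonSum, mul_sub, ← tsum_mul_left,
    sub_eq_add_neg, ← tsum_neg]
  congr 1
  · simp
  · refine tsum_congr fun k => ?_
    have : (k + 1 + 1) * s + (3 * (k + 1 + 1).choose 2 + (k + 1) + 1) =
        s + 1 + ((k + 1) * (s + 3) + (3 * (k + 1).choose 2 + k + 1)) := by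
      rw [Nat.choose_succ_succ' (k + 1) 1, Nat.choose_one_right]
      ring
    rw [this, pow_add q (s + 1), pow_succ (-1 : ℂ)]
    ring

lemma norm_dysonSum_le (hq : ‖q‖ < 1) (s : ℕ) : ‖dysonSum q s‖ ≤ (1 - ‖q‖)⁻¹ := by
  refine tsum_of_norm_bounded (hasSum_geometric_of_lt_one (norm_nonneg q) hq) fun k => ?_
  refine (norm_dysonTerm_le hq s k).trans (mul_le_of_le_one_left (by positivity) ?_)
  exact pow_le_one₀ (norm_nonneg q) hq.le

lemma norm_rankGeSeries_le (hq : ‖q‖ < 1) (s : ℕ) :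
    ‖rankGeSeries q s‖ ≤ ∑' n, (Fintype.card (Nat.Partition n) : ℝ) * ‖q‖ ^ n := by
  refine tsum_of_norm_bounded (summable_partitionBound hq).hasSum fun n => ?_
  rw [norm_mul, norm_pow, Complex.norm_natCast]
  gcongr
  exact rankGe_le s n

lemma rankGeSeries_eq_dysonSum (hq : ‖q‖ < 1) (s : ℕ) :
    rankGeSeries q s = (if s = 0 then 1 else 0) + (qProd q q)⁻¹ * dysonSum q s := by
  set P := (qProd q q)⁻¹
  set B := (∑' n, (Fintype.card (Nat.Partition n) : ℝ) * ‖q‖ ^ n) + ‖P‖ * (1 - ‖q‖)⁻¹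
  have hrec : ∀ s, s ≠ 0 → rankGeSeries q s - P * dysonSum q s =
      -(q ^ (s + 1) * (rankGeSeries q (s + 3) - P * dysonSum q (s + 3))) := by
    intro s hs
    rw [rankGeSeries_eq hq, if_neg hs, dysonSum_eq hq]
    ring
  have hbound : ∀ m s, s ≠ 0 → ‖rankGeSeries q s - P * dysonSum q s‖ ≤ ‖q‖ ^ m * B := by
    intro m
    induction m with
    | zero =>
      intro s _
      rw [pow_zero, one_mul]
      refine (norm_sub_le _ _).trans (add_le_add (norm_rankGeSeries_le hq s) ?_)
      rw [norm_mul]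
      gcongr
      exact norm_dysonSum_le hq s
    | succ m ih =>
      intro s hs
      rw [hrec s hs, norm_neg, norm_mul, norm_pow, pow_succ' _ m, mul_assoc]
      refine mul_le_mul ?_ (ih (s + 3) (by omega)) (norm_nonneg _) (norm_nonneg _)
      exact pow_le_of_le_one (norm_nonneg q) hq.le (Nat.succ_ne_zero s)
  have hzero : ∀ s, s ≠ 0 → rankGeSeries q s = P * dysonSum q s := by
    intro s hs
    have h1 : Tendsto (fun m => ‖q‖ ^ m * B) atTop (𝓝 0) := by
      simpa using (tendsto_pow_atTop_nhds_zero_of_lt_one (norm_nonneg q) hq).mul_const B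
    have h2 := ge_of_tendsto' h1 fun m => hbound m s hs
    exact sub_eq_zero.1 (norm_le_zero_iff.1 h2)
  rw [rankGeSeries_eq hq, hzero _ (by omega), dysonSum_eq hq s]
  ring

end

/-- The number of partitions of `n` with rank `m`. -/
def rankEq (m : ℤ) (n : ℕ) : ℕ :=
  (Finset.univ.filter fun π : Nat.Partition n => partitionRank π = m).card

lemma rankEq_add_rankGe (m : ℤ) (n : ℕ) : rankEq m n + rankGe (m + 1) n = rankGe m n := by
  rw [rankEq, rankGe, rankGe, ← Finset.card_union_of_disjoint]
  · congr 1
    ext π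
    simp only [Finset.mem_union, Finset.mem_filter, Finset.mem_univ, true_and]
    omega
  · refine Finset.disjoint_filter.2 fun π _ h => ?_
    omega

lemma rankEq_add_rankLe (m : ℤ) (n : ℕ) : rankEq m n + rankLe (m - 1) n = rankLe m n := by
  rw [rankEq, rankLe, rankLe, ← Finset.card_union_of_disjoint]
  · congr 1
    ext π
    simp only [Finset.mem_union, Finset.mem_filter, Finset.mem_univ, true_and]
    omega
  · refine Finset.disjoint_filter.2 fun π _ h => ?_
    omega

lemma rankEq_natAbs_add_rankGe (m : ℤ) (n : ℕ) :
    rankEq m n + rankGe (m.natAbs + 1 : ℕ) n = rankGe m.natAbs n := by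
  obtain ⟨k, rfl | rfl⟩ := m.eq_nat_or_neg
  · exact rankEq_add_rankGe k n
  · have h := rankEq_add_rankLe (-k) n
    rw [rankLe_neg, show -(k : ℤ) - 1 = -(k + 1 : ℕ) by push_cast; ring, rankLe_neg] at h
    simpa using h

lemma hasSum_rankEq (i : ℤ) (n : ℕ) :
    HasSum (fun j : ℤ => (rankEq (i + 11 * j) n : ℝ)) (rankCount i 11 n) := by
  have h : ∀ π : Nat.Partition n, HasSum
      (fun j : ℤ => if partitionRank π = i + 11 * j then (1 : ℝ) else 0)
      (if partitionRank π % 11 = i % 11 then 1 else 0) := by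
    intro π
    have h1 := hasSum_ite_eq ((partitionRank π - i) / 11)
      (if partitionRank π % 11 = i % 11 then (1 : ℝ) else 0)
    refine h1.congr_fun fun j => ?_
    have : partitionRank π = i + 11 * j ↔
        j = (partitionRank π - i) / 11 ∧ partitionRank π % 11 = i % 11 := by omega
    simp only [this, ite_and]
  have h2 := hasSum_sum fun π (_ : π ∈ Finset.univ) => h π
  simp only [rankEq, rankCount, Finset.card_filter, Nat.cast_sum, Nat.cast_ite, Nat.cast_one,
    Nat.cast_zero]
  exact h2

section

variable {q : ℂ}

/-- The generating function of partitions with rank `m`. -/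
noncomputable def rankEqSeries (q : ℂ) (m : ℤ) : ℂ := ∑' n, (rankEq m n : ℂ) * q ^ n

lemma rankEq_le (m : ℤ) (n : ℕ) : rankEq m n ≤ Fintype.card (Nat.Partition n) :=
  Finset.card_le_univ _

lemma rankCount_le (i r : ℤ) (n : ℕ) : rankCount i r n ≤ Fintype.card (Nat.Partition n) :=
  Finset.card_le_univ _

lemma rankEqSeries_eq (hq : ‖q‖ < 1) (m : ℤ) :
    rankEqSeries q m = (if m = 0 then 1 else 0) +
      (qProd q q)⁻¹ * (dysonSum q m.natAbs - dysonSum q (m.natAbs + 1)) := by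
  have h : rankEqSeries q m = rankGeSeries q m.natAbs - rankGeSeries q (m.natAbs + 1) := by
    refine HasSum.tsum_eq (((hasSum_rankGeSeries hq _).sub
      (hasSum_rankGeSeries hq _)).congr_fun fun n => ?_)
    rw [← rankEq_natAbs_add_rankGe m n]
    push_cast
    ring
  rw [h, rankGeSeries_eq_dysonSum hq, rankGeSeries_eq_dysonSum hq, if_neg (Nat.succ_ne_zero _)]
  simp only [Int.natAbs_eq_zero]
  ring

/-- The generating function of partitions with rank congruent to `i` modulo `11`. -/
noncomputable def rankSeries (i : ℤ) (q : ℂ) : ℂ := ∑' n, (rankCount i 11 n : ℂ) * q ^ n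

lemma hasSum_rankSeries (hq : ‖q‖ < 1) (i : ℤ) :
    HasSum (fun n => (rankCount i 11 n : ℂ) * q ^ n) (rankSeries i q) :=
  (summable_norm_of_le_partition hq (rankCount_le i 11)).of_norm.hasSum

lemma hasSum_rankEqSeries (hq : ‖q‖ < 1) (i : ℤ) :
    HasSum (fun j : ℤ => rankEqSeries q (i + 11 * j)) (rankSeries i q) := by
  have hn : ∀ n : ℕ, HasSum (fun j : ℤ => (rankEq (i + 11 * j) n : ℂ) * q ^ n)
      ((rankCount i 11 n : ℂ) * q ^ n) := fun n => by
    have := (Complex.hasSum_ofReal.2 (hasSum_rankEq i n)).mul_right (q ^ n)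
    simpa using this
  have hs : Summable fun p : ℕ × ℤ => (rankEq (i + 11 * p.2) p.1 : ℂ) * q ^ p.1 := by
    refine Summable.of_norm ((summable_prod_of_nonneg fun _ => norm_nonneg _).2 ⟨fun n => ?_, ?_⟩)
    · exact (hn n).summable.norm
    · refine (summable_norm_of_le_partition hq (rankCount_le i 11)).congr fun n => ?_
      have := (hasSum_rankEq i n).mul_right (‖q‖ ^ n)
      simp only [norm_mul, norm_pow, Complex.norm_natCast]
      exact this.tsum_eq.symm
  have h1 : HasSum (fun p : ℕ × ℤ => (rankEq (i + 11 * p.2) p.1 : ℂ) * q ^ p.1)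
      (rankSeries i q) := by
    rw [rankSeries, ← tsum_congr fun n => (hn n).tsum_eq, ← hs.tsum_prod]
    exact hs.hasSum
  have h2 := (Equiv.prodComm ℤ ℕ).hasSum_iff.2 h1
  exact h2.prod_fiberwise fun j =>
    (summable_norm_of_le_partition hq (rankEq_le (i + 11 * j))).of_norm.hasSum

/-- A summand of the Lambert series of the ranks congruent to `i` modulo `11`. -/
noncomputable def rankLambertTerm (q : ℂ) (i : ℕ) (k : ℕ) : ℂ :=
  (-1) ^ k * q ^ (3 * (k + 1).choose 2 + k + 1) * (1 - q ^ (k + 1)) *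
    ((q ^ (k + 1)) ^ i + (q ^ (k + 1)) ^ (11 - i)) / (1 - (q ^ (k + 1)) ^ 11)

lemma hasSum_pow_natAbs {x : ℂ} (hx : ‖x‖ < 1) {i : ℕ} (hi : i ≤ 10) :
    HasSum (fun j : ℤ => x ^ ((i : ℤ) + 11 * j).natAbs)
      ((x ^ i + x ^ (11 - i)) / (1 - x ^ 11)) := by
  have hg : HasSum (fun n : ℕ => (x ^ 11) ^ n) (1 - x ^ 11)⁻¹ :=
    hasSum_geometric_of_norm_lt_one (by simpa using pow_lt_one₀ (norm_nonneg x) hx (by norm_num))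
  rw [div_eq_mul_inv, add_mul]
  refine HasSum.of_nat_of_neg_add_one ((hg.mul_left (x ^ i)).congr_fun fun n => ?_)
    ((hg.mul_left (x ^ (11 - i))).congr_fun fun n => ?_)
  · rw [← pow_mul, ← pow_add]
    congr 1
  · rw [← pow_mul, ← pow_add]
    congr 1
    omega

lemma qProd_mul_rankSeries (hq : ‖q‖ < 1) (hE : qProd q q ≠ 0) {i : ℕ} (hi : i ≤ 10) :
    HasSum (rankLambertTerm q i)
      (qProd q q * rankSeries i q - if i = 0 then qProd q q else 0) := by
  have h1 := (hasSum_rankEqSeries hq i).mul_left (qProd q q)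
  have h2 := hasSum_ite_eq (0 : ℤ) (if i = 0 then qProd q q else 0)
  have h3 := h1.sub h2
  have h4 : HasSum (fun j : ℤ => dysonSum q ((i : ℤ) + 11 * j).natAbs -
      dysonSum q (((i : ℤ) + 11 * j).natAbs + 1))
      (qProd q q * rankSeries i q - if i = 0 then qProd q q else 0) := by
    refine h3.congr_fun fun j => ?_
    rw [rankEqSeries_eq hq, mul_add, mul_inv_cancel_left₀ hE]
    have : ((i : ℤ) + 11 * j = 0) ↔ (j = 0 ∧ i = 0) := by omega
    by_cases hj : j = 0 <;> by_cases h0 : i = 0 <;> simp [this, hj, h0]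
  set F : ℤ × ℕ → ℂ := fun p => (-1) ^ p.2 * q ^ (3 * (p.2 + 1).choose 2 + p.2 + 1) *
    (1 - q ^ (p.2 + 1)) * (q ^ (p.2 + 1)) ^ ((i : ℤ) + 11 * p.1).natAbs with hF
  have hFeq : ∀ (j : ℤ) (k : ℕ), F (j, k) =
      (-1) ^ k * q ^ ((k + 1) * ((i : ℤ) + 11 * j).natAbs + (3 * (k + 1).choose 2 + k + 1)) -
      (-1) ^ k * q ^ ((k + 1) * (((i : ℤ) + 11 * j).natAbs + 1) +
        (3 * (k + 1).choose 2 + k + 1)) := by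
    intro j k
    simp only [hF]
    ring
  have hpow : ∀ k : ℕ, ‖q ^ (k + 1)‖ < 1 := fun k => by
    simpa using pow_lt_one₀ (norm_nonneg q) hq (Nat.succ_ne_zero k)
  have hsF : Summable F := by
    have hz : Summable fun j : ℤ => ‖q‖ ^ ((i : ℤ) + 11 * j).natAbs := by
      simpa using (hasSum_pow_natAbs hq hi).summable.norm
    have hk := summable_geometric_of_lt_one (norm_nonneg q) hq
    refine Summable.of_norm_bounded ((hz.mul_of_nonneg hk (fun _ => by positivity)
      fun _ => by positivity).mul_left 2) ?_
    rintro ⟨j, k⟩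
    rw [hFeq]
    refine (norm_sub_le _ _).trans ?_
    refine (add_le_add (norm_dysonTerm_le hq _ k) ((norm_dysonTerm_le hq _ k).trans
      (mul_le_mul_of_nonneg_right (pow_le_pow_of_le_one (norm_nonneg q) hq.le
        (Nat.le_succ _)) (by positivity)))).trans (le_of_eq ?_)
    simp only
    ring
  have h5 : HasSum F (qProd q q * rankSeries i q - if i = 0 then qProd q q else 0) := by
    have h6 := hsF.hasSum.prod_fiberwise fun j => by
      have := ((summable_dysonTerm hq ((i : ℤ) + 11 * j).natAbs).hasSum.sub
        (summable_dysonTerm hq (((i : ℤ) + 11 * j).natAbs + 1)).hasSum)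
      simp only [← hFeq] at this
      exact this
    rw [← h6.unique h4]
    exact hsF.hasSum
  have h7 := (Equiv.prodComm ℕ ℤ).hasSum_iff.2 h5
  have h8 := h7.prod_fiberwise fun k => by
    have := (hasSum_pow_natAbs (hpow k) hi).mul_left
      ((-1) ^ k * q ^ (3 * (k + 1).choose 2 + k + 1) * (1 - q ^ (k + 1)))
    exact this
  refine h8.congr_fun fun k => ?_
  rw [rankLambertTerm, mul_div_assoc]

end

section

variable {q : ℂ}

/-- `∑ (-1)ⁿ q^(n(3n+1)/2 + xn) / (1 - q^(11n))` over nonzero `n`; the summand `n = 0` vanishes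
because of the division by zero. -/
noncomputable def rankLambert (q : ℂ) (x : ℤ) : ℂ :=
  ∑' n : ℤ, (-1) ^ n * q ^ (3 * tri n + (x - 1) * n) / (1 - q ^ (11 * n))

lemma lambert_eq_rankLambert (a : ℤ) : lambert q a = rankLambert q (16 - 3 * a) := by
  rw [lambert, rankLambert, show 16 - 3 * a - 1 = 15 - 3 * a by ring]

lemma hasSum_rankLambert (hq : ‖q‖ < 1) (hq0 : q ≠ 0) (x : ℤ) :
    HasSum (fun n : ℤ => (-1) ^ n * q ^ (3 * tri n + (x - 1) * n) / (1 - q ^ (11 * n)))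
      (rankLambert q x) := by
  have h := ((summable_tri hq hq0 (zpow_ne_zero (x - 1) hq0)).div_one_sub_zpow
    (norm_pow_lt_one hq (n := 11) (by norm_num)) (pow_ne_zero 11 hq0) one_ne_zero).of_norm
  refine (h.congr fun n => ?_).hasSum
  have : q ^ (11 * n) = (q ^ 11) ^ n := by rw [zpow_mul, zpow_ofNat]
  rw [zpow_add₀ hq0, zpow_mul q (x - 1), one_mul, this, mul_assoc]

lemma tri_neg (n : ℤ) : tri (-n) = tri n - n := by
  have h1 := two_mul_tri n
  have h2 := two_mul_tri (-n)
  linarith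

lemma rankLambert_ten_sub (hq : ‖q‖ < 1) (hq0 : q ≠ 0) (x : ℤ) :
    rankLambert q (10 - x) = -rankLambert q x := by
  have h1 := (Equiv.neg ℤ).hasSum_iff.2 (hasSum_rankLambert hq hq0 (10 - x))
  refine h1.unique ((hasSum_rankLambert hq hq0 x).neg.congr_fun fun n => ?_)
  simp only [Function.comp, Equiv.neg_apply]
  rcases eq_or_ne n 0 with rfl | hn
  · simp
  · have h2 : 1 - q ^ (11 * n) ≠ 0 := sub_ne_zero.2 (zpow_ne_one hq (by omega)).symm
    have h3 : 1 - q ^ (11 * -n) ≠ 0 := sub_ne_zero.2 (zpow_ne_one hq (by omega)).symm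
    rw [neg_one_zpow_neg, div_eq_iff h3, ← neg_div, div_mul_eq_mul_div, eq_div_iff h2, tri_neg,
      show 3 * (tri n - n) + (10 - x - 1) * -n = 3 * tri n + (x - 1) * n + 11 * -n by ring,
      zpow_add₀ hq0 _ (11 * -n)]
    have h4 : q ^ (11 * -n) * q ^ (11 * n) = 1 := by rw [← zpow_add₀ hq0]; simp
    linear_combination -(-1) ^ n * q ^ (3 * tri n + (x - 1) * n) * h4

lemma rankLambert_add_eleven (hq : ‖q‖ < 1) (hq0 : q ≠ 0) (x : ℤ) :
    rankLambert q (x + 11) = rankLambert q x - triSum q (q ^ (x - 1)) + 1 := by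
  have h1 := ((hasSum_rankLambert hq hq0 x).sub
    (hasSum_triSum hq hq0 (zpow_ne_zero (x - 1) hq0))).add (hasSum_ite_eq (0 : ℤ) (1 : ℂ))
  refine (hasSum_rankLambert hq hq0 (x + 11)).unique (h1.congr_fun fun n => ?_)
  rw [mul_assoc, ← zpow_mul, ← zpow_add₀ hq0]
  rcases eq_or_ne n 0 with rfl | hn
  · simp [show tri 0 = 0 from rfl]
  · have h2 : 1 - q ^ (11 * n) ≠ 0 := sub_ne_zero.2 (zpow_ne_one hq (by omega)).symm
    rw [if_neg hn, show 3 * tri n + (x + 11 - 1) * n = 3 * tri n + (x - 1) * n + 11 * n by ring,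
      zpow_add₀ hq0 _ (11 * n)]
    field_simp
    ring

lemma triSum_self (hq : ‖q‖ < 1) (hq0 : q ≠ 0) : triSum q q = -(qProd q q / q) := by
  have h1 := hasSum_triSum hq hq0 (one_div_ne_zero hq0)
  rw [triSum_one_div hq hq0, ← (Equiv.subLeft (-1 : ℤ)).hasSum_iff] at h1
  refine (hasSum_triSum hq hq0 hq0).unique ((h1.div_const q).neg.congr_fun fun n => ?_)
  have h2 : tri (-1 - n) = tri n := by
    have h1 := two_mul_tri n
    have h2 := two_mul_tri (-1 - n)
    linarith
  simp only [Function.comp, Equiv.subLeft_apply, h2]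
  rw [show -1 - n = -(n + 1) by ring, neg_one_zpow_neg, one_div, inv_zpow', neg_neg,
    zpow_add_one₀ hq0, zpow_add_one₀ (by norm_num)]
  field_simp

lemma tri_natCast_add_one (k : ℕ) : tri ((k : ℤ) + 1) = (k + 1).choose 2 + k + 1 := by
  induction k with
  | zero => rfl
  | succ k ih =>
    have h1 := two_mul_tri ((k : ℤ) + 1)
    have h2 := two_mul_tri (((k + 1 : ℕ) : ℤ) + 1)
    rw [Nat.choose_succ_succ' (k + 1) 1, Nat.choose_one_right]
    push_cast at *
    linarith

lemma rankLambert_summand_pos (hq0 : q ≠ 0) (x : ℤ) (k : ℕ) :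
    (-1) ^ ((k : ℤ) + 1) * q ^ (3 * tri (k + 1) + (x - 1) * (k + 1)) / (1 - q ^ (11 * ((k : ℤ) +
      1)))
      = -((-1) ^ k * q ^ (3 * (k + 1).choose 2 + k + 1) * (q ^ (k + 1)) ^ (x + 1)) /
        (1 - (q ^ (k + 1)) ^ 11) := by
  have h1 : q ^ (11 * ((k : ℤ) + 1)) = (q ^ (k + 1)) ^ 11 := by
    rw [← pow_mul, ← zpow_natCast]; congr 1; push_cast; ring
  have h2 : q ^ (3 * tri (k + 1) + (x - 1) * (k + 1)) =
      q ^ (3 * (k + 1).choose 2 + k + 1) * (q ^ (k + 1)) ^ (x + 1) := by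
    rw [← zpow_natCast q (k + 1), ← zpow_mul, ← zpow_natCast, ← zpow_add₀ hq0, tri_natCast_add_one]
    congr 1; push_cast; ring
  rw [h1, h2, zpow_add_one₀ (by norm_num), zpow_natCast]
  ring

lemma rankLambert_summand_neg (hq : ‖q‖ < 1) (hq0 : q ≠ 0) (x : ℤ) (k : ℕ) :
    (-1) ^ (-((k : ℤ) + 1)) * q ^ (3 * tri (-((k : ℤ) + 1)) + (x - 1) * (-((k : ℤ) + 1))) /
        (1 - q ^ (11 * (-((k : ℤ) + 1))))
      = (-1) ^ k * q ^ (3 * (k + 1).choose 2 + k + 1) * (q ^ (k + 1)) ^ (11 - x) /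
        (1 - (q ^ (k + 1)) ^ 11) := by
  have h1 : q ^ (11 * (-((k : ℤ) + 1))) * (q ^ (k + 1)) ^ 11 = 1 := by
    rw [← pow_mul, ← zpow_natCast, ← zpow_add₀ hq0]
    convert zpow_zero q using 2
    push_cast; ring
  have h2 : q ^ (3 * tri (-((k : ℤ) + 1)) + (x - 1) * (-((k : ℤ) + 1))) * (q ^ (k + 1)) ^ 11 =
      q ^ (3 * (k + 1).choose 2 + k + 1) * (q ^ (k + 1)) ^ (11 - x) := by
    rw [← pow_mul, ← zpow_natCast q (k + 1), ← zpow_mul, ← zpow_natCast, ← zpow_natCast,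
      ← zpow_add₀ hq0, ← zpow_add₀ hq0, tri_neg, tri_natCast_add_one]
    congr 1; push_cast; ring
  have h3 : 1 - q ^ (11 * (-((k : ℤ) + 1))) ≠ 0 := sub_ne_zero.2 (zpow_ne_one hq (by omega)).symm
  have h4 : (1 : ℂ) - (q ^ (k + 1)) ^ 11 ≠ 0 := by
    rw [← pow_mul]
    exact sub_ne_zero.2 (by exact_mod_cast (zpow_ne_one hq (n := ((k + 1) * 11 : ℕ))
      (by omega)).symm)
  rw [neg_one_zpow_neg, zpow_add_one₀ (by norm_num), zpow_natCast, div_eq_div_iff h3 h4]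
  linear_combination (-1) ^ k * h2 - (-1) ^ k * q ^ (11 * (-((k : ℤ) + 1))) * h2 +
    (-1) ^ k * q ^ (3 * tri (-((k : ℤ) + 1)) + (x - 1) * (-((k : ℤ) + 1))) * h1

lemma hasSum_rankLambertTerm (hq : ‖q‖ < 1) (hq0 : q ≠ 0) {i : ℕ} (hi : i ≤ 10) :
    HasSum (rankLambertTerm q i) (rankLambert q i - rankLambert q (i - 1)) := by
  have h1 := ((hasSum_rankLambert hq hq0 i).sub (hasSum_rankLambert hq hq0 (i - 1)))
  have h2 := (hasSum_nat_add_iff' 1).2 h1.nat_add_neg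
  simp only [mul_zero, zpow_zero, sub_self, div_zero, add_zero, Finset.range_one,
    Finset.sum_singleton, Nat.cast_zero, neg_zero, sub_zero] at h2
  refine h2.congr_fun fun k => ?_
  have hw : q ^ (k + 1) ≠ 0 := pow_ne_zero _ hq0
  rw [Nat.cast_add_one, rankLambert_summand_pos hq0, rankLambert_summand_pos hq0,
    rankLambert_summand_neg hq hq0, rankLambert_summand_neg hq hq0, rankLambertTerm,
    show (i : ℤ) - 1 + 1 = i by ring, show 11 - ((i : ℤ) - 1) = ((11 - i : ℕ) : ℤ) + 1 by omega,
    show 11 - (i : ℤ) = ((11 - i : ℕ) : ℤ) by omega, zpow_add_one₀ hw, zpow_add_one₀ hw]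
  simp only [zpow_natCast]
  ring

/-- The six Lambert series for the rank classes modulo eleven, combined with coefficients `c`. -/
lemma qProd_mul_sum_rankSeries (hq : ‖q‖ < 1) (hq0 : q ≠ 0) (hE : qProd q q ≠ 0) (c : ℕ → ℂ)
    {κ : ℤ → ℂ} (h₁ : κ 1 = c 2 - c 3) (h₂ : κ 2 = c 1 - 2 * c 0) (h₃ : κ 3 = c 4 - c 3)
    (h₄ : κ 4 = c 4 - c 5) (h₅ : κ 5 = c 1 - c 2) :
    qProd q q * ∑ i ∈ Finset.range 6, c i * rankSeries i q =
      c 0 - κ 1 - κ 1 * (qProd q q / q) + ∑ a ∈ Finset.Icc (1 : ℤ) 5, κ a * lambert q a := by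
  have hR : ∀ i ∈ Finset.range 6, qProd q q * rankSeries i q =
      rankLambert q i - rankLambert q (i - 1) + if i = 0 then qProd q q else 0 := fun i hi => by
    have hi : i ≤ 10 := by have := Finset.mem_range.1 hi; omega
    linear_combination (qProd_mul_rankSeries hq hE hi).unique (hasSum_rankLambertTerm hq hq0 hi)
  rw [Finset.mul_sum, Finset.sum_congr rfl fun i hi => by rw [mul_left_comm, hR i hi]]
  have e5 := rankLambert_ten_sub hq hq0 5
  have e7 := rankLambert_ten_sub hq hq0 3
  have e10 := rankLambert_ten_sub hq hq0 0
  have e11 := rankLambert_ten_sub hq hq0 (-1)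
  have e11' := rankLambert_add_eleven hq hq0 0
  have e13 := rankLambert_add_eleven hq hq0 2
  norm_num [triSum_self hq hq0] at e5 e7 e10 e11 e11' e13
  have hE' : triSum q q⁻¹ = qProd q q := by simpa using triSum_one_div hq hq0
  rw [hE'] at e11'
  have hIcc : Finset.Icc (1 : ℤ) 5 = {1, 2, 3, 4, 5} := by decide
  rw [hIcc]
  simp [Finset.sum_range_succ, lambert_eq_rankLambert, h₁, h₂, h₃, h₄, h₅]
  linear_combination c 0 * (e11' - e11) + (2 * c 0 - c 1) * e10 - (c 2 - c 3) * e13 -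
    (c 4 - c 3) * e7 + c 5 / 2 * e5

end

section

variable {q : ℂ}

lemma normCoeff_ne_zero (hq : ‖q‖ < 1) (hq0 : q ≠ 0) {r s ρ σ τ : ℂ}
    (H : ThetaCurve (thetaEleven q) r s ρ σ τ) : normCoeff r s ≠ 0 := by
  obtain ⟨hr, hs, hρ, hσ, hτ⟩ := H.ne
  have h1 : cuspDisc r s ≠ 0 := fun h => by
    have h2 := cuspDisc_thetaEleven hq hq0 H
    rw [h, zero_mul] at h2
    have := H.ne₁
    exact absurd h2.symm (by positivity)
  intro h
  have h2 := normCoeff_eq H.curve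
  rw [h, mul_zero] at h2
  exact absurd h2.symm (by positivity)

/-- The contribution of the Appell sums to the rank generating functions. -/
noncomputable def appellPart (κ : ℤ → ℂ) (q : ℂ) (a : ℤ) : ℂ :=
  κ a * (-1) ^ a * appell (q ^ 121) 1 (q ^ (11 * a)) * q ^ (3 * tri a + (15 - 3 * a) * a)

lemma sum_rankSeries_eq (hq : ‖q‖ < 1) (hq0 : q ≠ 0) {r s ρ σ τ : ℂ}
    (H : ThetaCurve (thetaEleven q) r s ρ σ τ) {c : ℕ → ℂ} {κ μ : ℤ → ℂ}
    (h₁ : κ 1 = c 2 - c 3) (h₂ : κ 2 = c 1 - 2 * c 0) (h₃ : κ 3 = c 4 - c 3)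
    (h₄ : κ 4 = c 4 - c 5) (h₅ : κ 5 = c 1 - c 2) (h₀ : c 0 - κ 1 + (μ 1 + μ 2) = 0)
    (m₁ : κ 1 = 2 * μ 1 + μ 5) (m₂ : κ 2 = 2 * μ 2 - μ 1) (m₃ : κ 3 = 2 * μ 3 + μ 4)
    (m₄ : κ 4 = 2 * μ 4 - μ 2) (m₅ : κ 5 = 2 * μ 5 + μ 3) :
    ∑ i ∈ Finset.range 6, c i * rankSeries i q =
      (∑ a ∈ Finset.Icc (1 : ℤ) 5, appellPart κ q a) / (q ^ 5 * qProd (q ^ 121) (q ^ 121)) +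
      qProd (q ^ 121) (q ^ 121) / (q ^ 5 * normCoeff r s) *
        ((∑ a ∈ Finset.Icc (1 : ℤ) 5, ∑ b ∈ Finset.Icc (1 : ℤ) 5,
          thetaCoeff κ μ a b * pairTerm (thetaEleven q) a b) *
          ∑ j ∈ Finset.range 11, invCoeff r s j * τ ^ j) - κ 1 / q := by
  have hE : qProd q q ≠ 0 := by simpa using qProd_pow_ne_zero hq one_ne_zero one_ne_zero
  have hJ : qProd (q ^ 121) (q ^ 121) ≠ 0 := qProd_pow_ne_zero hq (by norm_num) (by norm_num)
  have hD := normCoeff_ne_zero hq hq0 H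
  have hN := H.dissection_mul_sum_invCoeff
  rw [← H.eulerFactor_eq] at hN
  have hEq := qProd_self_eq hq hq0
  have hF : eulerFactor (thetaEleven q) ≠ 0 := fun h => hE (by rw [hEq, h, mul_zero])
  have h := qProd_mul_sum_rankSeries hq hq0 hE c h₁ h₂ h₃ h₄ h₅
  rw [sum_lambert_eq hq hq0 m₁ m₂ m₃ m₄ m₅] at h
  refine mul_left_cancel₀ hE (h.trans ?_)
  simp only [appellPart]
  generalize ∑ a ∈ Finset.Icc (1 : ℤ) 5, κ a * (-1) ^ a * appell (q ^ 121) 1 (q ^ (11 * a)) *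
    q ^ (3 * tri a + (15 - 3 * a) * a) = M
  generalize ∑ a ∈ Finset.Icc (1 : ℤ) 5, ∑ b ∈ Finset.Icc (1 : ℤ) 5,
    thetaCoeff κ μ a b * pairTerm (thetaEleven q) a b = X
  generalize ∑ j ∈ Finset.range 11, invCoeff r s j * τ ^ j = N at *
  rw [hEq, ← hN]
  have hN0 : N ≠ 0 := fun h => hD (by rw [← hN, h, mul_zero])
  field_simp
  linear_combination h₀

lemma zpow_eq_zpow_of_dvd {ω : ℂ} (hω : ω ^ 11 = 1) {m n : ℤ} (h : (11 : ℤ) ∣ m - n) :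
    ω ^ m = ω ^ n := by
  have hω0 : ω ≠ 0 := fun h => by simp [h] at hω
  obtain ⟨k, hk⟩ := h
  rw [show m = 11 * k + n by omega, zpow_add₀ hω0, zpow_mul]
  norm_cast
  rw [hω, one_zpow, one_mul]

lemma mul_pow_eleven_mul {ω : ℂ} (hω : ω ^ 11 = 1) (n : ℤ) : (ω * q) ^ (11 * n) = q ^ (11 * n) := by
  rw [mul_zpow, zpow_eq_zpow_of_dvd hω (n := 0) (by simp), zpow_zero, one_mul]

lemma mul_pow_121 {ω : ℂ} (hω : ω ^ 11 = 1) : (ω * q) ^ 121 = q ^ 121 := by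
  simpa using mul_pow_eleven_mul (q := q) hω 11

lemma thetaEleven_rotate {ω : ℂ} (hω : ω ^ 11 = 1) (n : ℤ) :
    thetaEleven (ω * q) n = ω ^ (6 * n ^ 2) * thetaEleven q n := by
  rw [thetaEleven, thetaEleven, mul_pow_121 hω, mul_pow_eleven_mul hω, mul_zpow, mul_assoc]
  congr 1
  refine zpow_eq_zpow_of_dvd hω ⟨-tri n, ?_⟩
  have h1 := two_mul_tri n
  have h2 : 2 * (n * (n - 11) / 2) = n * (n - 11) := by
    refine Int.mul_ediv_cancel' ?_
    have := Int.even_mul_succ_self n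
    rw [show n * (n - 11) = n * (n + 1) + 2 * (-6 * n) by ring]
    exact this.two_dvd.add (Dvd.intro _ rfl)
  linarith

lemma pairTerm_thetaEleven_rotate {ω : ℂ} (hω : ω ^ 11 = 1) (a b : ℤ) :
    pairTerm (thetaEleven (ω * q)) a b = ω ^ (4 * (a ^ 2 - b ^ 2)) * pairTerm (thetaEleven q) a b :=
      by
  have hω0 : ω ≠ 0 := fun h => by simp [h] at hω
  simp only [pairTerm, thetaEleven_rotate hω]
  split_ifs with h
  · subst h
    rw [sub_self, mul_zero, zpow_zero, one_mul]
    have h1 : (ω ^ (6 * (3 * a) ^ 2)) ^ 2 = (ω ^ (6 * a ^ 2)) ^ 2 * ω ^ (6 * (4 * a) ^ 2) := by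
      rw [← zpow_natCast, ← zpow_natCast, ← zpow_mul, ← zpow_mul, ← zpow_add₀ hω0]
      congr 1; push_cast; ring
    rw [mul_pow _ (thetaEleven q (3 * a)), mul_pow _ (thetaEleven q a), h1, mul_mul_mul_comm,
      mul_div_mul_left _ _ (by positivity)]
  · have h1 : ω ^ (6 * b ^ 2) * ω ^ (6 * (2 * b) ^ 2) = ω ^ (4 * (a ^ 2 - b ^ 2)) *
        (ω ^ (6 * (a - b) ^ 2) * ω ^ (6 * a ^ 2) * ω ^ (6 * (a + b) ^ 2)) := by
      simp only [← zpow_add₀ hω0]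
      exact zpow_eq_zpow_of_dvd hω ⟨2 * b ^ 2 - 2 * a ^ 2, by ring⟩
    rw [mul_mul_mul_comm, h1, mul_mul_mul_comm (ω ^ (6 * (a - b) ^ 2)), mul_mul_mul_comm
      (ω ^ (6 * (a - b) ^ 2) * _), mul_assoc, mul_div_assoc, mul_div_mul_left _ _ (by positivity)]

lemma thetaCurve_rotate (hq : ‖q‖ < 1) (hq0 : q ≠ 0) {ω : ℂ} (hω : ω ^ 11 = 1) {r s ρ σ τ : ℂ}
    (H : ThetaCurve (thetaEleven q) r s ρ σ τ) :
    ∃ ρ' σ', ThetaCurve (thetaEleven (ω * q)) r s ρ' σ' (ω ^ (-4 : ℤ) * τ) := by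
  have hω0 : ω ≠ 0 := fun h => by simp [h] at hω
  have hn : ‖ω * q‖ < 1 := by
    rw [norm_mul, Complex.norm_eq_one_of_pow_eq_one hω (by norm_num), one_mul]; exact hq
  obtain ⟨r', s', ρ', σ', τ', H'⟩ := thetaCurve_thetaEleven hn (mul_ne_zero hω0 hq0)
  have := H.ne₁; have := H.ne₂; have := H.ne₃; have := H.ne₄; have := H.ne₅
  have h1 : r' = r := by
    rw [H'.hr, H.hr]
    simp only [thetaEleven_rotate hω]
    norm_num
    field_simp
  have h2 : s' = s := by
    rw [H'.hs, H.hs]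
    simp only [thetaEleven_rotate hω]
    norm_num
    field_simp
  have h3 : τ' = ω ^ (-4 : ℤ) * τ := by
    rw [H'.hτ, H.hτ]
    simp only [thetaEleven_rotate hω]
    rw [mul_div_mul_comm, ← zpow_sub₀ hω0]
    congr 1
    exact zpow_eq_zpow_of_dvd hω ⟨2, by norm_num⟩
  exact ⟨ρ', σ', h1 ▸ h2 ▸ h3 ▸ H'⟩

end

section

variable {q ζ : ℂ}

lemma sum_range_zpow_root (hζ : IsPrimitiveRoot ζ 11) (m : ℤ) :
    ∑ k ∈ Finset.range 11, (ζ ^ k) ^ m = if (11 : ℤ) ∣ m then 11 else 0 := by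
  have h : ∀ k : ℕ, (ζ ^ k) ^ m = (ζ ^ m) ^ k := fun k => by
    rw [← zpow_natCast, ← zpow_mul, mul_comm, zpow_mul, zpow_natCast]
  simp only [h]
  split_ifs with hm
  · simp [(hζ.zpow_eq_one_iff_dvd m).2 (by exact_mod_cast hm)]
  · have h1 : ζ ^ m ≠ 1 := fun h => hm (by exact_mod_cast (hζ.zpow_eq_one_iff_dvd m).1 h)
    rw [geom_sum_eq h1, ← zpow_natCast, ← zpow_mul, mul_comm, zpow_mul]
    norm_cast
    rw [hζ.pow_eq_one]
    simp

/-- Averaging over the eleventh roots of unity extracts an arithmetic progression. -/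
lemma hasSum_residue_six (hζ : IsPrimitiveRoot ζ 11) {C : ℕ → ℂ} {G : ℂ → ℂ}
    (h : ∀ k : ℕ, HasSum (fun n => C n * (ζ ^ k * q) ^ n) (G (ζ ^ k * q))) :
    HasSum (fun n => C (11 * n + 6) * q ^ (11 * n + 6))
      ((∑ k ∈ Finset.range 11, (ζ ^ k) ^ (-6 : ℤ) * G (ζ ^ k * q)) / 11) := by
  have h1 := (hasSum_sum fun k (_ : k ∈ Finset.range 11) =>
    (h k).mul_left ((ζ ^ k) ^ (-6 : ℤ))).div_const 11
  have hinj : Function.Injective fun n : ℕ => 11 * n + 6 := fun a b h => by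
    simp only at h; omega
  have hterm : ∀ n : ℕ, (∑ k ∈ Finset.range 11, (ζ ^ k) ^ (-6 : ℤ) * (C n * (ζ ^ k * q) ^ n)) / 11 =
      if (11 : ℤ) ∣ n - 6 then C n * q ^ n else 0 := fun n => by
    have h2 : ∀ k : ℕ, (ζ ^ k) ^ (-6 : ℤ) * (C n * (ζ ^ k * q) ^ n) =
        (ζ ^ k) ^ ((n : ℤ) - 6) * (C n * q ^ n) := fun k => by
      have := hζ.ne_zero (by norm_num)
      rw [mul_pow, sub_eq_neg_add, zpow_add₀ (pow_ne_zero _ this), zpow_natCast]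
      ring
    rw [Finset.sum_congr rfl fun k _ => h2 k, ← Finset.sum_mul, sum_range_zpow_root hζ]
    split_ifs
    · ring
    · simp
  simp only [hterm] at h1
  rw [← hinj.hasSum_iff] at h1
  · refine h1.congr_fun fun n => ?_
    rw [Function.comp, if_pos ⟨n, by push_cast; ring⟩]
  · intro n hn
    rw [if_neg]
    rintro ⟨m, hm⟩
    exact hn ⟨m.toNat, by simp only; omega⟩

lemma classIndex_eq_iff {a b : ℤ} {j : ℕ} (hj : j < 11) :
    (11 : ℤ) ∣ a ^ 2 - b ^ 2 - j ↔ j = classIndex a b := by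
  rw [classIndex]
  omega

lemma sum_appellPart_rotate (hζ : IsPrimitiveRoot ζ 11) (κ : ℤ → ℂ) :
    ∑ k ∈ Finset.range 11, (ζ ^ k) ^ (-11 : ℤ) *
      ∑ a ∈ Finset.Icc (1 : ℤ) 5, appellPart κ (ζ ^ k * q) a = 0 := by
  have hω : ∀ k, (ζ ^ k) ^ 11 = 1 := fun k => by rw [pow_right_comm, hζ.pow_eq_one, one_pow]
  have h : ∀ k a, (ζ ^ k) ^ (-11 : ℤ) * appellPart κ (ζ ^ k * q) a =
      (ζ ^ k) ^ (3 * tri a + (15 - 3 * a) * a) * appellPart κ q a := fun k a => by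
    rw [appellPart, appellPart, mul_pow_121 (hω k), mul_pow_eleven_mul (hω k), mul_zpow,
      zpow_eq_zpow_of_dvd (hω k) (m := -11) (n := 0) (by norm_num), zpow_zero]
    ring
  simp only [Finset.mul_sum, h]
  rw [Finset.sum_comm]
  refine Finset.sum_eq_zero fun a ha => ?_
  rw [← Finset.sum_mul, sum_range_zpow_root hζ, if_neg, zero_mul]
  obtain ⟨h1, h2⟩ := Finset.mem_Icc.1 ha
  interval_cases a <;> decide

lemma sum_pairTerm_rotate (hζ : IsPrimitiveRoot ζ 11) (T : ℤ → ℤ → ℂ) (r s τ : ℂ) :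
    ∑ k ∈ Finset.range 11, (ζ ^ k) ^ (-11 : ℤ) * ((∑ a ∈ Finset.Icc (1 : ℤ) 5,
      ∑ b ∈ Finset.Icc (1 : ℤ) 5, T a b * pairTerm (thetaEleven (ζ ^ k * q)) a b) *
        ∑ j ∈ Finset.range 11, invCoeff r s j * ((ζ ^ k) ^ (-4 : ℤ) * τ) ^ j) =
      11 * ∑ a ∈ Finset.Icc (1 : ℤ) 5, ∑ b ∈ Finset.Icc (1 : ℤ) 5, T a b *
        pairTerm (thetaEleven q) a b * (invCoeff r s (classIndex a b) * τ ^ classIndex a b) := by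
  have hω : ∀ k, (ζ ^ k) ^ 11 = 1 := fun k => by rw [pow_right_comm, hζ.pow_eq_one, one_pow]
  have hω0 : ∀ k, ζ ^ k ≠ 0 := fun k => pow_ne_zero _ (hζ.ne_zero (by norm_num))
  have h : ∀ k a b j, (ζ ^ k) ^ (-11 : ℤ) * (T a b * pairTerm (thetaEleven (ζ ^ k * q)) a b *
      (invCoeff r s j * ((ζ ^ k) ^ (-4 : ℤ) * τ) ^ j)) = (ζ ^ k) ^ (4 * (a ^ 2 - b ^ 2 - j)) *
      (T a b * pairTerm (thetaEleven q) a b * (invCoeff r s j * τ ^ j)) := fun k a b j => by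
    have hk := hω k
    have hk0 := hω0 k
    generalize ζ ^ k = ω at *
    rw [pairTerm_thetaEleven_rotate hk, mul_pow, ← zpow_natCast (ω ^ (-4 : ℤ)), ← zpow_mul,
      mul_sub 4 _ (j : ℤ), sub_eq_add_neg _ (4 * (j : ℤ)), zpow_add₀ hk0, ← neg_mul,
      zpow_eq_zpow_of_dvd hk (m := -11) (n := 0) (by norm_num), zpow_zero]
    ring
  simp only [Finset.sum_mul, Finset.mul_sum, h]
  rw [Finset.sum_comm]
  have hj : ∀ j ∈ Finset.range 11, ∑ k ∈ Finset.range 11, ∑ a ∈ Finset.Icc (1 : ℤ) 5,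
      ∑ b ∈ Finset.Icc (1 : ℤ) 5, (ζ ^ k) ^ (4 * (a ^ 2 - b ^ 2 - (j : ℤ))) *
        (T a b * pairTerm (thetaEleven q) a b * (invCoeff r s j * τ ^ j)) =
      ∑ a ∈ Finset.Icc (1 : ℤ) 5, ∑ b ∈ Finset.Icc (1 : ℤ) 5, if j = classIndex a b then
        11 * (T a b * pairTerm (thetaEleven q) a b * (invCoeff r s j * τ ^ j)) else 0 := by
    intro j hj
    rw [Finset.sum_comm]
    refine Finset.sum_congr rfl fun a _ => ?_
    rw [Finset.sum_comm]
    refine Finset.sum_congr rfl fun b _ => ?_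
    have h4 : (11 : ℤ) ∣ 4 * (a ^ 2 - b ^ 2 - j) ↔ j = classIndex a b := by
      rw [← classIndex_eq_iff (Finset.mem_range.1 hj)]
      omega
    rw [← Finset.sum_mul, sum_range_zpow_root hζ, if_congr h4 rfl rfl, ite_mul, zero_mul]
  rw [Finset.sum_congr rfl hj, Finset.sum_comm]
  refine Finset.sum_congr rfl fun a _ => ?_
  rw [Finset.sum_comm]
  refine Finset.sum_congr rfl fun b _ => ?_
  rw [Finset.sum_ite_eq', if_pos]
  rw [Finset.mem_range, classIndex]
  omega

/-- A rank combination restricted to the progression `11 n + 6`, as a sum of theta quotients. -/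
lemma hasSum_rankSeries_residue_six (hq : ‖q‖ < 1) (hq0 : q ≠ 0) {r s ρ σ τ : ℂ}
    (H : ThetaCurve (thetaEleven q) r s ρ σ τ) {c : ℕ → ℂ} {κ μ : ℤ → ℂ}
    (h₁ : κ 1 = c 2 - c 3) (h₂ : κ 2 = c 1 - 2 * c 0) (h₃ : κ 3 = c 4 - c 3)
    (h₄ : κ 4 = c 4 - c 5) (h₅ : κ 5 = c 1 - c 2) (h₀ : c 0 - κ 1 + (μ 1 + μ 2) = 0)
    (m₁ : κ 1 = 2 * μ 1 + μ 5) (m₂ : κ 2 = 2 * μ 2 - μ 1) (m₃ : κ 3 = 2 * μ 3 + μ 4)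
    (m₄ : κ 4 = 2 * μ 4 - μ 2) (m₅ : κ 5 = 2 * μ 5 + μ 3) :
    HasSum (fun n : ℕ => (∑ i ∈ Finset.range 6, c i * rankCount i 11 (11 * n + 6)) *
        q ^ (11 * n + 6))
      (qProd (q ^ 121) (q ^ 121) / (q ^ 5 * normCoeff r s) *
        ∑ a ∈ Finset.Icc (1 : ℤ) 5, ∑ b ∈ Finset.Icc (1 : ℤ) 5, thetaCoeff κ μ a b *
          pairTerm (thetaEleven q) a b *
          (invCoeff r s (classIndex a b) * τ ^ classIndex a b)) := by
  have hζ := Complex.isPrimitiveRoot_exp 11 (by norm_num)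
  generalize Complex.exp (2 * Real.pi * Complex.I / (11 : ℕ)) = ζ at hζ
  have hω : ∀ k, (ζ ^ k) ^ 11 = 1 := fun k => by rw [pow_right_comm, hζ.pow_eq_one, one_pow]
  have hω0 : ∀ k, ζ ^ k ≠ 0 := fun k => pow_ne_zero _ (hζ.ne_zero (by norm_num))
  have hn : ∀ k, ‖ζ ^ k * q‖ < 1 := fun k => by
    rw [norm_mul, Complex.norm_eq_one_of_pow_eq_one (hω k) (by norm_num), one_mul]; exact hq
  have hser := hasSum_residue_six (q := q) hζ (C := fun n => ∑ i ∈ Finset.range 6,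
    c i * rankCount i 11 n) (G := fun x => ∑ i ∈ Finset.range 6, c i * rankSeries i x) fun k => by
      refine (hasSum_sum fun i (_ : i ∈ Finset.range 6) =>
        (hasSum_rankSeries (hn k) i).mul_left (c i)).congr_fun fun n => ?_
      rw [Finset.sum_mul]
      exact Finset.sum_congr rfl fun i _ => by ring
  convert hser using 1
  have hterm : ∀ k, (ζ ^ k) ^ (-6 : ℤ) * ∑ i ∈ Finset.range 6, c i * rankSeries i (ζ ^ k * q) =
      (ζ ^ k) ^ (-11 : ℤ) * (∑ a ∈ Finset.Icc (1 : ℤ) 5, appellPart κ (ζ ^ k * q) a) /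
        (q ^ 5 * qProd (q ^ 121) (q ^ 121)) +
      qProd (q ^ 121) (q ^ 121) / (q ^ 5 * normCoeff r s) * ((ζ ^ k) ^ (-11 : ℤ) *
        ((∑ a ∈ Finset.Icc (1 : ℤ) 5, ∑ b ∈ Finset.Icc (1 : ℤ) 5,
          thetaCoeff κ μ a b * pairTerm (thetaEleven (ζ ^ k * q)) a b) *
          ∑ j ∈ Finset.range 11, invCoeff r s j * ((ζ ^ k) ^ (-4 : ℤ) * τ) ^ j)) -
      κ 1 / q * (ζ ^ k) ^ (-7 : ℤ) := fun k => by
    obtain ⟨ρ', σ', H'⟩ := thetaCurve_rotate hq hq0 (hω k) H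
    rw [sum_rankSeries_eq (hn k) (mul_ne_zero (hω0 k) hq0) H' h₁ h₂ h₃ h₄ h₅ h₀ m₁ m₂ m₃ m₄ m₅,
      mul_pow_121 (hω k), mul_pow _ _ 5]
    have hk0 := hω0 k
    generalize ∑ a ∈ Finset.Icc (1 : ℤ) 5, appellPart κ (ζ ^ k * q) a = M
    generalize (∑ a ∈ Finset.Icc (1 : ℤ) 5, ∑ b ∈ Finset.Icc (1 : ℤ) 5,
      thetaCoeff κ μ a b * pairTerm (thetaEleven (ζ ^ k * q)) a b) *
        ∑ j ∈ Finset.range 11, invCoeff r s j * ((ζ ^ k) ^ (-4 : ℤ) * τ) ^ j = X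
    generalize ζ ^ k = ω at *
    have e1 : ω ^ (-11 : ℤ) = ω ^ (-6 : ℤ) / ω ^ 5 := by
      rw [eq_div_iff (by positivity), ← zpow_natCast, ← zpow_add₀ hk0]; norm_num
    have e2 : ω ^ (-7 : ℤ) = ω ^ (-6 : ℤ) / ω := by
      rw [eq_div_iff hk0, ← zpow_add_one₀ hk0]; norm_num
    rw [e1, e2]
    field_simp
  rw [Finset.sum_congr rfl fun k _ => hterm k, Finset.sum_sub_distrib, Finset.sum_add_distrib,
    ← Finset.sum_div, ← Finset.mul_sum, ← Finset.mul_sum, sum_appellPart_rotate hζ,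
    sum_pairTerm_rotate hζ, sum_range_zpow_root hζ, if_neg (by decide)]
  ring

end

lemma coeff_unique_of_hasSum {a b : ℕ → ℂ} {f : ℂ → ℂ}
    (ha : ∀ y, y ≠ 0 → ‖y‖ < 1 → HasSum (fun n => a n * y ^ n) (f y))
    (hb : ∀ y, y ≠ 0 → ‖y‖ < 1 → HasSum (fun n => b n * y ^ n) (f y)) : a = b := by
  have h : HasFPowerSeriesAt (fun _ => (0 : ℂ))
      (FormalMultilinearSeries.ofScalars ℂ fun n => if n = 0 then 0 else a (n - 1) - b (n - 1)) 0 :=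
        by
    rw [hasFPowerSeriesAt_iff]
    filter_upwards [Metric.ball_mem_nhds (0 : ℂ) one_pos] with y hy
    rw [mem_ball_zero_iff] at hy
    rw [← hasSum_nat_add_iff' 1]
    simp only [FormalMultilinearSeries.coeff_ofScalars]
    rcases eq_or_ne y 0 with rfl | h0
    · simp
    · have h1 := ((ha y h0 hy).sub (hb y h0 hy)).mul_left y
      rw [sub_self, mul_zero] at h1
      simp only [Finset.range_one, Finset.sum_singleton, if_true, smul_zero, sub_zero]
      refine h1.congr_fun fun n => ?_
      simp [pow_succ]
      ring
  have h0 := h.eq_zero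
  funext n
  have h1 : FormalMultilinearSeries.coeff (FormalMultilinearSeries.ofScalars ℂ fun n =>
    if n = 0 then 0 else a (n - 1) - b (n - 1)) (n + 1) = 0 := by
      rw [h0]; simp [FormalMultilinearSeries.coeff]
  simpa [FormalMultilinearSeries.coeff_ofScalars, sub_eq_zero] using h1

lemma theta_pow_eleven {q : ℂ} (hq0 : q ≠ 0) (n m : ℕ) (h : (n : ℤ) * (n - 11) / 2 = -m) :
    theta ((q ^ 11) ^ 11) ((q ^ 11) ^ n) = q ^ m * thetaEleven q n := by
  rw [thetaEleven, h, zpow_neg, zpow_natCast, mul_inv_cancel_left₀ (pow_ne_zero _ hq0), ← pow_mul,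
    ← pow_mul]
  norm_cast

lemma theta_quotient_rescale {q J S D t₁ t₂ t₃ t₄ t₅ : ℂ} {v e₁ e₂ e₃ e₄ e₅ : ℕ} (hq0 : q ≠ 0)
    (hv : 11 * v + 132 = 5 * e₁ + 9 * e₂ + 12 * e₃ + 14 * e₄ + 15 * e₅) (hD : D ≠ 0)
    (h₁ : t₁ ≠ 0) (h₂ : t₂ ≠ 0) (h₃ : t₃ ≠ 0) (h₄ : t₄ ≠ 0) (h₅ : t₅ ≠ 0)
    (hS : S * (q ^ 121 * (t₁ ^ e₁ * t₂ ^ e₂ * t₃ ^ e₃ * t₄ ^ e₄ * t₅ ^ e₅)) = 11 * D) :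
    J / (q ^ 5 * D) * S / q ^ 6 = 11 * ((q ^ 11) ^ v * J / ((q ^ 5 * t₁) ^ e₁ *
      (q ^ 9 * t₂) ^ e₂ * (q ^ 12 * t₃) ^ e₃ * (q ^ 14 * t₄) ^ e₄ * (q ^ 15 * t₅) ^ e₅)) := by
  have hpow : (q ^ 5) ^ e₁ * (q ^ 9) ^ e₂ * (q ^ 12) ^ e₃ * (q ^ 14) ^ e₄ * (q ^ 15) ^ e₅ =
      (q ^ 11) ^ v * q ^ 132 := by
    simp only [← pow_mul, ← pow_add]
    rw [hv]
  have hP : (q ^ 5 * t₁) ^ e₁ * (q ^ 9 * t₂) ^ e₂ * (q ^ 12 * t₃) ^ e₃ * (q ^ 14 * t₄) ^ e₄ *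
      (q ^ 15 * t₅) ^ e₅ =
      (q ^ 11) ^ v * q ^ 132 * (t₁ ^ e₁ * t₂ ^ e₂ * t₃ ^ e₃ * t₄ ^ e₄ * t₅ ^ e₅) := by
    rw [← hpow]
    simp only [mul_pow]
    ring
  have hT : t₁ ^ e₁ * t₂ ^ e₂ * t₃ ^ e₃ * t₄ ^ e₄ * t₅ ^ e₅ ≠ 0 := by positivity
  rw [hP]
  generalize t₁ ^ e₁ * t₂ ^ e₂ * t₃ ^ e₃ * t₄ ^ e₄ * t₅ ^ e₅ = P at *
  rw [eq_div_of_mul_eq (by positivity) hS]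
  field_simp

lemma rank_combination_nonneg {c : ℕ → ℤ} {κ μ : ℤ → ℂ} {v e₁ e₂ e₃ e₄ e₅ : ℕ}
    (hv : 11 * v + 132 = 5 * e₁ + 9 * e₂ + 12 * e₃ + 14 * e₄ + 15 * e₅)
    (he : 2 ≤ e₂) (h₁ : κ 1 = c 2 - c 3) (h₂ : κ 2 = c 1 - 2 * c 0) (h₃ : κ 3 = c 4 - c 3)
    (h₄ : κ 4 = c 4 - c 5) (h₅ : κ 5 = c 1 - c 2) (h₀ : c 0 - κ 1 + (μ 1 + μ 2) = 0)
    (m₁ : κ 1 = 2 * μ 1 + μ 5) (m₂ : κ 2 = 2 * μ 2 - μ 1) (m₃ : κ 3 = 2 * μ 3 + μ 4)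
    (m₄ : κ 4 = 2 * μ 4 - μ 2) (m₅ : κ 5 = 2 * μ 5 + μ 3)
    (hcomb : ∀ {Q : ℂ} {t : ℤ → ℂ} {r s ρ σ τ : ℂ}, ThetaCurve t r s ρ σ τ →
      cuspDisc r s * (r * σ ^ 4) = ρ ^ 6 * s ^ 4 * τ ^ 18 * t 1 ^ 12 * Q →
      (∑ a ∈ Finset.Icc (1 : ℤ) 5, ∑ b ∈ Finset.Icc (1 : ℤ) 5, thetaCoeff κ μ a b *
        pairTerm t a b * (invCoeff r s (classIndex a b) * τ ^ classIndex a b)) *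
        (Q * (t 1 ^ e₁ * t 2 ^ e₂ * t 3 ^ e₃ * t 4 ^ e₄ * t 5 ^ e₅)) =
        11 * normCoeff r s) (n : ℕ) :
    0 ≤ ∑ i ∈ Finset.range 6, c i * (rankCount i 11 (11 * n + 6) : ℤ) := by
  obtain ⟨e₂, rfl⟩ := Nat.exists_eq_add_of_le' he
  obtain ⟨φ, hφ⟩ := exists_hasNonnegSeries_theta_quotient v e₁ e₂ e₃ e₄ e₅
  have key : (fun n : ℕ => ∑ i ∈ Finset.range 6, (c i : ℂ) * rankCount i 11 (11 * n + 6)) =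
      fun n => 11 * (φ.coeff n : ℂ) := by
    refine coeff_unique_of_hasSum (fun y h0 hy => ?_) fun y h0 hy =>
      ((hφ.2 y hy).mul_left 11).congr_fun fun n => mul_assoc _ _ _
    obtain ⟨q, rfl⟩ := IsAlgClosed.exists_pow_nat_eq y (n := 11) (by norm_num)
    have hq0 : q ≠ 0 := fun h => h0 (by simp [h])
    have hq : ‖q‖ < 1 := by
      rw [norm_pow] at hy
      exact (pow_lt_one_iff_of_nonneg (norm_nonneg q) (by norm_num)).1 hy
    obtain ⟨r, s, ρ, σ, τ, H⟩ := thetaCurve_thetaEleven hq hq0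
    have hS := hcomb H (cuspDisc_thetaEleven hq hq0 H)
    have hD := normCoeff_ne_zero hq hq0 H
    have hsum := (hasSum_rankSeries_residue_six (c := fun i => c i) hq hq0 H h₁ h₂ h₃ h₄ h₅ h₀
      m₁ m₂ m₃ m₄ m₅).div_const (q ^ 6)
    generalize ∑ a ∈ Finset.Icc (1 : ℤ) 5, ∑ b ∈ Finset.Icc (1 : ℤ) 5, thetaCoeff κ μ a b *
      pairTerm (thetaEleven q) a b * (invCoeff r s (classIndex a b) * τ ^ classIndex a b) = S at *
    refine Eq.subst (motive := HasSum _) ?_ (hsum.congr_fun fun n => ?_)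
    · beta_reduce
      have t1 : theta ((q ^ 11) ^ 11) ((q ^ 11) ^ 1) = q ^ 5 * thetaEleven q 1 :=
        theta_pow_eleven hq0 1 5 rfl
      have t2 : theta ((q ^ 11) ^ 11) ((q ^ 11) ^ 2) = q ^ 9 * thetaEleven q 2 :=
        theta_pow_eleven hq0 2 9 rfl
      have t3 : theta ((q ^ 11) ^ 11) ((q ^ 11) ^ 3) = q ^ 12 * thetaEleven q 3 :=
        theta_pow_eleven hq0 3 12 rfl
      have t4 : theta ((q ^ 11) ^ 11) ((q ^ 11) ^ 4) = q ^ 14 * thetaEleven q 4 :=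
        theta_pow_eleven hq0 4 14 rfl
      have t5 : theta ((q ^ 11) ^ 11) ((q ^ 11) ^ 5) = q ^ 15 * thetaEleven q 5 :=
        theta_pow_eleven hq0 5 15 rfl
      rw [t1, t2, t3, t4, t5, show (q ^ 11) ^ 11 = q ^ 121 by ring]
      exact theta_quotient_rescale hq0 hv hD H.ne₁ H.ne₂ H.ne₃ H.ne₄ H.ne₅ hS
    · rw [pow_add, ← pow_mul]
      field_simp
  have hn : ((∑ i ∈ Finset.range 6, c i * (rankCount i 11 (11 * n + 6) : ℤ) : ℤ) : ℝ) =
      11 * φ.coeff n := by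
    have := congrFun key n
    exact_mod_cast this
  have : (0 : ℝ) ≤ (∑ i ∈ Finset.range 6, c i * (rankCount i 11 (11 * n + 6) : ℤ) : ℤ) := by
    rw [hn]; exact mul_nonneg (by norm_num) (hφ.1 n)
  exact_mod_cast this

lemma exists_map_one_to_five (a₁ a₂ a₃ a₄ a₅ : ℂ) :
    ∃ f : ℤ → ℂ, f 1 = a₁ ∧ f 2 = a₂ ∧ f 3 = a₃ ∧ f 4 = a₄ ∧ f 5 = a₅ :=
  ⟨fun a => if a = 1 then a₁ else if a = 2 then a₂ else if a = 3 then a₃ else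
    if a = 4 then a₄ else a₅, by norm_num⟩

lemma rank_combination_one_nonneg (n : ℕ) :
    0 ≤ 2 * (rankCount 1 11 (11 * n + 6) : ℤ) + (rankCount 2 11 (11 * n + 6) : ℤ)
      - 2 * (rankCount 3 11 (11 * n + 6) : ℤ) + 2 * (rankCount 4 11 (11 * n + 6) : ℤ)
      - 3 * (rankCount 5 11 (11 * n + 6) : ℤ) := by
  obtain ⟨κ, hκ⟩ := exists_map_one_to_five 3 2 4 5 1
  obtain ⟨μ, hμ⟩ := exists_map_one_to_five (4 / 3) (5 / 3) (1 / 3) (10 / 3) (1 / 3)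
  obtain ⟨k₁, k₂, k₃, k₄, k₅⟩ := id hκ
  obtain ⟨m₁, m₂, m₃, m₄, m₅⟩ := id hμ
  have h := rank_combination_nonneg (c := fun i => [0, 2, 1, -2, 2, -3].getD i 0)
    (κ := κ) (μ := μ) (v := 1) (e₁ := 2) (e₂ := 3) (e₃ := 4) (e₄ := 2) (e₅ := 2)
    (by norm_num) (by norm_num) (by norm_num [k₁]) (by norm_num [k₂]) (by norm_num [k₃])
    (by norm_num [k₄]) (by norm_num [k₅]) (by norm_num [k₁, m₁, m₂])
    (by norm_num [k₁, m₁, m₅]) (by norm_num [k₂, m₁, m₂]) (by norm_num [k₃, m₃, m₄])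
    (by norm_num [k₄, m₂, m₄]) (by norm_num [k₅, m₃, m₅])
    (fun H hΔ => by
      simpa only [pow_zero, one_mul, mul_one] using H.theta_combination_one hΔ hκ hμ) n
  simp [Finset.sum_range_succ] at h
  linarith

lemma rank_combination_two_nonneg (n : ℕ) :
    0 ≤ 2 * (rankCount 0 11 (11 * n + 6) : ℤ) - 2 * (rankCount 1 11 (11 * n + 6) : ℤ)
      + (rankCount 2 11 (11 * n + 6) : ℤ) - (rankCount 3 11 (11 * n + 6) : ℤ)
      - 2 * (rankCount 4 11 (11 * n + 6) : ℤ) + 2 * (rankCount 5 11 (11 * n + 6) : ℤ) := by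
  obtain ⟨κ, hκ⟩ := exists_map_one_to_five 2 (-6) (-1) (-4) (-3)
  obtain ⟨μ, hμ⟩ := exists_map_one_to_five 2 (-2) 1 (-3) (-2)
  obtain ⟨k₁, k₂, k₃, k₄, k₅⟩ := id hκ
  obtain ⟨m₁, m₂, m₃, m₄, m₅⟩ := id hμ
  have h := rank_combination_nonneg (c := fun i => [2, -2, 1, -1, -2, 2].getD i 0)
    (κ := κ) (μ := μ) (v := 3) (e₁ := 0) (e₂ := 3) (e₃ := 3) (e₄ := 3) (e₅ := 4)
    (by norm_num) (by norm_num) (by norm_num [k₁]) (by norm_num [k₂]) (by norm_num [k₃])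
    (by norm_num [k₄]) (by norm_num [k₅]) (by norm_num [k₁, m₁, m₂])
    (by norm_num [k₁, m₁, m₅]) (by norm_num [k₂, m₁, m₂]) (by norm_num [k₃, m₃, m₄])
    (by norm_num [k₄, m₂, m₄]) (by norm_num [k₅, m₃, m₅])
    (fun H hΔ => by
      simpa only [pow_zero, one_mul, mul_one] using H.theta_combination_two hΔ hκ hμ) n
  simp [Finset.sum_range_succ] at h
  linarith

lemma rank_combination_three_nonneg (n : ℕ) :
    0 ≤ (rankCount 0 11 (11 * n + 6) : ℤ) + (rankCount 1 11 (11 * n + 6) : ℤ)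
      - 4 * (rankCount 2 11 (11 * n + 6) : ℤ) + 3 * (rankCount 3 11 (11 * n + 6) : ℤ)
      + (rankCount 4 11 (11 * n + 6) : ℤ) - 2 * (rankCount 5 11 (11 * n + 6) : ℤ) := by
  obtain ⟨κ, hκ⟩ := exists_map_one_to_five (-7) (-1) (-2) 3 5
  obtain ⟨μ, hμ⟩ := exists_map_one_to_five (-5) (-3) (-1) 0 3
  obtain ⟨k₁, k₂, k₃, k₄, k₅⟩ := id hκ
  obtain ⟨m₁, m₂, m₃, m₄, m₅⟩ := id hμ
  have h := rank_combination_nonneg (c := fun i => [1, 1, -4, 3, 1, -2].getD i 0)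
    (κ := κ) (μ := μ) (v := 2) (e₁ := 1) (e₂ := 3) (e₃ := 3) (e₄ := 4) (e₅ := 2)
    (by norm_num) (by norm_num) (by norm_num [k₁]) (by norm_num [k₂]) (by norm_num [k₃])
    (by norm_num [k₄]) (by norm_num [k₅]) (by norm_num [k₁, m₁, m₂])
    (by norm_num [k₁, m₁, m₅]) (by norm_num [k₂, m₁, m₂]) (by norm_num [k₃, m₃, m₄])
    (by norm_num [k₄, m₂, m₄]) (by norm_num [k₅, m₃, m₅])
    (fun H hΔ => by
      simpa only [pow_zero, one_mul, mul_one] using H.theta_combination_three hΔ hκ hμ) n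
  simp [Finset.sum_range_succ] at h
  linarith

lemma rank_combination_four_nonneg (n : ℕ) :
    0 ≤ (rankCount 0 11 (11 * n + 6) : ℤ) + 6 * (rankCount 1 11 (11 * n + 6) : ℤ)
      + 4 * (rankCount 2 11 (11 * n + 6) : ℤ) - 2 * (rankCount 3 11 (11 * n + 6) : ℤ)
      - 5 * (rankCount 4 11 (11 * n + 6) : ℤ) - 4 * (rankCount 5 11 (11 * n + 6) : ℤ) := by
  obtain ⟨κ, hκ⟩ := exists_map_one_to_five 6 4 (-3) (-1) 2
  obtain ⟨μ, hμ⟩ := exists_map_one_to_five 2 3 (-2) 1 2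
  obtain ⟨k₁, k₂, k₃, k₄, k₅⟩ := id hκ
  obtain ⟨m₁, m₂, m₃, m₄, m₅⟩ := id hμ
  have h := rank_combination_nonneg (c := fun i => [1, 6, 4, -2, -5, -4].getD i 0)
    (κ := κ) (μ := μ) (v := 0) (e₁ := 3) (e₂ := 3) (e₃ := 4) (e₄ := 3) (e₅ := 0)
    (by norm_num) (by norm_num) (by norm_num [k₁]) (by norm_num [k₂]) (by norm_num [k₃])
    (by norm_num [k₄]) (by norm_num [k₅]) (by norm_num [k₁, m₁, m₂])
    (by norm_num [k₁, m₁, m₅]) (by norm_num [k₂, m₁, m₂]) (by norm_num [k₃, m₃, m₄])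
    (by norm_num [k₄, m₂, m₄]) (by norm_num [k₅, m₃, m₅])
    (fun H hΔ => by
      simpa only [pow_zero, one_mul, mul_one] using H.theta_combination_four hΔ hκ hμ) n
  simp [Finset.sum_range_succ] at h
  linarith

/-- Rank inequalities for the residue 6 modulo 11. -/
theorem rank_inequalities_residue_six (n : ℕ) :
    (2 * rankCount 1 11 (11  *  n  +  6)  +  rankCount 2 11 (11  *  n  +  6)  +  2 * rankCount 4 11 (11  *  n  +  6) ≥ 2 * rankCount 3 11 (11  *  n  +  6)  +  3 * rankCount 5 11 (11  *  n  +  6))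
    ∧ (2 * rankCount 0 11 (11  *  n  +  6)  +  rankCount 2 11 (11  *  n  +  6)  +  2 * rankCount 5 11 (11  *  n  +  6) ≥ 2 * rankCount 1 11 (11  *  n  +  6)  +  rankCount 3 11 (11  *  n  +  6)  +  2 * rankCount 4 11 (11  *  n  +  6))
    ∧ (rankCount 0 11 (11  *  n  +  6)  +  rankCount 1 11 (11  *  n  +  6)  +  3 * rankCount 3 11 (11  *  n  +  6)  +  rankCount 4 11 (11  *  n  +  6) ≥ 4 * rankCount 2 11 (11  *  n  +  6)  +  2 * rankCount 5 11 (11  *  n  +  6))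
    ∧ (rankCount 0 11 (11  *  n  +  6)  +  6 * rankCount 1 11 (11  *  n  +  6)  +  4 * rankCount 2 11 (11  *  n  +  6) ≥ 2 * rankCount 3 11 (11  *  n  +  6)  +  5 * rankCount 4 11 (11  *  n  +  6)  +  4 * rankCount 5 11 (11  *  n  +  6)) := by
  have h₁ := rank_combination_one_nonneg n
  have h₂ := rank_combination_two_nonneg n
  have h₃ := rank_combination_three_nonneg n
  have h₄ := rank_combination_four_nonneg n
  refine ⟨?_, ?_, ?_, ?_⟩ <;> omega
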